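/- Uniform central limit theorem replacing higher-order chaos with isotropic Gaussians (Theorem 4.2). Suppose the scaling C₀^{−1} ≤ p/d² ≤ C₀, the genericity condition ‖β_{ki}‖₂ = 1 and E_x[⟨β_{ki},h_k(x)⟩⁴] ≤ 3 + d^{−c₃} for all 2 ≤ k ≤ D' and i ≤ s_k, and the activation condition (A8) hold with constants independent of d. Then for any constants C, K > 0 there exist constants c, C', d₀ > 0 (depending only on the assumption constants and C, K) such that for all d ≥ d₀, with probability at least 1 − d^{−C} over W, the following holds simultaneously for every L > 0, every L-Lipschitz function φ : ℝ^{m+1} → ℝ, and every θ ∈ Θ^PG_W(K): |E[φ(f^RF, ⟨θ, z^RF⟩)] − E[φ(f^PG, ⟨θ, z^PG⟩)]| ≤ C'·L/d^c, where the first expectation is over x ~ N(0,I_d) defining (f^RF, z^RF) and the second is over the independent variables (x, g₃,…,g_{D'}, g*) defining (f^PG, z^PG), both conditional on W. -/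

import Mathlib

/-!
Uniform central limit theorem replacing higher-order chaos with isotropic Gaussians
(Theorem 4.2).
-/

noncomputable section

open MeasureTheory ProbabilityTheory

/-- The degree-`k` orthonormal probabilist's Hermite polynomial. -/
def He (k : ℕ) (x : ℝ) : ℝ :=
  (Polynomial.aeval x (Polynomial.hermite k)) / Real.sqrt (Nat.factorial k)

/-- Multi-indices on `Fin d` of total degree `k`. -/
abbrev MIdx (d k : ℕ) : Type :=
  {κ : Fin d → ℕ // κ ∈ Finset.Nat.antidiagonalTuple d k}

/-- Euclidean dot product on `ι → ℝ`. -/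
def dotp {ι : Type*} [Fintype ι] (u v : ι → ℝ) : ℝ := ∑ i, u i * v i

/-- Euclidean norm on `ι → ℝ`. -/
def enorm2 {ι : Type*} [Fintype ι] (u : ι → ℝ) : ℝ := Real.sqrt (∑ i, (u i) ^ 2)

/-- The vector `h_k(x)` of all degree-`k` multivariate Hermite polynomials. -/
def hvec (d k : ℕ) (x : Fin d → ℝ) : MIdx d k → ℝ :=
  fun κ => ∏ i, He (κ.1 i) (x i)

/-- The vector `q_k(w)`. -/
def qvec (d k : ℕ) (w : Fin d → ℝ) : MIdx d k → ℝ :=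
  fun κ => Real.sqrt ((Nat.factorial k : ℝ) / ∏ i, (Nat.factorial (κ.1 i) : ℝ)) *
    ∏ i, (w i) ^ (κ.1 i)

/-- The standard Gaussian measure on `ι → ℝ`. -/
def stdG (ι : Type*) [Fintype ι] : Measure (ι → ℝ) :=
  Measure.pi fun _ => gaussianReal 0 1

/-- The uniform distribution on the unit sphere of `ι → ℝ`. -/
def unifSphere (ι : Type*) [Fintype ι] : Measure (ι → ℝ) :=
  (stdG ι).map fun x => (enorm2 x)⁻¹ • x

/-- The `k`-th Hermite coefficient `μ_k = E[σ(G) He_k(G)]` of the activation. -/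
def hCoef (σa : Polynomial ℝ) (k : ℕ) : ℝ :=
  ∫ g, σa.eval g * He k g ∂(gaussianReal 0 1)

/-- `μ_{>2} = (∑_{k=3}^{D} μ_k²)^{1/2}`. -/
def muHigh (σa : Polynomial ℝ) (Dσ : ℕ) : ℝ :=
  Real.sqrt (∑ k ∈ Finset.Icc 3 Dσ, (hCoef σa k) ^ 2)

/-- Index of the latent-signal coordinates: `s` linear coordinates together with the
degree-`k` chaos coordinates `ξ_{ki}`, `2 ≤ k ≤ D'`, `1 ≤ i ≤ s_k`; in total `m`. -/
abbrev SigIdx (s D' : ℕ) (sk : ℕ → ℕ) : Type :=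
  Fin s ⊕ ((k : {k : ℕ // k ∈ Finset.Icc 2 D'}) × Fin (sk k.1))

/-- First `s` coordinates of `x ∈ ℝ^d`. -/
def coordS (d s : ℕ) (x : Fin d → ℝ) (i : Fin s) : ℝ :=
  if h : (i : ℕ) < d then x ⟨i, h⟩ else 0

/-- The RF latent signal `f^RF = (x_S, ξ₂, …, ξ_{D'})`. -/
def fRF (d s D' : ℕ) (sk : ℕ → ℕ) (β : (k : ℕ) → Fin (sk k) → MIdx d k → ℝ)
    (x : Fin d → ℝ) : SigIdx s D' sk → ℝ :=
  fun idx => match idx with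
  | Sum.inl i => coordS d s x i
  | Sum.inr ki => dotp (β ki.1.1 ki.2) (hvec d ki.1.1 x)

/-- The RF features `z^RF = σ(Wx)`. -/
def zRF (d p : ℕ) (σa : Polynomial ℝ) (w : Fin p → Fin d → ℝ) (x : Fin d → ℝ) :
    Fin p → ℝ :=
  fun j => σa.eval (dotp (w j) x)

/-- Randomness of one PGE feature/signal sample: `(x, (g_k)_k, g_*)`. -/
abbrev PGfeat (d p D' : ℕ) : Type :=
  (Fin d → ℝ) × ((k : Fin (D' + 3)) → MIdx d k.1 → ℝ) × (Fin p → ℝ)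

/-- The law of a PGE feature/signal sample. -/
def PGfeatMeas (d p D' : ℕ) : Measure (PGfeat d p D') :=
  (stdG (Fin d)).prod
    ((Measure.pi fun k : Fin (D' + 3) => stdG (MIdx d k.1)).prod (stdG (Fin p)))

/-- The PGE latent signal `f^PG = (x_S, ξ₂, ξ̃₃, …, ξ̃_{D'})`. -/
def fPG (d s D' : ℕ) (sk : ℕ → ℕ) (β : (k : ℕ) → Fin (sk k) → MIdx d k → ℝ)
    (x : Fin d → ℝ) (g : (k : Fin (D' + 3)) → MIdx d k.1 → ℝ) : SigIdx s D' sk → ℝ :=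
  fun idx => match idx with
  | Sum.inl i => coordS d s x i
  | Sum.inr ki =>
      if ki.1.1 ≤ 2 then dotp (β ki.1.1 ki.2) (hvec d ki.1.1 x)
      else dotp (β ki.1.1 ki.2)
        (g ⟨ki.1.1, by have h := (Finset.mem_Icc.mp ki.1.2).2; omega⟩)

/-- The PGE features `z^PG = μ₀1_p + μ₁Wx + μ₂V₂h₂(x) + μ_{>2} g_*`. -/
def zPG (d p Dσ : ℕ) (σa : Polynomial ℝ) (w : Fin p → Fin d → ℝ)
    (x : Fin d → ℝ) (gst : Fin p → ℝ) : Fin p → ℝ :=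
  fun j =>
    hCoef σa 0 + hCoef σa 1 * dotp (w j) x +
      hCoef σa 2 * dotp (qvec d 2 (w j)) (hvec d 2 x) + muHigh σa Dσ * gst j

/-- The constrained parameter set `Θ^PG_W(K)`. -/
def ThetaPG (d p : ℕ) (K μ1 : ℝ) (w : Fin p → Fin d → ℝ) : Set (Fin p → ℝ) :=
  {θ | (∀ j, |θ j| ≤ Real.log d ^ K * (d : ℝ) ^ (-(1 / 4 : ℝ))) ∧
    enorm2 θ ≤ Real.log d ^ K ∧
    |∑ j, θ j| ≤ Real.log d ^ K ∧
    enorm2 (fun i : Fin d => μ1 * ∑ j, w j i * θ j) ≤ Real.log d ^ K}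

set_option linter.unusedSectionVars false
set_option linter.unusedSimpArgs false
set_option linter.unusedVariables false
set_option linter.style.longLine false

namespace UC

/-! ### Gaussian integration by parts -/

lemma gauss_pow_integrable (n : ℕ) : Integrable (fun x : ℝ => x ^ n) (gaussianReal 0 1) := by
  rcases Nat.eq_zero_or_pos n with h | h
  · subst h; simp
  have := (memLp_id_gaussianReal' (μ := 0) (v := 1) (n : ENNReal) (by simp))
  have h2 := this.integrable_norm_pow (by omega)
  refine h2.mono' (by fun_prop) (Filter.Eventually.of_forall fun x => ?_)
  simp

instance stdG_prob (ι : Type*) [Fintype ι] : IsProbabilityMeasure (stdG ι) := by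
  unfold stdG; infer_instance

lemma integrable_gaussian_iff (f : ℝ → ℝ) :
    Integrable f (gaussianReal 0 1) ↔ Integrable (fun x => gaussianPDFReal 0 1 x * f x) := by
  rw [gaussianReal_of_var_ne_zero _ one_ne_zero]
  unfold gaussianPDF
  rw [integrable_withDensity_iff_integrable_smul' (by fun_prop)
    (Filter.Eventually.of_forall fun _ => ENNReal.ofReal_lt_top)]
  simp [ENNReal.toReal_ofReal (gaussianPDFReal_nonneg 0 1 _)]

lemma hasDerivAt_gpdf (x : ℝ) :
    HasDerivAt (gaussianPDFReal 0 1) (-(x * gaussianPDFReal 0 1 x)) x := by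
  have e : gaussianPDFReal 0 1 = fun x : ℝ =>
      (Real.sqrt (2 * Real.pi))⁻¹ * Real.exp (-(x ^ 2 / 2)) := by
    ext x; simp [gaussianPDFReal_def]; ring_nf; simp
  rw [e]
  have h : HasDerivAt (fun x : ℝ => -(x ^ 2 / 2)) (-x) x := by
    have := ((hasDerivAt_pow 2 x).div_const 2).fun_neg
    refine this.congr_deriv ?_
    simp
  refine ((h.exp).const_mul _).congr_deriv ?_
  ring

lemma ibp_one (h h' : ℝ → ℝ) (hd : ∀ x, HasDerivAt h (h' x) x)
    (i0 : Integrable h (gaussianReal 0 1)) (i1 : Integrable h' (gaussianReal 0 1))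
    (i2 : Integrable (fun x => x * h x) (gaussianReal 0 1)) :
    ∫ x, x * h x ∂(gaussianReal 0 1) = ∫ x, h' x ∂(gaussianReal 0 1) := by
  rw [integral_gaussianReal_eq_integral_smul one_ne_zero,
    integral_gaussianReal_eq_integral_smul one_ne_zero]
  rw [integrable_gaussian_iff] at i0 i1 i2
  have := integral_mul_deriv_eq_deriv_mul_of_integrable (u := h) (u' := h')
    (v := gaussianPDFReal 0 1) (v' := fun x => -(x * gaussianPDFReal 0 1 x))
    (fun x _ => hd x) (fun x _ => hasDerivAt_gpdf x)
    (by convert i2.neg using 1; ext x; simp; ring)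
    (by convert i1 using 1; ext x; simp; ring)
    (by convert i0 using 1; ext x; simp; ring)
  simp only [smul_eq_mul]
  have e1 : ∀ x, gaussianPDFReal 0 1 x * (x * h x) = -(h x * -(x * gaussianPDFReal 0 1 x)) := by
    intro x; ring
  simp_rw [e1, integral_neg, this, neg_neg]
  congr 1; ext x; ring

variable {ι : Type*} [Fintype ι] [DecidableEq ι]

lemma mp_update (i : ι) :
    MeasurePreserving (fun q : (ι → ℝ) × ℝ => Function.update q.1 i q.2)
      ((stdG ι).prod (gaussianReal 0 1)) (stdG ι) := by
  have hm : Measurable (fun q : (ι → ℝ) × ℝ => Function.update q.1 i q.2) := by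
    rw [measurable_pi_iff]
    intro j
    by_cases h : j = i
    · subst h; simpa using measurable_snd
    · simp only [Function.update_of_ne h]
      exact (measurable_pi_apply j).comp measurable_fst
  refine ⟨hm, ?_⟩
  unfold stdG
  symm
  apply Measure.pi_eq
  intro s hs
  rw [Measure.map_apply hm (MeasurableSet.univ_pi hs)]
  have : (fun q : (ι → ℝ) × ℝ => Function.update q.1 i q.2) ⁻¹' (Set.univ.pi s) =
      (Set.univ.pi (Function.update s i Set.univ)) ×ˢ s i := by
    ext q
    simp only [Set.mem_preimage, Set.mem_pi, Set.mem_univ, true_imp_iff, Set.mem_prod]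
    constructor
    · intro h
      refine ⟨fun j => ?_, by simpa using h i⟩
      by_cases hj : j = i
      · subst hj; simp
      · simpa [hj] using h j
    · rintro ⟨h1, h2⟩ j
      by_cases hj : j = i
      · subst hj; simpa using h2
      · simpa [hj] using h1 j
  rw [this, Measure.prod_prod, Measure.pi_pi]
  rw [← Finset.mul_prod_erase _ _ (Finset.mem_univ i)]
  rw [← Finset.mul_prod_erase _ (fun i => gaussianReal 0 1 (s i)) (Finset.mem_univ i)]
  simp only [Function.update_self, measure_univ, one_mul]
  rw [mul_comm]
  congr 1
  apply Finset.prod_congr rfl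
  intro j hj
  rw [Function.update_of_ne (Finset.ne_of_mem_erase hj)]

lemma ibp (i : ι) (H H' : (ι → ℝ) → ℝ)
    (hd : ∀ x, HasDerivAt (fun t => H (Function.update x i t)) (H' x) (x i))
    (i0 : Integrable H (stdG ι)) (i1 : Integrable H' (stdG ι))
    (i2 : Integrable (fun x => x i * H x) (stdG ι)) :
    ∫ x, x i * H x ∂(stdG ι) = ∫ x, H' x ∂(stdG ι) := by
  have mp := mp_update i
  have key : ∀ f : (ι → ℝ) → ℝ, Integrable f (stdG ι) →
      ∫ x, f x ∂(stdG ι) = ∫ x, ∫ t, f (Function.update x i t) ∂(gaussianReal 0 1) ∂(stdG ι) := by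
    intro f hf
    conv_lhs => rw [← mp.map_eq]
    rw [integral_map mp.measurable.aemeasurable (by rw [mp.map_eq]; exact hf.1)]
    rw [integral_prod]
    exact mp.integrable_comp_of_integrable hf
  have key2 : ∀ f : (ι → ℝ) → ℝ, Integrable f (stdG ι) →
      ∀ᵐ x ∂(stdG ι), Integrable (fun t => f (Function.update x i t)) (gaussianReal 0 1) := by
    intro f hf
    exact (mp.integrable_comp_of_integrable hf).prod_right_ae
  rw [key _ i2, key _ i1]
  apply integral_congr_ae
  filter_upwards [key2 _ i0, key2 _ i1, key2 _ i2] with x h0 h1 h2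
  simp only [Function.update_self] at h2 ⊢
  refine ibp_one _ _ (fun t => ?_) h0 h1 h2
  have := hd (Function.update x i t)
  simpa using this

open MvPolynomial

lemma poly_integrable (P : MvPolynomial ι ℝ) : Integrable (fun x => eval x P) (stdG ι) := by
  induction P using MvPolynomial.induction_on' with
  | monomial m c =>
    simp only [eval_monomial, Finsupp.prod_fintype _ _ (fun i => pow_zero _)]
    apply Integrable.const_mul
    exact Integrable.fintype_prod (f := fun i (t:ℝ) => t ^ (m i)) (fun i => gauss_pow_integrable _)
  | add p q hp hq => simp only [eval_add]; exact Integrable.add hp hq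

/-- expectation of a polynomial -/
def E : MvPolynomial ι ℝ →ₗ[ℝ] ℝ where
  toFun P := ∫ x, eval x P ∂(stdG ι)
  map_add' P Q := by simp [integral_add (poly_integrable P) (poly_integrable Q)]
  map_smul' c P := by simp [integral_const_mul]

lemma E_def (P : MvPolynomial ι ℝ) : E P = ∫ x, eval x P ∂(stdG ι) := rfl

lemma E_C (c : ℝ) : E (C c : MvPolynomial ι ℝ) = c := by simp [E_def]
lemma E_one : E (1 : MvPolynomial ι ℝ) = 1 := by simp [E_def]
lemma E_C_mul (c : ℝ) (P : MvPolynomial ι ℝ) : E (C c * P) = c * E P := by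
  rw [← smul_eq_C_mul]; simp

lemma E_sq_nonneg (P : MvPolynomial ι ℝ) : 0 ≤ E (P * P) := by
  rw [E_def]; apply integral_nonneg; intro x; simp [mul_self_nonneg]

lemma eval_update_deriv (P : MvPolynomial ι ℝ) (i : ι) (x : ι → ℝ) (t : ℝ) :
    HasDerivAt (fun t => eval (Function.update x i t) P)
      (eval (Function.update x i t) (pderiv i P)) t := by
  induction P using MvPolynomial.induction_on with
  | C a => simpa using hasDerivAt_const _ _
  | add p q hp hq => simp only [map_add]; exact HasDerivAt.fun_add hp hq
  | mul_X p j hp =>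
    simp only [eval_mul, eval_X, pderiv_mul, eval_add]
    by_cases h : j = i
    · subst h
      simpa using HasDerivAt.fun_mul hp (hasDerivAt_id' t)
    · simpa [h, pderiv_X, Pi.single_apply, Ne.symm h, Function.update_of_ne h] using hp.mul_const (x j)

lemma E_ibp (i : ι) (P : MvPolynomial ι ℝ) : E (X i * P) = E (pderiv i P) := by
  rw [E_def, E_def]
  simp only [eval_mul, eval_X]
  apply ibp i _ _ (fun x => ?_) (poly_integrable _) (poly_integrable _)
  · convert poly_integrable (X i * P) using 2; simp
  · simpa using eval_update_deriv P i x (x i)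

lemma pderiv_comm (i j : ι) (P : MvPolynomial ι ℝ) :
    pderiv i (pderiv j P) = pderiv j (pderiv i P) := by
  induction P using MvPolynomial.induction_on with
  | C a => simp
  | add p q hp hq => simp [hp, hq]
  | mul_X p k hp =>
    simp only [pderiv_mul, map_add, hp, pderiv_X]
    have : ∀ a b : ι, pderiv a ((Pi.single b (1 : MvPolynomial ι ℝ) : ι → MvPolynomial ι ℝ) k) = 0 := by
      intro a b
      by_cases h : k = b
      · subst h; simp
      · simp [Pi.single_apply, h]
    simp only [this]
    ring

lemma E_abs_le (P : MvPolynomial ι ℝ) :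
    ∫ x, |eval x P| ∂(stdG ι) ≤ Real.sqrt (E (P * P)) := by
  apply Real.le_sqrt_of_sq_le
  have h1 : Integrable (fun x => |eval x P|) (stdG ι) := (poly_integrable P).abs
  set m := ∫ x, |eval x P| ∂(stdG ι)
  have : 0 ≤ ∫ x, (|eval x P| - m) ^ 2 ∂(stdG ι) := integral_nonneg fun x => sq_nonneg _
  have e : ∀ x, (|eval x P| - m) ^ 2 = eval x (P * P) - 2 * m * |eval x P| + m ^ 2 := by
    intro x; rw [eval_mul, ← abs_mul_abs_self]; ring
  simp_rw [e] at this
  rw [integral_add (by exact (poly_integrable _).sub (h1.const_mul _)) (integrable_const _),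
    integral_sub (poly_integrable _) (h1.const_mul _), integral_const_mul] at this
  simp only [integral_const, probReal_univ, one_smul] at this
  rw [E_def]
  change 0 ≤ _ - 2 * m * m + m ^ 2 at this
  linarith [this]

end UC

namespace UC
open MvPolynomial
variable {ι : Type*} [Fintype ι] [DecidableEq ι]

/-! ### Chaos algebra -/

lemma E_CS (P Q : MvPolynomial ι ℝ) : E (P * Q) ^ 2 ≤ E (P * P) * E (Q * Q) := by
  have h : ∀ t : ℝ, 0 ≤ E (P * P) * (t * t) + (2 * E (P * Q)) * t + E (Q * Q) := by
    intro t
    have := E_sq_nonneg (C t * P + Q)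
    have e : (C t * P + Q) * (C t * P + Q) =
        C (t * t) * (P * P) + C (2 * t) * (P * Q) + Q * Q := by
      simp only [C_mul, map_ofNat]; ring
    rw [e, map_add, map_add, E_C_mul, E_C_mul] at this
    linarith
  have := discrim_le_zero h
  unfold discrim at this
  nlinarith

lemma E_null {P : MvPolynomial ι ℝ} (h : E (P * P) = 0) (Q : MvPolynomial ι ℝ) : E (P * Q) = 0 := by
  have := E_CS P Q
  rw [h, zero_mul] at this
  exact pow_eq_zero_iff (two_ne_zero) |>.1 (le_antisymm this (sq_nonneg _))

lemma E_sq_le (P : MvPolynomial ι ℝ) : E P ^ 2 ≤ E (P * P) := by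
  have := E_CS P 1
  simpa [E_one] using this

/-- Ornstein–Uhlenbeck generator -/
def Lop : MvPolynomial ι ℝ →ₗ[ℝ] MvPolynomial ι ℝ where
  toFun P := ∑ i, (pderiv i (pderiv i P) - X i * pderiv i P)
  map_add' P Q := by
    rw [← Finset.sum_add_distrib]; apply Finset.sum_congr rfl; intro i _; simp; ring
  map_smul' c P := by
    simp only [Derivation.map_smul, RingHom.id_apply, Finset.smul_sum, smul_sub, mul_smul_comm]

lemma Lop_def (P : MvPolynomial ι ℝ) :
    Lop P = ∑ i, (pderiv i (pderiv i P) - X i * pderiv i P) := rfl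

def Gam (P Q : MvPolynomial ι ℝ) : MvPolynomial ι ℝ := ∑ i, pderiv i P * pderiv i Q

def Chaos (x : ℝ) (P : MvPolynomial ι ℝ) : Prop := Lop P = -(x • P)

lemma E_Lop (P Q : MvPolynomial ι ℝ) : E (Lop P * Q) = - E (Gam P Q) := by
  rw [Lop_def, Gam, Finset.sum_mul, map_sum, map_sum, ← Finset.sum_neg_distrib]
  apply Finset.sum_congr rfl
  intro i _
  rw [sub_mul, map_sub, mul_assoc, E_ibp, pderiv_mul, map_add]
  ring

lemma Gam_comm (P Q : MvPolynomial ι ℝ) : Gam P Q = Gam Q P := by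
  unfold Gam; simp_rw [mul_comm]

lemma Chaos.gam {x : ℝ} {P : MvPolynomial ι ℝ} (h : Chaos x P) (Q : MvPolynomial ι ℝ) :
    E (Gam P Q) = x * E (P * Q) := by
  have := E_Lop P Q
  rw [h] at this
  simp at this
  linarith

lemma Chaos.orth {x y : ℝ} {P Q : MvPolynomial ι ℝ} (h : Chaos x P) (h' : Chaos y Q)
    (hxy : x ≠ y) : E (P * Q) = 0 := by
  have h1 := h.gam Q
  have h2 := h'.gam P
  rw [Gam_comm, h1, mul_comm Q P] at h2
  have : (x - y) * E (P * Q) = 0 := by linarith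
  rcases mul_eq_zero.1 this with h | h
  · exact absurd (sub_eq_zero.1 h) hxy
  · exact h

lemma Chaos.add {x : ℝ} {P Q : MvPolynomial ι ℝ} (h : Chaos x P) (h' : Chaos x Q) :
    Chaos x (P + Q) := by
  unfold Chaos at *; rw [map_add, h, h']; simp; ring

lemma Chaos.smul {x : ℝ} {P : MvPolynomial ι ℝ} (h : Chaos x P) (c : ℝ) : Chaos x (c • P) := by
  unfold Chaos at *; rw [map_smul, h, smul_neg, smul_comm]

lemma Chaos.zero {x : ℝ} : Chaos x (0 : MvPolynomial ι ℝ) := by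
  unfold Chaos; simp

lemma Chaos.sum {x : ℝ} {T : Type*} (s : Finset T) (F : T → MvPolynomial ι ℝ)
    (h : ∀ t ∈ s, Chaos x (F t)) : Chaos x (∑ t ∈ s, F t) := by
  classical
  induction s using Finset.induction_on with
  | empty => simpa using Chaos.zero
  | insert a s ha ih =>
    rw [Finset.sum_insert ha]
    exact (h a (Finset.mem_insert_self _ _)).add (ih fun t ht => h t (Finset.mem_insert_of_mem ht))

lemma chaos_C (c : ℝ) : Chaos 0 (C c : MvPolynomial ι ℝ) := by
  unfold Chaos; simp [Lop_def]

lemma Chaos.E_eq_zero {x : ℝ} {P : MvPolynomial ι ℝ} (h : Chaos x P) (hx : x ≠ 0) : E P = 0 := by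
  have := h.orth (chaos_C 1) hx
  simpa using this

lemma pderiv_Lop (i : ι) (P : MvPolynomial ι ℝ) :
    pderiv i (Lop P) = Lop (pderiv i P) - pderiv i P := by
  rw [Lop_def, Lop_def, map_sum]
  have : ∀ j, pderiv i (pderiv j (pderiv j P) - X j * pderiv j P) =
      (pderiv j (pderiv j (pderiv i P)) - X j * pderiv j (pderiv i P)) -
        (if j = i then pderiv i P else 0) := by
    intro j
    rw [map_sub, pderiv_mul, pderiv_comm i j (pderiv j P), pderiv_comm i j P]
    by_cases h : j = i
    · subst h; simp; ring
    · simp [h, Ne.symm h, pderiv_X_of_ne h]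
  simp_rw [this]
  rw [Finset.sum_sub_distrib]
  simp

lemma Chaos.pderiv {x : ℝ} {P : MvPolynomial ι ℝ} (h : Chaos x P) (i : ι) :
    Chaos (x - 1) (pderiv i P) := by
  unfold Chaos at *
  have := pderiv_Lop i P
  rw [h] at this
  rw [eq_sub_iff_add_eq] at this
  rw [← this]
  simp [sub_smul]
  ring

/-- iterated derivative -/
def D : (n : ℕ) → (Fin n → ι) → (MvPolynomial ι ℝ →ₗ[ℝ] MvPolynomial ι ℝ)
  | 0, _ => LinearMap.id
  | n + 1, α => (D n (Fin.tail α)).comp (MvPolynomial.pderiv (α 0)).toLinearMap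

@[simp] lemma D_zero (α : Fin 0 → ι) (P : MvPolynomial ι ℝ) : D 0 α P = P := rfl
@[simp] lemma D_cons (n : ℕ) (i : ι) (α : Fin n → ι) (P : MvPolynomial ι ℝ) :
    D (n + 1) (Fin.cons i α) P = D n α (MvPolynomial.pderiv i P) := rfl

lemma D_pderiv (n : ℕ) (α : Fin n → ι) (i : ι) (P : MvPolynomial ι ℝ) :
    D n α (MvPolynomial.pderiv i P) = MvPolynomial.pderiv i (D n α P) := by
  induction n generalizing P with
  | zero => rfl
  | succ n ih =>
    change D n _ (MvPolynomial.pderiv _ _) = MvPolynomial.pderiv i (D n _ (MvPolynomial.pderiv _ _))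
    rw [pderiv_comm, ih]

lemma Chaos.D {x : ℝ} {P : MvPolynomial ι ℝ} (h : Chaos x P) (n : ℕ) (α : Fin n → ι) :
    Chaos (x - n) (D n α P) := by
  induction n generalizing P x with
  | zero => simpa using h
  | succ n ih =>
    have := ih (h.pderiv (α 0)) (Fin.tail α)
    have e : x - ((n + 1 : ℕ) : ℝ) = x - 1 - n := by push_cast; ring
    rw [e]; exact this

lemma sum_cons {M : Type*} [AddCommMonoid M] (n : ℕ) (f : (Fin (n + 1) → ι) → M) :
    ∑ α, f α = ∑ i, ∑ α : Fin n → ι, f (Fin.cons i α) := by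
  rw [← (Fin.consEquiv (fun _ => ι)).sum_comp, Fintype.sum_prod_type]
  rfl

lemma sum_zero_idx {M : Type*} [AddCommMonoid M] (f : (Fin 0 → ι) → M) :
    ∑ α, f α = f Fin.elim0 := by
  rw [Fintype.sum_eq_single Fin.elim0]
  intro x hx; exact absurd (Subsingleton.elim _ _) hx

lemma Chaos.sum_D {x : ℝ} {P : MvPolynomial ι ℝ} (h : Chaos x P) (n : ℕ) (Q : MvPolynomial ι ℝ) :
    ∑ α : Fin n → ι, E (UC.D n α P * UC.D n α Q) =
      (∏ j ∈ Finset.range n, (x - j)) * E (P * Q) := by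
  induction n generalizing P Q x with
  | zero => simp [sum_zero_idx]
  | succ n ih =>
    rw [sum_cons]
    simp only [D_cons]
    have : ∀ i, ∑ α : Fin n → ι, E (UC.D n α (MvPolynomial.pderiv i P) * UC.D n α (MvPolynomial.pderiv i Q))
      = (∏ j ∈ Finset.range n, (x - 1 - j)) * E (MvPolynomial.pderiv i P * MvPolynomial.pderiv i Q) :=
      fun i => ih (h.pderiv i) _
    simp_rw [this]
    rw [← Finset.mul_sum, ← map_sum]
    have h2 := h.gam Q
    unfold Gam at h2
    rw [h2, Finset.prod_range_succ']
    have : ∀ j : ℕ, x - 1 - (j : ℝ) = x - ((j + 1 : ℕ) : ℝ) := by intro j; push_cast; ring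
    simp_rw [this]
    simp
    ring

lemma Chaos.neg_null {x : ℝ} {P : MvPolynomial ι ℝ} (h : Chaos x P) (hx : x < 0) : E (P * P) = 0 := by
  have h1 := h.gam P
  have h2 : 0 ≤ E (Gam P P) := by
    unfold Gam; rw [map_sum]; exact Finset.sum_nonneg fun i _ => E_sq_nonneg _
  have h3 := E_sq_nonneg P
  nlinarith

lemma totalDegree_pderiv_le (i : ι) (P : MvPolynomial ι ℝ) :
    (MvPolynomial.pderiv i P).totalDegree ≤ P.totalDegree - 1 := by
  conv_lhs => rw [P.as_sum, map_sum]
  apply totalDegree_finsetSum_le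
  intro m hm
  have h1 := le_totalDegree hm
  rw [pderiv_monomial]
  by_cases h : m i = 0
  · simp [h]
  refine (totalDegree_monomial_le _ _).trans ?_
  have : m = (m - Finsupp.single i 1) + Finsupp.single i 1 := by
    ext j; by_cases hj : j = i
    · subst hj; simp; omega
    · simp [Finsupp.single_apply, Ne.symm hj]
  have h2 : m.degree = (m - Finsupp.single i 1).degree + 1 := by
    conv_lhs => rw [this]
    simp
  change (m - Finsupp.single i 1).degree ≤ _
  change m.degree ≤ _ at h1
  omega

lemma Lop_deg (n : ℕ) (P : MvPolynomial ι ℝ) (h : P.totalDegree ≤ n + 1) :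
    (Lop P + ((n + 1 : ℕ) : ℝ) • P).totalDegree ≤ n := by
  have e : Lop P + ((n + 1 : ℕ) : ℝ) • P =
      ∑ m ∈ P.support, (Lop (monomial m (coeff m P)) + ((n + 1 : ℕ) : ℝ) • monomial m (coeff m P)) := by
    conv_lhs => rw [P.as_sum, map_sum, Finset.smul_sum, ← Finset.sum_add_distrib]
  rw [e]
  apply totalDegree_finsetSum_le
  intro m hm
  have h1 := (le_totalDegree hm).trans h
  change m.degree ≤ _ at h1
  rw [Lop_def, Finset.sum_sub_distrib]
  have e2 : ∑ i, X i * MvPolynomial.pderiv i (monomial m (coeff m P)) = (m.degree : ℝ) • monomial m (coeff m P) := by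
    simp_rw [X_mul_pderiv_monomial, ← Finset.sum_smul]
    rw [Finsupp.degree_eq_sum, ← Nat.cast_smul_eq_nsmul ℝ]
  rw [e2, sub_add, ← sub_smul]
  refine (totalDegree_sub _ _).trans (max_le ?_ ?_)
  · apply totalDegree_finsetSum_le
    intro i _
    refine (totalDegree_pderiv_le _ _).trans ?_
    have := totalDegree_pderiv_le i (monomial m (coeff m P))
    have h3 := totalDegree_monomial_le m (coeff m P)
    change _ ≤ m.degree at h3
    omega
  · rcases Nat.lt_or_ge m.degree (n + 1) with h2 | h2
    · refine (totalDegree_smul_le _ _).trans ((totalDegree_monomial_le _ _).trans ?_)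
      change m.degree ≤ _
      omega
    · have : m.degree = n + 1 := by omega
      simp [this]

lemma chaos_decomp (n : ℕ) (P : MvPolynomial ι ℝ) (h : P.totalDegree ≤ n) :
    ∃ R : ℕ → MvPolynomial ι ℝ, P = ∑ j ∈ Finset.range (n + 1), R j ∧ (∀ j : ℕ, Chaos j (R j)) ∧
      ∃ c, R 0 = C c := by
  induction n generalizing P with
  | zero =>
    have := totalDegree_eq_zero_iff_eq_C.1 (Nat.le_zero.1 h)
    refine ⟨fun j => if j = 0 then P else 0, by simp, fun j => ?_, _, by simpa using this⟩
    by_cases hj : j = 0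
    · subst hj; simp only [if_true]; rw [this]; simpa using chaos_C _
    · simpa [hj] using Chaos.zero
  | succ n ih =>
    obtain ⟨R, h1, h2, c, h3⟩ := ih _ (Lop_deg n P h)
    set P' := ∑ j ∈ Finset.range (n + 1), (((n : ℝ) + 1 - j)⁻¹ • R j) with hP'
    refine ⟨fun j => if j = n + 1 then P - P' else (((n : ℝ) + 1 - j)⁻¹ • R j), ?_, ?_, ?_⟩
    · rw [Finset.sum_range_succ]
      simp only [if_true]
      have : ∑ j ∈ Finset.range (n + 1), (if j = n + 1 then P - P' else (((n : ℝ) + 1 - j)⁻¹ • R j)) = P' := by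
        rw [hP']
        apply Finset.sum_congr rfl
        intro j hj
        rw [if_neg]; have := Finset.mem_range.1 hj; omega
      rw [this]; ring
    · intro j
      by_cases hj : j = n + 1
      · subst hj
        simp only [if_true]
        have : Lop P' + ((n + 1 : ℕ) : ℝ) • P' = Lop P + ((n + 1 : ℕ) : ℝ) • P := by
          rw [h1, hP', map_sum, Finset.smul_sum, ← Finset.sum_add_distrib]
          apply Finset.sum_congr rfl
          intro j hj
          have hj' : (j : ℝ) < n + 1 := by exact_mod_cast Finset.mem_range.1 hj
          rw [map_smul, h2 j, smul_neg, smul_smul, smul_smul, neg_add_eq_sub, ← sub_smul]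
          have : ((n + 1 : ℕ) : ℝ) * ((n : ℝ) + 1 - j)⁻¹ - ((n : ℝ) + 1 - j)⁻¹ * j = 1 := by
            push_cast
            have : (n : ℝ) + 1 - j ≠ 0 := by linarith
            field_simp
          rw [this, one_smul]
        unfold Chaos
        rw [map_sub, smul_sub]
        linear_combination (exp := 1) -this
      · simpa [hj] using (h2 j).smul _
    · refine ⟨((n : ℝ) + 1)⁻¹ * c, ?_⟩
      simp [h3, smul_eq_C_mul]

lemma E_mul_sum_chaos (n : ℕ) (R : ℕ → MvPolynomial ι ℝ) (h : ∀ j : ℕ, Chaos j (R j)) :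
    E ((∑ j ∈ Finset.range n, R j) * (∑ j ∈ Finset.range n, R j)) =
      ∑ j ∈ Finset.range n, E (R j * R j) := by
  rw [Finset.sum_mul_sum, map_sum]
  apply Finset.sum_congr rfl
  intro i hi
  rw [map_sum, Finset.sum_eq_single i]
  · intro j _ hj
    exact (h i).orth (h j) (by exact_mod_cast hj.symm)
  · intro h; exact absurd hi h

lemma E_gam_sum_chaos (n : ℕ) (R : ℕ → MvPolynomial ι ℝ) (h : ∀ j : ℕ, Chaos j (R j)) :
    E (Gam (∑ j ∈ Finset.range n, R j) (∑ j ∈ Finset.range n, R j)) =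
      ∑ j ∈ Finset.range n, (j : ℝ) * E (R j * R j) := by
  have h1 := E_Lop (∑ j ∈ Finset.range n, R j) (∑ j ∈ Finset.range n, R j)
  rw [← neg_eq_iff_eq_neg] at h1
  rw [← h1, map_sum, Finset.sum_mul_sum, map_sum, ← Finset.sum_neg_distrib]
  apply Finset.sum_congr rfl
  intro i hi
  rw [map_sum, Finset.sum_eq_single i, h i]
  · simp
  · intro j _ hj
    rw [h i]
    have := (h i).orth (h j) (by exact_mod_cast hj.symm)
    simp [this]
  · intro h; exact absurd hi h

lemma poincare (P : MvPolynomial ι ℝ) : E (P * P) ≤ E P ^ 2 + E (Gam P P) := by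
  obtain ⟨R, h1, h2, c, h3⟩ := chaos_decomp _ P le_rfl
  have e1 := E_mul_sum_chaos (P.totalDegree + 1) R h2
  have e2 := E_gam_sum_chaos (P.totalDegree + 1) R h2
  rw [← h1] at e1 e2
  have e3 : E P = c := by
    conv_lhs => rw [h1]
    rw [map_sum, Finset.sum_eq_single 0, h3, E_C]
    · intro j _ hj
      exact (h2 j).E_eq_zero (by exact_mod_cast hj)
    · simp
  rw [e1, e2, e3, Finset.sum_range_succ', Finset.sum_range_succ', h3]
  have : E ((C c : MvPolynomial ι ℝ) * C c) = c ^ 2 := by rw [← C_mul, E_C]; ring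
  rw [this]
  have : ∑ j ∈ Finset.range P.totalDegree, E (R (j + 1) * R (j + 1)) ≤
    ∑ j ∈ Finset.range P.totalDegree, ((j + 1 : ℕ) : ℝ) * E (R (j + 1) * R (j + 1)) := by
    apply Finset.sum_le_sum
    intro j _
    have := E_sq_nonneg (R (j + 1))
    push_cast
    nlinarith [(Nat.cast_nonneg j : (0:ℝ) ≤ j)]
  simp only [Nat.cast_zero, zero_mul]
  linarith

lemma inv_poincare (n : ℕ) (P : MvPolynomial ι ℝ) (h : P.totalDegree ≤ n) :
    E (Gam P P) ≤ n * E (P * P) := by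
  obtain ⟨R, h1, h2, c, h3⟩ := chaos_decomp _ P h
  have e1 := E_mul_sum_chaos (n + 1) R h2
  have e2 := E_gam_sum_chaos (n + 1) R h2
  rw [← h1] at e1 e2
  rw [e1, e2, Finset.mul_sum]
  apply Finset.sum_le_sum
  intro j hj
  have := Finset.mem_range.1 hj
  apply mul_le_mul_of_nonneg_right _ (E_sq_nonneg _)
  exact_mod_cast Nat.lt_succ_iff.1 this

/-- the squared norms of the expected n-th derivative tensor -/
def A (n : ℕ) (P : MvPolynomial ι ℝ) : ℝ := ∑ α : Fin n → ι, E (D n α P) ^ 2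

lemma A_nonneg (n : ℕ) (P : MvPolynomial ι ℝ) : 0 ≤ A n P := Finset.sum_nonneg fun _ _ => sq_nonneg _

lemma A_zero (P : MvPolynomial ι ℝ) : A 0 P = E P ^ 2 := by simp [A, sum_zero_idx]

lemma A_succ (n : ℕ) (P : MvPolynomial ι ℝ) : A (n + 1) P = ∑ i, A n (MvPolynomial.pderiv i P) := by
  simp [A, sum_cons]

lemma A_add (n : ℕ) (P Q : MvPolynomial ι ℝ) : A n (P + Q) ≤ 2 * A n P + 2 * A n Q := by
  unfold A
  rw [Finset.mul_sum, Finset.mul_sum, ← Finset.sum_add_distrib]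
  apply Finset.sum_le_sum
  intro α _
  rw [map_add, map_add]
  nlinarith [sq_nonneg (E (D n α P) - E (D n α Q))]

lemma E_sq_le_A (N : ℕ) (P : MvPolynomial ι ℝ) (h : P.totalDegree ≤ N) :
    E (P * P) ≤ ∑ n ∈ Finset.range (N + 1), A n P := by
  induction N generalizing P with
  | zero =>
    have := totalDegree_eq_zero_iff_eq_C.1 (Nat.le_zero.1 h)
    rw [this]
    rw [← C_mul, E_C]; simp [A_zero, E_C, sq]
  | succ N ih =>
    have h1 := poincare P
    have h2 : E (Gam P P) ≤ ∑ i, ∑ n ∈ Finset.range (N + 1), A n (MvPolynomial.pderiv i P) := by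
      unfold Gam
      rw [map_sum]
      apply Finset.sum_le_sum
      intro i _
      apply ih
      have := totalDegree_pderiv_le i P
      omega
    rw [Finset.sum_comm] at h2
    simp_rw [← A_succ] at h2
    rw [Finset.sum_range_succ', A_zero]
    linarith

lemma A_le_of_chaos (n : ℕ) (P : MvPolynomial ι ℝ) (h : Chaos n P) :
    A n P ≤ n.factorial * E (P * P) := by
  have h1 := h.sum_D n P
  have : (∏ j ∈ Finset.range n, ((n : ℝ) - j)) = n.factorial := by
    rw [← Finset.prod_range_reflect, ← Finset.prod_range_add_one_eq_factorial]
    push_cast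
    apply Finset.prod_congr rfl
    intro j hj
    have := Finset.mem_range.1 hj
    rw [Nat.sub_sub, Nat.cast_sub (by omega)]
    push_cast; ring
  rw [← this, ← h1]
  exact Finset.sum_le_sum fun α _ => E_sq_le _

lemma A_lower (n : ℕ) (hn : n ≠ 0) (P : MvPolynomial ι ℝ) :
    E P ^ 2 + A n P / n.factorial ≤ E (P * P) := by
  obtain ⟨R, h1, h2, c, h3⟩ := chaos_decomp (max n P.totalDegree) P (le_max_right _ _)
  set N := max n P.totalDegree
  have e1 := E_mul_sum_chaos (N + 1) R h2
  rw [← h1] at e1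
  have e3 : E P = c := by
    conv_lhs => rw [h1]
    rw [map_sum, Finset.sum_eq_single 0, h3, E_C]
    · intro j _ hj
      exact (h2 j).E_eq_zero (by exact_mod_cast hj)
    · simp
  have e4 : A n P = A n (R n) := by
    unfold A
    apply Finset.sum_congr rfl
    intro α _
    congr 1
    conv_lhs => rw [h1]
    rw [map_sum, map_sum, Finset.sum_eq_single n]
    · intro j _ hj
      apply ((h2 j).D n α).E_eq_zero
      rw [sub_ne_zero]
      exact_mod_cast hj
    · intro h; exfalso; apply h; rw [Finset.mem_range]; have := le_max_left n P.totalDegree; omega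
  have e5 : A n (R n) / n.factorial ≤ E (R n * R n) := by
    rw [div_le_iff₀ (by positivity), mul_comm]
    exact A_le_of_chaos n _ (h2 n)
  have e6 : E (R 0 * R 0) + E (R n * R n) ≤ ∑ j ∈ Finset.range (N + 1), E (R j * R j) := by
    rw [← Finset.sum_pair (f := fun j => E (R j * R j)) (Ne.symm hn)]
    apply Finset.sum_le_sum_of_subset_of_nonneg
    · intro j hj
      have := le_max_left n P.totalDegree
      simp at hj ⊢
      rcases hj with h | h <;> omega
    · intro j _ _; exact E_sq_nonneg _
  have : E (R 0 * R 0) = c ^ 2 := by rw [h3, ← C_mul, E_C]; ring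
  rw [e3, e4, e1]
  linarith

end UC

namespace UC
open MvPolynomial
variable {ι : Type*} [Fintype ι] [DecidableEq ι]

/-! ### Leibniz bound, contractions, fourth moment -/

def S {T : Type*} [Fintype T] (r s : ℕ) (F G : T → MvPolynomial ι ℝ) : ℝ :=
  ∑ α : Fin r → ι, ∑ β : Fin s → ι, (∑ t, E (D r α (F t) * D s β (G t))) ^ 2

lemma S_nonneg {T : Type*} [Fintype T] (r s : ℕ) (F G : T → MvPolynomial ι ℝ) : 0 ≤ S r s F G :=
  Finset.sum_nonneg fun _ _ => Finset.sum_nonneg fun _ _ => sq_nonneg _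

lemma S_succ_left {T : Type*} [Fintype T] (r s : ℕ) (F G : T → MvPolynomial ι ℝ) :
    S (r + 1) s F G = ∑ i, S r s (fun t => pderiv i (F t)) G := by
  simp [S, sum_cons]

lemma S_succ_right {T : Type*} [Fintype T] (r s : ℕ) (F G : T → MvPolynomial ι ℝ) :
    S r (s + 1) F G = ∑ i, S r s F (fun t => pderiv i (G t)) := by
  unfold S
  rw [Finset.sum_comm]
  simp only [sum_cons, D_cons]
  apply Finset.sum_congr rfl
  intro i _
  rw [Finset.sum_comm]

lemma A_mul_le {T : Type*} [Fintype T] (n : ℕ) (F G : T → MvPolynomial ι ℝ) :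
    A n (∑ t, F t * G t) ≤ 4 ^ n * ∑ q ∈ Finset.HasAntidiagonal.antidiagonal n, S q.1 q.2 F G := by
  induction n generalizing F G with
  | zero =>
    simp [A_zero, S, sum_zero_idx]
  | succ n ih =>
    rw [A_succ]
    have h1 : ∀ i, A n (pderiv i (∑ t, F t * G t)) ≤
        2 * (4 ^ n * ∑ q ∈ Finset.HasAntidiagonal.antidiagonal n, S q.1 q.2 (fun t => pderiv i (F t)) G) +
        2 * (4 ^ n * ∑ q ∈ Finset.HasAntidiagonal.antidiagonal n, S q.1 q.2 F (fun t => pderiv i (G t))) := by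
      intro i
      have : pderiv i (∑ t, F t * G t) = (∑ t, pderiv i (F t) * G t) + ∑ t, F t * pderiv i (G t) := by
        rw [map_sum, ← Finset.sum_add_distrib]
        apply Finset.sum_congr rfl
        intro t _
        rw [pderiv_mul]
      rw [this]
      refine (A_add _ _ _).trans ?_
      have := ih (fun t => pderiv i (F t)) G
      have := ih F (fun t => pderiv i (G t))
      linarith
    refine (Finset.sum_le_sum fun i _ => h1 i).trans ?_
    rw [Finset.sum_add_distrib, ← Finset.mul_sum, ← Finset.mul_sum, ← Finset.mul_sum, ← Finset.mul_sum,
      Finset.sum_comm, Finset.sum_comm (s := Finset.univ) (t := Finset.HasAntidiagonal.antidiagonal n)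
        (f := fun i q => S q.1 q.2 F (fun t => pderiv i (G t)))]
    simp_rw [← S_succ_left, ← S_succ_right]
    have e1 := Finset.Nat.sum_antidiagonal_succ (n := n) (f := fun q => S q.1 q.2 F G)
    have e2 := Finset.Nat.sum_antidiagonal_succ' (n := n) (f := fun q => S q.1 q.2 F G)
    simp only at e1 e2
    have n1 := S_nonneg 0 (n + 1) F G
    have n2 := S_nonneg (n + 1) 0 F G
    rw [pow_succ]
    have h4 : (0:ℝ) ≤ 4 ^ n := by positivity
    nlinarith [mul_nonneg h4 n1, mul_nonneg h4 n2]

lemma chaos_zero_mul {P : MvPolynomial ι ℝ} (h : Chaos 0 P) (Q : MvPolynomial ι ℝ) :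
    E (P * Q) = E P * E Q := by
  have h1 := poincare P
  rw [h.gam P, zero_mul, add_zero] at h1
  have h2 : E ((P - C (E P)) * (P - C (E P))) = 0 := by
    have e : (P - C (E P)) * (P - C (E P)) = P * P - C (2 * E P) * P + C (E P * E P) := by
      simp only [C_mul, map_ofNat]; ring
    apply le_antisymm _ (E_sq_nonneg _)
    rw [e, map_add, map_sub, E_C_mul, E_C]
    nlinarith
  have h3 := E_null h2 Q
  rw [sub_mul, map_sub, E_C_mul] at h3
  linarith

lemma fact_prod (n : ℕ) : (∏ j ∈ Finset.range n, ((n : ℝ) - j)) = n.factorial := by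
  rw [← Finset.prod_range_reflect, ← Finset.prod_range_add_one_eq_factorial]
  push_cast
  apply Finset.prod_congr rfl
  intro j hj
  have := Finset.mem_range.1 hj
  rw [Nat.sub_sub, Nat.cast_sub (by omega)]
  push_cast; ring

lemma chaos_pairing {n : ℕ} {P : MvPolynomial ι ℝ} (h : Chaos n P) (Q : MvPolynomial ι ℝ) :
    ∑ γ : Fin n → ι, E (D n γ P) * E (D n γ Q) = n.factorial * E (P * Q) := by
  have h1 := h.sum_D n Q
  rw [fact_prod] at h1
  rw [← h1]
  apply Finset.sum_congr rfl
  intro γ _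
  rw [chaos_zero_mul]
  simpa using h.D n γ

lemma D_comm (n m : ℕ) (α : Fin n → ι) (β : Fin m → ι) (P : MvPolynomial ι ℝ) :
    D n α (D m β P) = D m β (D n α P) := by
  induction n generalizing P with
  | zero => rfl
  | succ n ih =>
    change D n _ (pderiv _ _) = D m β (D n _ (pderiv _ _))
    rw [← D_pderiv, ih]

/-- squared norm of the `j`-th contraction -/
def Kc (j : ℕ) (F : MvPolynomial ι ℝ) : ℝ :=
  ∑ γ : Fin j → ι, ∑ γ' : Fin j → ι, (E (D j γ F * D j γ' F)) ^ 2

lemma Kc_nonneg (j : ℕ) (F : MvPolynomial ι ℝ) : 0 ≤ Kc j F :=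
  Finset.sum_nonneg fun _ _ => Finset.sum_nonneg fun _ _ => sq_nonneg _

lemma Kc_top {k : ℕ} {F : MvPolynomial ι ℝ} (h : Chaos k F) :
    Kc k F = (k.factorial * E (F * F)) ^ 2 := by
  rw [← chaos_pairing h, sq, Finset.sum_mul_sum]
  unfold Kc
  apply Finset.sum_congr rfl; intro γ _
  apply Finset.sum_congr rfl; intro γ' _
  rw [chaos_zero_mul (by simpa using h.D k γ)]
  ring

lemma Kc_zero (F : MvPolynomial ι ℝ) : Kc 0 F = (E (F * F)) ^ 2 := by
  simp [Kc, sum_zero_idx]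

lemma Chaos.null_D {k : ℕ} {F : MvPolynomial ι ℝ} (h : Chaos k F) {r : ℕ} (hr : k < r)
    (α : Fin r → ι) (Q : MvPolynomial ι ℝ) : E (UC.D r α F * Q) = 0 := by
  apply E_null
  apply (h.D r α).neg_null
  rw [sub_neg]; exact_mod_cast hr

/-- contraction bound, balanced case -/
lemma contr_bal (r r' j : ℕ) (F G : MvPolynomial ι ℝ) (hF : Chaos (r + j : ℕ) F)
    (hG : Chaos (r' + j : ℕ) G) :
    ∑ α : Fin r → ι, ∑ β : Fin r' → ι, E (D r α F * D r' β G) ^ 2 ≤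
      (r.factorial * r'.factorial) * Real.sqrt (Kc j F * Kc j G) := by
  have h1 : ∀ (α : Fin r → ι) (β : Fin r' → ι), (j.factorial : ℝ) * E (D r α F * D r' β G) =
      ∑ γ : Fin j → ι, E (D j γ (D r α F)) * E (D j γ (D r' β G)) := by
    intro α β
    rw [chaos_pairing]
    have := hF.D r α
    simpa using this
  have h2 : ∀ γ γ' : Fin j → ι, ∑ α : Fin r → ι, E (D j γ (D r α F)) * E (D j γ' (D r α F)) =
      r.factorial * E (D j γ F * D j γ' F) := by
    intro γ γ'
    rw [← chaos_pairing (n := r)]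
    · apply Finset.sum_congr rfl; intro α _
      rw [D_comm r j, D_comm r j]
    · have := hF.D j γ
      simpa using this
  have h3 : ∀ γ γ' : Fin j → ι, ∑ α : Fin r' → ι, E (D j γ (D r' α G)) * E (D j γ' (D r' α G)) =
      r'.factorial * E (D j γ G * D j γ' G) := by
    intro γ γ'
    rw [← chaos_pairing (n := r')]
    · apply Finset.sum_congr rfl; intro α _
      rw [D_comm r' j, D_comm r' j]
    · have := hG.D j γ
      simpa using this
  have h4 : (j.factorial : ℝ) ^ 2 * ∑ α : Fin r → ι, ∑ β : Fin r' → ι, E (D r α F * D r' β G) ^ 2 =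
      (r.factorial * r'.factorial) * ∑ γ : Fin j → ι, ∑ γ' : Fin j → ι,
        E (D j γ F * D j γ' F) * E (D j γ G * D j γ' G) := by
    have : ∀ γ γ' : Fin j → ι, ((r.factorial : ℝ) * r'.factorial) *
        (E (D j γ F * D j γ' F) * E (D j γ G * D j γ' G)) =
        ∑ α : Fin r → ι, ∑ β : Fin r' → ι, (E (D j γ (D r α F)) * E (D j γ (D r' β G))) *
          (E (D j γ' (D r α F)) * E (D j γ' (D r' β G))) := by
      intro γ γ'
      have : ((r.factorial : ℝ) * r'.factorial) *
        (E (D j γ F * D j γ' F) * E (D j γ G * D j γ' G)) =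
        (r.factorial * E (D j γ F * D j γ' F)) * (r'.factorial * E (D j γ G * D j γ' G)) := by ring
      rw [this, ← h2, ← h3, Finset.sum_mul_sum]
      apply Finset.sum_congr rfl; intro α _
      apply Finset.sum_congr rfl; intro β _
      ring
    simp_rw [Finset.mul_sum, this]
    have e : ∀ α β, (j.factorial : ℝ) ^ 2 * E (D r α F * D r' β G) ^ 2 =
        ∑ γ : Fin j → ι, ∑ γ' : Fin j → ι, (E (D j γ (D r α F)) * E (D j γ (D r' β G))) *
          (E (D j γ' (D r α F)) * E (D j γ' (D r' β G))) := by
      intro α β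
      rw [← mul_pow, h1, sq, Finset.sum_mul_sum]
    simp_rw [e]
    calc _ = ∑ α : Fin r → ι, ∑ γ : Fin j → ι, ∑ β : Fin r' → ι, ∑ γ' : Fin j → ι,
          (E (D j γ (D r α F)) * E (D j γ (D r' β G))) *
          (E (D j γ' (D r α F)) * E (D j γ' (D r' β G))) := by
            apply Finset.sum_congr rfl; intro α _; rw [Finset.sum_comm]
      _ = ∑ γ : Fin j → ι, ∑ α : Fin r → ι, ∑ γ' : Fin j → ι, ∑ β : Fin r' → ι,
          (E (D j γ (D r α F)) * E (D j γ (D r' β G))) *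
          (E (D j γ' (D r α F)) * E (D j γ' (D r' β G))) := by
            rw [Finset.sum_comm]
            apply Finset.sum_congr rfl; intro γ _
            apply Finset.sum_congr rfl; intro α _; rw [Finset.sum_comm]
      _ = _ := by
            apply Finset.sum_congr rfl; intro γ _
            rw [Finset.sum_comm]
  have h5 : ∑ γ : Fin j → ι, ∑ γ' : Fin j → ι,
        E (D j γ F * D j γ' F) * E (D j γ G * D j γ' G) ≤ Real.sqrt (Kc j F * Kc j G) := by
    apply Real.le_sqrt_of_sq_le
    unfold Kc
    simp_rw [← Fintype.sum_prod_type']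
    exact Finset.sum_mul_sq_le_sq_mul_sq _ _ _
  have h6 : (1 : ℝ) ≤ (j.factorial : ℝ) ^ 2 := by
    have : (1 : ℝ) ≤ j.factorial := by exact_mod_cast j.factorial_pos
    nlinarith
  have h7 : 0 ≤ ∑ α : Fin r → ι, ∑ β : Fin r' → ι, E (D r α F * D r' β G) ^ 2 :=
    Finset.sum_nonneg fun _ _ => Finset.sum_nonneg fun _ _ => sq_nonneg _
  have h8 : (0:ℝ) ≤ r.factorial * r'.factorial := by positivity
  calc _ ≤ (j.factorial : ℝ) ^ 2 * ∑ α : Fin r → ι, ∑ β : Fin r' → ι, E (D r α F * D r' β G) ^ 2 := by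
        nlinarith
    _ = _ := h4
    _ ≤ _ := mul_le_mul_of_nonneg_left h5 h8

def Cvar (k l : ℕ) : ℝ :=
  ∑ n ∈ Finset.range (k + l), 4 ^ (n + 1) * (((n + 1 : ℕ) + 1 : ℕ) * (k ^ 2 * (k.factorial * l.factorial)))

lemma Cvar_nonneg (k l : ℕ) : 0 ≤ Cvar k l := by unfold Cvar; positivity

lemma var_gam (k l : ℕ) (F G : MvPolynomial ι ℝ) (hF : Chaos k F) (hG : Chaos l G) (M : ℝ) (hM0 : 0 ≤ M)
    (hM : ∀ j, 1 ≤ j → j ≤ k → j ≤ l → ¬ (j = k ∧ j = l) → Kc j F * Kc j G ≤ M ^ 2) :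
    E (Gam F G * Gam F G) - E (Gam F G) ^ 2 ≤ Cvar k l * M := by
  have hS : ∀ r s, S r s (fun i => pderiv i F) (fun i => pderiv i G) =
      ((k : ℝ) - r) ^ 2 * ∑ α : Fin r → ι, ∑ β : Fin s → ι, E (D r α F * D s β G) ^ 2 := by
    intro r s
    unfold S
    simp_rw [Finset.mul_sum]
    apply Finset.sum_congr rfl; intro α _
    apply Finset.sum_congr rfl; intro β _
    simp_rw [D_pderiv]
    rw [← map_sum, ← mul_pow]
    congr 1
    exact (hF.D r α).gam _
  have hC : ∀ r s, (∃ α : Fin r → ι, ∃ β : Fin s → ι, E (D r α F * D s β G) ≠ 0) →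
      ∃ j, r + j = k ∧ s + j = l := by
    rintro r s ⟨α, β, h⟩
    have h1 : r ≤ k := by
      by_contra hr
      exact h (hF.null_D (by omega) α _)
    have h2 : s ≤ l := by
      by_contra hr
      exact h (by rw [mul_comm]; exact hG.null_D (by omega) β _)
    have h3 : (k : ℝ) - r = l - s := by
      by_contra hne
      exact h ((hF.D r α).orth (hG.D s β) hne)
    have h4 : k + s = l + r := by
      have : (k : ℝ) + s = l + r := by linarith
      exact_mod_cast this
    exact ⟨k - r, by omega, by omega⟩
  have hSz : ∀ r s, k + l < r + s → S r s (fun i => pderiv i F) (fun i => pderiv i G) = 0 := by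
    intro r s h
    rw [hS]
    have : ∀ (α : Fin r → ι) (β : Fin s → ι), E (D r α F * D s β G) = 0 := by
      intro α β
      by_contra hne
      obtain ⟨j, h1, h2⟩ := hC r s ⟨α, β, hne⟩
      omega
    simp [this]
  have hSb : ∀ r s, 1 ≤ r + s → S r s (fun i => pderiv i F) (fun i => pderiv i G) ≤
      (k ^ 2 * (k.factorial * l.factorial)) * M := by
    intro r s hrs
    rw [hS]
    by_cases hex : ∃ α : Fin r → ι, ∃ β : Fin s → ι, E (D r α F * D s β G) ≠ 0
    swap
    · push Not at hex
      simp only [hex]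
      simp
      positivity
    obtain ⟨j, h1, h2⟩ := hC r s hex
    have hk : ((k : ℝ) - r) = j := by rw [← h1]; push_cast; ring
    rw [hk]
    rcases Nat.eq_zero_or_pos j with hj | hj
    · subst hj
      simp
      positivity
    have hb := contr_bal r s j F G (by rw [h1]; exact hF) (by rw [h2]; exact hG)
    have hm := hM j hj (by omega) (by omega) (by omega)
    have hsq : Real.sqrt (Kc j F * Kc j G) ≤ M := by
      rw [Real.sqrt_le_left hM0]; exact hm
    have f1 : (r.factorial : ℝ) ≤ k.factorial := by exact_mod_cast Nat.factorial_le (by omega)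
    have f2 : (s.factorial : ℝ) ≤ l.factorial := by exact_mod_cast Nat.factorial_le (by omega)
    have f3 : (j : ℝ) ^ 2 ≤ k ^ 2 := by
      have : (j : ℝ) ≤ k := by exact_mod_cast (by omega : j ≤ k)
      gcongr
    calc _ ≤ (j : ℝ) ^ 2 * ((r.factorial * s.factorial) * Real.sqrt (Kc j F * Kc j G)) := by gcongr
      _ ≤ (k : ℝ) ^ 2 * ((k.factorial * l.factorial) * M) := by gcongr
      _ = _ := by ring
  have hA : ∀ n, A (n + 1) (Gam F G) ≤ 4 ^ (n + 1) * (((n + 1 : ℕ) + 1 : ℕ) * (k ^ 2 * (k.factorial * l.factorial))) * M := by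
    intro n
    refine (A_mul_le (n + 1) (fun i => pderiv i F) (fun i => pderiv i G)).trans ?_
    rw [mul_assoc]
    gcongr
    have : ∑ q ∈ Finset.HasAntidiagonal.antidiagonal (n + 1), S q.1 q.2 (fun i => pderiv i F) (fun i => pderiv i G) ≤
      ∑ q ∈ Finset.HasAntidiagonal.antidiagonal (n + 1), (k ^ 2 * (k.factorial * l.factorial)) * M := by
      apply Finset.sum_le_sum
      intro q hq
      rw [Finset.HasAntidiagonal.mem_antidiagonal] at hq
      exact hSb _ _ (by omega)
    refine this.trans ?_
    rw [Finset.sum_const, Finset.Nat.card_antidiagonal, nsmul_eq_mul]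
    apply le_of_eq; push_cast; ring
  have hAz : ∀ n, k + l < n → A n (Gam F G) = 0 := by
    intro n hn
    apply le_antisymm _ (A_nonneg _ _)
    refine (A_mul_le n (fun i => pderiv i F) (fun i => pderiv i G)).trans ?_
    rw [Finset.sum_eq_zero]
    · simp
    · intro q hq
      rw [Finset.HasAntidiagonal.mem_antidiagonal] at hq
      exact hSz _ _ (by omega)
  have hE := E_sq_le_A ((Gam F G).totalDegree + (k + l)) (Gam F G) (by omega)
  rw [Finset.sum_range_succ', A_zero] at hE
  have : ∑ n ∈ Finset.range ((Gam F G).totalDegree + (k + l)), A (n + 1) (Gam F G) =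
      ∑ n ∈ Finset.range (k + l), A (n + 1) (Gam F G) := by
    symm
    apply Finset.sum_subset
    · intro x hx; simp at hx ⊢; omega
    · intro x _ hx; simp at hx; exact hAz _ (by omega)
  rw [this] at hE
  have h2 : ∑ n ∈ Finset.range (k + l), A (n + 1) (Gam F G) ≤ Cvar k l * M := by
    unfold Cvar
    rw [Finset.sum_mul]
    exact Finset.sum_le_sum fun n _ => hA n
  linarith
end UC

namespace UC
open MvPolynomial
variable {ι : Type*} [Fintype ι] [DecidableEq ι]

/-! ### Fourth moment formula and hypercontractivity -/

def Zc (r s : ℕ) (F G F' G' : MvPolynomial ι ℝ) : ℝ :=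
  ∑ α : Fin r → ι, ∑ β : Fin s → ι, E (D r α F * D s β F') * E (D s β G * D r α G')

lemma Chaos.null_D' {x : ℝ} {F : MvPolynomial ι ℝ} (h : Chaos x F) {r : ℕ} (hr : x < r)
    (α : Fin r → ι) (Q : MvPolynomial ι ℝ) : E (UC.D r α F * Q) = 0 := by
  apply E_null
  apply (h.D r α).neg_null
  rw [sub_neg]; exact_mod_cast hr

lemma Zc_eq_zero_left {x y x' y' : ℝ} {F G F' G' : MvPolynomial ι ℝ} (hF : Chaos x F) (hG : Chaos y G)
    (r s n : ℕ) (hxy : x + y = n) (hr : n < r) : Zc r s F G F' G' = 0 := by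
  unfold Zc
  apply Finset.sum_eq_zero; intro α _
  apply Finset.sum_eq_zero; intro β _
  have hr' : (n : ℝ) < r := by exact_mod_cast hr
  by_cases h : x < r
  · rw [hF.null_D' h, zero_mul]
  · rw [hG.null_D' (lt_of_lt_of_le (by linarith : y < 0) (by positivity)), mul_zero]

lemma Zc_eq_zero_right {x y x' y' : ℝ} {F G F' G' : MvPolynomial ι ℝ} (hF : Chaos x F) (hG : Chaos y G)
    (r s n : ℕ) (hxy : x + y = n) (hr : n < s) : Zc r s F G F' G' = 0 := by
  unfold Zc
  apply Finset.sum_eq_zero; intro α _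
  apply Finset.sum_eq_zero; intro β _
  have hr' : (n : ℝ) < s := by exact_mod_cast hr
  by_cases h : y < s
  · rw [hG.null_D' h, mul_zero]
  · rw [hF.null_D' (lt_of_lt_of_le (by linarith : x < 0) (by positivity)), zero_mul]

def Rc (N : ℕ) (F G F' G' : MvPolynomial ι ℝ) : ℝ :=
  ∑ r ∈ Finset.range N, ∑ s ∈ Finset.range N, ((r.factorial : ℝ)⁻¹ * (s.factorial : ℝ)⁻¹) * Zc r s F G F' G'

def Tc (n : ℕ) (F G F' G' : MvPolynomial ι ℝ) : ℝ :=
  ∑ α : Fin n → ι, E (D n α (F * G)) * E (D n α (F' * G'))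

lemma Tc_succ (n : ℕ) (F G F' G' : MvPolynomial ι ℝ) : Tc (n + 1) F G F' G' =
    ∑ i, (Tc n (pderiv i F) G (pderiv i F') G' + Tc n (pderiv i F) G F' (pderiv i G') +
      (Tc n F (pderiv i G) (pderiv i F') G' + Tc n F (pderiv i G) F' (pderiv i G'))) := by
  unfold Tc
  rw [sum_cons]
  apply Finset.sum_congr rfl; intro i _
  simp_rw [← Finset.sum_add_distrib]
  apply Finset.sum_congr rfl; intro α _
  simp only [D_cons, pderiv_mul, map_add]
  ring

lemma sum_shift (N : ℕ) (Z : ℕ → ℝ) (hN : Z N = 0) :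
    ∑ r ∈ Finset.range N, (r.factorial : ℝ)⁻¹ * Z (r + 1) =
      ∑ r ∈ Finset.range N, (r : ℝ) * ((r.factorial : ℝ)⁻¹ * Z r) := by
  have e : ∀ r : ℕ, (r.factorial : ℝ)⁻¹ * Z (r + 1) =
      ((r + 1 : ℕ) : ℝ) * (((r + 1).factorial : ℝ)⁻¹ * Z (r + 1)) := by
    intro r
    rw [Nat.factorial_succ]
    have : ((r + 1 : ℕ) : ℝ) ≠ 0 := by positivity
    have : (r.factorial : ℝ) ≠ 0 := by positivity
    push_cast
    field_simp
  simp_rw [e]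
  have h1 := Finset.sum_range_succ (fun r : ℕ => (r : ℝ) * ((r.factorial : ℝ)⁻¹ * Z r)) N
  have h2 := Finset.sum_range_succ' (fun r : ℕ => (r : ℝ) * ((r.factorial : ℝ)⁻¹ * Z r)) N
  rw [h1] at h2
  simp [hN] at h2
  rw [h2]
  push_cast
  rfl

lemma sumZ1 {x : ℝ} (r s : ℕ) (F G F' G' : MvPolynomial ι ℝ) (hF : Chaos x F) :
    ∑ i, Zc r s (pderiv i F) G (pderiv i F') G' = (x - r) * Zc r s F G F' G' := by
  unfold Zc
  rw [Finset.sum_comm]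
  rw [Finset.mul_sum]
  apply Finset.sum_congr rfl; intro α _
  rw [Finset.sum_comm, Finset.mul_sum]
  apply Finset.sum_congr rfl; intro β _
  have := (hF.D r α).gam (D s β F')
  unfold Gam at this
  rw [← Finset.sum_mul, ← mul_assoc, ← this, map_sum]
  simp_rw [D_pderiv]

lemma sumZ4 {y : ℝ} (r s : ℕ) (F G F' G' : MvPolynomial ι ℝ) (hG : Chaos y G) :
    ∑ i, Zc r s F (pderiv i G) F' (pderiv i G') = (y - s) * Zc r s F G F' G' := by
  unfold Zc
  rw [Finset.sum_comm]
  rw [Finset.mul_sum]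
  apply Finset.sum_congr rfl; intro α _
  rw [Finset.sum_comm, Finset.mul_sum]
  apply Finset.sum_congr rfl; intro β _
  have := (hG.D s β).gam (D r α G')
  unfold Gam at this
  rw [← Finset.mul_sum, mul_left_comm, ← this, map_sum]
  simp_rw [D_pderiv]

lemma sumZ2 (r s : ℕ) (F G F' G' : MvPolynomial ι ℝ) :
    ∑ i, Zc r s (pderiv i F) G F' (pderiv i G') = Zc (r + 1) s F G F' G' := by
  unfold Zc
  rw [sum_cons]
  simp

lemma sumZ3 (r s : ℕ) (F G F' G' : MvPolynomial ι ℝ) :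
    ∑ i, Zc r s F (pderiv i G) (pderiv i F') G' = Zc r (s + 1) F G F' G' := by
  unfold Zc
  rw [Finset.sum_comm]
  simp_rw [sum_cons]
  simp

lemma Tc_eq (n N : ℕ) (hN : n < N) {x y x' y' : ℝ} (F G F' G' : MvPolynomial ι ℝ)
    (hF : Chaos x F) (hG : Chaos y G) (hF' : Chaos x' F') (hG' : Chaos y' G')
    (h1 : x + y = n) (h2 : x' + y' = n) :
    Tc n F G F' G' = n.factorial * Rc N F G F' G' := by
  induction n generalizing x y x' y' F G F' G' with
  | zero =>
    have hz : Rc N F G F' G' = Zc 0 0 F G F' G' := by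
      unfold Rc
      rw [Finset.sum_eq_single 0, Finset.sum_eq_single 0]
      · simp
      · intro s _ hs
        rw [Zc_eq_zero_right hF hG 0 s 0 (x' := x') (y' := y') h1 (Nat.pos_of_ne_zero hs), mul_zero]
      · simp; omega
      · intro r _ hr
        apply Finset.sum_eq_zero; intro s _
        rw [Zc_eq_zero_left hF hG r s 0 (x' := x') (y' := y') h1 (Nat.pos_of_ne_zero hr), mul_zero]
      · simp; omega
    rw [hz]
    simp only [Tc, Zc, sum_zero_idx, D_zero, Nat.factorial_zero, Nat.cast_one, one_mul]
    simp only [Nat.cast_zero] at h1 h2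
    have nul : ∀ {z : ℝ} {P : MvPolynomial ι ℝ}, Chaos z P → z < 0 → ∀ Q, E (P * Q) = 0 :=
      fun h hz Q => E_null (h.neg_null hz) Q
    rcases lt_trichotomy x 0 with hx | hx | hx
    · rw [nul hF hx, nul hF hx]; ring
    · rcases lt_trichotomy x' 0 with hx' | hx' | hx'
      · rw [nul hF' hx', mul_comm F F', nul hF' hx']; ring
      · have hy : y = 0 := by linarith
        have hy' : y' = 0 := by linarith
        subst hx hx' hy hy'
        rw [chaos_zero_mul hF, chaos_zero_mul hF', chaos_zero_mul hF, chaos_zero_mul hG]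
        ring
      · rw [mul_comm F' G', nul hG' (by linarith), mul_comm G G', nul hG' (by linarith)]; ring
    · rw [mul_comm F G, nul hG (by linarith), nul hG (by linarith)]; ring
  | succ n ih =>
    rw [Tc_succ]
    push_cast at h1 h2
    have e : ∀ i, (Tc n (pderiv i F) G (pderiv i F') G' + Tc n (pderiv i F) G F' (pderiv i G') +
      (Tc n F (pderiv i G) (pderiv i F') G' + Tc n F (pderiv i G) F' (pderiv i G'))) =
      n.factorial * (Rc N (pderiv i F) G (pderiv i F') G' + Rc N (pderiv i F) G F' (pderiv i G') +
      (Rc N F (pderiv i G) (pderiv i F') G' + Rc N F (pderiv i G) F' (pderiv i G'))) := by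
      intro i
      rw [ih (by omega) _ _ _ _ (hF.pderiv i) hG (hF'.pderiv i) hG' (by linarith) (by linarith),
        ih (by omega) _ _ _ _ (hF.pderiv i) hG hF' (hG'.pderiv i) (by linarith) (by linarith),
        ih (by omega) _ _ _ _ hF (hG.pderiv i) (hF'.pderiv i) hG' (by linarith) (by linarith),
        ih (by omega) _ _ _ _ hF (hG.pderiv i) hF' (hG'.pderiv i) (by linarith) (by linarith)]
      ring
    simp_rw [e]
    rw [← Finset.mul_sum, Finset.sum_add_distrib, Finset.sum_add_distrib, Finset.sum_add_distrib]
    have pull : ∀ (f : ι → ℕ → ℕ → ℝ), ∑ i, ∑ r ∈ Finset.range N, ∑ s ∈ Finset.range N,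
        ((r.factorial : ℝ)⁻¹ * (s.factorial : ℝ)⁻¹) * f i r s =
        ∑ r ∈ Finset.range N, ∑ s ∈ Finset.range N,
        ((r.factorial : ℝ)⁻¹ * (s.factorial : ℝ)⁻¹) * ∑ i, f i r s := by
      intro f
      rw [Finset.sum_comm]
      apply Finset.sum_congr rfl; intro r _
      rw [Finset.sum_comm]
      simp_rw [Finset.mul_sum]
    have r1 : ∑ i, Rc N (pderiv i F) G (pderiv i F') G' =
        ∑ r ∈ Finset.range N, ∑ s ∈ Finset.range N,
        (x - r) * (((r.factorial : ℝ)⁻¹ * (s.factorial : ℝ)⁻¹) * Zc r s F G F' G') := by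
      unfold Rc
      rw [pull]
      simp_rw [sumZ1 _ _ _ _ _ _ hF]
      apply Finset.sum_congr rfl; intro r _
      apply Finset.sum_congr rfl; intro s _
      ring
    have r4 : ∑ i, Rc N F (pderiv i G) F' (pderiv i G') =
        ∑ r ∈ Finset.range N, ∑ s ∈ Finset.range N,
        (y - s) * (((r.factorial : ℝ)⁻¹ * (s.factorial : ℝ)⁻¹) * Zc r s F G F' G') := by
      unfold Rc
      rw [pull]
      simp_rw [sumZ4 _ _ _ _ _ _ hG]
      apply Finset.sum_congr rfl; intro r _
      apply Finset.sum_congr rfl; intro s _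
      ring
    have r2 : ∑ i, Rc N (pderiv i F) G F' (pderiv i G') =
        ∑ r ∈ Finset.range N, ∑ s ∈ Finset.range N,
        r * (((r.factorial : ℝ)⁻¹ * (s.factorial : ℝ)⁻¹) * Zc r s F G F' G') := by
      unfold Rc
      rw [pull]
      simp_rw [sumZ2]
      refine Finset.sum_comm.trans (Eq.trans ?_ Finset.sum_comm)
      apply Finset.sum_congr rfl; intro s _
      have := sum_shift N (fun r => (s.factorial : ℝ)⁻¹ * Zc r s F G F' G')
        (by simp only [Zc_eq_zero_left hF hG N s (n + 1) (x' := x') (y' := y') (by push_cast; exact h1) hN, mul_zero])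
      simp_rw [mul_assoc]
      exact this
    have r3 : ∑ i, Rc N F (pderiv i G) (pderiv i F') G' =
        ∑ r ∈ Finset.range N, ∑ s ∈ Finset.range N,
        s * (((r.factorial : ℝ)⁻¹ * (s.factorial : ℝ)⁻¹) * Zc r s F G F' G') := by
      unfold Rc
      rw [pull]
      simp_rw [sumZ3]
      apply Finset.sum_congr rfl; intro r _
      have := sum_shift N (fun s => (r.factorial : ℝ)⁻¹ * Zc r s F G F' G')
        (by simp only [Zc_eq_zero_right hF hG r N (n + 1) (x' := x') (y' := y') (by push_cast; exact h1) hN, mul_zero])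
      simp_rw [mul_comm (r.factorial : ℝ)⁻¹, mul_assoc] at this ⊢
      simp_rw [mul_comm (r.factorial : ℝ)⁻¹]
      exact this
    rw [r1, r2, r3, r4]
    simp_rw [← Finset.sum_add_distrib, ← add_mul]
    rw [Nat.factorial_succ]
    unfold Rc
    push_cast
    rw [mul_comm ((n : ℝ) + 1), mul_assoc]
    congr 1
    simp_rw [Finset.mul_sum]
    apply Finset.sum_congr rfl; intro r _
    apply Finset.sum_congr rfl; intro s _
    rw [← h1]
    ring

lemma Zc_self_nonneg (r s : ℕ) (F : MvPolynomial ι ℝ) : 0 ≤ Zc r s F F F F := by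
  unfold Zc
  apply Finset.sum_nonneg; intro α _
  apply Finset.sum_nonneg; intro β _
  rw [mul_comm (D s β F)]
  exact mul_self_nonneg _

lemma Zc_self (r : ℕ) (F : MvPolynomial ι ℝ) : Zc r r F F F F = Kc r F := by
  unfold Zc Kc
  apply Finset.sum_congr rfl; intro α _
  apply Finset.sum_congr rfl; intro β _
  rw [mul_comm (D r β F)]
  ring

lemma fourth_moment (k j : ℕ) (hj : 1 ≤ j) (hjk : j < k) (F : MvPolynomial ι ℝ) (hF : Chaos k F) :
    Kc j F ≤ (j.factorial : ℝ) ^ 2 * (E ((F * F) * (F * F)) - 3 * E (F * F) ^ 2) := by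
  have h1 := A_lower (2 * k) (by omega) (F * F)
  have h2 : A (2 * k) (F * F) = Tc (2 * k) F F F F := by
    unfold A Tc; simp_rw [sq]
  rw [h2, Tc_eq (2 * k) (2 * k + 1) (by omega) F F F F hF hF hF hF (by push_cast; ring) (by push_cast; ring),
    mul_div_cancel_left₀ _ (by positivity)] at h1
  have h3 : ∑ r ∈ ({0, j, k} : Finset ℕ), ((r.factorial : ℝ)⁻¹ * (r.factorial : ℝ)⁻¹) * Zc r r F F F F ≤
      Rc (2 * k + 1) F F F F := by
    unfold Rc
    calc _ ≤ ∑ r ∈ ({0, j, k} : Finset ℕ), ∑ s ∈ Finset.range (2 * k + 1),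
          ((r.factorial : ℝ)⁻¹ * (s.factorial : ℝ)⁻¹) * Zc r s F F F F := by
          apply Finset.sum_le_sum
          intro r hr
          apply Finset.single_le_sum (f := fun s : ℕ => ((r.factorial : ℝ)⁻¹ * (s.factorial : ℝ)⁻¹) * Zc r s F F F F)
          · intro s _; exact mul_nonneg (by positivity) (Zc_self_nonneg _ _ _)
          · simp at hr ⊢; omega
      _ ≤ _ := by
          apply Finset.sum_le_sum_of_subset_of_nonneg
          · intro r hr; simp at hr ⊢; omega
          · intro r _ _
            apply Finset.sum_nonneg
            intro s _; exact mul_nonneg (by positivity) (Zc_self_nonneg _ _ _)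
  rw [Finset.sum_insert (by simp; omega), Finset.sum_pair (by omega)] at h3
  simp only [Zc_self, Kc_top hF, Kc_zero] at h3
  have hk : (k.factorial : ℝ) ≠ 0 := by positivity
  have hjf : (j.factorial : ℝ) ≠ 0 := by positivity
  have e1 : ((k.factorial : ℝ)⁻¹ * (k.factorial : ℝ)⁻¹) * (k.factorial * E (F * F)) ^ 2 = E (F * F) ^ 2 := by
    field_simp
  rw [e1] at h3
  simp at h3
  have h4 : (j.factorial : ℝ)⁻¹ * (j.factorial : ℝ)⁻¹ * Kc j F ≤ E ((F * F) * (F * F)) - 3 * E (F * F) ^ 2 := by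
    linarith
  calc Kc j F = (j.factorial : ℝ) ^ 2 * ((j.factorial : ℝ)⁻¹ * (j.factorial : ℝ)⁻¹ * Kc j F) := by field_simp
    _ ≤ _ := by gcongr

def Chyp (n : ℕ) : ℝ := ∑ m ∈ Finset.range (2 * n + 1), 4 ^ m * ((m + 1 : ℕ) * (n : ℝ) ^ m)

lemma Chyp_nonneg (n : ℕ) : 0 ≤ Chyp n := by unfold Chyp; positivity

lemma sum_D_sq_le (n r : ℕ) (P : MvPolynomial ι ℝ) (h : P.totalDegree ≤ n) :
    ∑ α : Fin r → ι, E (D r α P * D r α P) ≤ (n : ℝ) ^ r * E (P * P) := by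
  induction r generalizing P with
  | zero => simp [sum_zero_idx]
  | succ r ih =>
    rw [sum_cons]
    simp only [D_cons]
    have : ∀ i, ∑ α : Fin r → ι, E (D r α (pderiv i P) * D r α (pderiv i P)) ≤
        (n : ℝ) ^ r * E (pderiv i P * pderiv i P) := fun i => ih _ ((totalDegree_pderiv_le i P).trans (by omega))
    refine (Finset.sum_le_sum fun i _ => this i).trans ?_
    rw [← Finset.mul_sum, ← map_sum, pow_succ, mul_assoc]
    gcongr
    exact inv_poincare n P h

lemma hyper4 (n : ℕ) (P : MvPolynomial ι ℝ) (h : P.totalDegree ≤ n) :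
    E ((P * P) * (P * P)) ≤ Chyp n * E (P * P) ^ 2 := by
  have h1 := E_sq_le_A (2 * n) (P * P) ((totalDegree_mul _ _).trans (by omega))
  refine h1.trans ?_
  unfold Chyp
  rw [Finset.sum_mul]
  apply Finset.sum_le_sum
  intro m _
  have h2 := A_mul_le (T := Unit) m (fun _ => P) (fun _ => P)
  simp only [Finset.univ_unique, Finset.sum_singleton] at h2
  refine h2.trans ?_
  rw [mul_assoc]
  gcongr
  have : ∀ q ∈ Finset.HasAntidiagonal.antidiagonal m, S q.1 q.2 (fun _ : Unit => P) (fun _ => P) ≤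
      (n : ℝ) ^ m * E (P * P) ^ 2 := by
    intro q hq
    rw [Finset.HasAntidiagonal.mem_antidiagonal] at hq
    unfold S
    simp only [Finset.univ_unique, Finset.sum_singleton]
    calc _ ≤ ∑ α : Fin q.1 → ι, ∑ β : Fin q.2 → ι, E (D q.1 α P * D q.1 α P) * E (D q.2 β P * D q.2 β P) := by
          apply Finset.sum_le_sum; intro α _
          apply Finset.sum_le_sum; intro β _
          exact E_CS _ _
      _ = (∑ α : Fin q.1 → ι, E (D q.1 α P * D q.1 α P)) * (∑ β : Fin q.2 → ι, E (D q.2 β P * D q.2 β P)) := by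
          rw [Finset.sum_mul_sum]
      _ ≤ ((n : ℝ) ^ q.1 * E (P * P)) * ((n : ℝ) ^ q.2 * E (P * P)) := by
          apply mul_le_mul (sum_D_sq_le _ _ _ h) (sum_D_sq_le _ _ _ h)
          · exact Finset.sum_nonneg fun _ _ => E_sq_nonneg _
          · exact mul_nonneg (by positivity) (E_sq_nonneg _)
      _ = _ := by rw [← hq, pow_add]; ring
  refine (Finset.sum_le_sum this).trans ?_
  rw [Finset.sum_const, Finset.Nat.card_antidiagonal, nsmul_eq_mul, mul_assoc]

/-- high even moments -/
lemma hyper_pow (n q : ℕ) : ∃ c : ℝ, 0 ≤ c ∧ ∀ (ι : Type) [Fintype ι] [DecidableEq ι] (P : MvPolynomial ι ℝ),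
    P.totalDegree ≤ n → E (P ^ (2 ^ (q + 1))) ≤ c * E (P * P) ^ (2 ^ q) := by
  induction q with
  | zero => exact ⟨1, by norm_num, fun ι _ _ P _ => by simp [sq]⟩
  | succ q ih =>
    obtain ⟨c, hc, h⟩ := ih
    refine ⟨Chyp (n * 2 ^ q) * c ^ 2, mul_nonneg (Chyp_nonneg _) (sq_nonneg _), fun ι _ _ P hP => ?_⟩
    have h1 := hyper4 (n * 2 ^ q) (P ^ (2 ^ q)) ((totalDegree_pow _ _).trans (by rw [mul_comm]; gcongr))
    have e1 : P ^ 2 ^ q * P ^ 2 ^ q = P ^ 2 ^ (q + 1) := by rw [← pow_add]; congr 1; ring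
    have e2 : P ^ 2 ^ (q + 1) * P ^ 2 ^ (q + 1) = P ^ 2 ^ (q + 1 + 1) := by rw [← pow_add]; congr 1; ring
    rw [e1, e2] at h1
    refine h1.trans ?_
    have h2 := h ι P hP
    have h3 : 0 ≤ E (P ^ 2 ^ (q + 1)) := by rw [← e1]; exact E_sq_nonneg _
    calc _ ≤ Chyp (n * 2 ^ q) * (c * E (P * P) ^ 2 ^ q) ^ 2 := by
          have := Chyp_nonneg (n * 2 ^ q)
          gcongr
      _ = _ := by rw [mul_pow, ← pow_mul, ← pow_succ]; ring
end UC

namespace UC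
open MvPolynomial
variable {ι : Type*} [Fintype ι] [DecidableEq ι]

/-! ### Hermite features -/

/-- real Hermite polynomial -/
def hR (k : ℕ) : Polynomial ℝ := (Polynomial.hermite k).map (Int.castRingHom ℝ)

lemma hR_zero : hR 0 = 1 := by simp [hR]
lemma hR_one : hR 1 = Polynomial.X := by simp [hR]
lemma hR_succ (k : ℕ) : hR (k + 1) = Polynomial.X * hR k - Polynomial.derivative (hR k) := by
  simp [hR, Polynomial.hermite_succ, Polynomial.derivative_map]

lemma hR_derivative (k : ℕ) : Polynomial.derivative (hR (k + 1)) = Polynomial.C ((k : ℝ) + 1) * hR k := by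
  induction k with
  | zero => simp [hR_one, hR_zero]
  | succ k ih =>
    rw [hR_succ (k + 1), Polynomial.derivative_sub, Polynomial.derivative_mul, ih,
      Polynomial.derivative_C_mul, hR_succ k]
    push_cast
    simp only [Polynomial.derivative_X, map_add, map_one]
    ring

lemma hR_natDegree (k : ℕ) : (hR k).natDegree = k := by
  unfold hR
  rw [(Polynomial.hermite_monic k).natDegree_map, Polynomial.natDegree_hermite]

lemma hR_monic (k : ℕ) : (hR k).Monic := (Polynomial.hermite_monic k).map _

lemma He_eq (k : ℕ) (x : ℝ) : He k x = (√(k.factorial : ℝ))⁻¹ * (hR k).eval x := by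
  unfold He hR
  rw [Polynomial.eval_map, Polynomial.aeval_def, div_eq_inv_mul]
  rfl

/-- linear form -/
def lin (u : ι → ℝ) : MvPolynomial ι ℝ := ∑ i, C (u i) * X i

lemma eval_lin (u x : ι → ℝ) : eval x (lin u) = dotp u x := by simp [lin, dotp]

lemma lin_single (i : ι) : lin (Pi.single i (1 : ℝ)) = X i := by
  unfold lin
  rw [Finset.sum_eq_single i]
  · simp
  · intro j _ hj; simp [hj]
  · simp

lemma pderiv_lin (i : ι) (u : ι → ℝ) : pderiv i (lin u) = C (u i) := by
  unfold lin
  rw [map_sum, Finset.sum_eq_single i]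
  · simp [pderiv_mul]
  · intro j _ hj; simp [pderiv_mul, pderiv_X_of_ne hj]
  · simp

lemma pderiv_aeval (i : ι) (P : Polynomial ℝ) (Q : MvPolynomial ι ℝ) :
    pderiv i (Polynomial.aeval Q P) = Polynomial.aeval Q (Polynomial.derivative P) * pderiv i Q := by
  rw [Derivation.map_aeval, smul_eq_mul]

def Hp (k : ℕ) (u : ι → ℝ) : MvPolynomial ι ℝ :=
  C (√(k.factorial : ℝ))⁻¹ * Polynomial.aeval (lin u) (hR k)

lemma sqrt_fact_succ (k : ℕ) : √((k + 1).factorial : ℝ) = √((k : ℝ) + 1) * √(k.factorial : ℝ) := by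
  rw [Nat.factorial_succ]; push_cast; rw [Real.sqrt_mul (by positivity)]

lemma Hp_zero (u : ι → ℝ) : Hp 0 u = 1 := by simp [Hp, hR_zero]

lemma Hp_one (u : ι → ℝ) : Hp 1 u = lin u := by simp [Hp, hR_one]

lemma eval_Hp (k : ℕ) (u x : ι → ℝ) : eval x (Hp k u) = He k (dotp u x) := by
  unfold Hp
  rw [He_eq, map_mul, eval_C, ← eval_lin u x]
  congr 1
  rw [← MvPolynomial.coe_aeval_eq_eval]
  change (MvPolynomial.aeval x) (Polynomial.aeval (lin u) (hR k)) = _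
  rw [← Polynomial.aeval_algHom_apply, Polynomial.aeval_def, Polynomial.eval₂_eq_eval_map]
  simp

lemma pderiv_Hp (k : ℕ) (u : ι → ℝ) (i : ι) :
    pderiv i (Hp (k + 1) u) = C (√((k : ℝ) + 1) * u i) * Hp k u := by
  unfold Hp
  rw [pderiv_C_mul, pderiv_aeval, hR_derivative, pderiv_lin, sqrt_fact_succ, map_mul, Polynomial.aeval_C,
    MvPolynomial.algebraMap_eq]
  have h1 : 0 < √((k : ℝ) + 1) := Real.sqrt_pos.2 (by positivity)
  have h2 : 0 < √(k.factorial : ℝ) := Real.sqrt_pos.2 (by positivity)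
  have h3 : (√((k : ℝ) + 1) * √(k.factorial : ℝ))⁻¹ * ((k : ℝ) + 1) * u i =
    √((k : ℝ) + 1) * u i * (√(k.factorial : ℝ))⁻¹ := by
    have := Real.sq_sqrt (show (0 : ℝ) ≤ (k : ℝ) + 1 by positivity)
    field_simp
    rw [this]
  calc _ = C ((√((k : ℝ) + 1) * √(k.factorial : ℝ))⁻¹ * ((k : ℝ) + 1) * u i) * Polynomial.aeval (lin u) (hR k) := by
        simp only [C_mul]; ring
    _ = _ := by rw [h3]; simp only [C_mul]; ring

lemma pderiv_Hp' (k : ℕ) (u : ι → ℝ) (i : ι) :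
    pderiv i (Hp k u) = C (√(k : ℝ) * u i) * Hp (k - 1) u := by
  cases k with
  | zero => simp [Hp_zero]
  | succ k => rw [pderiv_Hp]; simp

lemma D_Hp (r j : ℕ) (α : Fin r → ι) (u : ι → ℝ) :
    D r α (Hp (r + j) u) = C (√((r + j).factorial : ℝ) / √(j.factorial : ℝ) * ∏ t, u (α t)) * Hp j u := by
  induction r with
  | zero =>
    have : 0 < √(j.factorial : ℝ) := Real.sqrt_pos.2 (by positivity)
    simp [div_self this.ne']
  | succ r ih =>
    have e : r + 1 + j = (r + j) + 1 := by ring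
    rw [← Fin.cons_self_tail α, D_cons, e, pderiv_Hp, ← smul_eq_C_mul, LinearMap.map_smul, ih, smul_eq_C_mul,
      ← mul_assoc, ← C_mul, Fin.prod_univ_succ]
    simp only [Fin.cons_zero, Fin.cons_succ]
    congr 2
    rw [sqrt_fact_succ]; push_cast
    ring

/-- three-term relation -/
lemma hR_ode (k : ℕ) : Polynomial.derivative (Polynomial.derivative (hR k)) - Polynomial.X * Polynomial.derivative (hR k)
    = - (Polynomial.C (k : ℝ) * hR k) := by
  cases k with
  | zero => simp [hR_zero]
  | succ k =>
    rw [hR_derivative, Polynomial.derivative_C_mul, hR_succ]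
    push_cast
    ring

lemma Hp_chaos (k : ℕ) (u : ι → ℝ) (hu : ∑ i, u i ^ 2 = 1) : Chaos k (Hp k u) := by
  unfold Chaos
  rw [Lop_def]
  have h1 : ∀ i, pderiv i (pderiv i (Hp k u)) - X i * pderiv i (Hp k u) =
    C (√(k.factorial : ℝ))⁻¹ * (C (u i ^ 2) * Polynomial.aeval (lin u) (Polynomial.derivative (Polynomial.derivative (hR k)))
     - (C (u i) * X i) * Polynomial.aeval (lin u) (Polynomial.derivative (hR k))) := by
    intro i
    unfold Hp
    rw [pderiv_C_mul, pderiv_aeval, pderiv_lin, pderiv_C_mul, pderiv_mul, pderiv_aeval, pderiv_lin, pderiv_C]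
    rw [sq, C_mul]
    ring
  simp_rw [h1]
  rw [← Finset.mul_sum, Finset.sum_sub_distrib, ← Finset.sum_mul, ← Finset.sum_mul, ← map_sum, hu]
  have h2 := congrArg (Polynomial.aeval (lin u)) (hR_ode k)
  rw [map_sub, map_mul, map_neg, map_mul, Polynomial.aeval_X, Polynomial.aeval_C] at h2
  change C _ * (C 1 * _ - lin u * _) = _
  rw [C_1, one_mul, h2, smul_eq_C_mul, MvPolynomial.algebraMap_eq]
  unfold Hp
  ring

lemma E_Hp (k : ℕ) (u v : ι → ℝ) (hu : ∑ i, u i ^ 2 = 1) : E (Hp k u * Hp k v) = (dotp u v) ^ k := by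
  induction k with
  | zero => simp [Hp_zero, E_one]
  | succ k ih =>
    have h1 := (Hp_chaos (k + 1) u hu).gam (Hp (k + 1) v)
    have h2 : E (Gam (Hp (k + 1) u) (Hp (k + 1) v)) = ((k : ℝ) + 1) * dotp u v * E (Hp k u * Hp k v) := by
      unfold Gam
      simp_rw [pderiv_Hp]
      rw [map_sum]
      have : ∀ i, E (C (√((k : ℝ) + 1) * u i) * Hp k u * (C (√((k : ℝ) + 1) * v i) * Hp k v)) =
        ((k : ℝ) + 1) * (u i * v i) * E (Hp k u * Hp k v) := by
        intro i
        rw [← E_C_mul]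
        congr 1
        have h3 : ((k : ℝ) + 1) = √((k : ℝ) + 1) * √((k : ℝ) + 1) := (Real.mul_self_sqrt (by positivity)).symm
        rw [show ((k : ℝ) + 1) * (u i * v i) = (√((k : ℝ) + 1) * u i) * (√((k : ℝ) + 1) * v i) by
          nth_rw 1 [h3]; ring]
        simp only [C_mul]; ring
      simp_rw [this]
      rw [← Finset.sum_mul, ← Finset.mul_sum]; rfl
    rw [h2, ih] at h1
    have h3 : ((k : ℝ) + 1) ≠ 0 := by positivity
    push_cast at h1
    have : ((k : ℝ) + 1) * E (Hp (k + 1) u * Hp (k + 1) v) = ((k : ℝ) + 1) * dotp u v ^ (k + 1) := by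
      rw [← h1]; ring
    exact mul_left_cancel₀ h3 this

lemma totalDegree_Hp (k : ℕ) (u : ι → ℝ) : (Hp k u).totalDegree ≤ k := by
  unfold Hp
  refine (totalDegree_mul _ _).trans ?_
  rw [totalDegree_C, zero_add, Polynomial.aeval_eq_sum_range, hR_natDegree]
  apply totalDegree_finsetSum_le
  intro i hi
  refine (totalDegree_smul_le _ _).trans ((totalDegree_pow _ _).trans ?_)
  have : (lin u).totalDegree ≤ 1 := by
    unfold lin
    apply totalDegree_finsetSum_le
    intro j _
    refine (totalDegree_mul _ _).trans ?_
    simp [totalDegree_X]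
  calc _ ≤ i * 1 := Nat.mul_le_mul_left _ this
    _ ≤ k := by simp at hi; omega

/-! one-dimensional facts -/

lemma integral_coord (i : ι) (f : ℝ → ℝ) (hf : Continuous f) :
    ∫ x, f (x i) ∂(stdG ι) = ∫ t, f t ∂(gaussianReal 0 1) := by
  have : MeasurePreserving (Function.eval i) (stdG ι) (gaussianReal 0 1) := measurePreserving_eval _ i
  rw [← this.map_eq, integral_map this.measurable.aemeasurable hf.aestronglyMeasurable]

lemma He_continuous (k : ℕ) : Continuous (He k) := by
  have : He k = fun x => (√(k.factorial : ℝ))⁻¹ * (hR k).eval x := funext (He_eq k)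
  rw [this]; fun_prop

lemma sum_single_sq (i : ι) : ∑ j, (Pi.single i (1 : ℝ) : ι → ℝ) j ^ 2 = 1 := by
  rw [Finset.sum_eq_single i] <;> simp +contextual

lemma dotp_single (i : ι) (x : ι → ℝ) : dotp (Pi.single i (1 : ℝ)) x = x i := by
  rw [← eval_lin, lin_single, eval_X]

lemma He_orth (j k : ℕ) : ∫ t, He j t * He k t ∂(gaussianReal 0 1) = if j = k then 1 else 0 := by
  rw [← integral_coord (ι := Unit) () (fun t => He j t * He k t) ((He_continuous j).mul (He_continuous k))]
  have : ∀ x : Unit → ℝ, He j (x ()) * He k (x ()) =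
      eval x (Hp j (Pi.single () (1 : ℝ)) * Hp k (Pi.single () (1 : ℝ))) := by
    intro x; rw [map_mul, eval_Hp, eval_Hp, dotp_single]
  simp_rw [this]
  rw [← E_def]
  split_ifs with h
  · subst h
    rw [E_Hp _ _ _ (sum_single_sq _), dotp_single]; simp
  · exact (Hp_chaos j _ (sum_single_sq _)).orth (Hp_chaos k _ (sum_single_sq _)) (by exact_mod_cast h)

/-- products of coordinate Hermite polynomials -/
def hK (κ : ι → ℕ) : MvPolynomial ι ℝ := ∏ i, Hp (κ i) (Pi.single i (1 : ℝ))

lemma eval_hK (κ : ι → ℕ) (x : ι → ℝ) : eval x (hK κ) = ∏ i, He (κ i) (x i) := by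
  unfold hK
  rw [map_prod]
  simp_rw [eval_Hp, dotp_single]

lemma E_hK (κ κ' : ι → ℕ) : E (hK κ * hK κ') = if κ = κ' then 1 else 0 := by
  rw [E_def]
  simp_rw [map_mul, eval_hK, ← Finset.prod_mul_distrib]
  unfold stdG
  rw [integral_fintype_prod_eq_prod (fun i t => He (κ i) t * He (κ' i) t)]
  simp_rw [He_orth]
  split_ifs with h
  · subst h; simp
  · obtain ⟨i, hi⟩ := Function.ne_iff.1 h
    exact Finset.prod_eq_zero (Finset.mem_univ i) (by simp [hi])

lemma pderiv_prod_erase (i : ι) (κ : ι → ℕ) :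
    pderiv i (∏ j ∈ Finset.univ.erase i, Hp (κ j) (Pi.single j (1 : ℝ)) : MvPolynomial ι ℝ) = 0 := by
  have : ∀ s : Finset ι, i ∉ s → pderiv i (∏ j ∈ s, Hp (κ j) (Pi.single j (1 : ℝ)) : MvPolynomial ι ℝ) = 0 := by
    intro s
    induction s using Finset.induction_on with
    | empty => intro _; simp
    | insert a s ha ih =>
      intro hi
      rw [Finset.prod_insert ha, pderiv_mul, ih (by simp at hi; tauto), pderiv_Hp', Pi.single_eq_of_ne]
      · simp
      · rintro rfl; simp at hi
  exact this _ (by simp)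

lemma hK_split (i : ι) (κ : ι → ℕ) : hK κ = Hp (κ i) (Pi.single i (1 : ℝ)) *
    ∏ j ∈ Finset.univ.erase i, Hp (κ j) (Pi.single j (1 : ℝ)) :=
  (Finset.mul_prod_erase _ _ (Finset.mem_univ i)).symm

lemma pderiv_hK (i : ι) (κ : ι → ℕ) :
    pderiv i (hK κ) = C (√(κ i : ℝ)) * hK (Function.update κ i (κ i - 1)) := by
  rw [hK_split i κ, hK_split i (Function.update κ i (κ i - 1)), pderiv_mul, pderiv_prod_erase, pderiv_Hp']
  have : ∀ j ∈ Finset.univ.erase i, Hp (Function.update κ i (κ i - 1) j) (Pi.single j (1 : ℝ)) = Hp (κ j) (Pi.single j (1 : ℝ)) := by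
    intro j hj
    rw [Function.update_of_ne (Finset.ne_of_mem_erase hj)]
  rw [Finset.prod_congr rfl this]
  simp; ring

lemma hK_chaos (κ : ι → ℕ) (k : ℕ) (hk : ∑ i, κ i = k) : Chaos k (hK κ) := by
  unfold Chaos
  rw [Lop_def]
  have : ∀ i, pderiv i (pderiv i (hK κ)) - X i * pderiv i (hK κ) = C (-(κ i : ℝ)) * hK κ := by
    intro i
    have h := Hp_chaos (κ i) (Pi.single i (1 : ℝ)) (sum_single_sq i)
    unfold Chaos at h
    rw [Lop_def, Finset.sum_eq_single i] at h
    · rw [hK_split i κ, pderiv_mul, pderiv_prod_erase, mul_zero, add_zero, pderiv_mul, pderiv_prod_erase, mul_zero, add_zero]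
      rw [← mul_assoc, ← mul_assoc, ← sub_mul, h, smul_eq_C_mul, C_neg]; ring
    · intro j _ hj
      rw [pderiv_Hp', Pi.single_eq_of_ne hj]; simp
    · simp
  simp_rw [this]
  rw [← Finset.sum_mul, ← map_sum, smul_eq_C_mul, Finset.sum_neg_distrib, C_neg, neg_mul]
  congr 3
  rw [← hk]; push_cast; rfl

lemma totalDegree_hK (κ : ι → ℕ) (k : ℕ) (hk : ∑ i, κ i = k) : (hK κ).totalDegree ≤ k := by
  unfold hK
  refine (totalDegree_finsetProd _ _).trans ?_
  rw [← hk]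
  exact Finset.sum_le_sum fun i _ => totalDegree_Hp _ _

/-- the polynomial `⟨β, h_k⟩` -/
def xiP {d k : ℕ} (β : MIdx d k → ℝ) : MvPolynomial (Fin d) ℝ := ∑ κ, C (β κ) * hK κ.1

lemma eval_xiP {d k : ℕ} (β : MIdx d k → ℝ) (x : Fin d → ℝ) : eval x (xiP β) = dotp β (hvec d k x) := by
  unfold xiP dotp hvec
  simp [eval_hK]

lemma midx_sum {d k : ℕ} (κ : MIdx d k) : ∑ i, κ.1 i = k := Finset.Nat.mem_antidiagonalTuple.1 κ.2

lemma xiP_chaos {d k : ℕ} (β : MIdx d k → ℝ) : Chaos k (xiP β) := by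
  unfold xiP
  apply Chaos.sum
  intro κ _
  rw [← smul_eq_C_mul]
  exact (hK_chaos _ _ (midx_sum κ)).smul _

lemma totalDegree_xiP {d k : ℕ} (β : MIdx d k → ℝ) : (xiP β).totalDegree ≤ k := by
  unfold xiP
  apply totalDegree_finsetSum_le
  intro κ _
  refine (totalDegree_mul _ _).trans ?_
  rw [totalDegree_C, zero_add]
  exact totalDegree_hK _ _ (midx_sum κ)

lemma E_hK_xiP {d k : ℕ} (β : MIdx d k → ℝ) (κ : MIdx d k) : E (hK κ.1 * xiP β) = β κ := by
  unfold xiP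
  rw [Finset.mul_sum, map_sum, Finset.sum_eq_single κ]
  · rw [mul_left_comm, E_C_mul, E_hK]; simp
  · intro κ' _ h
    rw [mul_left_comm, E_C_mul, E_hK, if_neg]; · simp
    intro h'; exact h (Subtype.ext h'.symm)
  · simp

lemma E_xiP {d k : ℕ} (β β' : MIdx d k → ℝ) : E (xiP β * xiP β') = dotp β β' := by
  conv_lhs => enter [2, 1]; unfold xiP
  rw [Finset.sum_mul, map_sum]
  unfold dotp
  apply Finset.sum_congr rfl
  intro κ _
  rw [mul_assoc, E_C_mul, E_hK_xiP]


end UC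

namespace UC
open MvPolynomial
variable {ι : Type*} [Fintype ι] [DecidableEq ι]

/-! ### Hermite expansion and the second order feature -/

lemma He_expand_exists (n : ℕ) (σa : Polynomial ℝ) (h : σa.natDegree ≤ n) :
    ∃ a : ℕ → ℝ, ∀ t, σa.eval t = ∑ k ∈ Finset.range (n + 1), a k * He k t := by
  induction n generalizing σa with
  | zero =>
    refine ⟨fun _ => σa.coeff 0, fun t => ?_⟩
    rw [Polynomial.eq_C_of_natDegree_le_zero h]
    simp [He_eq, hR_zero]
  | succ n ih =>
    have hd : (σa - Polynomial.C (σa.coeff (n + 1)) * hR (n + 1)).natDegree ≤ n := by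
      rw [Polynomial.natDegree_le_iff_coeff_eq_zero]
      intro N hN
      rw [Polynomial.coeff_sub, Polynomial.coeff_C_mul]
      rcases eq_or_lt_of_le (Nat.succ_le_of_lt hN) with h1 | h1
      · have h2 := (hR_monic (n + 1)).coeff_natDegree
        rw [hR_natDegree] at h2
        rw [← h1]
        simp only [Nat.succ_eq_add_one]
        rw [h2]; ring
      · rw [Polynomial.coeff_eq_zero_of_natDegree_lt (lt_of_le_of_lt h h1),
          Polynomial.coeff_eq_zero_of_natDegree_lt (p := hR (n + 1)) (by rw [hR_natDegree]; exact h1)]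
        ring
    obtain ⟨a, ha⟩ := ih _ hd
    refine ⟨fun k => if k = n + 1 then σa.coeff (n + 1) * √((n + 1).factorial : ℝ) else a k, fun t => ?_⟩
    rw [Finset.sum_range_succ]
    have h1 := ha t
    rw [Polynomial.eval_sub, Polynomial.eval_mul, Polynomial.eval_C] at h1
    have h2 : ∑ k ∈ Finset.range (n + 1), (if k = n + 1 then σa.coeff (n + 1) * √((n + 1).factorial : ℝ) else a k) * He k t
      = ∑ k ∈ Finset.range (n + 1), a k * He k t := by
      apply Finset.sum_congr rfl
      intro k hk
      rw [if_neg (by simp at hk; omega)]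
    rw [h2, ← h1]
    simp only [if_true]
    rw [He_eq]
    have : √((n + 1).factorial : ℝ) ≠ 0 := (Real.sqrt_pos.2 (by positivity)).ne'
    field_simp
    ring

lemma He_integrable (j k : ℕ) : Integrable (fun t => He j t * He k t) (gaussianReal 0 1) := by
  have : (fun t => He j t * He k t) = fun t =>
    ((Polynomial.C (√(j.factorial : ℝ))⁻¹ * hR j) * (Polynomial.C (√(k.factorial : ℝ))⁻¹ * hR k)).eval t := by
    funext t; simp [He_eq]
  rw [this]
  simp_rw [Polynomial.eval_eq_sum_range]
  exact integrable_finsetSum _ fun i _ => (gauss_pow_integrable i).const_mul _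

lemma He_expand (n : ℕ) (σa : Polynomial ℝ) (h : σa.natDegree ≤ n) (t : ℝ) :
    σa.eval t = ∑ k ∈ Finset.range (n + 1), hCoef σa k * He k t := by
  obtain ⟨a, ha⟩ := He_expand_exists n σa h
  rw [ha]
  apply Finset.sum_congr rfl
  intro k hk
  congr 1
  unfold hCoef
  simp_rw [ha, Finset.sum_mul]
  rw [integral_finsetSum _ (fun j _ => by simp_rw [mul_assoc]; exact (He_integrable j k).const_mul _)]
  simp_rw [mul_assoc, integral_const_mul, He_orth]
  simp only [mul_ite, mul_one, mul_zero]
  rw [Finset.sum_ite_eq' , if_pos hk]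

/-- `q_κ(w)` for arbitrary multi-indices -/
def qK (κ : ι → ℕ) (w : ι → ℝ) : ℝ :=
  √(((∑ i, κ i).factorial : ℝ) / ∏ i, ((κ i).factorial : ℝ)) * ∏ i, w i ^ κ i

lemma qK_rec (k : ℕ) (κ : ι → ℕ) (hκ : ∑ i, κ i = k + 1) (w : ι → ℝ) (i : ι) :
    √((k : ℝ) + 1) * w i * (√(κ i : ℝ) * qK (Function.update κ i (κ i - 1)) w) = κ i * qK κ w := by
  by_cases h0 : κ i = 0
  · simp [h0]
  obtain ⟨m, hm⟩ : ∃ m, κ i = m + 1 := ⟨κ i - 1, by omega⟩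
  have hs : ∑ j, Function.update κ i (κ i - 1) j = k := by
    have h1 := Finset.sum_update_of_mem (Finset.mem_univ i) κ (κ i - 1)
    have h2 := Finset.add_sum_erase Finset.univ κ (Finset.mem_univ i)
    rw [h1, Finset.sdiff_singleton_eq_erase]; omega
  have hp1 : ∏ j, ((κ j).factorial : ℝ) = (κ i : ℝ) * ∏ j, ((Function.update κ i (κ i - 1) j).factorial : ℝ) := by
    rw [← Finset.mul_prod_erase _ _ (Finset.mem_univ i), ← Finset.mul_prod_erase _ (fun j => ((Function.update κ i (κ i - 1) j).factorial : ℝ)) (Finset.mem_univ i)]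
    rw [Function.update_self, hm, Nat.factorial_succ]
    have : ∀ j ∈ Finset.univ.erase i, ((Function.update κ i (m + 1 - 1) j).factorial : ℝ) = ((κ j).factorial : ℝ) := by
      intro j hj; rw [Function.update_of_ne (Finset.ne_of_mem_erase hj)]
    rw [Finset.prod_congr rfl this]; push_cast; ring
  have hp2 : ∏ j, w j ^ κ j = w i * ∏ j, w j ^ (Function.update κ i (κ i - 1) j) := by
    rw [← Finset.mul_prod_erase _ _ (Finset.mem_univ i), ← Finset.mul_prod_erase _ (fun j => w j ^ (Function.update κ i (κ i - 1) j)) (Finset.mem_univ i)]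
    rw [Function.update_self, hm, pow_succ]
    have : ∀ j ∈ Finset.univ.erase i, w j ^ (Function.update κ i (m + 1 - 1) j) = w j ^ (κ j) := by
      intro j hj; rw [Function.update_of_ne (Finset.ne_of_mem_erase hj)]
    rw [Finset.prod_congr rfl this]; simp; ring
  unfold qK
  rw [hs, hκ, hp1, hp2]
  set P := ∏ j, ((Function.update κ i (κ i - 1) j).factorial : ℝ)
  set W := ∏ j, w j ^ (Function.update κ i (κ i - 1) j)
  have hP : 0 < P := Finset.prod_pos fun j _ => by positivity
  have hk : (0 : ℝ) < κ i := by rw [hm]; positivity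
  have : √((k : ℝ) + 1) * √(κ i : ℝ) * √((k.factorial : ℝ) / P) = κ i * √(((k + 1).factorial : ℝ) / (κ i * P)) := by
    rw [Nat.factorial_succ, ← Real.sqrt_mul (by positivity), ← Real.sqrt_mul (by positivity)]
    push_cast
    rw [← Real.sqrt_sq hk.le, ← Real.sqrt_mul (by positivity), Real.sqrt_sq hk.le]
    congr 1
    field_simp
  linear_combination (w i * W) * this

lemma E_Hp_hK (k : ℕ) (κ : ι → ℕ) (hκ : ∑ i, κ i = k) (w : ι → ℝ) (hw : ∑ i, w i ^ 2 = 1) :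
    E (Hp k w * hK κ) = qK κ w := by
  induction k generalizing κ with
  | zero =>
    have : ∀ i, κ i = 0 := by simpa using hκ
    simp [Hp_zero, hK, this, E_one, qK]
  | succ k ih =>
    have h1 := (Hp_chaos (k + 1) w hw).gam (hK κ)
    have h2 : ∀ i, E (pderiv i (Hp (k + 1) w) * pderiv i (hK κ)) = κ i * qK κ w := by
      intro i
      rw [pderiv_Hp, pderiv_hK, ← qK_rec k κ hκ w i]
      by_cases h0 : κ i = 0
      · simp [h0]
      rw [show C (√((k : ℝ) + 1) * w i) * Hp k w * (C √(κ i : ℝ) * hK (Function.update κ i (κ i - 1))) =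
        C (√((k : ℝ) + 1) * w i) * (C √(κ i : ℝ) * (Hp k w * hK (Function.update κ i (κ i - 1)))) by ring,
        E_C_mul, E_C_mul, ih]
      have h1 := Finset.sum_update_of_mem (Finset.mem_univ i) κ (κ i - 1)
      have h2 := Finset.add_sum_erase Finset.univ κ (Finset.mem_univ i)
      rw [h1, Finset.sdiff_singleton_eq_erase]; omega
    unfold Gam at h1
    rw [map_sum] at h1
    simp_rw [h2] at h1
    rw [← Finset.sum_mul] at h1
    have h3 : ∑ i, (κ i : ℝ) = ((k + 1 : ℕ) : ℝ) := by rw [← hκ]; push_cast; rfl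
    rw [h3] at h1
    exact (mul_left_cancel₀ (by positivity) h1).symm

lemma qvec_eq {d k : ℕ} (w : Fin d → ℝ) (κ : MIdx d k) : qvec d k w κ = qK κ.1 w := by
  unfold qvec qK; rw [midx_sum]

lemma sum_qvec_sq (d k : ℕ) (w : Fin d → ℝ) : ∑ κ, qvec d k w κ ^ 2 = (∑ i, w i ^ 2) ^ k := by
  rw [Finset.sum_pow_eq_sum_piAntidiag, Finset.piAntidiag_univ_fin_eq_antidiagonalTuple]
  rw [← Finset.sum_coe_sort (Finset.Nat.antidiagonalTuple d k)]
  apply Finset.sum_congr rfl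
  intro κ _
  unfold qvec
  rw [mul_pow, Real.sq_sqrt (by positivity)]
  congr 1
  · have := Nat.multinomial_spec Finset.univ κ.1
    rw [midx_sum] at this
    rw [← this]; push_cast
    rw [mul_div_assoc, mul_comm, div_mul_cancel₀]
    exact (Finset.prod_pos fun j _ => by positivity).ne'
  · rw [← Finset.prod_pow]
    apply Finset.prod_congr rfl; intros; ring

lemma E_zero_ae {P : MvPolynomial ι ℝ} (h : E (P * P) = 0) : ∀ᵐ x ∂(stdG ι), eval x P = 0 := by
  rw [E_def] at h
  have h2 := (integral_eq_zero_iff_of_nonneg (μ := stdG ι) (f := fun x => eval x (P * P)) (fun x => by simp [mul_self_nonneg]) (poly_integrable _)).1 h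
  filter_upwards [h2] with x hx
  simpa using hx

lemma Hp_eq_xiP_ae {d : ℕ} (k : ℕ) (w : Fin d → ℝ) (hw : ∑ i, w i ^ 2 = 1) :
    ∀ᵐ x ∂(stdG (Fin d)), dotp (qvec d k w) (hvec d k x) = He k (dotp w x) := by
  have h1 : E (Hp k w * xiP (qvec d k w)) = 1 := by
    unfold xiP
    rw [Finset.mul_sum, map_sum, ← one_pow k, ← hw, ← sum_qvec_sq]
    apply Finset.sum_congr rfl
    intro κ _
    rw [mul_left_comm, E_C_mul, E_Hp_hK k κ.1 (midx_sum κ) w hw, qvec_eq]; ring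
  have h2 : E (xiP (qvec d k w) * xiP (qvec d k w)) = 1 := by
    rw [E_xiP, ← one_pow k, ← hw, ← sum_qvec_sq]
    unfold dotp
    apply Finset.sum_congr rfl; intros; ring
  have h3 : E (Hp k w * Hp k w) = 1 := by
    rw [E_Hp k w w hw]
    have : dotp w w = 1 := by rw [← hw]; unfold dotp; apply Finset.sum_congr rfl; intros; ring
    rw [this, one_pow]
  have h4 : E ((xiP (qvec d k w) - Hp k w) * (xiP (qvec d k w) - Hp k w)) = 0 := by
    rw [show (xiP (qvec d k w) - Hp k w) * (xiP (qvec d k w) - Hp k w) =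
      xiP (qvec d k w) * xiP (qvec d k w) - (Hp k w * xiP (qvec d k w) + Hp k w * xiP (qvec d k w)) + Hp k w * Hp k w by ring]
    rw [map_add, map_sub, map_add, h1, h2, h3]; ring
  filter_upwards [E_zero_ae h4] with x hx
  rw [map_sub, eval_xiP, eval_Hp] at hx
  linarith

end UC

namespace UC
open MvPolynomial
variable {ι : Type*} [Fintype ι] [DecidableEq ι] {α : Type*} [Fintype α] [DecidableEq α]

/-! ### Contractions of the random features (deterministic bounds) -/

/-- monomial -/
def pw {l : ℕ} (u : ι → ℝ) (γ : Fin l → ι) : ℝ := ∏ t, u (γ t)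

lemma sum_pw (l : ℕ) (u v : ι → ℝ) : ∑ γ : Fin l → ι, pw u γ * pw v γ = dotp u v ^ l := by
  induction l with
  | zero => simp [sum_zero_idx, pw]
  | succ l ih =>
    rw [sum_cons]
    have : ∀ i, ∀ γ : Fin l → ι, pw u (Fin.cons i γ : Fin (l + 1) → ι) * pw v (Fin.cons i γ : Fin (l + 1) → ι)
      = (u i * v i) * (pw u γ * pw v γ) := by
      intro i γ
      unfold pw
      rw [Fin.prod_univ_succ, Fin.prod_univ_succ]
      simp only [Fin.cons_zero, Fin.cons_succ]; ring
    simp_rw [this, ← Finset.mul_sum, ih, ← Finset.sum_mul]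
    rw [pow_succ, mul_comm]; rfl

def Yf (k : ℕ) (θ : α → ℝ) (w : α → ι → ℝ) : MvPolynomial ι ℝ := ∑ a, C (θ a) * Hp k (w a)

def tq (k : ℕ) (θ : α → ℝ) (w : α → ι → ℝ) : ℝ := ∑ a, ∑ b, θ a * θ b * dotp (w a) (w b) ^ k

lemma Yf_chaos (k : ℕ) (θ : α → ℝ) (w : α → ι → ℝ) (hw : ∀ a, ∑ i, w a i ^ 2 = 1) : Chaos k (Yf k θ w) := by
  unfold Yf
  apply Chaos.sum
  intro a _
  rw [← smul_eq_C_mul]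
  exact (Hp_chaos k _ (hw a)).smul _

lemma E_Yf (k : ℕ) (θ : α → ℝ) (w : α → ι → ℝ) (hw : ∀ a, ∑ i, w a i ^ 2 = 1) :
    E (Yf k θ w * Yf k θ w) = tq k θ w := by
  unfold Yf tq
  rw [Finset.sum_mul_sum, map_sum]
  apply Finset.sum_congr rfl; intro a _
  rw [map_sum]
  apply Finset.sum_congr rfl; intro b _
  rw [show C (θ a) * Hp k (w a) * (C (θ b) * Hp k (w b)) = C (θ a) * (C (θ b) * (Hp k (w a) * Hp k (w b))) by ring,
    E_C_mul, E_C_mul, E_Hp k _ _ (hw a)]; ring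

def Rr (m l : ℕ) (θ : α → ℝ) (w : α → ι → ℝ) : ℝ :=
  ∑ γ : Fin l → ι, ∑ γ' : Fin l → ι,
    (∑ a, ∑ b, (θ a * pw (w a) γ) * (θ b * pw (w b) γ') * dotp (w a) (w b) ^ m) ^ 2

lemma swap4 {A A' B B' : Type*} [Fintype A] [Fintype B] [Fintype A'] [Fintype B'] (f : A → A' → B → B' → ℝ) :
    ∑ a, ∑ a', ∑ b, ∑ b', f a a' b b' = ∑ b, ∑ b', ∑ a, ∑ a', f a a' b b' := by
  have : ∀ a, ∑ a', ∑ b, ∑ b', f a a' b b' = ∑ b, ∑ b', ∑ a', f a a' b b' := by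
    intro a
    rw [Finset.sum_comm]
    apply Finset.sum_congr rfl; intro b _
    rw [Finset.sum_comm]
  simp_rw [this]
  rw [Finset.sum_comm]
  apply Finset.sum_congr rfl; intro b _
  rw [Finset.sum_comm]

def Qq (m l : ℕ) (θ : α → ℝ) (w : α → ι → ℝ) : ℝ :=
  ∑ a, ∑ b, ∑ a', ∑ b', (θ a * θ b * θ a' * θ b') * (dotp (w a) (w b) ^ m * dotp (w a') (w b') ^ m *
    (dotp (w a) (w a') ^ l * dotp (w b) (w b') ^ l))

lemma Rr_eq (m l : ℕ) (θ : α → ℝ) (w : α → ι → ℝ) : Rr m l θ w = Qq m l θ w := by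
  unfold Rr Qq
  have h1 : ∀ a b a' b' : α, (θ a * θ b * θ a' * θ b') * (dotp (w a) (w b) ^ m * dotp (w a') (w b') ^ m *
    (dotp (w a) (w a') ^ l * dotp (w b) (w b') ^ l)) = ∑ γ : Fin l → ι, ∑ γ' : Fin l → ι,
    ((θ a * pw (w a) γ) * (θ b * pw (w b) γ') * dotp (w a) (w b) ^ m) *
    ((θ a' * pw (w a') γ) * (θ b' * pw (w b') γ') * dotp (w a') (w b') ^ m) := by
    intro a b a' b'
    rw [← sum_pw l (w a), ← sum_pw l (w b), Finset.sum_mul_sum, Finset.mul_sum, Finset.mul_sum]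
    apply Finset.sum_congr rfl; intro γ _
    rw [Finset.mul_sum, Finset.mul_sum]
    apply Finset.sum_congr rfl; intro γ' _
    ring
  have h2 : ∀ a b : α, ∑ a', ∑ b', (θ a * θ b * θ a' * θ b') * (dotp (w a) (w b) ^ m * dotp (w a') (w b') ^ m *
    (dotp (w a) (w a') ^ l * dotp (w b) (w b') ^ l)) = ∑ γ : Fin l → ι, ∑ γ' : Fin l → ι,
    ((θ a * pw (w a) γ) * (θ b * pw (w b) γ') * dotp (w a) (w b) ^ m) * ∑ a', ∑ b',
    ((θ a' * pw (w a') γ) * (θ b' * pw (w b') γ') * dotp (w a') (w b') ^ m) := by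
    intro a b
    simp_rw [h1, Finset.mul_sum]
    exact swap4 _
  simp_rw [h2]
  rw [swap4]
  apply Finset.sum_congr rfl; intro γ _
  apply Finset.sum_congr rfl; intro γ' _
  rw [sq]
  simp_rw [Finset.sum_mul]

lemma Qq_symm (m l : ℕ) (θ : α → ℝ) (w : α → ι → ℝ) : Qq m l θ w = Qq l m θ w := by
  unfold Qq
  apply Finset.sum_congr rfl; intro a _
  rw [Finset.sum_comm]
  apply Finset.sum_congr rfl; intro b _
  apply Finset.sum_congr rfl; intro a' _
  apply Finset.sum_congr rfl; intro b' _
  ring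

lemma Kc_Yf (r j : ℕ) (θ : α → ℝ) (w : α → ι → ℝ) (hw : ∀ a, ∑ i, w a i ^ 2 = 1) :
    Kc r (Yf (r + j) θ w) = (√((r + j).factorial : ℝ) / √(j.factorial : ℝ)) ^ 4 * Rr j r θ w := by
  unfold Kc Rr
  rw [Finset.mul_sum]
  apply Finset.sum_congr rfl; intro γ _
  rw [Finset.mul_sum]
  apply Finset.sum_congr rfl; intro γ' _
  set c := √((r + j).factorial : ℝ) / √(j.factorial : ℝ) with hc
  have hD : ∀ γ : Fin r → ι, D r γ (Yf (r + j) θ w) = ∑ a, C (c * (θ a * pw (w a) γ)) * Hp j (w a) := by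
    intro γ
    unfold Yf
    rw [map_sum]
    apply Finset.sum_congr rfl; intro a _
    rw [← smul_eq_C_mul, LinearMap.map_smul, D_Hp, smul_eq_C_mul, ← mul_assoc, ← C_mul]
    congr 2
    unfold pw; ring
  have : E (D r γ (Yf (r + j) θ w) * D r γ' (Yf (r + j) θ w)) =
    c ^ 2 * (∑ a, ∑ b, (θ a * pw (w a) γ) * (θ b * pw (w b) γ') * dotp (w a) (w b) ^ j) := by
    rw [hD, hD, Finset.sum_mul_sum, map_sum, Finset.mul_sum]
    apply Finset.sum_congr rfl; intro a _
    rw [map_sum, Finset.mul_sum]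
    apply Finset.sum_congr rfl; intro b _
    rw [mul_mul_mul_comm, ← C_mul, E_C_mul, E_Hp j _ _ (hw a)]; ring
  rw [this]; ring

/-! quadratic forms -/

lemma had_bound (n : ℕ) (w : α → ι → ℝ) (hw : ∀ a, ∑ i, w a i ^ 2 = 1) (R : α → α → ℝ) (B : ℝ)
    (hR : ∀ v : α → ℝ, |∑ a, ∑ b, v a * v b * R a b| ≤ B * ∑ a, v a ^ 2) (v : α → ℝ) :
    |∑ a, ∑ b, v a * v b * (dotp (w a) (w b) ^ n * R a b)| ≤ B * ∑ a, v a ^ 2 := by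
  have h1 : ∑ a, ∑ b, v a * v b * (dotp (w a) (w b) ^ n * R a b) =
      ∑ η : Fin n → ι, ∑ a, ∑ b, (v a * pw (w a) η) * (v b * pw (w b) η) * R a b := by
    symm
    rw [Finset.sum_comm]
    apply Finset.sum_congr rfl; intro a _
    rw [Finset.sum_comm]
    apply Finset.sum_congr rfl; intro b _
    rw [← sum_pw, Finset.sum_mul, Finset.mul_sum]
    apply Finset.sum_congr rfl; intro η _
    ring
  rw [h1]
  refine (Finset.abs_sum_le_sum_abs _ _).trans ?_
  refine (Finset.sum_le_sum fun η _ => hR _).trans ?_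
  rw [← Finset.mul_sum, Finset.sum_comm]
  apply le_of_eq
  congr 1
  apply Finset.sum_congr rfl; intro a _
  have := sum_pw n (w a) (w a)
  have h2 : dotp (w a) (w a) = 1 := by rw [← hw a]; unfold dotp; apply Finset.sum_congr rfl; intros; ring
  rw [h2, one_pow] at this
  calc ∑ η : Fin n → ι, (v a * pw (w a) η) ^ 2 = v a ^ 2 * ∑ η : Fin n → ι, pw (w a) η * pw (w a) η := by
        rw [Finset.mul_sum]; apply Finset.sum_congr rfl; intros; ring
    _ = _ := by rw [this, mul_one]

lemma op_bound (T : α → α → ℝ) (hs : ∀ a b, T a b = T b a) (B : ℝ) (hB : 0 < B)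
    (hT : ∀ v : α → ℝ, |∑ a, ∑ b, v a * v b * T a b| ≤ B * ∑ a, v a ^ 2) (v : α → ℝ) :
    ∑ a, (∑ b, T a b * v b) ^ 2 ≤ B ^ 2 * ∑ a, v a ^ 2 := by
  set z : α → ℝ := fun a => ∑ b, T a b * v b with hz
  have key : ∀ u : α → ℝ, 2 * ∑ a, u a * z a ≤ B * (∑ a, u a ^ 2 + ∑ a, v a ^ 2) := by
    intro u
    have h1 := (abs_le.1 (hT (fun a => u a + v a))).2
    have h2 := (abs_le.1 (hT (fun a => u a - v a))).1
    have h3 : ∑ a, ∑ b, (u a + v a) * (u b + v b) * T a b - ∑ a, ∑ b, (u a - v a) * (u b - v b) * T a b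
        = 4 * ∑ a, u a * z a := by
      have e1 : ∑ a, u a * z a = ∑ a, ∑ b, u a * v b * T a b := by
        apply Finset.sum_congr rfl; intro a _
        rw [hz]; simp only; rw [Finset.mul_sum]; apply Finset.sum_congr rfl; intros; ring
      have e2 : ∑ a, u a * z a = ∑ a, ∑ b, v a * u b * T a b := by
        rw [e1, Finset.sum_comm]
        apply Finset.sum_congr rfl; intro a _
        apply Finset.sum_congr rfl; intro b _
        rw [hs b a]; ring
      rw [show 4 * ∑ a, u a * z a = 2 * ∑ a, u a * z a + 2 * ∑ a, u a * z a by ring]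
      nth_rw 1 [e1]; rw [e2, Finset.mul_sum, Finset.mul_sum, ← Finset.sum_add_distrib, ← Finset.sum_sub_distrib]
      apply Finset.sum_congr rfl; intro a _
      rw [Finset.mul_sum, Finset.mul_sum, ← Finset.sum_add_distrib, ← Finset.sum_sub_distrib]
      apply Finset.sum_congr rfl; intro b _
      ring
    have h4 : ∑ a, (u a + v a) ^ 2 + ∑ a, (u a - v a) ^ 2 = 2 * (∑ a, u a ^ 2 + ∑ a, v a ^ 2) := by
      rw [mul_add, Finset.mul_sum, Finset.mul_sum, ← Finset.sum_add_distrib, ← Finset.sum_add_distrib]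
      apply Finset.sum_congr rfl; intro a _; ring
    nlinarith
  have h1 := key (fun a => z a / B)
  have h2 : ∑ a, z a / B * z a = (∑ a, z a ^ 2) / B := by
    rw [Finset.sum_div]; apply Finset.sum_congr rfl; intros; ring
  have h3 : ∑ a, (z a / B) ^ 2 = (∑ a, z a ^ 2) / B ^ 2 := by
    rw [Finset.sum_div]; apply Finset.sum_congr rfl; intros; ring
  rw [h2, h3] at h1
  have h4 : B * ((∑ a, z a ^ 2) / B ^ 2 + ∑ a, v a ^ 2) = (∑ a, z a ^ 2) / B + B * ∑ a, v a ^ 2 := by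
    field_simp
  rw [h4] at h1
  have h5 : (∑ a, z a ^ 2) / B ≤ B * ∑ a, v a ^ 2 := by linarith
  rw [div_le_iff₀ hB] at h5
  calc _ ≤ _ := h5
    _ = _ := by ring

lemma frob_bound {Γ : Type*} [Fintype Γ] [DecidableEq Γ] (U : Matrix Γ α ℝ) (T : Matrix α α ℝ) (hs : ∀ a b, T a b = T b a)
    (B : ℝ) (hB : 0 < B)
    (hT : ∀ v : α → ℝ, |∑ a, ∑ b, v a * v b * T a b| ≤ B * ∑ a, v a ^ 2) :
    ∑ γ, ∑ γ', (∑ a, ∑ b, U γ a * U γ' b * T a b) ^ 2 ≤ B ^ 2 * ∑ a, ∑ b, (∑ γ, U γ a * U γ b) ^ 2 := by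
  open Matrix in
  have hTt : Tᵀ = T := by ext a b; exact hs b a
  have e0 : ∀ γ γ', ∑ a, ∑ b, U γ a * U γ' b * T a b = (U * T * Matrix.transpose U) γ γ' := by
    intro γ γ'
    rw [Matrix.mul_apply]
    simp_rw [Matrix.mul_apply, Finset.sum_mul]
    rw [Finset.sum_comm]
    apply Finset.sum_congr rfl; intro b _
    apply Finset.sum_congr rfl; intro a _
    rw [Matrix.transpose_apply]; ring
  have e1 : ∀ a b, ∑ γ, U γ a * U γ b = (Matrix.transpose U * U) a b := by
    intro a b; rw [Matrix.mul_apply]; rfl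
  simp_rw [e0, e1]
  set N := Matrix.transpose U * U with hN
  have hNt : Matrix.transpose N = N := by rw [hN, Matrix.transpose_mul, Matrix.transpose_transpose]
  have e2 : ∑ γ, ∑ γ', ((U * T * Matrix.transpose U) γ γ') ^ 2 = ∑ a, ∑ b, (T * N) a b * (T * N) b a := by
    have h1 : ∑ γ, ∑ γ', ((U * T * Matrix.transpose U) γ γ') ^ 2 =
        Matrix.trace ((U * T * Matrix.transpose U) * Matrix.transpose (U * T * Matrix.transpose U)) := by
      rw [Matrix.trace]
      apply Finset.sum_congr rfl; intro γ _
      rw [Matrix.diag_apply, Matrix.mul_apply]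
      apply Finset.sum_congr rfl; intro γ' _
      rw [Matrix.transpose_apply]; ring
    have h2 : ∑ a, ∑ b, (T * N) a b * (T * N) b a = Matrix.trace ((T * N) * (T * N)) := by
      rw [Matrix.trace]
      apply Finset.sum_congr rfl; intro γ _
      rw [Matrix.diag_apply, Matrix.mul_apply]
    rw [h1, h2, Matrix.transpose_mul, Matrix.transpose_mul, Matrix.transpose_transpose, hTt, hN]
    rw [show U * T * Matrix.transpose U * (U * (T * Matrix.transpose U)) = U * (T * Matrix.transpose U * (U * (T * Matrix.transpose U))) by
      simp only [Matrix.mul_assoc]]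
    rw [Matrix.trace_mul_comm]
    simp only [Matrix.mul_assoc]
  rw [e2]
  have h3 : ∑ a, ∑ b, (T * N) a b * (T * N) b a ≤ ∑ a, ∑ b, ((T * N) a b) ^ 2 := by
    have : ∑ a, ∑ b, ((T * N) a b) ^ 2 = ∑ a, ∑ b, (((T * N) a b) ^ 2 + ((T * N) b a) ^ 2) / 2 := by
      have h4 : ∑ a, ∑ b, ((T * N) b a) ^ 2 = ∑ a, ∑ b, ((T * N) a b) ^ 2 := Finset.sum_comm
      simp_rw [← Finset.sum_div, Finset.sum_add_distrib]
      rw [h4]; ring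
    rw [this]
    apply Finset.sum_le_sum; intro a _
    apply Finset.sum_le_sum; intro b _
    nlinarith [sq_nonneg ((T * N) a b - (T * N) b a)]
  refine h3.trans ?_
  rw [Finset.sum_comm, Finset.sum_comm (f := fun a b => N a b ^ 2), Finset.mul_sum]
  apply Finset.sum_le_sum; intro b _
  have := op_bound T hs B hB hT (fun a => N a b)
  simpa [Matrix.mul_apply] using this

end UC

namespace UC
open MvPolynomial
variable {ι : Type*} [Fintype ι] [DecidableEq ι] {α : Type*} [Fintype α] [DecidableEq α]

lemma tq_eq (k : ℕ) (θ : α → ℝ) (w : α → ι → ℝ) :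
    tq k θ w = ∑ γ : Fin k → ι, (∑ a, θ a * pw (w a) γ) ^ 2 := by
  unfold tq
  have : ∀ a b : α, θ a * θ b * dotp (w a) (w b) ^ k = ∑ γ : Fin k → ι, (θ a * pw (w a) γ) * (θ b * pw (w b) γ) := by
    intro a b
    rw [← sum_pw, Finset.mul_sum]
    apply Finset.sum_congr rfl; intros; ring
  simp_rw [this]
  have h : ∀ a : α, ∑ b, ∑ γ : Fin k → ι, (θ a * pw (w a) γ) * (θ b * pw (w b) γ) =
    ∑ γ : Fin k → ι, ∑ b, (θ a * pw (w a) γ) * (θ b * pw (w b) γ) := fun a => Finset.sum_comm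
  simp_rw [h]
  rw [Finset.sum_comm]
  apply Finset.sum_congr rfl; intro γ _
  rw [sq, Finset.sum_mul_sum]

lemma tq_nonneg (k : ℕ) (θ : α → ℝ) (w : α → ι → ℝ) : 0 ≤ tq k θ w := by
  rw [tq_eq]; exact Finset.sum_nonneg fun _ _ => sq_nonneg _

lemma Rr_le (m l : ℕ) (θ : α → ℝ) (w : α → ι → ℝ) : Rr m l θ w ≤ tq (m + l) θ w ^ 2 := by
  set x : (Fin l → ι) → (Fin m → ι) → ℝ := fun γ η => ∑ a, θ a * pw (w a) γ * pw (w a) η with hx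
  have e1 : ∀ γ γ' : Fin l → ι, ∑ a, ∑ b, (θ a * pw (w a) γ) * (θ b * pw (w b) γ') * dotp (w a) (w b) ^ m
      = ∑ η, x γ η * x γ' η := by
    intro γ γ'
    simp_rw [hx, Finset.sum_mul_sum]
    symm
    rw [Finset.sum_comm]
    apply Finset.sum_congr rfl; intro a _
    rw [Finset.sum_comm]
    apply Finset.sum_congr rfl; intro b _
    rw [← sum_pw, Finset.mul_sum]
    apply Finset.sum_congr rfl; intros; ring
  have e2 : ∑ γ, ∑ η, x γ η ^ 2 = tq (m + l) θ w := by
    have h1 : ∀ γ η, x γ η ^ 2 = ∑ a, ∑ b, θ a * θ b * (pw (w a) γ * pw (w b) γ) * (pw (w a) η * pw (w b) η) := by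
      intro γ η
      rw [hx, sq, Finset.sum_mul_sum]
      apply Finset.sum_congr rfl; intro a _
      apply Finset.sum_congr rfl; intro b _
      ring
    simp_rw [h1]
    rw [swap4]
    unfold tq
    apply Finset.sum_congr rfl; intro a _
    apply Finset.sum_congr rfl; intro b _
    simp_rw [← Finset.mul_sum, sum_pw]
    rw [← Finset.sum_mul, ← Finset.mul_sum, sum_pw, pow_add]; ring
  unfold Rr
  simp_rw [e1]
  rw [← e2, sq, Finset.sum_mul_sum]
  apply Finset.sum_le_sum; intro γ _
  apply Finset.sum_le_sum; intro γ' _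
  exact Finset.sum_mul_sq_le_sq_mul_sq _ _ _

lemma Rr_step (m l : ℕ) (θ : α → ℝ) (w : α → ι → ℝ) (hw : ∀ a, ∑ i, w a i ^ 2 = 1) (δ B : ℝ) (hB : 0 < B)
    (hG : ∀ v : α → ℝ, |∑ a, ∑ b, v a * v b * (dotp (w a) (w b) ^ 2 - δ)| ≤ B * ∑ a, v a ^ 2) :
    Rr (m + 2) l θ w ≤ 2 * δ ^ 2 * tq (m + l) θ w ^ 2 +
      2 * (B ^ 2 * ∑ a, ∑ b, (θ a * θ b * dotp (w a) (w b) ^ l) ^ 2) := by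
  have hsym : ∀ a b, dotp (w a) (w b) = dotp (w b) (w a) := by
    intro a b; unfold dotp; apply Finset.sum_congr rfl; intros; ring
  have h1 := frob_bound (Γ := Fin l → ι) (fun γ a => θ a * pw (w a) γ)
    (fun a b => dotp (w a) (w b) ^ m * (dotp (w a) (w b) ^ 2 - δ))
    (fun a b => by rw [hsym a b]) B hB (had_bound m w hw _ B hG)
  have e1 : ∀ a b, ∑ γ : Fin l → ι, θ a * pw (w a) γ * (θ b * pw (w b) γ) = θ a * θ b * dotp (w a) (w b) ^ l := by
    intro a b; rw [← sum_pw, Finset.mul_sum]; apply Finset.sum_congr rfl; intros; ring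
  simp_rw [e1] at h1
  have h2 := Rr_le m l θ w
  have h3 : Rr (m + 2) l θ w ≤ 2 * δ ^ 2 * Rr m l θ w + 2 * ∑ γ : Fin l → ι, ∑ γ' : Fin l → ι,
      (∑ a, ∑ b, θ a * pw (w a) γ * (θ b * pw (w b) γ') * (dotp (w a) (w b) ^ m * (dotp (w a) (w b) ^ 2 - δ))) ^ 2 := by
    unfold Rr
    rw [Finset.mul_sum, Finset.mul_sum, ← Finset.sum_add_distrib]
    apply Finset.sum_le_sum; intro γ _
    rw [Finset.mul_sum, Finset.mul_sum, ← Finset.sum_add_distrib]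
    apply Finset.sum_le_sum; intro γ' _
    have : ∑ a, ∑ b, θ a * pw (w a) γ * (θ b * pw (w b) γ') * dotp (w a) (w b) ^ (m + 2) =
      δ * (∑ a, ∑ b, θ a * pw (w a) γ * (θ b * pw (w b) γ') * dotp (w a) (w b) ^ m) +
      ∑ a, ∑ b, θ a * pw (w a) γ * (θ b * pw (w b) γ') * (dotp (w a) (w b) ^ m * (dotp (w a) (w b) ^ 2 - δ)) := by
      rw [Finset.mul_sum, ← Finset.sum_add_distrib]
      apply Finset.sum_congr rfl; intro a _
      rw [Finset.mul_sum, ← Finset.sum_add_distrib]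
      apply Finset.sum_congr rfl; intro b _
      ring
    rw [this]
    set x := ∑ a, ∑ b, θ a * pw (w a) γ * (θ b * pw (w b) γ') * dotp (w a) (w b) ^ m
    set y := ∑ a, ∑ b, θ a * pw (w a) γ * (θ b * pw (w b) γ') * (dotp (w a) (w b) ^ m * (dotp (w a) (w b) ^ 2 - δ))
    nlinarith [sq_nonneg (δ * x - y)]
  refine h3.trans ?_
  have : 0 ≤ 2 * δ ^ 2 := by positivity
  exact add_le_add (mul_le_mul_of_nonneg_left h2 this) (by linarith)

lemma had_sum_le (l : ℕ) (hl : 1 ≤ l) (θ : α → ℝ) (w : α → ι → ℝ) (hw : ∀ a, ∑ i, w a i ^ 2 = 1) (t ρ : ℝ)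
    (ht : ∀ a, |θ a| ≤ t) (hρ1 : ρ ≤ 1) (hρ : ∀ a b, a ≠ b → |dotp (w a) (w b)| ≤ ρ) :
    ∑ a, ∑ b, (θ a * θ b * dotp (w a) (w b) ^ l) ^ 2 ≤ t ^ 2 * (∑ a, θ a ^ 2) + ρ ^ 2 * (∑ a, θ a ^ 2) ^ 2 := by
  have h1 : ∀ a b, (θ a * θ b * dotp (w a) (w b) ^ l) ^ 2 ≤ (if a = b then t ^ 2 * θ a ^ 2 else 0) + ρ ^ 2 * (θ a ^ 2 * θ b ^ 2) := by
    intro a b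
    by_cases hab : a = b
    · subst hab
      have h2 : dotp (w a) (w a) = 1 := by rw [← hw a]; unfold dotp; apply Finset.sum_congr rfl; intros; ring
      rw [h2, if_pos rfl, one_pow, mul_one]
      have h3 : θ a ^ 2 ≤ t ^ 2 := by rw [← sq_abs]; exact pow_le_pow_left₀ (abs_nonneg _) (ht a) 2
      have : 0 ≤ ρ ^ 2 * (θ a ^ 2 * θ a ^ 2) := by positivity
      nlinarith [sq_nonneg (θ a)]
    · rw [if_neg hab, zero_add]
      have h3 := hρ a b hab
      have h4 : |dotp (w a) (w b) ^ l| ≤ ρ := by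
        rw [abs_pow]
        obtain ⟨l', rfl⟩ : ∃ l', l = l' + 1 := ⟨l - 1, by omega⟩
        rw [pow_succ]
        calc _ ≤ 1 * ρ := mul_le_mul (pow_le_one₀ (abs_nonneg _) (h3.trans hρ1)) h3 (abs_nonneg _) zero_le_one
          _ = ρ := one_mul _
      have h5 : (dotp (w a) (w b) ^ l) ^ 2 ≤ ρ ^ 2 := by rw [← sq_abs]; exact pow_le_pow_left₀ (abs_nonneg _) h4 2
      calc _ = (θ a ^ 2 * θ b ^ 2) * (dotp (w a) (w b) ^ l) ^ 2 := by ring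
        _ ≤ (θ a ^ 2 * θ b ^ 2) * ρ ^ 2 := mul_le_mul_of_nonneg_left h5 (by positivity)
        _ = _ := by ring
  refine (Finset.sum_le_sum fun a _ => Finset.sum_le_sum fun b _ => h1 a b).trans (le_of_eq ?_)
  simp_rw [Finset.sum_add_distrib, Finset.sum_ite_eq, Finset.mem_univ, if_true]
  rw [sq (∑ a, θ a ^ 2), Finset.sum_mul_sum, Finset.mul_sum, Finset.mul_sum]
  simp_rw [Finset.mul_sum]

lemma tq_step (m : ℕ) (θ : α → ℝ) (w : α → ι → ℝ) (hw : ∀ a, ∑ i, w a i ^ 2 = 1) (δ B : ℝ)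
    (hG : ∀ v : α → ℝ, |∑ a, ∑ b, v a * v b * (dotp (w a) (w b) ^ 2 - δ)| ≤ B * ∑ a, v a ^ 2) :
    tq (m + 2) θ w ≤ δ * tq m θ w + B * ∑ a, θ a ^ 2 := by
  have h1 := (abs_le.1 (had_bound m w hw _ B hG θ)).2
  have : tq (m + 2) θ w = δ * tq m θ w + ∑ a, ∑ b, θ a * θ b * (dotp (w a) (w b) ^ m * (dotp (w a) (w b) ^ 2 - δ)) := by
    unfold tq
    rw [Finset.mul_sum, ← Finset.sum_add_distrib]
    apply Finset.sum_congr rfl; intro a _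
    rw [Finset.mul_sum, ← Finset.sum_add_distrib]
    apply Finset.sum_congr rfl; intro b _
    ring
  linarith

lemma tq_diff (m : ℕ) (θ : α → ℝ) (w : α → ι → ℝ) (hw : ∀ a, ∑ i, w a i ^ 2 = 1) (δ B : ℝ) (hδ : 0 ≤ δ)
    (hG : ∀ v : α → ℝ, |∑ a, ∑ b, v a * v b * (if a = b then 0 else dotp (w a) (w b) ^ 3 - δ * dotp (w a) (w b))| ≤ B * ∑ a, v a ^ 2) :
    |tq (m + 3) θ w - ∑ a, θ a ^ 2| ≤ B * (∑ a, θ a ^ 2) + δ * (tq (m + 1) θ w + ∑ a, θ a ^ 2) := by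
  have h1 := had_bound m w hw _ B hG θ
  have hd : ∀ a, dotp (w a) (w a) = 1 := by
    intro a; rw [← hw a]; unfold dotp; apply Finset.sum_congr rfl; intros; ring
  have e : tq (m + 3) θ w - ∑ a, θ a ^ 2 = (∑ a, ∑ b, θ a * θ b * (dotp (w a) (w b) ^ m *
      (if a = b then 0 else dotp (w a) (w b) ^ 3 - δ * dotp (w a) (w b)))) + δ * (tq (m + 1) θ w - ∑ a, θ a ^ 2) := by
    unfold tq
    rw [mul_sub, ← Finset.sum_sub_distrib, Finset.mul_sum, Finset.mul_sum, ← Finset.sum_sub_distrib, ← Finset.sum_add_distrib]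
    apply Finset.sum_congr rfl; intro a _
    have e1 : θ a ^ 2 = ∑ b, if a = b then θ a * θ b else 0 := by simp [sq]
    rw [e1, ← Finset.sum_sub_distrib, Finset.mul_sum, Finset.mul_sum, ← Finset.sum_sub_distrib, ← Finset.sum_add_distrib]
    apply Finset.sum_congr rfl; intro b _
    by_cases hab : a = b
    · subst hab; simp [hd]
    · simp [hab]; ring
  rw [e]
  refine (abs_add_le _ _).trans (add_le_add h1 ?_)
  rw [abs_mul, abs_of_nonneg hδ]
  apply mul_le_mul_of_nonneg_left _ hδ
  have h2 := tq_nonneg (m + 1) θ w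
  have h3 : 0 ≤ ∑ a, θ a ^ 2 := Finset.sum_nonneg fun _ _ => sq_nonneg _
  rw [abs_le]; constructor <;> linarith

/-- Main bound on the contractions of `Yf`. -/
lemma Kc_Yf_le (k j : ℕ) (hj : 1 ≤ j) (hjk : j < k) (hk : 3 ≤ k) (θ : α → ℝ) (w : α → ι → ℝ)
    (hw : ∀ a, ∑ i, w a i ^ 2 = 1) (δ B t ρ : ℝ) (hB : 0 < B)
    (hG : ∀ v : α → ℝ, |∑ a, ∑ b, v a * v b * (dotp (w a) (w b) ^ 2 - δ)| ≤ B * ∑ a, v a ^ 2)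
    (ht : ∀ a, |θ a| ≤ t) (hρ1 : ρ ≤ 1) (hρ : ∀ a b, a ≠ b → |dotp (w a) (w b)| ≤ ρ) :
    Kc j (Yf k θ w) ≤ (k.factorial : ℝ) ^ 2 * (2 * δ ^ 2 * tq (k - 2) θ w ^ 2 +
      2 * (B ^ 2 * (t ^ 2 * (∑ a, θ a ^ 2) + ρ ^ 2 * (∑ a, θ a ^ 2) ^ 2))) := by
  obtain ⟨i, rfl⟩ : ∃ i, k = j + i := ⟨k - j, by omega⟩
  rw [Kc_Yf j i θ w hw]
  have hc : (√((j + i).factorial : ℝ) / √(i.factorial : ℝ)) ^ 4 ≤ ((j + i).factorial : ℝ) ^ 2 := by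
    rw [div_pow, show (4:ℕ) = 2 * 2 by rfl, pow_mul, pow_mul, Real.sq_sqrt (by positivity), Real.sq_sqrt (by positivity)]
    apply div_le_self (by positivity)
    have : (1:ℝ) ≤ i.factorial := by exact_mod_cast Nat.one_le_iff_ne_zero.2 (Nat.factorial_ne_zero _)
    exact one_le_pow₀ this
  have hR0 : 0 ≤ Rr i j θ w := by
    unfold Rr; exact Finset.sum_nonneg fun _ _ => Finset.sum_nonneg fun _ _ => sq_nonneg _
  have hR : Rr i j θ w ≤ 2 * δ ^ 2 * tq (j + i - 2) θ w ^ 2 +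
      2 * (B ^ 2 * (t ^ 2 * (∑ a, θ a ^ 2) + ρ ^ 2 * (∑ a, θ a ^ 2) ^ 2)) := by
    by_cases hi : 2 ≤ i
    · obtain ⟨m, rfl⟩ : ∃ m, i = m + 2 := ⟨i - 2, by omega⟩
      refine (Rr_step m j θ w hw δ B hB hG).trans ?_
      rw [show j + (m + 2) - 2 = m + j by omega]
      have := had_sum_le j hj θ w hw t ρ ht hρ1 hρ
      gcongr
    · obtain ⟨m, rfl⟩ : ∃ m, j = m + 2 := ⟨j - 2, by omega⟩
      rw [Rr_eq, Qq_symm, ← Rr_eq]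
      refine (Rr_step m i θ w hw δ B hB hG).trans ?_
      rw [show m + 2 + i - 2 = m + i by omega]
      have := had_sum_le i (by omega) θ w hw t ρ ht hρ1 hρ
      gcongr
  exact mul_le_mul hc hR hR0 (by positivity)

lemma Kc_le {k : ℕ} {F : MvPolynomial ι ℝ} (h : Chaos k F) (j : ℕ) :
    Kc j F ≤ ((k : ℝ) ^ j * E (F * F)) ^ 2 := by
  have h1 := h.sum_D j F
  have h0 : ∑ γ : Fin j → ι, E (D j γ F * D j γ F) ≤ (k : ℝ) ^ j * E (F * F) := by
    by_cases hjk : j ≤ k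
    · rw [h1]
      apply mul_le_mul_of_nonneg_right _ (E_sq_nonneg _)
      calc _ ≤ ∏ j ∈ Finset.range j, (k : ℝ) := by
            apply Finset.prod_le_prod
            · intro i hi
              have : i < j := Finset.mem_range.1 hi
              have : (i : ℝ) ≤ k := by exact_mod_cast (by omega)
              linarith
            · intro i hi; have : (0:ℝ) ≤ i := by positivity
              linarith
        _ = _ := by simp
    · rw [Finset.sum_eq_zero]
      · have := E_sq_nonneg F; positivity
      · intro γ _; exact h.null_D (by omega) _ _
  have h2 : 0 ≤ ∑ γ : Fin j → ι, E (D j γ F * D j γ F) := Finset.sum_nonneg fun _ _ => E_sq_nonneg _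
  calc Kc j F ≤ (∑ γ : Fin j → ι, E (D j γ F * D j γ F)) ^ 2 := by
        rw [sq, Finset.sum_mul_sum]
        unfold Kc
        apply Finset.sum_le_sum; intro γ _
        apply Finset.sum_le_sum; intro γ' _
        exact E_CS _ _
    _ ≤ _ := pow_le_pow_left₀ h2 h0 2

end UC

namespace UC
open MvPolynomial
variable {ι : Type*} [Fintype ι] [DecidableEq ι]

/-- homogeneous polynomial with coefficient tensor `E (D_γ ξ)` -/
def Phi : ℕ → MvPolynomial ι ℝ → MvPolynomial ι ℝ
  | 0, ξ => C (E ξ)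
  | k + 1, ξ => ∑ j, X j * Phi k (pderiv j ξ)

lemma Phi_C_mul (k : ℕ) (c : ℝ) (ξ : MvPolynomial ι ℝ) : Phi k (C c * ξ) = C c * Phi k ξ := by
  induction k generalizing ξ with
  | zero => simp [Phi, E_C_mul]
  | succ k ih =>
    simp only [Phi, pderiv_C_mul, ih, Finset.mul_sum]
    apply Finset.sum_congr rfl; intros; ring

lemma Phi_zero' (k : ℕ) : Phi k (0 : MvPolynomial ι ℝ) = 0 := by
  have := Phi_C_mul k 0 (0 : MvPolynomial ι ℝ)
  simpa using this

lemma Phi_add (k : ℕ) (ξ η : MvPolynomial ι ℝ) : Phi k (ξ + η) = Phi k ξ + Phi k η := by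
  induction k generalizing ξ η with
  | zero => simp [Phi]
  | succ k ih => simp only [Phi, map_add, ih, mul_add, Finset.sum_add_distrib]

lemma Phi_sum {β : Type*} (s : Finset β) (k : ℕ) (ξ : β → MvPolynomial ι ℝ) :
    Phi k (∑ i ∈ s, ξ i) = ∑ i ∈ s, Phi k (ξ i) := by
  classical
  induction s using Finset.induction_on with
  | empty => simp [Phi_zero']
  | insert a s ha ih => rw [Finset.sum_insert ha, Finset.sum_insert ha, Phi_add, ih]

lemma Phi_eval (k : ℕ) (ξ : MvPolynomial ι ℝ) (w : ι → ℝ) :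
    eval w (Phi k ξ) = ∑ γ : Fin k → ι, pw w γ * E (D k γ ξ) := by
  induction k generalizing ξ with
  | zero => simp [Phi, sum_zero_idx, pw]
  | succ k ih =>
    rw [sum_cons, Phi, map_sum]
    apply Finset.sum_congr rfl; intro j _
    rw [eval_mul, eval_X, ih, Finset.mul_sum]
    apply Finset.sum_congr rfl; intro γ _
    unfold pw
    rw [Fin.prod_univ_succ]; simp only [Fin.cons_zero, Fin.cons_succ, D_cons]; ring

lemma Phi_hom (k : ℕ) (ξ : MvPolynomial ι ℝ) : (Phi k ξ).IsHomogeneous k := by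
  induction k generalizing ξ with
  | zero => exact isHomogeneous_C _ _
  | succ k ih =>
    rw [Phi]
    apply IsHomogeneous.sum; intro j _
    rw [add_comm]
    exact (isHomogeneous_X ℝ j).mul (ih _)

lemma pderiv_Phi (k : ℕ) (i : ι) (ξ : MvPolynomial ι ℝ) :
    pderiv i (Phi (k + 1) ξ) = C ((k : ℝ) + 1) * Phi k (pderiv i ξ) := by
  induction k generalizing ξ with
  | zero =>
    simp only [Phi, map_sum, Derivation.leibniz, pderiv_C, pderiv_X, smul_eq_mul]
    simp [Pi.single_apply, Finset.sum_ite_eq]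
  | succ k ih =>
    rw [Phi, map_sum]
    have : ∀ j, pderiv i (X j * Phi (k + 1) (pderiv j ξ)) =
      (if i = j then Phi (k + 1) (pderiv j ξ) else 0) + C ((k : ℝ) + 1) * (X j * Phi k (pderiv j (pderiv i ξ))) := by
      intro j
      rw [Derivation.leibniz, ih, pderiv_X, smul_eq_mul, smul_eq_mul, pderiv_comm i j, Pi.single_apply]
      split_ifs with h1 h2 h2
      · subst h1; ring
      · exact absurd h1.symm h2
      · exact absurd h2.symm h1
      · ring
    simp_rw [this, Finset.sum_add_distrib, Finset.sum_ite_eq, Finset.mem_univ, if_true, ← Finset.mul_sum]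
    have e : ∑ j, X j * Phi k (pderiv j (pderiv i ξ)) = Phi (k + 1) (pderiv i ξ) := rfl
    rw [e]; push_cast; simp only [map_add, C_1]; ring

lemma D_Phi (n m : ℕ) (α : Fin n → ι) (ξ : MvPolynomial ι ℝ) :
    C (m.factorial : ℝ) * D n α (Phi (m + n) ξ) = C ((m + n).factorial : ℝ) * Phi m (D n α ξ) := by
  induction n generalizing ξ with
  | zero => simp
  | succ n ih =>
    rw [← Fin.cons_self_tail α, D_cons, D_cons, show m + (n + 1) = (m + n) + 1 by ring, pderiv_Phi,
      ← smul_eq_C_mul (Phi _ _), LinearMap.map_smul, smul_eq_C_mul, mul_left_comm, ih, ← mul_assoc, ← C_mul,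
      Nat.factorial_succ]
    push_cast; rfl

def Lap (P : MvPolynomial ι ℝ) : MvPolynomial ι ℝ := ∑ i, pderiv i (pderiv i P)

lemma E_Phi_succ (m : ℕ) (η : MvPolynomial ι ℝ) : E (Phi (m + 2) η) = (m + 1) * E (Phi m (Lap η)) := by
  rw [Phi, map_sum]
  simp_rw [E_ibp, pderiv_Phi, E_C_mul]
  rw [← Finset.mul_sum, Lap, Phi_sum, map_sum]

lemma E_Phi_one (η : MvPolynomial ι ℝ) : E (Phi 1 η) = 0 := by
  rw [Phi, map_sum]
  apply Finset.sum_eq_zero; intro j _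
  rw [E_ibp]; simp [Phi]

lemma E_Phi_odd (a : ℕ) (η : MvPolynomial ι ℝ) : E (Phi (2 * a + 1) η) = 0 := by
  induction a generalizing η with
  | zero => exact E_Phi_one η
  | succ a ih =>
    rw [show 2 * (a + 1) + 1 = (2 * a + 1) + 2 by ring, E_Phi_succ, ih, mul_zero]

lemma E_Phi_even (a : ℕ) (η : MvPolynomial ι ℝ) :
    (E (Phi (2 * a) η)) ^ 2 ≤ ((2 * a).factorial : ℝ) ^ 2 * (E (Lap^[a] η)) ^ 2 := by
  induction a generalizing η with
  | zero => simp [Phi, E_C]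
  | succ a ih =>
    rw [show 2 * (a + 1) = 2 * a + 2 by ring, E_Phi_succ, mul_pow, Function.iterate_succ_apply]
    calc _ ≤ (((2 * a : ℕ) : ℝ) + 1) ^ 2 * (((2 * a).factorial : ℝ) ^ 2 * (E (Lap^[a] (Lap η))) ^ 2) :=
          mul_le_mul_of_nonneg_left (ih _) (sq_nonneg _)
      _ = ((2 * a + 1).factorial : ℝ) ^ 2 * (E (Lap^[a] (Lap η))) ^ 2 := by
          rw [Nat.factorial_succ]; push_cast; ring
      _ ≤ _ := by
          apply mul_le_mul_of_nonneg_right _ (sq_nonneg _)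
          have : (2 * a + 1).factorial ≤ (2 * a + 2).factorial := Nat.factorial_le (by omega)
          have h2 : ((2 * a + 1).factorial : ℝ) ≤ ((2 * a + 2).factorial : ℝ) := by exact_mod_cast this
          exact pow_le_pow_left₀ (by positivity) h2 2

lemma D_Lap (n : ℕ) (α : Fin n → ι) (P : MvPolynomial ι ℝ) : D n α (Lap P) = Lap (D n α P) := by
  unfold Lap
  rw [map_sum]
  simp_rw [D_pderiv]

lemma D_Lap_iter (a n : ℕ) (α : Fin n → ι) (P : MvPolynomial ι ℝ) : D n α (Lap^[a] P) = Lap^[a] (D n α P) := by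
  induction a generalizing P with
  | zero => rfl
  | succ a ih => rw [Function.iterate_succ_apply, Function.iterate_succ_apply, ih, D_Lap]

lemma A_Phi_even (n a : ℕ) (ξ : MvPolynomial ι ℝ) :
    A n (Phi (2 * a + n) ξ) ≤ ((2 * a + n).factorial : ℝ) ^ 2 * A n (Lap^[a] ξ) := by
  unfold A
  rw [Finset.mul_sum]
  apply Finset.sum_le_sum; intro α _
  have h1 := congrArg E (D_Phi n (2 * a) α ξ)
  rw [E_C_mul, E_C_mul] at h1
  have h2 := E_Phi_even a (D n α ξ)
  rw [D_Lap_iter]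
  have h3 : 0 < ((2 * a).factorial : ℝ) ^ 2 := by positivity
  have h4 : ((2 * a).factorial : ℝ) ^ 2 * E (D n α (Phi (2 * a + n) ξ)) ^ 2 =
    ((2 * a + n).factorial : ℝ) ^ 2 * E (Phi (2 * a) (D n α ξ)) ^ 2 := by
    rw [← mul_pow, h1, mul_pow]
  have h5 : ((2 * a).factorial : ℝ) ^ 2 * E (D n α (Phi (2 * a + n) ξ)) ^ 2 ≤
      ((2 * a).factorial : ℝ) ^ 2 * (((2 * a + n).factorial : ℝ) ^ 2 * E (Lap^[a] (D n α ξ)) ^ 2) := by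
    rw [h4]
    calc _ ≤ ((2 * a + n).factorial : ℝ) ^ 2 * (((2 * a).factorial : ℝ) ^ 2 * E (Lap^[a] (D n α ξ)) ^ 2) :=
          mul_le_mul_of_nonneg_left h2 (sq_nonneg _)
      _ = _ := by ring
  exact le_of_mul_le_mul_left h5 h3

lemma A_Phi_odd (n a : ℕ) (ξ : MvPolynomial ι ℝ) : A n (Phi (2 * a + 1 + n) ξ) = 0 := by
  unfold A
  apply Finset.sum_eq_zero; intro α _
  have h1 := congrArg E (D_Phi n (2 * a + 1) α ξ)
  rw [E_C_mul, E_C_mul, E_Phi_odd, mul_zero] at h1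
  rcases mul_eq_zero.1 h1 with h | h
  · exact absurd h (by positivity)
  · rw [h]; simp

lemma A_Lap_le (n : ℕ) (P : MvPolynomial ι ℝ) : A n (Lap P) ≤ Fintype.card ι * A (n + 2) P := by
  rw [show n + 2 = (n + 1) + 1 by ring, A_succ]
  simp_rw [A_succ]
  have h1 : A n (Lap P) ≤ Fintype.card ι * ∑ i, A n (pderiv i (pderiv i P)) := by
    unfold A Lap
    rw [Finset.sum_comm, Finset.mul_sum]
    apply Finset.sum_le_sum; intro α _
    rw [map_sum, map_sum]
    have := sq_sum_le_card_mul_sum_sq (s := Finset.univ) (f := fun i => E (D n α (pderiv i (pderiv i P))))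
    simpa using this
  refine h1.trans (mul_le_mul_of_nonneg_left ?_ (by positivity))
  apply Finset.sum_le_sum; intro i _
  exact Finset.single_le_sum (f := fun j => A n (pderiv j (pderiv i P))) (fun j _ => A_nonneg _ _) (Finset.mem_univ i)

lemma A_Lap_iter_le (a n : ℕ) (P : MvPolynomial ι ℝ) :
    A n (Lap^[a] P) ≤ (Fintype.card ι : ℝ) ^ a * A (2 * a + n) P := by
  induction a generalizing n with
  | zero => simp
  | succ a ih =>
    rw [Function.iterate_succ_apply']
    refine (A_Lap_le n _).trans ?_
    calc _ ≤ (Fintype.card ι : ℝ) * ((Fintype.card ι : ℝ) ^ a * A (2 * a + (n + 2)) P) :=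
          mul_le_mul_of_nonneg_left (ih _) (by positivity)
      _ = _ := by rw [show 2 * a + (n + 2) = 2 * (a + 1) + n by ring]; ring

lemma A_Lap_chaos (m : ℕ) (ξ : MvPolynomial ι ℝ) (h : Chaos (m + 2 : ℕ) ξ) :
    A m (Lap ξ) ≤ m.factorial * (Fintype.card ι * √(Kc 2 ξ)) := by
  have hp : ∀ i, Chaos (m : ℕ) (pderiv i (pderiv i ξ)) := by
    intro i
    have := (h.pderiv i).pderiv i
    push_cast at this
    convert this using 1; ring
  have h1 : A m (Lap ξ) = m.factorial * ∑ i, ∑ j, E (pderiv i (pderiv i ξ) * pderiv j (pderiv j ξ)) := by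
    unfold A
    have e : ∀ α : Fin m → ι, E (D m α (Lap ξ)) ^ 2 = ∑ i, ∑ j, E (D m α (pderiv i (pderiv i ξ))) * E (D m α (pderiv j (pderiv j ξ))) := by
      intro α; rw [Lap, map_sum, map_sum, sq, Finset.sum_mul_sum]
    simp_rw [e]
    rw [Finset.sum_comm, Finset.mul_sum]
    apply Finset.sum_congr rfl; intro i _
    rw [Finset.sum_comm, Finset.mul_sum]
    apply Finset.sum_congr rfl; intro j _
    exact chaos_pairing (hp i) _
  rw [h1]
  apply mul_le_mul_of_nonneg_left _ (by positivity)
  set x : ι × ι → ℝ := fun q => E (pderiv q.1 (pderiv q.1 ξ) * pderiv q.2 (pderiv q.2 ξ)) with hx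
  have h2 : ∑ i, ∑ j, E (pderiv i (pderiv i ξ) * pderiv j (pderiv j ξ)) = ∑ q, x q := by
    rw [Fintype.sum_prod_type]
  have h3 : (∑ q, x q) ^ 2 ≤ (Fintype.card ι : ℝ) ^ 2 * ∑ q, x q ^ 2 := by
    have := sq_sum_le_card_mul_sum_sq (s := Finset.univ) (f := x)
    simpa [sq, Fintype.card_prod] using this
  have h4 : ∑ q, x q ^ 2 ≤ Kc 2 ξ := by
    rw [Fintype.sum_prod_type]
    unfold Kc
    simp only [sum_cons, sum_zero_idx, D_cons, D_zero]
    apply Finset.sum_le_sum; intro i _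
    refine le_trans ?_ (Finset.single_le_sum (f := fun j => ∑ i', ∑ j', E (pderiv j (pderiv i ξ) * pderiv j' (pderiv i' ξ)) ^ 2)
      (fun _ _ => Finset.sum_nonneg fun _ _ => Finset.sum_nonneg fun _ _ => sq_nonneg _) (Finset.mem_univ i))
    apply Finset.sum_le_sum; intro j _
    exact Finset.single_le_sum (f := fun j' => E (pderiv i (pderiv i ξ) * pderiv j' (pderiv j ξ)) ^ 2)
      (fun _ _ => sq_nonneg _) (Finset.mem_univ j)
  rw [h2]
  calc ∑ q, x q ≤ √((∑ q, x q) ^ 2) := by rw [Real.sqrt_sq_eq_abs]; exact le_abs_self _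
    _ ≤ √((Fintype.card ι : ℝ) ^ 2 * Kc 2 ξ) := Real.sqrt_le_sqrt (h3.trans (by gcongr))
    _ = _ := by rw [Real.sqrt_mul (by positivity), Real.sqrt_sq (by positivity)]

lemma E_Phi_sq_le (k : ℕ) (hk : 3 ≤ k) (ξ : MvPolynomial ι ℝ) (h : Chaos k ξ) (h1 : E (ξ * ξ) = 1)
    (hd : 1 ≤ Fintype.card ι) :
    E (Phi k ξ * Phi k ξ) ≤ (k + 1) * (k.factorial : ℝ) ^ 3 * ((Fintype.card ι : ℝ) ^ (k - 2) *
      ((Fintype.card ι : ℝ)⁻¹ + √(Kc 2 ξ))) := by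
  have hd' : (1 : ℝ) ≤ Fintype.card ι := by exact_mod_cast hd
  set d : ℝ := (Fintype.card ι : ℝ) with hdd
  have hK := Real.sqrt_nonneg (Kc 2 ξ)
  set κ := √(Kc 2 ξ)
  have hf1 : (1:ℝ) ≤ (k.factorial : ℝ) := by exact_mod_cast Nat.one_le_iff_ne_zero.2 (Nat.factorial_ne_zero k)
  refine (E_sq_le_A k _ (Phi_hom k ξ).totalDegree_le).trans ?_
  have key : ∀ n ∈ Finset.range (k + 1), A n (Phi k ξ) ≤ (k.factorial : ℝ) ^ 3 * (d ^ (k - 2) * (d⁻¹ + κ)) := by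
    intro n hn
    have hn' : n ≤ k := by simpa [Nat.lt_succ_iff] using hn
    rcases Nat.even_or_odd' (k - n) with ⟨a, ha | ha⟩
    · obtain rfl : k = 2 * a + n := by omega
      refine (A_Phi_even n a ξ).trans ?_
      rw [pow_succ (_ : ℝ) 2, mul_assoc]
      apply mul_le_mul_of_nonneg_left _ (by positivity)
      by_cases ha0 : a = 0
      · subst ha0
        simp only [Nat.mul_zero, Nat.zero_add, Function.iterate_zero, id] at *
        refine (A_le_of_chaos n ξ (by simpa using h)).trans ?_
        rw [h1]
        apply mul_le_mul_of_nonneg_left _ (by positivity)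
        have : (1:ℝ) ≤ d ^ (n - 2) * d⁻¹ := by
          rw [show n - 2 = (n - 3) + 1 by omega, pow_succ, mul_assoc, mul_inv_cancel₀ (by positivity), mul_one]
          exact one_le_pow₀ hd'
        have h2 : 0 ≤ d ^ (n - 2) * κ := by positivity
        linarith
      · obtain ⟨b, rfl⟩ : ∃ b, a = b + 1 := ⟨a - 1, by omega⟩
        rw [Function.iterate_succ_apply]
        refine (A_Lap_iter_le b n _).trans ?_
        have h2 := A_Lap_chaos (2 * b + n) ξ (by convert h using 2; push_cast; ring)
        have hfac : ((2 * b + n).factorial : ℝ) ≤ ((2 * (b + 1) + n).factorial : ℝ) := by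
          exact_mod_cast Nat.factorial_le (by omega)
        have hdp : d ^ b * d ≤ d ^ (2 * (b + 1) + n - 2) := by
          rw [← pow_succ]; exact pow_le_pow_right₀ hd' (by omega)
        calc _ ≤ d ^ b * (((2 * b + n).factorial : ℝ) * (d * κ)) := by gcongr
          _ = ((2 * b + n).factorial : ℝ) * ((d ^ b * d) * κ) := by ring
          _ ≤ ((2 * (b + 1) + n).factorial : ℝ) * (d ^ (2 * (b + 1) + n - 2) * κ) := by gcongr
          _ ≤ _ := by
            gcongr
            have : 0 ≤ d⁻¹ := by positivity
            linarith
    · obtain rfl : k = 2 * a + 1 + n := by omega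
      rw [A_Phi_odd]
      positivity
  refine (Finset.sum_le_sum key).trans (le_of_eq ?_)
  simp; ring

/-- value of `Phi` at a unit vector -/
lemma Phi_eval_Hp (k : ℕ) (ξ : MvPolynomial ι ℝ) (h : Chaos k ξ) (w : ι → ℝ) :
    E (ξ * Hp k w) = (√(k.factorial : ℝ))⁻¹ * eval w (Phi k ξ) := by
  have h1 := chaos_pairing h (Hp k w)
  have h2 : ∀ γ : Fin k → ι, E (D k γ (Hp k w)) = √(k.factorial : ℝ) * pw w γ := by
    intro γ
    have := D_Hp k 0 γ w
    simp only [Nat.add_zero] at this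
    rw [this, E_C_mul, Hp_zero, E_one]
    simp [pw]
  simp_rw [h2] at h1
  have h3 : ∑ γ : Fin k → ι, E (D k γ ξ) * (√(k.factorial : ℝ) * pw w γ) = √(k.factorial : ℝ) * eval w (Phi k ξ) := by
    rw [Phi_eval, Finset.mul_sum]; apply Finset.sum_congr rfl; intros; ring
  rw [h3] at h1
  have hs : √(k.factorial : ℝ) * √(k.factorial : ℝ) = k.factorial := Real.mul_self_sqrt (by positivity)
  have hp : 0 < √(k.factorial : ℝ) := Real.sqrt_pos.2 (by positivity)
  have h1 : √(k.factorial : ℝ) * eval w (Phi k ξ) = √(k.factorial : ℝ) * (√(k.factorial : ℝ) * E (ξ * Hp k w)) := by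
    rw [h1, ← mul_assoc, hs]
  have h4 := mul_left_cancel₀ hp.ne' h1
  rw [h4]; field_simp

end UC

namespace UC
open MvPolynomial
variable {ι : Type*} [Fintype ι] [DecidableEq ι]

/-! ### Moments on the sphere -/

def N2 (x : ι → ℝ) : ℝ := ∑ i, x i ^ 2
def NP : MvPolynomial ι ℝ := ∑ i, X i ^ 2

lemma N2_nonneg (x : ι → ℝ) : 0 ≤ N2 x := Finset.sum_nonneg fun _ _ => sq_nonneg _
lemma eval_NP (x : ι → ℝ) : eval x NP = N2 x := by simp [NP, N2]
lemma poly_cont (P : MvPolynomial ι ℝ) : Continuous fun x : ι → ℝ => eval x P := MvPolynomial.continuous_eval P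
lemma N2_cont : Continuous (N2 : (ι → ℝ) → ℝ) := by unfold N2; fun_prop

lemma hom_bound {m : ℕ} {P : MvPolynomial ι ℝ} (h : P.IsHomogeneous (2 * m)) :
    ∃ c : ℝ, 0 ≤ c ∧ ∀ x, |eval x P| ≤ c * N2 x ^ m := by
  refine ⟨∑ κ ∈ P.support, |coeff κ P|, Finset.sum_nonneg fun _ _ => abs_nonneg _, fun x => ?_⟩
  rw [eval_eq', Finset.sum_mul]
  refine (Finset.abs_sum_le_sum_abs _ _).trans (Finset.sum_le_sum fun κ hκ => ?_)
  rw [abs_mul]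
  apply mul_le_mul_of_nonneg_left _ (abs_nonneg _)
  have hx : ∀ i, |x i| ≤ √(N2 x) := by
    intro i
    apply Real.abs_le_sqrt
    exact Finset.single_le_sum (f := fun i => x i ^ 2) (fun _ _ => sq_nonneg _) (Finset.mem_univ i)
  have hdeg : ∑ i, κ i = 2 * m := by
    have := h (mem_support_iff.1 hκ)
    rw [Finsupp.weight_apply, Finsupp.sum_fintype _ _ (by simp)] at this
    simpa using this
  rw [Finset.abs_prod]
  calc ∏ i, |x i ^ κ i| ≤ ∏ i, √(N2 x) ^ κ i := by
        apply Finset.prod_le_prod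
        · intros; exact abs_nonneg _
        · intro i _; rw [abs_pow]; exact pow_le_pow_left₀ (abs_nonneg _) (hx i) _
    _ = N2 x ^ m := by
        rw [Finset.prod_pow_eq_pow_sum, hdeg, pow_mul, Real.sq_sqrt (N2_nonneg x)]

lemma eval_smul_hom {r : ℕ} {P : MvPolynomial ι ℝ} (h : P.IsHomogeneous r) (c : ℝ) (x : ι → ℝ) :
    eval (c • x) P = c ^ r * eval x P := by
  rw [eval_eq', eval_eq', Finset.mul_sum]
  apply Finset.sum_congr rfl; intro κ hκ
  have hdeg : ∑ i, κ i = r := by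
    have := h (mem_support_iff.1 hκ)
    rw [Finsupp.weight_apply, Finsupp.sum_fintype _ _ (by simp)] at this
    simpa using this
  simp only [Pi.smul_apply, smul_eq_mul, mul_pow, Finset.prod_mul_distrib, Finset.prod_pow_eq_pow_sum, hdeg]
  ring

lemma int_U (P : MvPolynomial ι ℝ) (b : ℕ) (ε : ℝ) (hε : 0 < ε) :
    Integrable (fun x => eval x P * ((N2 x + ε)⁻¹) ^ b) (stdG ι) := by
  have hpos : ∀ x : ι → ℝ, 0 < N2 x + ε := fun x => by have := N2_nonneg x; linarith
  refine Integrable.mono' ((poly_integrable P).abs.mul_const ((ε⁻¹) ^ b)) ?_ ?_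
  · apply Continuous.aestronglyMeasurable
    apply (poly_cont P).mul
    apply Continuous.pow
    exact (N2_cont.add continuous_const).inv₀ (fun x => (hpos x).ne')
  · refine Filter.Eventually.of_forall fun x => ?_
    rw [Real.norm_eq_abs, abs_mul]
    apply mul_le_mul_of_nonneg_left _ (abs_nonneg _)
    have h1 := hpos x
    rw [abs_of_nonneg (by positivity)]
    apply pow_le_pow_left₀ (by positivity)
    apply inv_anti₀ hε
    have := N2_nonneg x; linarith

lemma eps_ident {m : ℕ} {P : MvPolynomial ι ℝ} (h : P.IsHomogeneous (2 * m)) (j : ℕ) (ε : ℝ) (hε : 0 < ε) :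
    ∫ x, eval x (NP * P) * ((N2 x + ε)⁻¹) ^ j ∂(stdG ι) =
      (Fintype.card ι + 2 * m) * ∫ x, eval x P * ((N2 x + ε)⁻¹) ^ j ∂(stdG ι)
      - 2 * j * ∫ x, eval x (NP * P) * ((N2 x + ε)⁻¹) ^ (j + 1) ∂(stdG ι) := by
  have hpos : ∀ x : ι → ℝ, 0 < N2 x + ε := fun x => by have := N2_nonneg x; linarith
  have key : ∀ i : ι, ∫ x, eval x (X i ^ 2 * P) * ((N2 x + ε)⁻¹) ^ j ∂(stdG ι) =
      ∫ x, (eval x (P + X i * pderiv i P) * ((N2 x + ε)⁻¹) ^ j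
        - 2 * j * (eval x (X i ^ 2 * P) * ((N2 x + ε)⁻¹) ^ (j + 1))) ∂(stdG ι) := by
    intro i
    have := ibp i (fun x => eval x (X i * P) * ((N2 x + ε)⁻¹) ^ j) (fun x => eval x (P + X i * pderiv i P) * ((N2 x + ε)⁻¹) ^ j
        - 2 * j * (eval x (X i ^ 2 * P) * ((N2 x + ε)⁻¹) ^ (j + 1))) ?_ (int_U _ _ _ hε)
        ((int_U _ _ _ hε).sub ((int_U _ _ _ hε).const_mul _)) ?_
    · rw [← this]
      congr 1; funext x; simp; ring
    · intro x
      have h1 := eval_update_deriv (X i * P) i x (x i)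
      have hN : HasDerivAt (fun t => N2 (Function.update x i t) + ε) (2 * x i) (x i) := by
        have h2 := (eval_update_deriv (NP : MvPolynomial ι ℝ) i x (x i)).add_const ε
        simp only [eval_NP] at h2
        refine h2.congr_deriv ?_
        have : pderiv i (NP : MvPolynomial ι ℝ) = 2 * X i := by
          unfold NP
          rw [map_sum, Finset.sum_eq_single i]
          · rw [pderiv_pow, pderiv_X_self]; simp
          · intro b _ hb; rw [pderiv_pow, pderiv_X_of_ne hb]; simp
          · simp
        rw [this]; simp
      have hx : Function.update x i (x i) = x := Function.update_eq_self i x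
      have hne : N2 (Function.update x i (x i)) + ε ≠ 0 := (hpos _).ne'
      have h3 := (hN.inv hne).pow j
      have h4 := h1.fun_mul h3
      rw [hx] at h4
      refine h4.congr_deriv ?_
      have hp := hpos x
      have e1 : pderiv i (X i * P) = P + X i * pderiv i P := by
        rw [Derivation.leibniz, pderiv_X_self, smul_eq_mul, smul_eq_mul]; ring
      rw [e1]
      simp only [Pi.pow_apply, Pi.inv_apply, hx]
      rcases j with _ | j
      · simp
      · simp only [eval_mul, eval_pow, eval_X, Nat.add_sub_cancel]
        push_cast
        rw [div_eq_mul_inv, ← inv_pow]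
        ring
    · convert int_U (X i ^ 2 * P) j ε hε using 2
      simp; ring
  have e1 : ∀ b, ∫ x, eval x (NP * P) * ((N2 x + ε)⁻¹) ^ b ∂(stdG ι) = ∑ i, ∫ x, eval x (X i ^ 2 * P) * ((N2 x + ε)⁻¹) ^ b ∂(stdG ι) := by
    intro b
    rw [← integral_finsetSum _ (fun i _ => int_U _ _ _ hε)]
    congr 1; funext x
    unfold NP
    rw [Finset.sum_mul, map_sum, Finset.sum_mul]
  have e2 : ∑ i, ∫ x, eval x (P + X i * pderiv i P) * ((N2 x + ε)⁻¹) ^ j ∂(stdG ι) =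
      (Fintype.card ι + 2 * m) * ∫ x, eval x P * ((N2 x + ε)⁻¹) ^ j ∂(stdG ι) := by
    rw [← integral_finsetSum _ (fun i _ => int_U _ _ _ hε), ← integral_const_mul]
    congr 1; funext x
    rw [← Finset.sum_mul, ← map_sum, Finset.sum_add_distrib, h.sum_X_mul_pderiv]
    simp; ring
  rw [e1 j, e1 (j + 1), ← e2, Finset.mul_sum, ← Finset.sum_sub_distrib]
  apply Finset.sum_congr rfl; intro i _
  rw [key i, integral_sub (int_U _ _ _ hε) ((int_U _ _ _ hε).const_mul _), integral_const_mul]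

def Jm (P : MvPolynomial ι ℝ) (b : ℕ) : ℝ := ∫ x, eval x P * ((N2 x)⁻¹) ^ b ∂(stdG ι)

lemma hom_int {m : ℕ} (hm : 1 ≤ m) {P : MvPolynomial ι ℝ} (h : P.IsHomogeneous (2 * m)) (b : ℕ) (hb : b ≤ m) :
    Filter.Tendsto (fun n : ℕ => ∫ x, eval x P * ((N2 x + (1 / ((n : ℝ) + 1)))⁻¹) ^ b ∂(stdG ι)) Filter.atTop (nhds (Jm P b)) := by
  obtain ⟨c, hc, hP⟩ := hom_bound h
  have hintg : Integrable (fun x : ι → ℝ => c * eval x (NP ^ (m - b) : MvPolynomial ι ℝ)) (stdG ι) := (poly_integrable _).const_mul _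
  apply tendsto_integral_of_dominated_convergence _ _ hintg
  · intro n
    refine Filter.Eventually.of_forall fun x => ?_
    have hε : (0:ℝ) < 1 / ((n:ℝ) + 1) := by positivity
    set ε := 1 / ((n:ℝ) + 1)
    have hN := N2_nonneg x
    rw [Real.norm_eq_abs, abs_mul, abs_of_nonneg (a := ((N2 x + ε)⁻¹) ^ b) (by positivity)]
    rw [eval_pow, eval_NP]
    calc |eval x P| * ((N2 x + ε)⁻¹) ^ b ≤ c * N2 x ^ m * ((N2 x + ε)⁻¹) ^ b := by gcongr; exact hP x
      _ = c * N2 x ^ (m - b) * (N2 x * (N2 x + ε)⁻¹) ^ b := by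
        rw [mul_pow, ← pow_sub_mul_pow (N2 x) hb]; ring
      _ ≤ c * N2 x ^ (m - b) * 1 := by
        gcongr
        apply pow_le_one₀ (by positivity)
        rw [← div_eq_mul_inv, div_le_one (by linarith)]; linarith
      _ = _ := by ring
  · refine Filter.Eventually.of_forall fun x => ?_
    by_cases hx : N2 x = 0
    · have : eval x P = 0 := by
        have := hP x
        rw [hx, zero_pow (by omega), mul_zero] at this
        exact abs_eq_zero.1 (le_antisymm this (abs_nonneg _))
      simp [this]
    · apply Filter.Tendsto.const_mul
      apply Filter.Tendsto.pow
      apply Filter.Tendsto.inv₀ _ hx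
      have := tendsto_one_div_add_atTop_nhds_zero_nat (𝕜 := ℝ)
      simpa using this.const_add (N2 x)
  · intro n
    have hε : (0:ℝ) < 1 / ((n:ℝ) + 1) := by positivity
    exact (int_U P b _ hε).aestronglyMeasurable

lemma NP_hom : (NP : MvPolynomial ι ℝ).IsHomogeneous 2 := by
  unfold NP
  apply IsHomogeneous.sum; intro i _
  exact isHomogeneous_X_pow i 2

lemma Jm_rec {m : ℕ} (hm : 1 ≤ m) {P : MvPolynomial ι ℝ} (h : P.IsHomogeneous (2 * m)) (j : ℕ) (hj : j + 1 ≤ m) :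
    Jm P j = (Fintype.card ι + 2 * m - 2 * (j + 1)) * Jm P (j + 1) := by
  have hNP : (NP * P).IsHomogeneous (2 * (m + 1)) := by
    rw [mul_add, add_comm]; exact NP_hom.mul h
  obtain ⟨c, hc, hP⟩ := hom_bound h
  have red : ∀ b, Jm (NP * P) (b + 1) = Jm P b := by
    intro b
    unfold Jm
    congr 1; funext x
    rw [eval_mul, eval_NP]
    by_cases hx : N2 x = 0
    · have : eval x P = 0 := by
        have := hP x
        rw [hx, zero_pow (by omega), mul_zero] at this
        exact abs_eq_zero.1 (le_antisymm this (abs_nonneg _))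
      simp [this]
    · rw [pow_succ]
      have := mul_inv_cancel₀ hx
      linear_combination (eval x P * (N2 x)⁻¹ ^ b) * this
  have t1 := hom_int (by omega) hNP (j + 1) (by omega)
  have t2 := hom_int hm h (j + 1) hj
  have t3 := hom_int (by omega) hNP (j + 2) (by omega)
  have t4 := (t2.const_mul ((Fintype.card ι : ℝ) + 2 * m)).sub (t3.const_mul (2 * ((j : ℝ) + 1)))
  have t5 := tendsto_nhds_unique t1 (t4.congr fun n => ?_)
  · rw [red, red (j + 1)] at t5
    linarith
  · have hε : (0:ℝ) < 1 / ((n:ℝ) + 1) := by positivity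
    have := eps_ident h (j + 1) _ hε
    push_cast at this
    rw [this]

def sphDen (d m : ℕ) : ℝ := ∏ j ∈ Finset.range m, ((d : ℝ) + 2 * j)

lemma Jm_prod {m : ℕ} (hm : 1 ≤ m) {P : MvPolynomial ι ℝ} (h : P.IsHomogeneous (2 * m)) :
    E P = sphDen (Fintype.card ι) m * Jm P m := by
  have : ∀ j ≤ m, E P = (∏ i ∈ Finset.range j, ((Fintype.card ι : ℝ) + 2 * m - 2 * (i + 1))) * Jm P j := by
    intro j
    induction j with
    | zero => intro _; simp [Jm, E_def]
    | succ j ih =>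
      intro hj
      rw [ih (by omega), Jm_rec hm h j hj, Finset.prod_range_succ]; ring
  rw [this m le_rfl]
  congr 1
  unfold sphDen
  rw [← Finset.prod_range_reflect]
  apply Finset.prod_congr rfl; intro i hi
  have : i < m := Finset.mem_range.1 hi
  rw [Nat.sub_sub, Nat.cast_sub (by omega)]; push_cast; ring

lemma enorm2_meas : Measurable (fun x : ι → ℝ => (enorm2 x)⁻¹ • x) := by
  unfold enorm2
  apply Measurable.fun_smul
  · apply Measurable.inv
    apply Measurable.sqrt
    fun_prop
  · exact measurable_id

instance sph_prob : IsProbabilityMeasure (unifSphere ι) := by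
  unfold unifSphere
  exact Measure.isProbabilityMeasure_map enorm2_meas.aemeasurable

lemma sphere_int {m : ℕ} (hm : 1 ≤ m) {P : MvPolynomial ι ℝ} (h : P.IsHomogeneous (2 * m)) (hd : 1 ≤ Fintype.card ι) :
    ∫ w, eval w P ∂(unifSphere ι) = E P / sphDen (Fintype.card ι) m := by
  have hpos : 0 < sphDen (Fintype.card ι) m := by
    unfold sphDen
    apply Finset.prod_pos; intro i _
    have : (1:ℝ) ≤ Fintype.card ι := by exact_mod_cast hd
    positivity
  rw [Jm_prod hm h, mul_div_cancel_left₀ _ hpos.ne']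
  unfold unifSphere Jm
  rw [integral_map enorm2_meas.aemeasurable (poly_cont P).aestronglyMeasurable]
  congr 1; funext x
  rw [eval_smul_hom h, pow_mul, mul_comm]
  congr 2
  rw [inv_pow, show enorm2 x = √(N2 x) from rfl, Real.sq_sqrt (N2_nonneg x)]

lemma sph_unit [Nonempty ι] : ∀ᵐ w ∂(unifSphere ι), ∑ i, w i ^ 2 = 1 := by
  unfold unifSphere
  have hms : MeasurableSet {w : ι → ℝ | ∑ i, w i ^ 2 = 1} := by
    apply measurableSet_eq_fun <;> fun_prop
  rw [ae_map_iff enorm2_meas.aemeasurable hms]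
  obtain ⟨i⟩ := ‹Nonempty ι›
  have h0 : ∀ᵐ x ∂(stdG ι), x ≠ 0 := by
    have : NullSingletonClass (stdG ι) := by
      unfold stdG
      have : NullSingletonClass (gaussianReal 0 1) := nullSingletonClass_gaussianReal (by norm_num)
      exact Measure.pi_nullSingletonClass i
    rw [ae_iff]; simp
  filter_upwards [h0] with x hx
  have hN : 0 < ∑ i, x i ^ 2 := by
    apply lt_of_le_of_ne (N2_nonneg x)
    intro h
    apply hx
    funext i
    have := (Finset.sum_eq_zero_iff_of_nonneg (fun i _ => sq_nonneg (x i))).1 h.symm i (Finset.mem_univ i)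
    simpa using this
  simp only [Pi.smul_apply, smul_eq_mul, mul_pow]
  rw [← Finset.mul_sum, enorm2, inv_pow, Real.sq_sqrt hN.le, inv_mul_cancel₀ hN.ne']

end UC

namespace UC
open MvPolynomial
variable {ι : Type*} [Fintype ι] [DecidableEq ι]

lemma dotp_self (u : ι → ℝ) : dotp u u = N2 u := by
  unfold dotp N2; apply Finset.sum_congr rfl; intros; ring
lemma dotp_comm (u v : ι → ℝ) : dotp u v = dotp v u := by
  unfold dotp; apply Finset.sum_congr rfl; intros; ring

lemma lin_hom (u : ι → ℝ) : (lin u).IsHomogeneous 1 := by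
  unfold lin
  apply IsHomogeneous.sum; intro i _
  rw [← zero_add 1]
  exact (isHomogeneous_C _ _).mul (isHomogeneous_X _ _)

lemma E_lin_mul (u : ι → ℝ) (P : MvPolynomial ι ℝ) : E (lin u * P) = ∑ i, u i * E (pderiv i P) := by
  unfold lin
  rw [Finset.sum_mul, map_sum]
  apply Finset.sum_congr rfl; intro i _
  rw [mul_assoc, E_C_mul, E_ibp]

lemma E_lin_pow (u v : ι → ℝ) (k l : ℕ) :
    E (lin u ^ (k + 1) * lin v ^ l) = k * N2 u * E (lin u ^ (k - 1) * lin v ^ l) + l * dotp u v * E (lin u ^ k * lin v ^ (l - 1)) := by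
  rw [pow_succ, mul_comm (lin u ^ k), mul_assoc, E_lin_mul]
  have : ∀ i, u i * E (pderiv i (lin u ^ k * lin v ^ l)) = (u i * u i) * (k * E (lin u ^ (k - 1) * lin v ^ l)) +
      (u i * v i) * (l * E (lin u ^ k * lin v ^ (l - 1))) := by
    intro i
    rw [Derivation.leibniz, pderiv_pow, pderiv_pow, pderiv_lin, pderiv_lin, smul_eq_mul, smul_eq_mul, map_add]
    rw [show lin u ^ k * ((l : MvPolynomial ι ℝ) * lin v ^ (l - 1) * C (v i)) = C (v i) * (C (l : ℝ) * (lin u ^ k * lin v ^ (l - 1))) by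
      rw [map_natCast]; ring]
    rw [show lin v ^ l * ((k : MvPolynomial ι ℝ) * lin u ^ (k - 1) * C (u i)) = C (u i) * (C (k : ℝ) * (lin u ^ (k - 1) * lin v ^ l)) by
      rw [map_natCast]; ring]
    rw [E_C_mul, E_C_mul, E_C_mul, E_C_mul]; ring
  simp_rw [this]
  rw [Finset.sum_add_distrib, ← Finset.sum_mul, ← Finset.sum_mul, ← dotp_self]
  unfold dotp; ring

lemma E_NP_mul {r : ℕ} {R : MvPolynomial ι ℝ} (h : R.IsHomogeneous r) : E (NP * R) = (Fintype.card ι + r) * E R := by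
  unfold NP
  rw [Finset.sum_mul, map_sum]
  have : ∀ i, E (X i ^ 2 * R) = E R + E (X i * pderiv i R) := by
    intro i
    rw [sq, mul_assoc, E_ibp, Derivation.leibniz, pderiv_X_self, smul_eq_mul, smul_eq_mul, map_add]
    rw [mul_one]; ring
  simp_rw [this]
  have e : ∑ i, E (X i * pderiv i R) = E (∑ i, X i * pderiv i R) := (map_sum E _ _).symm
  rw [Finset.sum_add_distrib, e, h.sum_X_mul_pderiv, map_nsmul, Finset.sum_const, Finset.card_univ, nsmul_eq_mul, nsmul_eq_mul]
  ring

def HP2 (u : ι → ℝ) : MvPolynomial ι ℝ := lin u ^ 2 - C (N2 u / Fintype.card ι) * NP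
def HP3 (u : ι → ℝ) : MvPolynomial ι ℝ := lin u ^ 3 - C (3 / (Fintype.card ι + 2) * N2 u) * (NP * lin u)
def H2 (u v : ι → ℝ) : ℝ := dotp u v ^ 2 - N2 u * N2 v / Fintype.card ι
def H3 (u v : ι → ℝ) : ℝ := dotp u v ^ 3 - 3 / (Fintype.card ι + 2) * N2 u * (N2 v * dotp u v)

lemma eval_HP2 (u v : ι → ℝ) : eval v (HP2 u) = H2 u v := by
  simp [HP2, H2, eval_lin, eval_NP]; ring
lemma eval_HP3 (u v : ι → ℝ) : eval v (HP3 u) = H3 u v := by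
  simp [HP3, H3, eval_lin, eval_NP]
lemma H2_symm (u v : ι → ℝ) : H2 u v = H2 v u := by
  unfold H2; rw [dotp_comm]; ring
lemma H3_symm (u v : ι → ℝ) : H3 u v = H3 v u := by
  unfold H3; rw [dotp_comm]; ring

lemma HP2_hom (u : ι → ℝ) : (HP2 u).IsHomogeneous 2 := by
  unfold HP2
  apply IsHomogeneous.sub
  · have h := (lin_hom u).pow 2
    rwa [one_mul] at h
  · have h := (isHomogeneous_C ι (N2 u / Fintype.card ι)).mul (NP_hom (ι := ι))
    rwa [zero_add] at h
lemma HP3_hom (u : ι → ℝ) : (HP3 u).IsHomogeneous 3 := by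
  unfold HP3
  apply IsHomogeneous.sub
  · have h := (lin_hom u).pow 3
    rwa [one_mul] at h
  · have h := (isHomogeneous_C ι (3 / (Fintype.card ι + 2) * N2 u)).mul (NP_hom.mul (lin_hom u))
    rwa [zero_add] at h

lemma E_lin2 (u v : ι → ℝ) : E (lin u * lin v) = dotp u v := by
  have := E_lin_pow u v 0 1
  simpa [E_one] using this
lemma E_lin_sq (u : ι → ℝ) : E (lin u ^ 2) = N2 u := by
  rw [sq, E_lin2, dotp_self]
lemma E_lin22 (u v : ι → ℝ) : E (lin u ^ 2 * lin v ^ 2) = N2 u * N2 v + 2 * dotp u v ^ 2 := by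
  have := E_lin_pow u v 1 2
  simp [E_lin2, E_lin_sq] at this
  rw [this]; ring
lemma E_lin13 (u v : ι → ℝ) : E (lin u * lin v ^ 3) = 3 * dotp u v * N2 v := by
  have := E_lin_pow u v 0 3
  simp [E_lin2, E_lin_sq] at this
  rw [this]
lemma E_lin33 (u v : ι → ℝ) : E (lin u ^ 3 * lin v ^ 3) = 9 * N2 u * N2 v * dotp u v + 6 * dotp u v ^ 3 := by
  have := E_lin_pow u v 2 3
  simp [E_lin22, E_lin13] at this
  rw [this]; ring

lemma E_HP2 (u v : ι → ℝ) (hd : 1 ≤ Fintype.card ι) : E (HP2 u * HP2 v) = 2 * H2 u v := by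
  have hd' : (Fintype.card ι : ℝ) ≠ 0 := by positivity
  have e : HP2 u * HP2 v = lin u ^ 2 * lin v ^ 2 - C (N2 u / Fintype.card ι) * (NP * lin v ^ 2)
    - C (N2 v / Fintype.card ι) * (NP * lin u ^ 2) + C (N2 u / Fintype.card ι * (N2 v / Fintype.card ι)) * (NP * NP) := by
    unfold HP2; rw [C_mul]; ring
  have e1 : E (NP : MvPolynomial ι ℝ) = Fintype.card ι := by
    have := E_NP_mul (isHomogeneous_one ι ℝ)
    simpa [E_one] using this
  have h1 := fun u : ι → ℝ => E_NP_mul ((lin_hom u).pow 2)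
  have h2 := E_NP_mul (NP_hom (ι := ι))
  simp only [e, map_add, map_sub, E_C_mul, E_lin22, h1, h2, E_lin_sq, e1]
  unfold H2
  push_cast
  field_simp
  ring

lemma E_HP3 (u v : ι → ℝ) : E (HP3 u * HP3 v) = 6 * H3 u v := by
  have hd' : (Fintype.card ι : ℝ) + 2 ≠ 0 := by positivity
  set a := 3 / ((Fintype.card ι : ℝ) + 2) * N2 u with ha
  set b := 3 / ((Fintype.card ι : ℝ) + 2) * N2 v with hb
  have e : HP3 u * HP3 v = lin u ^ 3 * lin v ^ 3 - C a * (NP * (lin u * lin v ^ 3))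
    - C b * (NP * (lin v * lin u ^ 3)) + C (a * b) * (NP * (NP * (lin u * lin v))) := by
    have ec : (C (a * b) : MvPolynomial ι ℝ) = C a * C b := C_mul
    unfold HP3; rw [← ha, ← hb, ec]; ring
  have h1 := fun u v : ι → ℝ => E_NP_mul ((lin_hom u).mul ((lin_hom v).pow 3))
  have h2 := E_NP_mul ((lin_hom u).mul (lin_hom v))
  have h3 := E_NP_mul (NP_hom.mul ((lin_hom u).mul (lin_hom v)))
  simp only [e, map_add, map_sub, E_C_mul, E_lin33, h1, h2, h3, E_lin13, E_lin2]
  rw [ha, hb]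
  unfold H3
  rw [dotp_comm v u]
  push_cast
  field_simp
  ring

lemma sph_H2 (u v : ι → ℝ) (hd : 1 ≤ Fintype.card ι) :
    ∫ w, H2 u w * H2 w v ∂(unifSphere ι) = 2 / ((Fintype.card ι : ℝ) * (Fintype.card ι + 2)) * H2 u v := by
  have := sphere_int (m := 2) (by norm_num) ((HP2_hom u).mul (HP2_hom v)) hd
  simp only [eval_mul, eval_HP2, E_HP2 u v hd, sphDen, Finset.prod_range_succ, Finset.prod_range_zero] at this
  have e : ∀ w, H2 w v = H2 v w := fun w => H2_symm w v
  simp only [e]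
  rw [this, e u]; push_cast
  ring

lemma sph_H3 (u v : ι → ℝ) (hd : 1 ≤ Fintype.card ι) :
    ∫ w, H3 u w * H3 w v ∂(unifSphere ι) =
      6 / ((Fintype.card ι : ℝ) * (Fintype.card ι + 2) * (Fintype.card ι + 4)) * H3 u v := by
  have := sphere_int (m := 3) (by norm_num) ((HP3_hom u).mul (HP3_hom v)) hd
  simp only [eval_mul, eval_HP3, E_HP3 u v, sphDen, Finset.prod_range_succ, Finset.prod_range_zero] at this
  have e : ∀ w, H3 w v = H3 v w := fun w => H3_symm w v
  simp only [e]
  rw [this, e u]; push_cast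
  ring

lemma sph_moment (r : ℕ) (hr : 1 ≤ r) (q : ℕ) : ∃ c : ℝ, 0 ≤ c ∧ ∀ (ι : Type) [Fintype ι] [DecidableEq ι] (P : MvPolynomial ι ℝ),
    P.IsHomogeneous r → 1 ≤ Fintype.card ι →
    ∫ w, eval w P ^ (2 ^ (q + 1)) ∂(unifSphere ι) ≤ c * (E (P * P) / (Fintype.card ι : ℝ) ^ r) ^ (2 ^ q) := by
  obtain ⟨c, hc, h⟩ := hyper_pow r q
  refine ⟨c, hc, ?_⟩
  intro ι _ _ P hP hd
  have hd' : (1:ℝ) ≤ Fintype.card ι := by exact_mod_cast hd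
  have hh : (P ^ (2 ^ (q + 1))).IsHomogeneous (2 * (r * 2 ^ q)) := by
    have := hP.pow (2 ^ (q + 1))
    convert this using 1; rw [pow_succ]; ring
  have h1 := sphere_int (Nat.mul_pos hr (by positivity)) hh hd
  simp only [eval_pow] at h1
  rw [h1]
  have h2 := h ι P hP.totalDegree_le
  have h3 : (Fintype.card ι : ℝ) ^ (r * 2 ^ q) ≤ sphDen (Fintype.card ι) (r * 2 ^ q) := by
    unfold sphDen
    have e : (Fintype.card ι : ℝ) ^ (r * 2 ^ q) = ∏ _j ∈ Finset.range (r * 2 ^ q), (Fintype.card ι : ℝ) := by simp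
    rw [e]
    apply Finset.prod_le_prod
    · intros; positivity
    · intro i _; have : (0:ℝ) ≤ 2 * i := by positivity
      linarith
  have hE := E_sq_nonneg P
  calc _ ≤ c * E (P * P) ^ 2 ^ q / (Fintype.card ι : ℝ) ^ (r * 2 ^ q) := by gcongr
    _ = _ := by rw [div_pow, ← pow_mul, mul_div_assoc]

end UC

namespace UC
open MvPolynomial

/-! ### Random kernel matrices: deterministic part -/

lemma spectral_exists {n : Type*} [Fintype n] [DecidableEq n] (B : Matrix n n ℝ) (hB : B.transpose = B) :
    ∃ (ev : n → ℝ) (U : Matrix n n ℝ), (∀ k i j, (B ^ k) i j = ∑ l, U i l * U j l * ev l ^ k) ∧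
      (∀ l, ∑ i, U i l * U i l = 1) := by
  have hH : B.IsHermitian := by
    unfold Matrix.IsHermitian; rw [Matrix.conjTranspose_eq_transpose_of_trivial, hB]
  refine ⟨hH.eigenvalues, (hH.eigenvectorUnitary : Matrix n n ℝ), ?_, ?_⟩
  · intro k i j
    have h := hH.spectral_theorem
    have h1 : B ^ k = (Unitary.conjStarAlgAut ℝ (Matrix n n ℝ) hH.eigenvectorUnitary)
        (Matrix.diagonal (hH.eigenvalues ^ k)) := by
      rw [← Matrix.diagonal_pow, map_pow]
      congr 1
    rw [h1, Unitary.conjStarAlgAut_apply, Matrix.mul_apply]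
    apply Finset.sum_congr rfl; intro l _
    rw [Matrix.mul_diagonal, Matrix.star_apply]
    simp only [Pi.pow_apply, star_trivial]; ring
  · intro l
    have h := Unitary.coe_star_mul_self hH.eigenvectorUnitary
    have h2 := congrFun (congrFun h l) l
    rw [Matrix.mul_apply, Matrix.one_apply_eq] at h2
    simpa [Matrix.star_apply] using h2

/-- quadratic form of powers -/
def qa {n : Type*} [Fintype n] [DecidableEq n] (B : Matrix n n ℝ) (m : n → ℝ) (k : ℕ) : ℝ := ∑ i, ∑ j, m i * m j * (B ^ k) i j

lemma qa_spec {n : Type*} [Fintype n] [DecidableEq n] (B : Matrix n n ℝ) (m : n → ℝ) (ev : n → ℝ) (U : Matrix n n ℝ)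
    (h : ∀ k i j, (B ^ k) i j = ∑ l, U i l * U j l * ev l ^ k) (k : ℕ) :
    qa B m k = ∑ l, (∑ i, U i l * m i) ^ 2 * ev l ^ k := by
  unfold qa
  simp_rw [h, Finset.mul_sum]
  have : ∀ l, (∑ i, U i l * m i) ^ 2 * ev l ^ k = ∑ i, ∑ j, m i * m j * (U i l * U j l * ev l ^ k) := by
    intro l
    rw [sq, Finset.sum_mul_sum, Finset.sum_mul]
    apply Finset.sum_congr rfl; intro i _
    rw [Finset.sum_mul]
    apply Finset.sum_congr rfl; intro j _; ring
  simp_rw [this]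
  rw [Finset.sum_comm' (t' := Finset.univ) (s' := fun _ => Finset.univ) (by simp)]
  conv_rhs => rw [Finset.sum_comm]
  rw [Finset.sum_comm]
  apply Finset.sum_congr rfl; intro i _
  rw [Finset.sum_comm]

lemma tr_spec {n : Type*} [Fintype n] [DecidableEq n] (B : Matrix n n ℝ) (ev : n → ℝ) (U : Matrix n n ℝ)
    (h : ∀ k i j, (B ^ k) i j = ∑ l, U i l * U j l * ev l ^ k) (h1 : ∀ l, ∑ i, U i l * U i l = 1) (k : ℕ) :
    (B ^ k).trace = ∑ l, ev l ^ k := by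
  unfold Matrix.trace
  simp_rw [Matrix.diag_apply, h]
  rw [Finset.sum_comm]
  apply Finset.sum_congr rfl; intro l _
  rw [← Finset.sum_mul, h1, one_mul]

lemma qa_interp {n : Type*} [Fintype n] [DecidableEq n] (B : Matrix n n ℝ) (hB : B.transpose = B) (m : n → ℝ)
    (q k : ℕ) (hk : k ≤ 2 * q) (ρ : ℝ) (hρ : 0 < ρ) (h0 : qa B m 0 ≤ ρ ^ 2) (h1 : qa B m (2 * q) ≤ ρ ^ (2 * q + 2)) :
    |qa B m k| ≤ 2 * ρ ^ (k + 2) := by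
  obtain ⟨ev, U, hs, hu⟩ := spectral_exists B hB
  rw [qa_spec B m ev U hs] at h0 h1 ⊢
  simp only [pow_zero, mul_one] at h0
  have hpt : ∀ l, ρ ^ (2 * q - k) * |ev l| ^ k ≤ ρ ^ (2 * q) + ev l ^ (2 * q) := by
    intro l
    have e : ev l ^ (2 * q) = |ev l| ^ (2 * q) := by rw [pow_mul, pow_mul, sq_abs]
    rw [e]
    have hs : 2 * q - k + k = 2 * q := by omega
    rcases le_total (|ev l|) ρ with h | h
    · calc ρ ^ (2 * q - k) * |ev l| ^ k ≤ ρ ^ (2 * q - k) * ρ ^ k := by gcongr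
        _ = ρ ^ (2 * q) := by rw [← pow_add, hs]
        _ ≤ _ := by have : 0 ≤ |ev l| ^ (2 * q) := by positivity
                    linarith
    · calc ρ ^ (2 * q - k) * |ev l| ^ k ≤ |ev l| ^ (2 * q - k) * |ev l| ^ k := by gcongr
        _ = |ev l| ^ (2 * q) := by rw [← pow_add, hs]
        _ ≤ _ := by have : 0 ≤ ρ ^ (2 * q) := by positivity
                    linarith
  have hmain : ρ ^ (2 * q - k) * |∑ l, (∑ i, U i l * m i) ^ 2 * ev l ^ k| ≤ ρ ^ (2 * q - k) * (2 * ρ ^ (k + 2)) := by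
    calc _ ≤ ρ ^ (2 * q - k) * ∑ l, (∑ i, U i l * m i) ^ 2 * |ev l| ^ k := by
          gcongr
          refine (Finset.abs_sum_le_sum_abs _ _).trans (le_of_eq ?_)
          apply Finset.sum_congr rfl; intro l _
          rw [abs_mul, abs_pow, abs_pow, sq_abs]
      _ = ∑ l, (∑ i, U i l * m i) ^ 2 * (ρ ^ (2 * q - k) * |ev l| ^ k) := by
          rw [Finset.mul_sum]; apply Finset.sum_congr rfl; intros; ring
      _ ≤ ∑ l, (∑ i, U i l * m i) ^ 2 * (ρ ^ (2 * q) + ev l ^ (2 * q)) := by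
          apply Finset.sum_le_sum; intro l _
          exact mul_le_mul_of_nonneg_left (hpt l) (sq_nonneg _)
      _ = ρ ^ (2 * q) * ∑ l, (∑ i, U i l * m i) ^ 2 + ∑ l, (∑ i, U i l * m i) ^ 2 * ev l ^ (2 * q) := by
          rw [Finset.mul_sum, ← Finset.sum_add_distrib]; apply Finset.sum_congr rfl; intros; ring
      _ ≤ ρ ^ (2 * q) * ρ ^ 2 + ρ ^ (2 * q + 2) := by gcongr
      _ = _ := by
          have : ρ ^ (2 * q - k) * (2 * ρ ^ (k + 2)) = 2 * ρ ^ (2 * q - k + (k + 2)) := by rw [pow_add]; ring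
          rw [this, show 2 * q - k + (k + 2) = 2 * q + 2 by omega, pow_add]; ring
  exact le_of_mul_le_mul_left hmain (by positivity)

lemma x_rec {p : ℕ} (M : Matrix (Fin (p + 1)) (Fin (p + 1)) ℝ) (hM : M.transpose = M) (h00 : M 0 0 = 0) (n : ℕ) :
    (M ^ (n + 2)) 0 0 = ∑ a ∈ Finset.range (n + 1), qa (M.submatrix Fin.succ Fin.succ) (fun j => M 0 j.succ) a * (M ^ (n - a)) 0 0 := by
  set B := M.submatrix Fin.succ Fin.succ with hB
  set m : Fin p → ℝ := fun j => M 0 j.succ with hm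
  have hy : ∀ n, ∀ j : Fin p, (M ^ n) j.succ 0 = ∑ a ∈ Finset.range n, (∑ i, (B ^ a) j i * m i) * (M ^ (n - 1 - a)) 0 0 := by
    intro n
    induction n with
    | zero => intro j; simp [Matrix.one_apply]
    | succ n ih =>
      intro j
      rw [pow_succ', Matrix.mul_apply, Fin.sum_univ_succ, Finset.sum_range_succ']
      simp only [ih, pow_zero]
      have e1 : M j.succ 0 = m j := by
        have := congrFun (congrFun hM j.succ) 0
        rw [Matrix.transpose_apply] at this; exact this.symm
      rw [e1, add_comm]
      congr 1
      · simp only [Finset.mul_sum]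
        rw [Finset.sum_comm]
        apply Finset.sum_congr rfl; intro a ha
        rw [Finset.sum_mul]
        simp only [pow_succ', Matrix.mul_apply, Finset.sum_mul]
        rw [Finset.sum_comm]
        apply Finset.sum_congr rfl; intro k _
        rw [show n + 1 - 1 - (a + 1) = n - 1 - a by omega]
        rw [Finset.mul_sum]
        apply Finset.sum_congr rfl; intro i _
        simp only [hB, Matrix.submatrix_apply]; ring
      · simp [Matrix.one_apply]
  rw [show n + 2 = (n + 1) + 1 by ring, pow_succ', Matrix.mul_apply, Fin.sum_univ_succ, h00, zero_mul, zero_add]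
  simp only [hy]
  simp only [Finset.mul_sum]
  rw [Finset.sum_comm]
  apply Finset.sum_congr rfl; intro a _
  unfold qa
  rw [Finset.sum_mul]
  apply Finset.sum_congr rfl; intro i _
  rw [Finset.sum_mul, Finset.sum_mul, Finset.mul_sum]
  apply Finset.sum_congr rfl; intro j _
  rw [show n + 1 - 1 - a = n - a by omega]
  simp only [hm]; ring

lemma sub_symm {p : ℕ} (M : Matrix (Fin (p + 1)) (Fin (p + 1)) ℝ) (hM : M.transpose = M) :
    (M.submatrix Fin.succ Fin.succ).transpose = M.submatrix Fin.succ Fin.succ := by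
  rw [Matrix.transpose_submatrix, hM]

lemma x_bound1 {p : ℕ} (M : Matrix (Fin (p + 1)) (Fin (p + 1)) ℝ) (hM : M.transpose = M) (h00 : M 0 0 = 0) (q : ℕ)
    (ρ : ℝ) (hρ : 0 < ρ) (h0 : qa (M.submatrix Fin.succ Fin.succ) (fun j => M 0 j.succ) 0 ≤ ρ ^ 2)
    (h1 : qa (M.submatrix Fin.succ Fin.succ) (fun j => M 0 j.succ) (2 * q) ≤ ρ ^ (2 * q + 2)) :
    ∀ b, b ≤ 2 * q + 2 → |(M ^ b) 0 0| ≤ 3 ^ b * ρ ^ b := by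
  intro b
  induction b using Nat.strong_induction_on with
  | _ b ih =>
    intro hb
    match b with
    | 0 => simp
    | 1 => simp [h00]; positivity
    | n + 2 =>
      rw [x_rec M hM h00]
      have hstep : ∀ a ∈ Finset.range (n + 1), |qa (M.submatrix Fin.succ Fin.succ) (fun j => M 0 j.succ) a * (M ^ (n - a)) 0 0| ≤
          2 * ρ ^ (n + 2) * 3 ^ (n - a) := by
        intro a ha
        have ha' : a ≤ n := by simpa [Nat.lt_succ_iff] using ha
        rw [abs_mul]
        have e1 := qa_interp _ (sub_symm M hM) (fun j => M 0 j.succ) q a (by omega) ρ hρ h0 h1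
        have e2 := ih (n - a) (by omega) (by omega)
        calc _ ≤ (2 * ρ ^ (a + 2)) * (3 ^ (n - a) * ρ ^ (n - a)) := by gcongr
          _ = 2 * ρ ^ (a + 2 + (n - a)) * 3 ^ (n - a) := by rw [pow_add]; ring
          _ = _ := by rw [show a + 2 + (n - a) = n + 2 by omega]
      calc _ ≤ ∑ a ∈ Finset.range (n + 1), 2 * ρ ^ (n + 2) * 3 ^ (n - a) :=
            (Finset.abs_sum_le_sum_abs _ _).trans (Finset.sum_le_sum hstep)
        _ = 2 * ρ ^ (n + 2) * ∑ a ∈ Finset.range (n + 1), 3 ^ a := by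
            rw [← Finset.mul_sum]; congr 1
            have := Finset.sum_range_reflect (fun a => (3:ℝ) ^ a) (n + 1)
            simpa using this
        _ ≤ _ := by
            rw [geom_sum_eq (by norm_num)]
            have : (0:ℝ) < 3 ^ n := by positivity
            have h2 : 2 * (((3:ℝ) ^ (n + 1) - 1) / (3 - 1)) ≤ 3 ^ (n + 2) := by
              rw [pow_succ, pow_add]; linarith
            calc _ = 2 * (((3:ℝ) ^ (n + 1) - 1) / (3 - 1)) * ρ ^ (n + 2) := by ring
              _ ≤ _ := by gcongr

lemma qa_nonneg {n : Type*} [Fintype n] [DecidableEq n] (B : Matrix n n ℝ) (hB : B.transpose = B) (m : n → ℝ) (q : ℕ) :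
    0 ≤ qa B m (2 * q) := by
  obtain ⟨ev, U, hs, hu⟩ := spectral_exists B hB
  rw [qa_spec B m ev U hs]
  apply Finset.sum_nonneg; intro l _
  rw [pow_mul]; positivity

lemma qa_zero {n : Type*} [Fintype n] [DecidableEq n] (B : Matrix n n ℝ) (m : n → ℝ) : qa B m 0 = ∑ i, m i ^ 2 := by
  unfold qa
  apply Finset.sum_congr rfl; intro i _
  simp [Matrix.one_apply, sq]

lemma x_bound {p : ℕ} (M : Matrix (Fin (p + 1)) (Fin (p + 1)) ℝ) (hM : M.transpose = M) (h00 : M 0 0 = 0) (q : ℕ) :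
    (M ^ (2 * q + 2)) 0 0 ≤ 3 ^ (2 * q + 2) * (qa (M.submatrix Fin.succ Fin.succ) (fun j => M 0 j.succ) (2 * q) +
      (∑ j : Fin p, M 0 j.succ ^ 2) ^ (q + 1)) := by
  set a := qa (M.submatrix Fin.succ Fin.succ) (fun j => M 0 j.succ) (2 * q) with ha
  set b := ∑ j : Fin p, M 0 j.succ ^ 2 with hb
  have ha0 : 0 ≤ a := qa_nonneg _ (sub_symm M hM) _ _
  have hb0 : 0 ≤ b := Finset.sum_nonneg (fun _ _ => sq_nonneg _)
  have key : ∀ δ : ℝ, 0 < δ → (M ^ (2 * q + 2)) 0 0 ≤ 3 ^ (2 * q + 2) * (a + b ^ (q + 1) + δ) := by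
    intro δ hδ
    set y := a + b ^ (q + 1) + δ with hy
    have hy0 : 0 < y := by positivity
    set ρ := y ^ ((1:ℝ) / (2 * q + 2 : ℕ)) with hρ
    have hρ0 : 0 < ρ := by positivity
    have hρn : ρ ^ (2 * q + 2) = y := by
      rw [hρ, ← Real.rpow_natCast, ← Real.rpow_mul hy0.le]
      rw [one_div, inv_mul_cancel₀ (by positivity), Real.rpow_one]
    have h1 : a ≤ ρ ^ (2 * q + 2) := by
      rw [hρn]; have : 0 ≤ b ^ (q + 1) := by positivity
      linarith
    have h0 : b ≤ ρ ^ 2 := by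
      have : b ^ (q + 1) ≤ (ρ ^ 2) ^ (q + 1) := by
        rw [← pow_mul, show 2 * (q + 1) = 2 * q + 2 by ring, hρn]; linarith
      exact le_of_pow_le_pow_left₀ (by omega) (by positivity) this
    have := x_bound1 M hM h00 q ρ hρ0 (by rw [qa_zero]; exact h0) h1 (2 * q + 2) le_rfl
    rw [hρn] at this
    exact (le_abs_self _).trans this
  apply le_of_forall_pos_le_add
  intro ε hε
  have := key (ε / 3 ^ (2 * q + 2)) (by positivity)
  rw [mul_add, mul_div_cancel₀ _ (by positivity)] at this
  exact this

lemma tr_interp {n : Type*} [Fintype n] [DecidableEq n] (B : Matrix n n ℝ) (hB : B.transpose = B) (q : ℕ) (t : ℝ) (ht : 0 < t) :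
    (B ^ (2 * q + 1)).trace ≤ (B ^ (2 * q + 2)).trace / (2 * t) + t / 2 * (B ^ (2 * q)).trace := by
  obtain ⟨ev, U, hs, hu⟩ := spectral_exists B hB
  simp only [tr_spec B ev U hs hu]
  rw [Finset.sum_div, Finset.mul_sum, ← Finset.sum_add_distrib]
  apply Finset.sum_le_sum; intro l _
  have h0 : 0 ≤ ev l ^ (2 * q) := by rw [pow_mul]; positivity
  have : ev l ^ (2 * q + 2) / (2 * t) + t / 2 * ev l ^ (2 * q) - ev l ^ (2 * q + 1) = ev l ^ (2 * q) * (ev l - t) ^ 2 / (2 * t) := by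
    field_simp; ring
  have h3 : 0 ≤ ev l ^ (2 * q) * (ev l - t) ^ 2 / (2 * t) := by positivity
  linarith

lemma diag_nonneg {n : Type*} [Fintype n] [DecidableEq n] (B : Matrix n n ℝ) (hB : B.transpose = B) (q : ℕ) (i : n) :
    0 ≤ (B ^ (2 * q)) i i := by
  obtain ⟨ev, U, hs, hu⟩ := spectral_exists B hB
  rw [hs]
  apply Finset.sum_nonneg; intro l _
  rw [pow_mul]; have := mul_self_nonneg (U i l); positivity

lemma quad_of_tr {n : Type*} [Fintype n] [DecidableEq n] (B : Matrix n n ℝ) (hB : B.transpose = B) (q : ℕ) (R : ℝ) (hR : 0 ≤ R)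
    (hq : 1 ≤ q) (h : (B ^ (2 * q)).trace ≤ R ^ (2 * q)) (u : n → ℝ) : |∑ i, ∑ j, u i * u j * B i j| ≤ R * ∑ i, u i ^ 2 := by
  obtain ⟨ev, U, hs, hu⟩ := spectral_exists B hB
  rw [tr_spec B ev U hs hu] at h
  have hev : ∀ l, |ev l| ≤ R := by
    intro l
    have h1 : ev l ^ (2 * q) ≤ ∑ l, ev l ^ (2 * q) := Finset.single_le_sum (f := fun l => ev l ^ (2 * q))
      (fun l _ => by show 0 ≤ ev l ^ (2 * q); rw [pow_mul]; positivity) (Finset.mem_univ l)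
    have h2 : |ev l| ^ (2 * q) ≤ R ^ (2 * q) := by
      have e : |ev l| ^ (2 * q) = ev l ^ (2 * q) := by rw [pow_mul, pow_mul, sq_abs]
      rw [e]; exact h1.trans h
    exact le_of_pow_le_pow_left₀ (by omega) hR h2
  have e1 : ∑ i, ∑ j, u i * u j * B i j = qa B u 1 := by unfold qa; simp
  rw [e1, ← qa_zero B, qa_spec B u ev U hs, qa_spec B u ev U hs, Finset.mul_sum]
  refine (Finset.abs_sum_le_sum_abs _ _).trans (Finset.sum_le_sum ?_)
  intro l _
  rw [abs_mul, abs_of_nonneg (sq_nonneg _), pow_one, pow_zero, mul_one, mul_comm]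
  exact mul_le_mul_of_nonneg_right (hev l) (sq_nonneg _)

end UC

namespace UC
open MvPolynomial

/-! ### Random kernel matrices: moments -/

section RMT
variable {Ω : Type*} [MeasurableSpace Ω]

def BM (f : Ω → ℝ) : Prop := Measurable f ∧ ∃ c, ∀ w, |f w| ≤ c

lemma BM.const (c : ℝ) : BM (fun _ : Ω => c) := ⟨measurable_const, |c|, fun _ => le_rfl⟩
lemma BM.add {f g : Ω → ℝ} (hf : BM f) (hg : BM g) : BM (fun w => f w + g w) := by
  obtain ⟨h1, c1, h2⟩ := hf; obtain ⟨h3, c2, h4⟩ := hg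
  exact ⟨h1.add h3, c1 + c2, fun w => (abs_add_le _ _).trans (add_le_add (h2 w) (h4 w))⟩
lemma BM.mul {f g : Ω → ℝ} (hf : BM f) (hg : BM g) : BM (fun w => f w * g w) := by
  obtain ⟨h1, c1, h2⟩ := hf; obtain ⟨h3, c2, h4⟩ := hg
  refine ⟨h1.mul h3, c1 * c2, fun w => ?_⟩
  rw [abs_mul]
  exact mul_le_mul (h2 w) (h4 w) (abs_nonneg _) ((abs_nonneg _).trans (h2 w))
lemma BM.pow {f : Ω → ℝ} (hf : BM f) (n : ℕ) : BM (fun w => f w ^ n) := by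
  induction n with
  | zero => simpa using BM.const 1
  | succ n ih => simpa [pow_succ] using ih.mul hf
lemma BM.sum {α : Type*} (s : Finset α) {f : α → Ω → ℝ} (h : ∀ a, BM (f a)) : BM (fun w => ∑ a ∈ s, f a w) := by
  classical
  induction s using Finset.induction_on with
  | empty => simpa using BM.const 0
  | insert a s ha ih => simp only [Finset.sum_insert ha]; exact (h a).add ih
lemma BM.comp {Ω' : Type*} [MeasurableSpace Ω'] {f : Ω → ℝ} (hf : BM f) {g : Ω' → Ω} (hg : Measurable g) : BM (fun w => f (g w)) :=
  ⟨hf.1.comp hg, hf.2.imp fun c h w => h (g w)⟩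
lemma BM.int {f : Ω → ℝ} (hf : BM f) (μ : Measure Ω) [IsFiniteMeasure μ] : Integrable f μ := by
  obtain ⟨h1, c, h2⟩ := hf
  exact Integrable.of_bound h1.aestronglyMeasurable c (Filter.Eventually.of_forall h2)

lemma BM.matpow {n : Type*} [Fintype n] [DecidableEq n] {M : Ω → Matrix n n ℝ} (h : ∀ i j, BM (fun w => M w i j)) (k : ℕ) :
    ∀ i j, BM (fun w => (M w ^ k) i j) := by
  induction k with
  | zero => intro i j; simpa using BM.const _
  | succ k ih =>
    intro i j
    simp only [pow_succ, Matrix.mul_apply]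
    exact BM.sum _ (fun l => (ih i l).mul (h l j))

def Mk (H : Ω → Ω → ℝ) {p : ℕ} (w : Fin p → Ω) : Matrix (Fin p) (Fin p) ℝ := fun i j => if i = j then 0 else H (w i) (w j)

lemma Mk_symm {H : Ω → Ω → ℝ} (hs : ∀ u v, H u v = H v u) {p : ℕ} (w : Fin p → Ω) : (Mk H w).transpose = Mk H w := by
  ext i j
  simp only [Matrix.transpose_apply, Mk, hs (w i) (w j), eq_comm]

lemma Mk_BM {H : Ω → Ω → ℝ} (hH : BM (fun z : Ω × Ω => H z.1 z.2)) {p : ℕ} (i j : Fin p) : BM (fun w : Fin p → Ω => Mk H w i j) := by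
  unfold Mk
  split_ifs
  · exact BM.const 0
  · exact hH.comp (g := fun w : Fin p → Ω => (w i, w j)) (by fun_prop)

lemma tr_BM {H : Ω → Ω → ℝ} (hH : BM (fun z : Ω × Ω => H z.1 z.2)) {p : ℕ} (n : ℕ) : BM (fun w : Fin p → Ω => (Mk H w ^ n).trace) := by
  unfold Matrix.trace
  exact BM.sum _ (fun i => BM.matpow (Mk_BM hH) n i i)

variable (μ : Measure Ω) [IsProbabilityMeasure μ]

def Tr (H : Ω → Ω → ℝ) (p n : ℕ) : ℝ := ∫ w : Fin p → Ω, (Mk H w ^ n).trace ∂(Measure.pi fun _ => μ)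

lemma fubini_cons {p : ℕ} {f : (Fin (p + 1) → Ω) → ℝ} (hf : BM f) :
    ∫ w, f w ∂(Measure.pi fun _ : Fin (p + 1) => μ) = ∫ w', ∫ w0, f (Fin.cons w0 w') ∂μ ∂(Measure.pi fun _ : Fin p => μ) := by
  have h := (measurePreserving_piFinSuccAbove (fun _ : Fin (p + 1) => μ) 0).symm
  have e : ∀ z : Ω × (Fin p → Ω), (MeasurableEquiv.piFinSuccAbove (fun _ : Fin (p + 1) => Ω) 0).symm z = Fin.cons z.1 z.2 := by
    intro z
    show Fin.insertNth (α := fun _ => Ω) 0 z.1 z.2 = _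
    rw [Fin.insertNth_zero']
  rw [← h.integral_comp' f]
  simp only [e]
  have hm : Measurable (fun z : Ω × (Fin p → Ω) => (Fin.cons z.1 z.2 : Fin (p + 1) → Ω)) := by
    have := (MeasurableEquiv.piFinSuccAbove (fun _ : Fin (p + 1) => Ω) 0).symm.measurable
    rw [show (fun z : Ω × (Fin p → Ω) => (Fin.cons z.1 z.2 : Fin (p + 1) → Ω)) = _ from (funext e).symm]
    exact this
  exact integral_prod_symm _ ((hf.comp hm).int _)

lemma exch {H : Ω → Ω → ℝ} {p : ℕ} (n : ℕ) (i : Fin (p + 1)) :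
    ∫ w, (Mk H w ^ n) i i ∂(Measure.pi fun _ : Fin (p + 1) => μ) = ∫ w, (Mk H w ^ n) 0 0 ∂(Measure.pi fun _ : Fin (p + 1) => μ) := by
  have h := measurePreserving_piCongrLeft (fun _ : Fin (p + 1) => μ) (Equiv.swap 0 i)
  rw [← h.integral_comp' (fun w => (Mk H w ^ n) i i)]
  apply integral_congr_ae
  refine Filter.Eventually.of_forall fun w => ?_
  have hw : ∀ a, (MeasurableEquiv.piCongrLeft (fun _ : Fin (p + 1) => Ω) (Equiv.swap 0 i)) w ((Equiv.swap 0 i) a) = w a := by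
    intro a
    exact Equiv.piCongrLeft_apply_apply (fun _ : Fin (p + 1) => Ω) (Equiv.swap 0 i) w a
  have e : Mk H w = (Mk H ((MeasurableEquiv.piCongrLeft (fun _ : Fin (p + 1) => Ω) (Equiv.swap 0 i)) w)).submatrix (Equiv.swap 0 i) (Equiv.swap 0 i) := by
    ext a b
    simp only [Mk, Matrix.submatrix_apply, hw, (Equiv.swap 0 i).injective.eq_iff]
  have hp : ∀ (A : Matrix (Fin (p + 1)) (Fin (p + 1)) ℝ) (k : ℕ),
      (A.submatrix (Equiv.swap 0 i) (Equiv.swap 0 i)) ^ k = (A ^ k).submatrix (Equiv.swap 0 i) (Equiv.swap 0 i) := by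
    intro A k
    induction k with
    | zero => simp
    | succ k ih => rw [pow_succ, pow_succ, ih, Matrix.submatrix_mul_equiv]
  show (Mk H _ ^ n) i i = (Mk H w ^ n) 0 0
  rw [e, hp, Matrix.submatrix_apply, Equiv.swap_apply_left]

lemma Tr_succ {H : Ω → Ω → ℝ} (hH : BM (fun z : Ω × Ω => H z.1 z.2)) (p n : ℕ) :
    Tr μ H (p + 1) n = (p + 1) * ∫ w, (Mk H w ^ n) 0 0 ∂(Measure.pi fun _ : Fin (p + 1) => μ) := by
  unfold Tr Matrix.trace
  simp only [Matrix.diag_apply]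
  rw [integral_finsetSum _ (fun i _ => (BM.matpow (Mk_BM hH) n i i).int _)]
  simp only [exch μ n]
  simp

lemma Mk_sub {H : Ω → Ω → ℝ} {p : ℕ} (w0 : Ω) (w' : Fin p → Ω) :
    (Mk H (Fin.cons w0 w' : Fin (p + 1) → Ω)).submatrix Fin.succ Fin.succ = Mk H w' := by
  ext i j; simp [Mk]
lemma Mk_row {H : Ω → Ω → ℝ} {p : ℕ} (w0 : Ω) (w' : Fin p → Ω) (j : Fin p) :
    Mk H (Fin.cons w0 w' : Fin (p + 1) → Ω) 0 j.succ = H w0 (w' j) := by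
  have : (0 : Fin (p + 1)) ≠ j.succ := (Fin.succ_ne_zero j).symm
  simp [Mk, this]

lemma int_qa {H : Ω → Ω → ℝ} (hH : BM (fun z : Ω × Ω => H z.1 z.2)) (hs : ∀ u v, H u v = H v u) (hd : ∀ u, H u u ≤ 1)
    (lam : ℝ) (hl0 : 0 ≤ lam) (hl : ∀ u v, ∫ w, H u w * H w v ∂μ = lam * H u v) {p : ℕ} (w : Fin p → Ω) (q : ℕ) (t : ℝ) (ht : 0 < t) :
    ∫ w0, qa (Mk H w) (fun j => H w0 (w j)) (2 * q) ∂μ ≤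
      lam * ((Mk H w ^ (2 * q + 2)).trace / (2 * t) + (t / 2 + 1) * (Mk H w ^ (2 * q)).trace) := by
  have hb : ∀ v, BM (fun u => H u v) := fun v => hH.comp (g := fun u => (u, v)) (by fun_prop)
  have e : ∫ w0, qa (Mk H w) (fun j => H w0 (w j)) (2 * q) ∂μ = ∑ i, ∑ j, lam * H (w i) (w j) * (Mk H w ^ (2 * q)) i j := by
    unfold qa
    rw [integral_finsetSum]
    · apply Finset.sum_congr rfl; intro i _
      rw [integral_finsetSum]
      · apply Finset.sum_congr rfl; intro j _
        rw [integral_mul_const, ← hl]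
        congr 1
        apply integral_congr_ae
        exact Filter.Eventually.of_forall fun u => by simp only [hs u (w i)]
      · intro j _; exact (((hb _).mul (hb _)).mul (BM.const _)).int _
    · intro i _; exact (BM.sum _ (fun j => ((hb _).mul (hb _)).mul (BM.const _))).int _
  rw [e]
  have e2 : ∑ i, ∑ j, lam * H (w i) (w j) * (Mk H w ^ (2 * q)) i j =
      lam * ((Mk H w ^ (2 * q + 1)).trace + ∑ i, H (w i) (w i) * (Mk H w ^ (2 * q)) i i) := by
    unfold Matrix.trace
    rw [← Finset.sum_add_distrib, Finset.mul_sum]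
    apply Finset.sum_congr rfl; intro i _
    rw [Matrix.diag_apply, pow_succ, Matrix.mul_apply]
    have : ∀ j, lam * H (w i) (w j) * (Mk H w ^ (2 * q)) i j =
        lam * ((Mk H w ^ (2 * q)) i j * Mk H w j i) + if i = j then lam * (H (w i) (w i) * (Mk H w ^ (2 * q)) i i) else 0 := by
      intro j
      by_cases hij : i = j
      · subst hij
        have e0 : Mk H w i i = 0 := if_pos rfl
        rw [e0, if_pos rfl]; ring
      · have e0 : Mk H w j i = H (w j) (w i) := if_neg (Ne.symm hij)
        rw [e0, if_neg hij, hs (w j)]; ring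
    simp_rw [this]
    rw [Finset.sum_add_distrib, Finset.sum_ite_eq, if_pos (Finset.mem_univ _), ← Finset.mul_sum, mul_add]
  rw [e2]
  apply mul_le_mul_of_nonneg_left _ hl0
  have h1 := tr_interp _ (Mk_symm hs w) q t ht
  have h2 : ∑ i, H (w i) (w i) * (Mk H w ^ (2 * q)) i i ≤ (Mk H w ^ (2 * q)).trace := by
    unfold Matrix.trace
    apply Finset.sum_le_sum; intro i _
    rw [Matrix.diag_apply]
    have := diag_nonneg _ (Mk_symm hs w) q i
    nlinarith [hd (w i)]
  linarith

lemma int_row {H : Ω → Ω → ℝ} (hH : BM (fun z : Ω × Ω => H z.1 z.2)) (q : ℕ) (c : ℝ)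
    (hmom : ∀ v, ∫ u, H u v ^ (2 * (q + 1)) ∂μ ≤ c) {p : ℕ} (w : Fin p → Ω) :
    ∫ w0, (∑ j, H w0 (w j) ^ 2) ^ (q + 1) ∂μ ≤ (p : ℝ) ^ (q + 1) * c := by
  have hb : ∀ v, BM (fun u => H u v) := fun v => hH.comp (g := fun u => (u, v)) (by fun_prop)
  rcases Nat.eq_zero_or_pos p with rfl | hp
  · simp
  have hp' : (0:ℝ) < p := by exact_mod_cast hp
  calc _ ≤ ∫ w0, (p:ℝ) ^ q * ∑ j, H w0 (w j) ^ (2 * (q + 1)) ∂μ := by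
        apply integral_mono
        · exact (BM.pow (BM.sum _ (fun j => (hb _).pow _)) _).int _
        · exact ((BM.const _).mul (BM.sum _ (fun j => (hb _).pow _))).int _
        · intro u
          have := pow_sum_div_card_le_sum_pow (s := Finset.univ) (f := fun j => H u (w j) ^ 2) (fun _ _ => sq_nonneg _) q
          rw [div_le_iff₀ (by simp; positivity)] at this
          simp only [← pow_mul, Finset.card_univ, Fintype.card_fin] at this
          show _ ≤ (p:ℝ) ^ q * ∑ j, H u (w j) ^ (2 * (q + 1))
          rw [mul_comm]; exact this
    _ = (p:ℝ) ^ q * ∑ j, ∫ w0, H w0 (w j) ^ (2 * (q + 1)) ∂μ := by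
        rw [integral_const_mul, integral_finsetSum _ (fun j _ => ((hb _).pow _).int _)]
    _ ≤ (p:ℝ) ^ q * ∑ j : Fin p, c := by gcongr; exact hmom _
    _ = _ := by simp; ring

lemma Tr_rec {H : Ω → Ω → ℝ} (hH : BM (fun z : Ω × Ω => H z.1 z.2)) (hs : ∀ u v, H u v = H v u) (hd : ∀ u, H u u ≤ 1)
    (lam : ℝ) (hl0 : 0 ≤ lam) (hl : ∀ u v, ∫ w, H u w * H w v ∂μ = lam * H u v) (q : ℕ) (c : ℝ)
    (hmom : ∀ v, ∫ u, H u v ^ (2 * (q + 1)) ∂μ ≤ c) (p : ℕ) (t : ℝ) (ht : 0 < t) :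
    Tr μ H (p + 1) (2 * q + 2) ≤ (p + 1) * (3 ^ (2 * q + 2) * (lam * (Tr μ H p (2 * q + 2) / (2 * t) + (t / 2 + 1) * Tr μ H p (2 * q)) +
      (p : ℝ) ^ (q + 1) * c)) := by
  rw [Tr_succ μ hH]
  apply mul_le_mul_of_nonneg_left _ (by positivity)
  have hb : ∀ v, BM (fun u => H u v) := fun v => hH.comp (g := fun u => (u, v)) (by fun_prop)
  have hfB := BM.matpow (Mk_BM hH (p := p + 1)) (2 * q + 2) 0 0
  have hc : ∀ w' : Fin p → Ω, Measurable (fun w0 : Ω => (Fin.cons w0 w' : Fin (p + 1) → Ω)) := by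
    intro w'
    rw [measurable_pi_iff]
    intro a
    refine Fin.cases ?_ (fun j => ?_) a
    · simp only [Fin.cons_zero]; exact measurable_id
    · simp
  have hc2 : Measurable (fun z : (Fin p → Ω) × Ω => (Fin.cons z.2 z.1 : Fin (p + 1) → Ω)) := by
    rw [measurable_pi_iff]
    intro a
    refine Fin.cases ?_ (fun j => ?_) a
    · simp only [Fin.cons_zero]; exact measurable_snd
    · simp only [Fin.cons_succ]; fun_prop
  rw [fubini_cons μ hfB]
  have hTB := tr_BM hH (p := p)
  calc _ ≤ ∫ w' : Fin p → Ω, 3 ^ (2 * q + 2) * (lam * ((Mk H w' ^ (2 * q + 2)).trace / (2 * t) + (t / 2 + 1) * (Mk H w' ^ (2 * q)).trace) +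
      (p : ℝ) ^ (q + 1) * c) ∂(Measure.pi fun _ : Fin p => μ) := by
        apply integral_mono
        · exact ((hfB.comp hc2).int ((Measure.pi fun _ : Fin p => μ).prod μ)).integral_prod_left
        · refine (BM.mul (BM.const _) (BM.add (BM.mul (BM.const _) (BM.add ?_ (BM.mul (BM.const _) (hTB _)))) (BM.const _))).int _
          simp only [div_eq_mul_inv]
          exact (hTB _).mul (BM.const _)
        · intro w'
          have h1 : ∀ w0, (Mk H (Fin.cons w0 w' : Fin (p + 1) → Ω) ^ (2 * q + 2)) 0 0 ≤
              3 ^ (2 * q + 2) * (qa (Mk H w') (fun j => H w0 (w' j)) (2 * q) + (∑ j, H w0 (w' j) ^ 2) ^ (q + 1)) := by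
            intro w0
            have := x_bound (Mk H (Fin.cons w0 w' : Fin (p + 1) → Ω)) (Mk_symm hs _) (by simp [Mk]) q
            simpa only [Mk_sub, Mk_row] using this
          have hqB : BM (fun w0 => qa (Mk H w') (fun j => H w0 (w' j)) (2 * q)) :=
            BM.sum _ (fun i => BM.sum _ (fun j => ((hb _).mul (hb _)).mul (BM.const _)))
          have hrB : BM (fun w0 => (∑ j, H w0 (w' j) ^ 2) ^ (q + 1)) := BM.pow (BM.sum _ (fun j => (hb _).pow _)) _
          calc _ ≤ ∫ w0, 3 ^ (2 * q + 2) * (qa (Mk H w') (fun j => H w0 (w' j)) (2 * q) + (∑ j, H w0 (w' j) ^ 2) ^ (q + 1)) ∂μ := by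
                apply integral_mono
                · exact (hfB.comp (hc w')).int _
                · exact ((BM.const _).mul (hqB.add hrB)).int _
                · exact h1
            _ = 3 ^ (2 * q + 2) * (∫ w0, qa (Mk H w') (fun j => H w0 (w' j)) (2 * q) ∂μ + ∫ w0, (∑ j, H w0 (w' j) ^ 2) ^ (q + 1) ∂μ) := by
                rw [integral_const_mul, integral_add (hqB.int _) (hrB.int _)]
            _ ≤ _ := by
                have h2 := int_qa μ hH hs hd lam hl0 hl w' q t ht
                have h3 := int_row μ hH q c hmom w'
                exact mul_le_mul_of_nonneg_left (add_le_add h2 h3) (by positivity)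
    _ = _ := by
        have i1 := (hTB (2 * q + 2)).int (Measure.pi fun _ : Fin p => μ)
        have i2 := (hTB (2 * q)).int (Measure.pi fun _ : Fin p => μ)
        have i3 : Integrable (fun w : Fin p → Ω => (Mk H w ^ (2 * q + 2)).trace / (2 * t) + (t / 2 + 1) * (Mk H w ^ (2 * q)).trace)
          (Measure.pi fun _ : Fin p => μ) := (i1.div_const _).add (i2.const_mul _)
        rw [integral_const_mul, integral_add (i3.const_mul _) (integrable_const _),
          integral_const_mul, integral_add (i1.div_const _) (i2.const_mul _), integral_div, integral_const_mul]
        simp [Tr]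

def Acon (τ0 : ℝ) (Cm : ℕ → ℝ) : ℕ → ℝ
  | 0 => 1
  | q + 1 => 2 * (3 ^ (2 * q + 2) * ((3 ^ (2 * q + 2) * τ0 / 2 + 1) * Acon τ0 Cm q + Cm (q + 1)))

lemma Acon_nonneg (τ0 : ℝ) (h0 : 0 ≤ τ0) (Cm : ℕ → ℝ) (hC : ∀ q, 0 ≤ Cm q) (q : ℕ) : 0 ≤ Acon τ0 Cm q := by
  induction q with
  | zero => simp [Acon]
  | succ q ih => have := hC (q + 1); simp only [Acon]; positivity

lemma Tr_bound {H : Ω → Ω → ℝ} (hH : BM (fun z : Ω × Ω => H z.1 z.2)) (hs : ∀ u v, H u v = H v u) (hd : ∀ u, H u u ≤ 1)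
    (lam : ℝ) (hl0 : 0 ≤ lam) (hl : ∀ u v, ∫ w, H u w * H w v ∂μ = lam * H u v) (h : ℝ) (hh : 0 ≤ h) (Cm : ℕ → ℝ) (hC : ∀ q, 0 ≤ Cm q)
    (hmom : ∀ q v, ∫ u, H u v ^ (2 * q) ∂μ ≤ Cm q * h ^ q) (P τ τ0 : ℝ) (hP : 0 ≤ P) (hτ : 0 < τ) (hτ0 : τ ≤ τ0) (h1 : P * lam ≤ τ) (h2 : P * h ≤ τ)
    (q : ℕ) : ∀ p : ℕ, (p : ℝ) ≤ P → Tr μ H p (2 * q) ≤ Acon τ0 Cm q * (P * τ ^ q) := by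
  induction q with
  | zero => intro p hp; simp [Tr, Acon]; exact hp
  | succ q ihq =>
    intro p
    induction p with
    | zero =>
      intro _
      have := Acon_nonneg τ0 (hτ.le.trans hτ0) Cm hC (q + 1)
      simp [Tr, Matrix.trace]; positivity
    | succ p ihp =>
      intro hp
      push_cast at hp
      have hp' : (p:ℝ) ≤ P := by linarith
      have i1 := ihp hp'
      have i2 := ihq p hp'
      have hA := Acon_nonneg τ0 (hτ.le.trans hτ0) Cm hC q
      have hCq := hC (q + 1)
      have hr := Tr_rec μ hH hs hd lam hl0 hl q _ (hmom (q + 1)) p (3 ^ (2 * q + 2) * τ) (by positivity)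
      rw [show 2 * (q + 1) = 2 * q + 2 by ring] at i1 ⊢
      set N : ℝ := 3 ^ (2 * q + 2) with hN
      have hN0 : 0 < N := by positivity
      set A' := Acon τ0 Cm (q + 1) with hA'
      have eA : A' = 2 * (N * ((N * τ0 / 2 + 1) * Acon τ0 Cm q + Cm (q + 1))) := rfl
      have hA'0 : 0 ≤ A' := Acon_nonneg τ0 (hτ.le.trans hτ0) Cm hC (q + 1)
      have j1 : (p + 1 : ℝ) * lam ≤ τ := (mul_le_mul_of_nonneg_right hp hl0).trans h1
      have j2 : (p:ℝ) * h ≤ τ := (mul_le_mul_of_nonneg_right hp' hh).trans h2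
      have j3 : (p:ℝ) ^ (q + 1) * h ^ (q + 1) ≤ τ ^ (q + 1) := by rw [← mul_pow]; gcongr
      refine hr.trans ?_
      have k1 : (p + 1 : ℝ) * (N * (lam * (Tr μ H p (2 * q + 2) / (2 * (N * τ)) + (N * τ / 2 + 1) * Tr μ H p (2 * q)) + (p : ℝ) ^ (q + 1) * (Cm (q + 1) * h ^ (q + 1))))
        ≤ (p + 1 : ℝ) * (N * (lam * (A' * (P * τ ^ (q + 1)) / (2 * (N * τ)) + (N * τ0 / 2 + 1) * (Acon τ0 Cm q * (P * τ ^ q))) + Cm (q + 1) * τ ^ (q + 1))) := by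
        have k0 : (p : ℝ) ^ (q + 1) * (Cm (q + 1) * h ^ (q + 1)) ≤ Cm (q + 1) * τ ^ (q + 1) := by
          calc _ = Cm (q + 1) * ((p : ℝ) ^ (q + 1) * h ^ (q + 1)) := by ring
            _ ≤ _ := by gcongr
        have k00 : (N * τ / 2 + 1) * Tr μ H p (2 * q) ≤ (N * τ0 / 2 + 1) * (Acon τ0 Cm q * (P * τ ^ q)) := by
          calc _ ≤ (N * τ / 2 + 1) * (Acon τ0 Cm q * (P * τ ^ q)) := by gcongr
            _ ≤ _ := by gcongr
        gcongr
      refine k1.trans ?_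
      have k2 : (p + 1 : ℝ) * (N * (lam * (A' * (P * τ ^ (q + 1)) / (2 * (N * τ)) + (N * τ0 / 2 + 1) * (Acon τ0 Cm q * (P * τ ^ q))) + Cm (q + 1) * τ ^ (q + 1)))
        = ((p + 1 : ℝ) * lam) * (N * (A' * (P * τ ^ (q + 1)) / (2 * (N * τ)) + (N * τ0 / 2 + 1) * (Acon τ0 Cm q * (P * τ ^ q)))) + (p + 1) * (N * (Cm (q + 1) * τ ^ (q + 1))) := by ring
      have hτ00 : 0 ≤ τ0 := hτ.le.trans hτ0
      rw [k2]
      calc _ ≤ τ * (N * (A' * (P * τ ^ (q + 1)) / (2 * (N * τ)) + (N * τ0 / 2 + 1) * (Acon τ0 Cm q * (P * τ ^ q)))) + P * (N * (Cm (q + 1) * τ ^ (q + 1))) := by gcongr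
        _ = A' * (P * τ ^ (q + 1)) / 2 + N * ((N * τ0 / 2 + 1) * Acon τ0 Cm q + Cm (q + 1)) * (P * τ ^ (q + 1)) := by
            field_simp; ring
        _ = _ := by rw [eA]; ring
end RMT
end UC

namespace UC
open MvPolynomial

/-! ### Good event -/

lemma pow_dom (A a b : ℝ) (h : a < b) : ∀ᶠ d : ℕ in Filter.atTop, A * (d : ℝ) ^ a ≤ (d : ℝ) ^ b := by
  have h1 : Filter.Tendsto (fun d : ℕ => (d : ℝ) ^ (b - a)) Filter.atTop Filter.atTop :=
    (tendsto_rpow_atTop (by linarith)).comp tendsto_natCast_atTop_atTop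
  filter_upwards [h1.eventually_ge_atTop A, Filter.eventually_ge_atTop 1] with d hd hd1
  have hd0 : (0:ℝ) < d := by exact_mod_cast hd1
  calc A * (d : ℝ) ^ a ≤ (d : ℝ) ^ (b - a) * (d : ℝ) ^ a := by gcongr
    _ = _ := by rw [← Real.rpow_add hd0]; congr 1; ring

lemma log_dom (K ε : ℝ) (h : 0 < ε) : ∀ᶠ d : ℕ in Filter.atTop, Real.log d ^ K ≤ (d : ℝ) ^ ε := by
  have h1 := (isLittleO_log_rpow_rpow_atTop K h).bound (c := 1) one_pos
  have h2 := tendsto_natCast_atTop_atTop (R := ℝ) |>.eventually h1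
  filter_upwards [h2, Filter.eventually_ge_atTop 1] with d hd hd1
  rw [one_mul] at hd
  refine (le_abs_self _).trans (hd.trans (le_of_eq ?_))
  rw [Real.norm_eq_abs, abs_of_nonneg]; positivity

lemma markov {Ω : Type*} [MeasurableSpace Ω] (Q : Measure Ω) [IsProbabilityMeasure Q] {f : Ω → ℝ} (hf : BM f) (h0 : ∀ w, 0 ≤ f w)
    (y R : ℝ) (hR : 0 < R) (h : ∫ w, f w ∂Q ≤ y) : Q {w | R < f w} ≤ ENNReal.ofReal (y / R) := by
  have h1 := mul_meas_ge_le_integral_of_nonneg (μ := Q) (Filter.Eventually.of_forall h0) (hf.int Q) R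
  have h2 : Q.real {w | R ≤ f w} ≤ y / R := by
    rw [le_div_iff₀ hR, mul_comm]; exact h1.trans h
  calc Q {w | R < f w} ≤ Q {w | R ≤ f w} := measure_mono (fun w (hw : R < f w) => (le_of_lt hw : R ≤ f w))
    _ = ENNReal.ofReal (Q.real {w | R ≤ f w}) := by rw [ofReal_measureReal]
    _ ≤ _ := ENNReal.ofReal_le_ofReal h2

lemma mom_interp {Ω : Type*} [MeasurableSpace Ω] (Q : Measure Ω) [IsProbabilityMeasure Q] {X : Ω → ℝ} (hX : BM X) (h c : ℝ) (hh : 0 < h)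
    (q N : ℕ) (hN : q ≤ N) (hc : ∫ w, X w ^ (2 * N) ∂Q ≤ c * h ^ N) : ∫ w, X w ^ (2 * q) ∂Q ≤ (1 + c) * h ^ q := by
  have hpt : ∀ w, X w ^ (2 * q) ≤ h ^ q + X w ^ (2 * N) * (h ^ q / h ^ N) := by
    intro w
    rw [pow_mul, pow_mul]
    set s := X w ^ 2
    have hs : 0 ≤ s := sq_nonneg _
    rcases le_total s h with h1 | h1
    · have : s ^ q ≤ h ^ q := by gcongr
      have h2 : 0 ≤ s ^ N * (h ^ q / h ^ N) := by positivity
      linarith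
    · have : s ^ q ≤ s ^ N * (h ^ q / h ^ N) := by
        rw [← mul_div_assoc, le_div_iff₀ (by positivity)]
        obtain ⟨r, rfl⟩ := Nat.exists_eq_add_of_le hN
        rw [pow_add, pow_add]
        calc s ^ q * (h ^ q * h ^ r) ≤ s ^ q * (h ^ q * s ^ r) := by gcongr
          _ = _ := by ring
      have h2 : 0 ≤ h ^ q := by positivity
      linarith
  have i1 := (hX.pow (2 * N)).int Q
  calc _ ≤ ∫ w, h ^ q + X w ^ (2 * N) * (h ^ q / h ^ N) ∂Q :=
        integral_mono ((hX.pow _).int Q) ((integrable_const _).add (i1.mul_const _)) hpt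
    _ = h ^ q + (∫ w, X w ^ (2 * N) ∂Q) * (h ^ q / h ^ N) := by
        rw [integral_add (integrable_const _) (i1.mul_const _), integral_mul_const]; simp
    _ ≤ h ^ q + (c * h ^ N) * (h ^ q / h ^ N) := by gcongr
    _ = _ := by field_simp

lemma ae_unit (d p : ℕ) (hd : 1 ≤ d) : ∀ᵐ w ∂(Measure.pi fun _ : Fin p => unifSphere (Fin d)), ∀ a, N2 (w a) = 1 := by
  have : Nonempty (Fin d) := ⟨⟨0, hd⟩⟩
  rw [ae_all_iff]
  intro a
  exact (Measure.quasiMeasurePreserving_eval (fun _ : Fin p => unifSphere (Fin d)) a).ae (sph_unit (ι := Fin d))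

def trunc {d : ℕ} (H : (Fin d → ℝ) → (Fin d → ℝ) → ℝ) (u v : Fin d → ℝ) : ℝ := if N2 u = 1 ∧ N2 v = 1 then H u v else 0

lemma rmt_event (r : ℕ) (hr : 2 ≤ r) (H : ∀ d, (Fin d → ℝ) → (Fin d → ℝ) → ℝ) (lam : ℕ → ℝ)
    (HPol : ∀ d, (Fin d → ℝ) → MvPolynomial (Fin d) ℝ)
    (hhom : ∀ d u, (HPol d u).IsHomogeneous r) (hev : ∀ d u v, eval v (HPol d u) = H d u v)
    (hE : ∀ d u, 1 ≤ d → N2 u = 1 → E (HPol d u * HPol d u) ≤ 6)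
    (hmeas : ∀ d, Measurable (fun z : (Fin d → ℝ) × (Fin d → ℝ) => H d z.1 z.2))
    (hb : ∀ d u v, 1 ≤ d → N2 u = 1 → N2 v = 1 → |H d u v| ≤ 4)
    (hs : ∀ d u v, H d u v = H d v u) (hdg : ∀ d u, 1 ≤ d → N2 u = 1 → H d u u ≤ 1)
    (hl : ∀ d u v, 1 ≤ d → ∫ w, H d u w * H d w v ∂(unifSphere (Fin d)) = lam d * H d u v)
    (hl0 : ∀ d, 0 ≤ lam d) (hl1 : ∀ d : ℕ, 1 ≤ d → lam d ≤ 6 / (d : ℝ) ^ r) (C0 ε C : ℝ) (hC0 : 0 < C0) (hε : 0 < ε) :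
    ∀ᶠ d : ℕ in Filter.atTop, ∀ p : ℕ, (p : ℝ) ≤ C0 * (d : ℝ) ^ 2 →
      (Measure.pi fun _ : Fin p => unifSphere (Fin d)) {w | ¬ ∀ v : Fin p → ℝ,
        |∑ a, ∑ b, v a * v b * (if a = b then 0 else H d (w a) (w b))| ≤ (d : ℝ) ^ (1 - (r : ℝ) / 2 + ε) * ∑ a, v a ^ 2}
        ≤ ENNReal.ofReal ((d : ℝ) ^ (-C)) := by
  choose c hc hcm using fun q => sph_moment r (by omega) q
  set Cm : ℕ → ℝ := fun q => 1 + c q with hCm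
  obtain ⟨q, hq⟩ := exists_nat_gt ((|C| + 3) / (2 * ε))
  have hq1 : 1 ≤ q := by
    rcases Nat.eq_zero_or_pos q with rfl | h
    · have : 0 ≤ (|C| + 3) / (2 * ε) := by positivity
      simp at hq; linarith
    · exact h
  have hq2 : |C| + 3 < 2 * ε * q := by
    rw [div_lt_iff₀ (by positivity)] at hq; linarith
  set Aq := Acon (6 * C0) Cm q with hAq
  filter_upwards [pow_dom (Aq * (C0 * (6 * C0) ^ q)) (2 - 2 * ε * q) (-C) (by linarith [le_abs_self C]), Filter.eventually_ge_atTop 1] with d hdom hd p hp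
  have hd0 : (0:ℝ) < d := by exact_mod_cast hd
  have hd1 : (1:ℝ) ≤ d := by exact_mod_cast hd
  have : Nonempty (Fin d) := ⟨⟨0, hd⟩⟩
  set T := trunc (H d) with hT
  have hTm : BM (fun z : (Fin d → ℝ) × (Fin d → ℝ) => T z.1 z.2) := by
    refine ⟨?_, 4, ?_⟩
    · apply Measurable.ite _ (hmeas d) measurable_const
      exact (measurableSet_eq_fun (N2_cont.measurable.comp measurable_fst) measurable_const).inter
        (measurableSet_eq_fun (N2_cont.measurable.comp measurable_snd) measurable_const)
    · intro z
      show |if _ then _ else _| ≤ _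
      split_ifs with h
      · exact hb d _ _ hd h.1 h.2
      · simp
  have hTs : ∀ u v, T u v = T v u := by
    intro u v; simp only [hT, trunc, hs d u v, and_comm]
  have hTd : ∀ u, T u u ≤ 1 := by
    intro u; simp only [hT, trunc]
    split_ifs with h
    · exact hdg d u hd h.1
    · norm_num
  have hae := sph_unit (ι := Fin d)
  have hTl : ∀ u v, ∫ w, T u w * T w v ∂(unifSphere (Fin d)) = lam d * T u v := by
    intro u v
    by_cases h : N2 u = 1 ∧ N2 v = 1
    · have e1 : T u v = H d u v := if_pos h
      rw [e1, ← hl d u v hd]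
      apply integral_congr_ae
      filter_upwards [hae] with w hw
      have e2 : T u w = H d u w := if_pos ⟨h.1, hw⟩
      have e3 : T w v = H d w v := if_pos ⟨hw, h.2⟩
      simp only [e2, e3]
    · have e1 : T u v = 0 := if_neg h
      rw [e1, mul_zero]
      have : ∀ w, T u w * T w v = 0 := by
        intro w
        simp only [hT, trunc]
        by_cases h1 : N2 u = 1
        · have h2 : N2 v ≠ 1 := fun h2 => h ⟨h1, h2⟩
          simp [h2]
        · simp [h1]
      simp [this]
  set h : ℝ := 6 / (d : ℝ) ^ r with hh
  have hh0 : 0 < h := by positivity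
  have hmom : ∀ q v, ∫ u, T u v ^ (2 * q) ∂(unifSphere (Fin d)) ≤ Cm q * h ^ q := by
    intro q v
    have hBv : BM (fun u => T u v) := hTm.comp (g := fun u => (u, v)) (by fun_prop)
    apply mom_interp _ hBv h (c q) hh0 q (2 ^ q) Nat.lt_two_pow_self.le
    by_cases hv : N2 v = 1
    · have := hcm q (Fin d) (HPol d v) (hhom d v) (by simpa using hd)
      simp only [hev] at this
      calc _ = ∫ w, H d v w ^ 2 ^ (q + 1) ∂(unifSphere (Fin d)) := by
            apply integral_congr_ae
            filter_upwards [hae] with w hw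
            have e2 : T w v = H d w v := if_pos ⟨hw, hv⟩
            rw [e2, hs d w v, pow_succ 2 q, mul_comm 2]
        _ ≤ _ := this
        _ ≤ _ := by
            have := E_sq_nonneg (HPol d v)
            have := hE d v hd hv
            have := hc q
            rw [Fintype.card_fin, hh]
            gcongr
    · have e : ∀ u, T u v = 0 := fun u => if_neg (fun h => hv h.2)
      simp only [e]
      rw [zero_pow (by positivity)]; simp
      have := hc q
      positivity
  have hCm0 : ∀ q, 0 ≤ Cm q := fun q => by have := hc q; simp only [hCm]; linarith
  set τ : ℝ := 6 * C0 * (d : ℝ) ^ (2 - (r:ℝ)) with hτ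
  have hτ0 : 0 < τ := by positivity
  have hτ1 : τ ≤ 6 * C0 := by
    have : (d : ℝ) ^ (2 - (r:ℝ)) ≤ 1 := by
      apply Real.rpow_le_one_of_one_le_of_nonpos hd1
      have : (2:ℝ) ≤ r := by exact_mod_cast hr
      linarith
    rw [hτ]; nlinarith
  have hPh : C0 * (d:ℝ) ^ 2 * h = τ := by
    rw [hh, hτ, Real.rpow_sub hd0, Real.rpow_natCast]
    norm_cast
    ring
  have hTr := Tr_bound (unifSphere (Fin d)) hTm hTs hTd (lam d) (hl0 d) hTl h hh0.le Cm hCm0 hmom (C0 * (d:ℝ) ^ 2) τ (6 * C0)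
    (by positivity) hτ0 hτ1 ((mul_le_mul_of_nonneg_left (hl1 d hd) (by positivity)).trans hPh.le) hPh.le q p hp
  set R : ℝ := (d : ℝ) ^ (1 - (r : ℝ) / 2 + ε) with hR
  have hR0 : 0 < R := by positivity
  have hsub : {w : Fin p → Fin d → ℝ | ¬ ∀ v : Fin p → ℝ,
        |∑ a, ∑ b, v a * v b * (if a = b then 0 else H d (w a) (w b))| ≤ R * ∑ a, v a ^ 2}
      ≤ᵐ[Measure.pi fun _ : Fin p => unifSphere (Fin d)] {w | R ^ (2 * q) < (Mk T w ^ (2 * q)).trace} := by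
    filter_upwards [ae_unit d p hd] with w hw
    intro hbad
    by_contra hcon
    apply hbad
    intro v
    have := quad_of_tr (Mk T w) (Mk_symm hTs w) q R hR0.le hq1 (not_lt.1 hcon) v
    have e : Mk T w = fun a b => if a = b then 0 else H d (w a) (w b) := by
      ext a b
      have : T (w a) (w b) = H d (w a) (w b) := if_pos ⟨hw a, hw b⟩
      simp only [Mk, this]
    rw [e] at this
    exact this
  refine (measure_mono_ae hsub).trans ?_
  refine (markov _ (tr_BM hTm (2 * q)) ?_ _ (R ^ (2 * q)) (by positivity) hTr).trans ?_
  · intro w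
    unfold Matrix.trace
    exact Finset.sum_nonneg fun i _ => diag_nonneg _ (Mk_symm hTs w) q i
  · apply ENNReal.ofReal_le_ofReal
    refine le_trans (le_of_eq ?_) hdom
    have e1 : R ^ (2 * q) = (d:ℝ) ^ ((2 - (r:ℝ)) * q) * (d:ℝ) ^ (2 * ε * q) := by
      rw [hR, ← Real.rpow_natCast, ← Real.rpow_mul hd0.le, ← Real.rpow_add hd0]
      congr 1; push_cast; ring
    have e2 : τ ^ q = (6 * C0) ^ q * (d:ℝ) ^ ((2 - (r:ℝ)) * q) := by
      rw [hτ, mul_pow, ← Real.rpow_natCast ((d:ℝ) ^ _), ← Real.rpow_mul hd0.le]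
    have e3 : (d:ℝ) ^ (2 - 2 * ε * q) = (d:ℝ) ^ 2 / (d:ℝ) ^ (2 * ε * q) := by
      rw [Real.rpow_sub hd0]; norm_cast
    rw [e1, e2, e3]
    have p1 : (d:ℝ) ^ ((2 - (r:ℝ)) * q) ≠ 0 := by positivity
    have p2 : (d:ℝ) ^ (2 * ε * q) ≠ 0 := by positivity
    rw [← hAq]
    generalize (d:ℝ) ^ ((2 - (r:ℝ)) * q) = y1 at p1 ⊢
    generalize (d:ℝ) ^ (2 * ε * q) = y2 at p2 ⊢
    field_simp

lemma N2_dotp_le {d : ℕ} (u v : Fin d → ℝ) (hu : N2 u = 1) (hv : N2 v = 1) : |dotp u v| ≤ 1 := by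
  have h := Finset.sum_mul_sq_le_sq_mul_sq Finset.univ u v
  have e : dotp u v ^ 2 ≤ N2 u * N2 v := h
  rw [hu, hv] at e
  exact abs_le_one_iff_mul_self_le_one.2 (by nlinarith)

lemma dotp_meas (d : ℕ) : Measurable (fun z : (Fin d → ℝ) × (Fin d → ℝ) => dotp z.1 z.2) := by
  unfold dotp; fun_prop

lemma H2_event (C0 ε C : ℝ) (hC0 : 0 < C0) (hε : 0 < ε) :
    ∀ᶠ d : ℕ in Filter.atTop, ∀ p : ℕ, (p : ℝ) ≤ C0 * (d : ℝ) ^ 2 →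
      (Measure.pi fun _ : Fin p => unifSphere (Fin d)) {w | ¬ ∀ v : Fin p → ℝ,
        |∑ a, ∑ b, v a * v b * (if a = b then 0 else H2 (w a) (w b))| ≤ (d : ℝ) ^ ε * ∑ a, v a ^ 2}
        ≤ ENNReal.ofReal ((d : ℝ) ^ (-C)) := by
  have key : ∀ d (u v : Fin d → ℝ), 1 ≤ d → N2 u = 1 → N2 v = 1 → |H2 u v| ≤ 4 ∧ H2 u u ≤ 1 := by
    intro d u v hd hu hv
    have hd1 : (1:ℝ) ≤ d := by exact_mod_cast hd
    have h1 := N2_dotp_le u v hu hv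
    have h2 : dotp u v ^ 2 ≤ 1 := by rw [← sq_abs]; nlinarith [abs_nonneg (dotp u v)]
    have h3 : (1:ℝ) / d ≤ 1 := by rw [div_le_one (by linarith)]; exact hd1
    have h4 : (0:ℝ) ≤ 1 / d := by positivity
    constructor
    · simp only [H2, hu, hv, Fintype.card_fin, mul_one]
      rw [abs_le]; constructor <;> nlinarith [sq_nonneg (dotp u v)]
    · simp only [H2, dotp_self, hu, Fintype.card_fin, mul_one]; linarith
  have := rmt_event 2 le_rfl (fun d => H2) (fun d => 2 / ((d : ℝ) * (d + 2))) (fun d => HP2) (fun d u => HP2_hom u)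
    (fun d u v => eval_HP2 u v) ?_ ?_ (fun d u v hd hu hv => (key d u v hd hu hv).1) (fun d u v => H2_symm u v)
    (fun d u hd hu => (key d u u hd hu hu).2) ?_ (fun d => by positivity) ?_ C0 ε C hC0 hε
  · simpa using this
  · intro d u hd hu
    rw [E_HP2 u u (by simpa using hd)]
    have := (key d u u hd hu hu).2
    linarith
  · intro d
    simp only [H2]
    have := dotp_meas d
    have h2 := (N2_cont (ι := Fin d)).measurable
    fun_prop
  · intro d u v hd
    have := sph_H2 u v (by simpa using hd)
    simpa using this
  · intro d hd
    have hd0 : (0:ℝ) < d := by exact_mod_cast hd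
    apply div_le_div₀
    · norm_num
    · norm_num
    · positivity
    · have : (d:ℝ) ^ 2 = d * d := by ring
      rw [this]
      gcongr; linarith

lemma H3_event (C0 ε C : ℝ) (hC0 : 0 < C0) (hε : 0 < ε) :
    ∀ᶠ d : ℕ in Filter.atTop, ∀ p : ℕ, (p : ℝ) ≤ C0 * (d : ℝ) ^ 2 →
      (Measure.pi fun _ : Fin p => unifSphere (Fin d)) {w | ¬ ∀ v : Fin p → ℝ,
        |∑ a, ∑ b, v a * v b * (if a = b then 0 else H3 (w a) (w b))| ≤ (d : ℝ) ^ (-(1 / 2 : ℝ) + ε) * ∑ a, v a ^ 2}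
        ≤ ENNReal.ofReal ((d : ℝ) ^ (-C)) := by
  have key : ∀ d (u v : Fin d → ℝ), 1 ≤ d → N2 u = 1 → N2 v = 1 → |H3 u v| ≤ 4 ∧ H3 u u ≤ 1 := by
    intro d u v hd hu hv
    have hd1 : (1:ℝ) ≤ d := by exact_mod_cast hd
    have h1 := N2_dotp_le u v hu hv
    have h2 : |dotp u v ^ 3| ≤ 1 := by rw [abs_pow]; exact pow_le_one₀ (abs_nonneg _) h1
    have h3 : (3:ℝ) / (d + 2) ≤ 1 := by rw [div_le_one (by linarith)]; linarith
    have h4 : (0:ℝ) ≤ 3 / (d + 2) := by positivity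
    constructor
    · simp only [H3, hu, hv, Fintype.card_fin, mul_one, one_mul]
      have h5 : |3 / ((d:ℝ) + 2) * dotp u v| ≤ 1 := by
        rw [abs_mul, abs_of_nonneg h4]; exact mul_le_one₀ h3 (abs_nonneg _) h1
      have := abs_sub (dotp u v ^ 3) (3 / ((d:ℝ) + 2) * dotp u v)
      linarith
    · simp only [H3, dotp_self, hu, Fintype.card_fin, mul_one]; linarith
  have := rmt_event 3 (by norm_num) (fun d => H3) (fun d => 6 / ((d : ℝ) * (d + 2) * (d + 4))) (fun d => HP3) (fun d u => HP3_hom u)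
    (fun d u v => eval_HP3 u v) ?_ ?_ (fun d u v hd hu hv => (key d u v hd hu hv).1) (fun d u v => H3_symm u v)
    (fun d u hd hu => (key d u u hd hu hu).2) ?_ (fun d => by positivity) ?_ C0 ε C hC0 hε
  · have e : (1:ℝ) - ((3:ℕ):ℝ) / 2 + ε = -(1 / 2 : ℝ) + ε := by push_cast; ring
    rw [e] at this; exact this
  · intro d u hd hu
    rw [E_HP3 u u]
    have := (key d u u hd hu hu).2
    linarith
  · intro d
    simp only [H3]
    have := dotp_meas d
    have h2 := (N2_cont (ι := Fin d)).measurable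
    fun_prop
  · intro d u v hd
    have := sph_H3 u v (by simpa using hd)
    simpa using this
  · intro d hd
    have hd0 : (0:ℝ) < d := by exact_mod_cast hd
    apply div_le_div₀
    · norm_num
    · norm_num
    · positivity
    · have : (d:ℝ) ^ 3 = d * d * d := by ring
      rw [this]
      gcongr <;> linarith

lemma f_event (k : ℕ) (hk : 3 ≤ k) (C0 ε C : ℝ) (hC0 : 0 < C0) (hε : 0 < ε) :
    ∀ᶠ d : ℕ in Filter.atTop, ∀ p : ℕ, (p : ℝ) ≤ C0 * (d : ℝ) ^ 2 → ∀ ξ : MvPolynomial (Fin d) ℝ, Chaos k ξ → E (ξ * ξ) = 1 →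
      (Measure.pi fun _ : Fin p => unifSphere (Fin d)) {w | ¬ ∑ a, E (ξ * Hp k (w a)) ^ 2 ≤ (d : ℝ) ^ ε * ((d:ℝ)⁻¹ + √(Kc 2 ξ))}
        ≤ ENNReal.ofReal ((d : ℝ) ^ (-C)) := by
  obtain ⟨n, hn⟩ := exists_nat_gt ((|C| + 1) / ε)
  obtain ⟨c, hc, hcm⟩ := sph_moment k (by omega) n
  set N := 2 ^ n with hN
  have hNn : (n:ℝ) ≤ N := by rw [hN]; exact_mod_cast Nat.lt_two_pow_self.le
  have hN2 : |C| + 1 < ε * N := by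
    rw [div_lt_iff₀ hε] at hn; nlinarith
  set Kk : ℝ := (k + 1) * (k.factorial : ℝ) ^ 3 with hKk
  have hKk0 : 0 < Kk := by positivity
  filter_upwards [pow_dom (c * (C0 * Kk) ^ N) (-(ε * N)) (-C) (by linarith [le_abs_self C]), Filter.eventually_ge_atTop 1] with d hdom hd p hp ξ hξ hξ1
  have hd0 : (0:ℝ) < d := by exact_mod_cast hd
  have : Nonempty (Fin d) := ⟨⟨0, hd⟩⟩
  set η := (d:ℝ)⁻¹ + √(Kc 2 ξ) with hη
  have hη0 : 0 < η := by positivity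
  have hae := sph_unit (ι := Fin d)
  set f : (Fin d → ℝ) → ℝ := fun w => if N2 w = 1 then eval w (Phi k ξ) else 0 with hf
  have hfB : BM f := by
    refine ⟨Measurable.ite (measurableSet_eq_fun N2_cont.measurable measurable_const) (poly_cont _).measurable measurable_const, ?_⟩
    have hh : (Phi k ξ * Phi k ξ).IsHomogeneous (2 * k) := by
      rw [two_mul]; exact (Phi_hom k ξ).mul (Phi_hom k ξ)
    obtain ⟨cc, hcc, hb⟩ := hom_bound hh
    refine ⟨cc + 1, fun w => ?_⟩
    simp only [hf]
    split_ifs with hw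
    · have := hb w
      rw [hw, one_pow, mul_one, eval_mul, abs_mul] at this
      nlinarith [abs_nonneg (eval w (Phi k ξ))]
    · simp; positivity
  have hN1 : N - 1 + 1 = N := Nat.sub_add_cancel Nat.one_le_two_pow
  have hfm : ∫ w, f w ^ (2 * N) ∂(unifSphere (Fin d)) ≤ c * (Kk * η / (d:ℝ) ^ 2) ^ N := by
    have h1 := hcm (Fin d) (Phi k ξ) (Phi_hom k ξ) (by simpa using hd)
    calc _ = ∫ w, eval w (Phi k ξ) ^ 2 ^ (n + 1) ∂(unifSphere (Fin d)) := by
          apply integral_congr_ae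
          filter_upwards [hae] with w hw
          have e2 : f w = eval w (Phi k ξ) := if_pos hw
          rw [e2, pow_succ 2 n, mul_comm 2]
      _ ≤ _ := h1
      _ ≤ _ := by
          have h2 := E_sq_nonneg (Phi k ξ)
          have h3 := E_Phi_sq_le k hk ξ hξ hξ1 (by simpa using hd)
          rw [Fintype.card_fin] at h3 ⊢
          have h4 : E (Phi k ξ * Phi k ξ) / (d:ℝ) ^ k ≤ Kk * η / (d:ℝ) ^ 2 := ?_
          · gcongr
          rw [div_le_iff₀ (by positivity)]
          refine h3.trans (le_of_eq ?_)
          have e : (d:ℝ) ^ k = (d:ℝ) ^ (k - 2) * (d:ℝ) ^ 2 := by rw [← pow_add]; congr 1; omega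
          rw [e, hη, hKk]; field_simp
  set G : (Fin p → Fin d → ℝ) → ℝ := fun w => (∑ a, f (w a) ^ 2) ^ N with hG
  have hfa : ∀ a : Fin p, BM (fun w : Fin p → Fin d → ℝ => f (w a)) := fun a => hfB.comp (by fun_prop)
  have hGB : BM G := BM.pow (BM.sum _ fun a => (hfa a).pow 2) N
  have hGi : ∫ w, G w ∂(Measure.pi fun _ : Fin p => unifSphere (Fin d)) ≤ c * (C0 * Kk) ^ N * η ^ N := by
    rcases Nat.eq_zero_or_pos p with hp0 | hp0
    · subst hp0
      have : ∀ w, G w = 0 := by intro w; simp only [hG, Finset.univ_eq_empty, Finset.sum_empty]; exact zero_pow (by positivity)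
      simp only [this]; simp; positivity
    have hp' : (0:ℝ) < p := by exact_mod_cast hp0
    calc _ ≤ ∫ w : Fin p → Fin d → ℝ, (p:ℝ) ^ (N - 1) * ∑ a, f (w a) ^ (2 * N) ∂(Measure.pi fun _ : Fin p => unifSphere (Fin d)) := by
          apply integral_mono (hGB.int _) (((BM.const _).mul (BM.sum _ fun a => (hfa a).pow _)).int _)
          intro w
          have := pow_sum_div_card_le_sum_pow (s := Finset.univ) (f := fun j => f (w j) ^ 2) (fun _ _ => sq_nonneg _) (N - 1)
          rw [div_le_iff₀ (by simp; positivity), hN1] at this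
          simp only [← pow_mul, Finset.card_univ, Fintype.card_fin] at this
          show (∑ a, f (w a) ^ 2) ^ N ≤ (p:ℝ) ^ (N - 1) * ∑ a, f (w a) ^ (2 * N)
          rw [mul_comm]; exact this
      _ = (p:ℝ) ^ (N - 1) * ∑ a : Fin p, ∫ w, f w ^ (2 * N) ∂(unifSphere (Fin d)) := by
          rw [integral_const_mul, integral_finsetSum _ (fun j _ => ((hfa _).pow _).int _)]
          congr 1
          apply Finset.sum_congr rfl; intro a _
          have := (measurePreserving_eval (fun _ : Fin p => unifSphere (Fin d)) a)
          have h5 := integral_map (μ := Measure.pi fun _ : Fin p => unifSphere (Fin d)) (f := fun w => f w ^ (2 * N)) this.measurable.aemeasurable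
            (hfB.1.pow_const _).aestronglyMeasurable
          rw [this.map_eq] at h5
          exact h5.symm
      _ ≤ (p:ℝ) ^ (N - 1) * ∑ a : Fin p, c * (Kk * η / (d:ℝ) ^ 2) ^ N := by gcongr
      _ = c * (p * (Kk * η / (d:ℝ) ^ 2)) ^ N := by
          have e1 : (p:ℝ) ^ N = (p:ℝ) ^ (N - 1) * p := by rw [← pow_succ, hN1]
          rw [mul_pow, e1]; simp; ring
      _ ≤ c * ((C0 * (d:ℝ) ^ 2) * (Kk * η / (d:ℝ) ^ 2)) ^ N := by gcongr
      _ = _ := by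
          rw [show (C0 * (d:ℝ) ^ 2) * (Kk * η / (d:ℝ) ^ 2) = C0 * Kk * η by field_simp, mul_pow]; ring
  set R := (d:ℝ) ^ ε * η with hR
  have hR0 : 0 < R := by positivity
  have hsub : {w : Fin p → Fin d → ℝ | ¬ ∑ a, E (ξ * Hp k (w a)) ^ 2 ≤ R}
      ≤ᵐ[Measure.pi fun _ : Fin p => unifSphere (Fin d)] {w | R ^ N < G w} := by
    filter_upwards [ae_unit d p hd] with w hw
    intro hbad
    have hbad' : R < ∑ a, E (ξ * Hp k (w a)) ^ 2 := not_le.1 hbad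
    show R ^ N < (∑ a, f (w a) ^ 2) ^ N
    apply pow_lt_pow_left₀ _ hR0.le (by positivity)
    refine hbad'.trans_le (Finset.sum_le_sum fun a _ => ?_)
    have e2 : f (w a) = eval (w a) (Phi k ξ) := if_pos (hw a)
    rw [Phi_eval_Hp k ξ hξ, e2, mul_pow, inv_pow, Real.sq_sqrt (by positivity)]
    have : ((k.factorial : ℝ))⁻¹ ≤ 1 := inv_le_one_of_one_le₀ (by exact_mod_cast Nat.factorial_pos k)
    have := sq_nonneg (eval (w a) (Phi k ξ))
    nlinarith
  refine (measure_mono_ae hsub).trans ?_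
  refine (markov _ hGB ?_ _ (R ^ N) (by positivity) hGi).trans ?_
  · intro w; exact pow_nonneg (Finset.sum_nonneg fun _ _ => sq_nonneg _) _
  · apply ENNReal.ofReal_le_ofReal
    refine le_trans (le_of_eq ?_) hdom
    have e3 : ((d:ℝ) ^ ε) ^ N = (d:ℝ) ^ (ε * N) := by rw [← Real.rpow_natCast, ← Real.rpow_mul hd0.le]
    rw [hR, mul_pow (_ ^ ε), e3, Real.rpow_neg hd0.le]
    have : (d:ℝ) ^ (ε * N) ≠ 0 := by positivity
    field_simp

end UC

namespace UC
open MvPolynomial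

/-! ### Central limit theorem by Gaussian interpolation -/

variable {ι : Type*} [Fintype ι] [DecidableEq ι] {J : Type*} [Fintype J] [DecidableEq J]

lemma bp_int {f : (ι → ℝ) → ℝ} (hf : Measurable f) (B : ℝ) (hB : ∀ x, |f x| ≤ B) (P : MvPolynomial ι ℝ) :
    Integrable (fun x => f x * eval x P) (stdG ι) :=
  (poly_integrable P).bdd_mul hf.aestronglyMeasurable (Filter.Eventually.of_forall hB)

/-- evaluation of a vector of polynomials -/
def ev (V : J → MvPolynomial ι ℝ) (x : ι → ℝ) : J → ℝ := fun j => eval x (V j)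

lemma ev_cont (V : J → MvPolynomial ι ℝ) : Continuous (ev V) :=
  continuous_pi fun j => poly_cont _

/-- partial derivative -/
def pd (j : J) (g : (J → ℝ) → ℝ) (v : J → ℝ) : ℝ := fderiv ℝ g v (Pi.single j 1)

lemma pd_cont (j : J) {g : (J → ℝ) → ℝ} (hg : ContDiff ℝ 1 g) : Continuous (pd j g) :=
  (hg.continuous_fderiv (by norm_num)).clm_apply continuous_const

lemma fderiv_eq_sum (g : (J → ℝ) → ℝ) (v u : J → ℝ) : fderiv ℝ g v u = ∑ j, u j * pd j g v := by
  have e : u = ∑ j, u j • (Pi.single j 1 : J → ℝ) := by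
    ext k; simp [Finset.sum_apply, Pi.single_apply]
  conv_lhs => rw [e]
  simp [pd]

lemma ev_deriv (V : J → MvPolynomial ι ℝ) (a : ι) (x : ι → ℝ) :
    HasDerivAt (fun t => ev V (Function.update x a t)) (fun j => eval x (pderiv a (V j))) (x a) := by
  rw [hasDerivAt_pi]
  intro j
  have h := eval_update_deriv (V j) a x (x a)
  rw [Function.update_eq_self] at h
  exact h

lemma ibpV {g : (J → ℝ) → ℝ} (hg : ContDiff ℝ 1 g) (L B : ℝ) (hL : ∀ v, |g v| ≤ L) (hB : ∀ j v, |pd j g v| ≤ B)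
    (V : J → MvPolynomial ι ℝ) (U : MvPolynomial ι ℝ) :
    ∫ x, g (ev V x) * eval x (Lop U) ∂(stdG ι) = - ∑ j, ∫ x, pd j g (ev V x) * eval x (Gam (V j) U) ∂(stdG ι) := by
  have m0 : Measurable (fun x => g (ev V x)) := (hg.continuous.comp (ev_cont V)).measurable
  have m1 : ∀ j, Measurable (fun x => pd j g (ev V x)) := fun j => ((pd_cont j hg).comp (ev_cont V)).measurable
  have I0 : ∀ P, Integrable (fun x => g (ev V x) * eval x P) (stdG ι) := fun P => bp_int m0 L (fun x => hL _) P
  have I1 : ∀ j P, Integrable (fun x => pd j g (ev V x) * eval x P) (stdG ι) := fun j P => bp_int (m1 j) B (fun x => hB j _) P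
  have key : ∀ a, ∫ x, g (ev V x) * eval x (pderiv a (pderiv a U) - X a * pderiv a U) ∂(stdG ι)
      = - ∑ j, ∫ x, pd j g (ev V x) * eval x (pderiv a (V j) * pderiv a U) ∂(stdG ι) := by
    intro a
    have h := ibp a (fun x => g (ev V x) * eval x (pderiv a U))
      (fun x => (∑ j, pd j g (ev V x) * eval x (pderiv a (V j) * pderiv a U)) + g (ev V x) * eval x (pderiv a (pderiv a U))) ?_ (I0 _) ?_ ?_
    · rw [integral_add (integrable_finsetSum _ fun j _ => I1 j _) (I0 _), integral_finsetSum _ fun j _ => I1 j _] at h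
      have e : ∀ x, g (ev V x) * eval x (pderiv a (pderiv a U) - X a * pderiv a U) =
          g (ev V x) * eval x (pderiv a (pderiv a U)) - x a * (g (ev V x) * eval x (pderiv a U)) := by
        intro x; simp; ring
      simp_rw [e]
      rw [integral_sub (I0 _), h]
      · ring
      · have := I0 (X a * pderiv a U)
        refine this.congr (Filter.Eventually.of_forall fun x => ?_)
        simp; ring
    · intro x
      have h1 : HasFDerivAt g (fderiv ℝ g (ev V (Function.update x a (x a)))) (ev V (Function.update x a (x a))) :=
        (hg.differentiable (by norm_num) _).hasFDerivAt
      have h2 := h1.comp_hasDerivAt (x a) (ev_deriv V a x)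
      have h3 := eval_update_deriv (pderiv a U) a x (x a)
      refine (HasDerivAt.fun_mul h2 h3).congr_deriv ?_
      rw [fderiv_eq_sum, Function.update_eq_self, Finset.sum_mul]
      simp only [Function.comp, Function.update_eq_self, eval_mul]
      congr 1
      apply Finset.sum_congr rfl; intro j _; ring
    · exact (integrable_finsetSum _ fun j _ => I1 j _).add (I0 _)
    · have := I0 (X a * pderiv a U)
      refine this.congr (Filter.Eventually.of_forall fun x => ?_)
      simp; ring
  have e1 : ∀ x, g (ev V x) * eval x (Lop U) = ∑ a, g (ev V x) * eval x (pderiv a (pderiv a U) - X a * pderiv a U) := by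
    intro x; rw [Lop_def, map_sum, Finset.mul_sum]
  simp_rw [e1]
  rw [integral_finsetSum _ fun a _ => I0 _]
  simp_rw [key]
  rw [Finset.sum_neg_distrib, Finset.sum_comm]
  congr 1
  apply Finset.sum_congr rfl; intro j _
  have e2 : ∀ x, pd j g (ev V x) * eval x (Gam (V j) U) = ∑ a, pd j g (ev V x) * eval x (pderiv a (V j) * pderiv a U) := by
    intro x; rw [Gam, map_sum, Finset.mul_sum]
  simp_rw [e2]
  rw [integral_finsetSum _ fun a _ => I1 j _]

lemma clt_smooth {f : (J → ℝ) → ℝ} (hf : ContDiff ℝ 2 f) (L B : ℝ) (hL : ∀ i v, |pd i f v| ≤ L)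
    (hB : ∀ i j v, |pd j (pd i f) v| ≤ B) (hintg : ∀ V : J → MvPolynomial ι ℝ, Integrable (fun x => f (ev V x)) (stdG ι))
    (X F N U : J → MvPolynomial ι ℝ) (S : J → J → ℝ)
    (hU : ∀ i, Lop (U i) = - F i) (hN : ∀ i, Lop (N i) = - N i) (hNN : ∀ i j, Gam (N j) (N i) = C (S i j))
    (hXN : ∀ i j, Gam (X j) (N i) = 0) (hFN : ∀ i j, Gam (F j) (N i) = 0) (hNU : ∀ i j, Gam (N j) (U i) = 0) :
    |(∫ x, f (ev (fun j => X j + F j) x) ∂(stdG ι)) - ∫ x, f (ev (fun j => X j + N j) x) ∂(stdG ι)|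
      ≤ 2 * (B * ∑ i, ∑ j, ((∫ x, |eval x (Gam (X j) (U i))| ∂(stdG ι)) + ∫ x, |eval x (Gam (F j) (U i) - C (S i j))| ∂(stdG ι))) := by
  set V : ℝ → J → MvPolynomial ι ℝ := fun s j => X j + C (Real.sin s) * F j + C (Real.cos s) * N j with hV
  set W : ℝ → J → MvPolynomial ι ℝ := fun s j => C (Real.cos s) * F j - C (Real.sin s) * N j with hW
  have hp : ∀ i, ContDiff ℝ 1 (pd i f) := fun i => (hf.fderiv_right (m := 1) (by norm_num)).clm_apply contDiff_const
  have hf1 : ContDiff ℝ 1 f := hf.of_le (by norm_num)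
  set M := B * ∑ i, ∑ j, ((∫ x, |eval x (Gam (X j) (U i))| ∂(stdG ι)) + ∫ x, |eval x (Gam (F j) (U i) - C (S i j))| ∂(stdG ι)) with hM
  set h' : ℝ → (ι → ℝ) → ℝ := fun s x => ∑ i, pd i f (ev (V s) x) * eval x (W s i) with hh'
  have m1 : ∀ s i, Measurable (fun x => pd i f (ev (V s) x)) := fun s i => ((hp i).continuous.comp (ev_cont _)).measurable
  have m2 : ∀ s i j, Measurable (fun x => pd j (pd i f) (ev (V s) x)) := fun s i j => ((pd_cont j (hp i)).comp (ev_cont _)).measurable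
  have I1 : ∀ s i P, Integrable (fun x => pd i f (ev (V s) x) * eval x P) (stdG ι) := fun s i P => bp_int (m1 s i) L (fun x => hL i _) P
  have I2 : ∀ s i j P, Integrable (fun x => pd j (pd i f) (ev (V s) x) * eval x P) (stdG ι) :=
    fun s i j P => bp_int (m2 s i j) B (fun x => hB i j _) P
  have hder : ∀ s, HasDerivAt (fun s => ∫ x, f (ev (V s) x) ∂(stdG ι)) (∫ x, h' s x ∂(stdG ι)) s := by
    intro s
    refine (hasDerivAt_integral_of_dominated_loc_of_deriv_le (F := fun s x => f (ev (V s) x)) (F' := h') (s := Set.univ)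
      (bound := fun x => ∑ i, L * (|eval x (F i)| + |eval x (N i)|)) Filter.univ_mem ?_ (hintg _) ?_ ?_ ?_ ?_).2
    · exact Filter.Eventually.of_forall fun s => (hintg _).aestronglyMeasurable
    · exact (integrable_finsetSum _ fun i _ => I1 s i _).aestronglyMeasurable
    · refine Filter.Eventually.of_forall fun x s _ => ?_
      rw [Real.norm_eq_abs]
      refine (Finset.abs_sum_le_sum_abs _ _).trans (Finset.sum_le_sum fun i _ => ?_)
      rw [abs_mul]
      have h1 : |eval x (W s i)| ≤ |eval x (F i)| + |eval x (N i)| := by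
        simp only [hW, map_sub, eval_mul, eval_C]
        refine (abs_sub _ _).trans ?_
        rw [abs_mul, abs_mul]
        have := Real.abs_cos_le_one s
        have := Real.abs_sin_le_one s
        nlinarith [abs_nonneg (eval x (F i)), abs_nonneg (eval x (N i))]
      have h2 := hL i (ev (V s) x)
      exact mul_le_mul h2 h1 (abs_nonneg _) ((abs_nonneg _).trans h2)
    · exact integrable_finsetSum _ fun i _ => ((poly_integrable _).abs.add (poly_integrable _).abs).const_mul _
    · refine Filter.Eventually.of_forall fun x s _ => ?_
      have h1 : HasDerivAt (fun s => ev (V s) x) (fun i => eval x (W s i)) s := by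
        rw [hasDerivAt_pi]
        intro i
        have e1 : (fun s => ev (V s) x i) = fun s => eval x (X i) + Real.sin s * eval x (F i) + Real.cos s * eval x (N i) := by
          ext s; simp [ev, hV]
        rw [e1]
        have := ((Real.hasDerivAt_sin s).mul_const (eval x (F i))).const_add (eval x (X i)) |>.fun_add ((Real.hasDerivAt_cos s).mul_const (eval x (N i)))
        refine this.congr_deriv ?_
        simp [hW]; ring
      have h2 := (hf1.differentiable (by norm_num) (ev (V s) x)).hasFDerivAt.comp_hasDerivAt s h1
      refine h2.congr_deriv ?_
      rw [fderiv_eq_sum]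
      apply Finset.sum_congr rfl; intro i _; ring
  have hbd : ∀ s, |∫ x, h' s x ∂(stdG ι)| ≤ M := by
    intro s
    have e1 : ∫ x, h' s x ∂(stdG ι) = ∑ i, ∑ j, ∫ x, pd j (pd i f) (ev (V s) x) *
        eval x (C (Real.cos s) * Gam (X j) (U i) + C (Real.sin s * Real.cos s) * (Gam (F j) (U i) - C (S i j))) ∂(stdG ι) := by
      simp only [hh']
      rw [integral_finsetSum _ fun i _ => I1 s i _]
      apply Finset.sum_congr rfl; intro i _
      have e2 : W s i = Lop (C (Real.sin s) * N i - C (Real.cos s) * U i) := by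
        simp only [hW, ← smul_eq_C_mul, map_sub, map_smul, hU, hN]
        simp only [smul_neg]; ring
      rw [e2, ibpV (hp i) L B (hL i) (fun j v => hB i j v), ← Finset.sum_neg_distrib]
      apply Finset.sum_congr rfl; intro j _
      rw [← integral_neg]
      congr 1; ext x
      rw [← mul_neg, ← map_neg]
      congr 2
      have e3 : Gam (V s j) (C (Real.sin s) * N i - C (Real.cos s) * U i) =
          C (Real.sin s) * (Gam (X j) (N i) + C (Real.sin s) * Gam (F j) (N i) + C (Real.cos s) * Gam (N j) (N i))
          - C (Real.cos s) * (Gam (X j) (U i) + C (Real.sin s) * Gam (F j) (U i) + C (Real.cos s) * Gam (N j) (U i)) := by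
        simp only [Gam, hV, map_add, map_sub, pderiv_C_mul, Finset.mul_sum, ← Finset.sum_add_distrib, ← Finset.sum_sub_distrib]
        apply Finset.sum_congr rfl; intro a _; ring
      rw [e3, hNN, hXN, hFN, hNU, C_mul]; ring
    rw [e1, hM, Finset.mul_sum]
    refine (Finset.abs_sum_le_sum_abs _ _).trans (Finset.sum_le_sum fun i _ => ?_)
    rw [Finset.mul_sum]
    refine (Finset.abs_sum_le_sum_abs _ _).trans (Finset.sum_le_sum fun j _ => ?_)
    refine (abs_integral_le_integral_abs).trans ?_
    rw [← integral_add (poly_integrable _).abs (poly_integrable _).abs, ← integral_const_mul]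
    apply integral_mono (I2 s i j _).abs (((poly_integrable _).abs.add (poly_integrable _).abs).const_mul _)
    intro x
    show |_ * _| ≤ B * (|_| + |_|)
    have h2 := hB i j (ev (V s) x)
    rw [abs_mul]
    refine mul_le_mul h2 ?_ (abs_nonneg _) ((abs_nonneg _).trans h2)
    rw [map_add, eval_mul, eval_mul, eval_C, eval_C]
    refine (abs_add_le _ _).trans ?_
    rw [abs_mul, abs_mul, abs_mul]
    have h3 := Real.abs_cos_le_one s
    have h4 := Real.abs_sin_le_one s
    have h5 : |Real.sin s| * |Real.cos s| ≤ 1 := mul_le_one₀ h4 (abs_nonneg _) h3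
    nlinarith [abs_nonneg (eval x (Gam (X j) (U i))), abs_nonneg (eval x (Gam (F j) (U i) - C (S i j)))]
  have hmv := Convex.norm_image_sub_le_of_norm_hasDerivWithin_le (s := Set.univ) (C := M) (x := 0) (y := Real.pi / 2)
    (fun s _ => (hder s).hasDerivWithinAt) (fun s _ => hbd s) convex_univ (Set.mem_univ _) (Set.mem_univ _)
  have e0 : V 0 = fun j => X j + N j := by ext1 j; simp [hV]
  have e1 : V (Real.pi / 2) = fun j => X j + F j := by ext1 j; simp [hV]
  rw [e0, e1] at hmv
  simp only [Real.norm_eq_abs, sub_zero] at hmv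
  refine hmv.trans ?_
  rw [abs_of_pos (by positivity)]
  have hM0 : 0 ≤ M := (abs_nonneg _).trans (hbd 0)
  nlinarith [Real.pi_le_four]

end UC

namespace UC
open MvPolynomial

/-! ### Smoothing and the Lipschitz central limit theorem -/

variable {ι : Type*} [Fintype ι] [DecidableEq ι] {J : Type*} [Fintype J] [DecidableEq J]

lemma lip_cont {φ : (J → ℝ) → ℝ} {L : ℝ} (hL : 0 ≤ L) (hφ : ∀ u v, |φ u - φ v| ≤ L * ‖u - v‖) : Continuous φ := by
  have : LipschitzWith ⟨L, hL⟩ φ := LipschitzWith.of_dist_le_mul fun u v => by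
    rw [Real.dist_eq, dist_eq_norm]; exact hφ u v
  exact this.continuous

lemma conv_lip {E₁ E₂ : Type*} [NormedAddCommGroup E₁] [NormedSpace ℝ E₁] [NormedAddCommGroup E₂] [NormedSpace ℝ E₂]
    (Lm : E₁ →L[ℝ] ℝ →L[ℝ] E₂) (hLm : ∀ a c, ‖Lm a c‖ ≤ ‖a‖ * |c|) {f : (J → ℝ) → E₁} (hf : Continuous f) (hc : HasCompactSupport f)
    {φ : (J → ℝ) → ℝ} {L : ℝ} (hL : 0 ≤ L) (hφ : ∀ u v, |φ u - φ v| ≤ L * ‖u - v‖) (v v' : J → ℝ) :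
    ‖(convolution f φ Lm volume) v - (convolution f φ Lm volume) v'‖ ≤ (∫ t, ‖f t‖) * (L * ‖v - v'‖) := by
  have hφc := lip_cont hL hφ
  have hex := HasCompactSupport.convolutionExists_left (μ := volume) Lm hc hf hφc.locallyIntegrable
  have hfi : Integrable f volume := hf.integrable_of_hasCompactSupport hc
  have i1 := (hex v).integrable
  have i2 := (hex v').integrable
  unfold convolution
  rw [← integral_sub i1 i2]
  refine (norm_integral_le_integral_norm _).trans ?_
  rw [← integral_mul_const]
  apply integral_mono (i1.sub i2).norm (hfi.norm.mul_const _)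
  intro t
  show ‖Lm (f t) (φ (v - t)) - Lm (f t) (φ (v' - t))‖ ≤ ‖f t‖ * (L * ‖v - v'‖)
  rw [← map_sub]
  refine (hLm _ _).trans ?_
  have := hφ (v - t) (v' - t)
  rw [sub_sub_sub_cancel_right] at this
  gcongr

lemma smooth_exists (J : Type*) [Fintype J] [DecidableEq J] : ∃ Cρ : ℝ, 0 ≤ Cρ ∧ ∀ (φ : (J → ℝ) → ℝ) (L : ℝ), 0 ≤ L →
    (∀ u v, |φ u - φ v| ≤ L * ‖u - v‖) → ∃ g : (J → ℝ) → ℝ, ContDiff ℝ 2 g ∧ (∀ v, |g v - φ v| ≤ L) ∧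
      (∀ i v, |pd i g v| ≤ L) ∧ ∀ i j v, |pd j (pd i g) v| ≤ Cρ * L := by
  let b : ContDiffBump (0 : J → ℝ) := ⟨1 / 2, 1, by norm_num, by norm_num⟩
  set ρ := b.normed volume with hρ
  have hρc : HasCompactSupport ρ := b.hasCompactSupport_normed
  have hρs : ∀ n : ℕ∞, ContDiff ℝ n ρ := fun n => b.contDiff_normed
  have hρ1 : ContDiff ℝ 1 ρ := hρs 1
  refine ⟨∫ t, ‖fderiv ℝ ρ t‖, integral_nonneg fun _ => norm_nonneg _, fun φ L hL hφ => ?_⟩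
  have hφc := lip_cont hL hφ
  set lm := ContinuousLinearMap.lsmul ℝ ℝ (E := ℝ) with hlm
  set g := convolution ρ φ lm volume with hg
  have single_norm : ∀ i : J, ‖(Pi.single i 1 : J → ℝ)‖ ≤ 1 := by
    intro i
    rw [pi_norm_le_iff_of_nonneg zero_le_one]
    intro k
    rw [Pi.single_apply]; split_ifs <;> simp
  have lip_pd : ∀ (h : (J → ℝ) → ℝ) (M : ℝ), 0 ≤ M → (∀ u v, |h u - h v| ≤ M * ‖u - v‖) → ∀ i v, |pd i h v| ≤ M := by
    intro h M hM hh i v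
    have : LipschitzWith ⟨M, hM⟩ h := LipschitzWith.of_dist_le_mul fun u v => by
      rw [Real.dist_eq, dist_eq_norm]; exact hh u v
    have h1 := norm_fderiv_le_of_lipschitz ℝ (x₀ := v) this
    have h2 := (fderiv ℝ h v).le_opNorm (Pi.single i 1)
    refine h2.trans ?_
    have h3 := single_norm i
    have h1' : ‖fderiv ℝ h v‖ ≤ M := h1
    nlinarith [norm_nonneg (fderiv ℝ h v), norm_nonneg (Pi.single i 1 : J → ℝ)]
  have hρi : ∫ t, ‖ρ t‖ = 1 := by
    have : ∀ t, ‖ρ t‖ = ρ t := fun t => Real.norm_of_nonneg (b.nonneg_normed t)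
    simp_rw [this]
    exact b.integral_normed
  refine ⟨g, ?_, ?_, ?_, ?_⟩
  · exact HasCompactSupport.contDiff_convolution_left (n := 2) lm hρc (hρs 2) hφc.locallyIntegrable
  · intro v
    have := dist_convolution_le (μ := volume) (f := ρ) (g := φ) (x₀ := v) (R := 1) (z₀ := φ v) hL ?_ (fun t => b.nonneg_normed t) b.integral_normed
      hφc.aestronglyMeasurable ?_
    · rwa [Real.dist_eq] at this
    · rw [hρ, b.support_normed_eq]
    · intro u hu
      rw [Real.dist_eq]
      refine (hφ u v).trans ?_
      rw [Metric.mem_ball, dist_eq_norm] at hu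
      nlinarith
  · apply lip_pd g L hL
    intro u v
    have := conv_lip lm (fun a c => by simp [hlm]) hρ1.continuous hρc hL hφ u v
    rw [hρi, one_mul] at this
    exact this
  · intro i
    have hder : ∀ v, fderiv ℝ g v = convolution (fderiv ℝ ρ) φ (lm.precompL (J → ℝ)) volume v := fun v =>
      (HasCompactSupport.hasFDerivAt_convolution_left (μ := volume) lm hρc hρ1 hφc.locallyIntegrable v).fderiv
    have hCρ : 0 ≤ ∫ t, ‖fderiv ℝ ρ t‖ := integral_nonneg fun _ => norm_nonneg _
    refine lip_pd (pd i g) _ (by positivity) ?_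
    intro u v
    unfold pd
    have h0 := (fderiv ℝ g u - fderiv ℝ g v).le_opNorm (Pi.single i 1)
    refine le_trans h0 ?_
    have h1 : ‖fderiv ℝ g u - fderiv ℝ g v‖ ≤ (∫ t, ‖fderiv ℝ ρ t‖) * (L * ‖u - v‖) := by
      rw [hder, hder]
      apply conv_lip (lm.precompL (J → ℝ)) _ (hρ1.continuous_fderiv (by norm_num)) (hρc.fderiv ℝ) hL hφ u v
      intro a c
      apply ContinuousLinearMap.opNorm_le_bound _ (by positivity)
      intro x
      rw [ContinuousLinearMap.precompL_apply]
      simp only [hlm, ContinuousLinearMap.lsmul_apply, norm_smul, smul_eq_mul, norm_mul, Real.norm_eq_abs c]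
      have := a.le_opNorm x
      nlinarith [abs_nonneg c]
    have h3 := single_norm i
    nlinarith [norm_nonneg (fderiv ℝ g u - fderiv ℝ g v), norm_nonneg (Pi.single i 1 : J → ℝ)]

lemma lip_int {φ : (J → ℝ) → ℝ} {L : ℝ} (hL : 0 ≤ L) (hφ : ∀ u v, |φ u - φ v| ≤ L * ‖u - v‖) (V : J → MvPolynomial ι ℝ) :
    Integrable (fun x => φ (ev V x)) (stdG ι) := by
  have h1 : Integrable (fun x => |φ 0| + L * ∑ j, |eval x (V j)|) (stdG ι) :=
    (integrable_const _).add ((integrable_finsetSum _ fun j _ => (poly_integrable _).abs).const_mul _)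
  refine h1.mono' ((lip_cont hL hφ).comp (ev_cont V)).aestronglyMeasurable (Filter.Eventually.of_forall fun x => ?_)
  have h2 := hφ (ev V x) 0
  rw [sub_zero] at h2
  have h3 : ‖ev V x‖ ≤ ∑ j, |eval x (V j)| := by
    rw [pi_norm_le_iff_of_nonneg (Finset.sum_nonneg fun _ _ => abs_nonneg _)]
    intro j
    exact Finset.single_le_sum (f := fun j => |eval x (V j)|) (fun _ _ => abs_nonneg _) (Finset.mem_univ j)
  rw [Real.norm_eq_abs]
  have h4 := abs_sub_abs_le_abs_sub (φ (ev V x)) (φ 0)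
  nlinarith

lemma clt_lip (J : Type*) [Fintype J] [DecidableEq J] : ∃ Cρ : ℝ, 0 ≤ Cρ ∧ ∀ {ι : Type} [Fintype ι] [DecidableEq ι]
    (φ : (J → ℝ) → ℝ) (L : ℝ) (_ : 0 ≤ L) (_ : ∀ u v, |φ u - φ v| ≤ L * ‖u - v‖)
    (X F N U : J → MvPolynomial ι ℝ) (S : J → J → ℝ)
    (_ : ∀ i, Lop (U i) = - F i) (_ : ∀ i, Lop (N i) = - N i) (_ : ∀ i j, Gam (N j) (N i) = C (S i j))
    (_ : ∀ i j, Gam (X j) (N i) = 0) (_ : ∀ i j, Gam (F j) (N i) = 0) (_ : ∀ i j, Gam (N j) (U i) = 0)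
    (δ : ℝ) (_ : 0 < δ) (_ : ∑ i, ∑ j, ((∫ x, |eval x (Gam (X j) (U i))| ∂(stdG ι)) +
      ∫ x, |eval x (Gam (F j) (U i) - C (S i j))| ∂(stdG ι)) ≤ δ ^ 2),
    |(∫ x, φ (ev (fun j => X j + F j) x) ∂(stdG ι)) - ∫ x, φ (ev (fun j => X j + N j) x) ∂(stdG ι)| ≤ Cρ * L * δ := by
  obtain ⟨Cρ, hC, hsm⟩ := smooth_exists J
  refine ⟨2 + 2 * Cρ, by positivity, ?_⟩
  intro ι _ _ φ L hL hφ X F N U S hU hN hNN hXN hFN hNU δ hδ hΔ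
  obtain ⟨g, hg, hg0, hg1, hg2⟩ := hsm (fun v => δ⁻¹ * φ (δ • v)) L hL (by
    intro u v
    rw [← mul_sub, abs_mul, abs_of_pos (inv_pos.2 hδ)]
    have := hφ (δ • u) (δ • v)
    rw [← smul_sub, norm_smul, Real.norm_of_nonneg hδ.le] at this
    calc _ ≤ δ⁻¹ * (L * (δ * ‖u - v‖)) := by gcongr
      _ = _ := by field_simp)
  set f : (J → ℝ) → ℝ := fun v => δ * g (δ⁻¹ • v) with hf
  have hpd : ∀ (h : (J → ℝ) → ℝ) (a : ℝ), Differentiable ℝ h → ∀ i v, pd i (fun v => a * h (δ⁻¹ • v)) v = a * δ⁻¹ * pd i h (δ⁻¹ • v) := by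
    intro h a hh i v
    unfold pd
    have hd : DifferentiableAt ℝ (fun v => h (δ⁻¹ • v)) v := (hh _).comp v (by fun_prop)
    rw [fderiv_const_mul hd, fderiv_comp_smul]
    simp; ring
  have hgd : Differentiable ℝ g := hg.differentiable (by norm_num)
  have hgp : ∀ i, ContDiff ℝ 1 (pd i g) := fun i => (hg.fderiv_right (m := 1) (by norm_num)).clm_apply contDiff_const
  have hf1 : ∀ i, pd i f = fun v => 1 * pd i g (δ⁻¹ • v) := by
    intro i; ext v
    rw [hf, hpd g δ hgd]
    field_simp
  have hfφ : ∀ v, |f v - φ v| ≤ L * δ := by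
    intro v
    have := hg0 (δ⁻¹ • v)
    rw [smul_smul, mul_inv_cancel₀ hδ.ne', one_smul] at this
    have e : f v - φ v = δ * (g (δ⁻¹ • v) - δ⁻¹ * φ v) := by rw [hf]; field_simp
    rw [e, abs_mul, abs_of_pos hδ]
    nlinarith
  have hfc : ContDiff ℝ 2 f := contDiff_const.mul (hg.comp (contDiff_const_smul δ⁻¹))
  have hφi := fun V : J → MvPolynomial ι ℝ => lip_int hL hφ V
  have hfi : ∀ V : J → MvPolynomial ι ℝ, Integrable (fun x => f (ev V x)) (stdG ι) := by
    intro V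
    have h1 : Integrable (fun x => |φ (ev V x)| + L * δ) (stdG ι) := (hφi V).abs.add (integrable_const _)
    refine h1.mono' (hfc.continuous.comp (ev_cont V)).aestronglyMeasurable (Filter.Eventually.of_forall fun x => ?_)
    have h2 := hfφ (ev V x)
    have h3 := abs_sub_abs_le_abs_sub (f (ev V x)) (φ (ev V x))
    rw [Real.norm_eq_abs]; linarith
  have hmain := clt_smooth hfc L (Cρ * L * δ⁻¹) (fun i v => by rw [hf1]; simpa using hg1 i _) (fun i j v => by
    rw [hf1, hpd _ 1 ((hgp i).differentiable (by norm_num)), one_mul, abs_mul, abs_of_pos (inv_pos.2 hδ), mul_comm]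
    exact mul_le_mul_of_nonneg_right (hg2 i j _) (inv_pos.2 hδ).le) hfi X F N U S hU hN hNN hXN hFN hNU
  have hcmp : ∀ V : J → MvPolynomial ι ℝ, |(∫ x, φ (ev V x) ∂(stdG ι)) - ∫ x, f (ev V x) ∂(stdG ι)| ≤ L * δ := by
    intro V
    rw [← integral_sub (hφi V) (hfi V)]
    refine abs_integral_le_integral_abs.trans ?_
    calc _ ≤ ∫ x, L * δ ∂(stdG ι) := by
          apply integral_mono ((hφi V).sub (hfi V)).abs (integrable_const _)
          intro x
          show |φ (ev V x) - f (ev V x)| ≤ L * δ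
          rw [abs_sub_comm]; exact hfφ _
      _ = _ := by simp
  have c1 := hcmp (fun j => X j + F j)
  have c2 := hcmp (fun j => X j + N j)
  have c3 : 2 * (Cρ * L * δ⁻¹ * ∑ i, ∑ j, ((∫ x, |eval x (Gam (X j) (U i))| ∂(stdG ι)) +
      ∫ x, |eval x (Gam (F j) (U i) - C (S i j))| ∂(stdG ι))) ≤ 2 * (Cρ * L * δ⁻¹ * δ ^ 2) := by
    gcongr
  have c4 : 2 * (Cρ * L * δ⁻¹ * δ ^ 2) = 2 * Cρ * L * δ := by field_simp
  rw [abs_le] at *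
  constructor <;> linarith [hmain.1, hmain.2, c1.1, c1.2, c2.1, c2.2]

end UC

namespace UC
open MvPolynomial

/-! ### Chaos-level central limit theorem -/

variable {ι : Type*} [Fintype ι] [DecidableEq ι] {ι' : Type*} [Fintype ι'] [DecidableEq ι'] {J : Type*} [Fintype J] [DecidableEq J]

lemma mp_sum : MeasurePreserving (fun x : (ι ⊕ ι') → ℝ => ((fun i => x (Sum.inl i)), (fun i => x (Sum.inr i))))
    (stdG (ι ⊕ ι')) ((stdG ι).prod (stdG ι')) :=
  measurePreserving_sumPiEquivProdPi (X := fun _ : ι ⊕ ι' => ℝ) (fun _ => gaussianReal 0 1)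

lemma int_prod_sum (f : (ι → ℝ) × (ι' → ℝ) → ℝ) :
    ∫ z, f z ∂((stdG ι).prod (stdG ι')) = ∫ x, f ((fun i => x (Sum.inl i)), (fun i => x (Sum.inr i))) ∂(stdG (ι ⊕ ι')) := by
  have h : MeasurePreserving (MeasurableEquiv.sumPiEquivProdPi (fun _ : ι ⊕ ι' => ℝ)) (stdG (ι ⊕ ι')) ((stdG ι).prod (stdG ι')) := mp_sum
  exact (h.integral_comp' f).symm

lemma int_inl (f : (ι → ℝ) → ℝ) (hf : Continuous f) :
    ∫ x, f (fun i => x (Sum.inl i)) ∂(stdG (ι ⊕ ι')) = ∫ x, f x ∂(stdG ι) := by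
  have h := (measurePreserving_fst (μ := stdG ι) (ν := stdG ι')).comp (mp_sum (ι := ι) (ι' := ι'))
  rw [← h.map_eq, integral_map h.measurable.aemeasurable hf.aestronglyMeasurable]
  rfl

/-- inclusion of polynomials -/
def rn (ι' : Type*) (P : MvPolynomial ι ℝ) : MvPolynomial (ι ⊕ ι') ℝ := rename Sum.inl P

lemma eval_rn (P : MvPolynomial ι ℝ) (x : (ι ⊕ ι') → ℝ) : eval x (rn ι' P) = eval (fun i => x (Sum.inl i)) P := by
  rw [rn, eval_rename]; rfl

lemma pderiv_rn_inl (P : MvPolynomial ι ℝ) (i : ι) : pderiv (Sum.inl i) (rn ι' P) = rn ι' (pderiv i P) :=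
  pderiv_rename Sum.inl_injective i P

lemma pderiv_rn_inr (P : MvPolynomial ι ℝ) (i : ι') : pderiv (Sum.inr i) (rn ι' P) = 0 := by
  apply pderiv_eq_zero_of_notMem_vars
  intro h
  have := vars_rename Sum.inl P h
  simp at this

lemma Lop_rn (P : MvPolynomial ι ℝ) : Lop (rn ι' P) = rn ι' (Lop P) := by
  rw [Lop_def, Lop_def, Fintype.sum_sum_type]
  simp only [pderiv_rn_inl, pderiv_rn_inr, map_zero, mul_zero, sub_zero, Finset.sum_const_zero, add_zero]
  simp only [rn, map_sum, map_sub, map_mul, rename_X]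

lemma Gam_rn (P Q : MvPolynomial ι ℝ) : Gam (rn ι' P) (rn ι' Q) = rn ι' (Gam P Q) := by
  unfold Gam
  rw [Fintype.sum_sum_type]
  simp only [pderiv_rn_inl, pderiv_rn_inr, mul_zero, Finset.sum_const_zero, add_zero]
  simp only [rn, map_sum, map_mul]

/-- linear form in the second block -/
def ln (ι : Type*) [Fintype ι] (n : ι' → ℝ) : MvPolynomial (ι ⊕ ι') ℝ := lin (Sum.elim (fun _ : ι => 0) n)

lemma eval_ln (n : ι' → ℝ) (x : (ι ⊕ ι') → ℝ) : eval x (ln ι n) = dotp n (fun i => x (Sum.inr i)) := by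
  rw [ln, eval_lin]; simp [dotp, Fintype.sum_sum_type]

lemma Lop_ln (n : ι' → ℝ) : Lop (ln ι n) = - ln ι n := by
  rw [Lop_def]
  simp only [ln, pderiv_lin, pderiv_C, zero_sub, Finset.sum_neg_distrib]
  congr 1
  unfold lin
  apply Finset.sum_congr rfl; intro i _; ring

lemma Gam_ln (n m : ι' → ℝ) : Gam (ln ι n) (ln ι m) = C (dotp n m) := by
  unfold Gam
  simp only [ln, pderiv_lin, Fintype.sum_sum_type, Sum.elim_inl, Sum.elim_inr, dotp, map_sum, map_mul]
  simp

lemma Gam_rn_ln (P : MvPolynomial ι ℝ) (m : ι' → ℝ) : Gam (rn ι' P) (ln ι m) = 0 := by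
  unfold Gam
  simp only [ln, pderiv_lin, Fintype.sum_sum_type, Sum.elim_inl, Sum.elim_inr, pderiv_rn_inr]
  simp

lemma gam_dev (k l : ℕ) (P Q : MvPolynomial ι ℝ) (hP : Chaos k P) (hQ : Chaos l Q) (M : ℝ) (hM0 : 0 ≤ M)
    (hM : ∀ j, 1 ≤ j → j ≤ k → j ≤ l → ¬ (j = k ∧ j = l) → Kc j P * Kc j Q ≤ M ^ 2) :
    ∫ x, |eval x (Gam P Q - C (k * E (P * Q)))| ∂(stdG ι) ≤ √(Cvar k l * M) := by
  refine (E_abs_le _).trans (Real.sqrt_le_sqrt ?_)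
  have h1 := var_gam k l P Q hP hQ M hM0 hM
  have h2 := hP.gam Q
  refine le_trans (le_of_eq ?_) h1
  rw [← h2]
  set G := Gam P Q
  have e : (G - C (E G)) * (G - C (E G)) = G * G - C (2 * E G) * G + C (E G ^ 2) := by
    simp only [map_mul, map_pow, map_ofNat]; ring
  rw [e, map_add, map_sub, E_C_mul, E_C]; ring

lemma Gam_sum (n m : Finset ℕ) (P Q : ℕ → MvPolynomial ι ℝ) :
    Gam (∑ l ∈ n, P l) (∑ k ∈ m, Q k) = ∑ l ∈ n, ∑ k ∈ m, Gam (P l) (Q k) := by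
  unfold Gam
  simp only [map_sum, Finset.sum_mul, Finset.mul_sum]
  rw [Finset.sum_comm]
  conv_rhs => rw [Finset.sum_comm]
  apply Finset.sum_congr rfl; intro k _
  rw [Finset.sum_comm]

lemma Gam_C_mul (P Q : MvPolynomial ι ℝ) (c : ℝ) : Gam P (C c * Q) = C c * Gam P Q := by
  unfold Gam
  rw [Finset.mul_sum]
  apply Finset.sum_congr rfl; intro i _
  rw [pderiv_C_mul]; ring

/-- a constant dominating all variance constants up to degree `D` -/
def G0 (D : ℕ) : ℝ := ∑ l ∈ Finset.range (D + 3), ∑ k ∈ Finset.range (D + 3), √(Cvar l k * ((D:ℝ) + 2) ^ (D + 2))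

lemma le_G0 (D l k : ℕ) (hl : l < D + 3) (hk : k < D + 3) : √(Cvar l k * ((D:ℝ) + 2) ^ (D + 2)) ≤ G0 D := by
  refine le_trans ?_ (Finset.single_le_sum (f := fun l => ∑ k ∈ Finset.range (D + 3), √(Cvar l k * ((D:ℝ) + 2) ^ (D + 2)))
    (fun _ _ => Finset.sum_nonneg fun _ _ => Real.sqrt_nonneg _) (Finset.mem_range.2 hl))
  exact Finset.single_le_sum (f := fun k => √(Cvar l k * ((D:ℝ) + 2) ^ (D + 2))) (fun _ _ => Real.sqrt_nonneg _) (Finset.mem_range.2 hk)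

lemma G0_nonneg (D : ℕ) : 0 ≤ G0 D := Finset.sum_nonneg fun _ _ => Finset.sum_nonneg fun _ _ => Real.sqrt_nonneg _

lemma Kc_le' (D k j : ℕ) (hk : k ≤ D + 2) (hj : j ≤ k) {P : MvPolynomial ι ℝ} (h : Chaos k P) (b : ℝ) (hb : E (P * P) ≤ b) :
    Kc j P ≤ (((D:ℝ) + 2) ^ (D + 2) * b) ^ 2 := by
  refine (Kc_le h j).trans ?_
  have h0 := E_sq_nonneg P
  have h1 : (k:ℝ) ^ j ≤ ((D:ℝ) + 2) ^ (D + 2) := by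
    have hk' : (k:ℝ) ≤ (D:ℝ) + 2 := by exact_mod_cast hk
    calc (k:ℝ) ^ j ≤ ((D:ℝ) + 2) ^ j := by gcongr
      _ ≤ _ := pow_le_pow_right₀ (by linarith [(Nat.cast_nonneg D : (0:ℝ) ≤ D)]) (by omega)
  gcongr

lemma gam_dev' (D l k : ℕ) (hl : l ≤ D + 2) (hk : k ≤ D + 2) (P Q : MvPolynomial ι ℝ) (hP : Chaos l P) (hQ : Chaos k Q)
    (b κ : ℝ) (hb : 0 ≤ b) (hκ : 0 ≤ κ) (hPb : E (P * P) ≤ b) (hQb : E (Q * Q) ≤ b)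
    (h : ∀ j, 1 ≤ j → j ≤ l → j ≤ k → ¬ (j = l ∧ j = k) → Kc j P ≤ κ ∨ Kc j Q ≤ κ) :
    ∫ x, |eval x (Gam P Q - C (l * E (P * Q)))| ∂(stdG ι) ≤ G0 D * √(b * √κ) := by
  set T := ((D:ℝ) + 2) ^ (D + 2) with hT
  refine (gam_dev l k P Q hP hQ (T * (b * √κ)) (by positivity) ?_).trans ?_
  · intro j h1 h2 h3 h4
    have kP := Kc_le' D l j hl h2 hP b hPb
    have kQ := Kc_le' D k j hk h3 hQ b hQb
    have nP := Kc_nonneg j P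
    have nQ := Kc_nonneg j Q
    have e : (T * (b * √κ)) ^ 2 = (T * b) ^ 2 * κ := by
      rw [show (T * (b * √κ)) ^ 2 = (T * b) ^ 2 * (√κ) ^ 2 by ring, Real.sq_sqrt hκ]
    rw [e]
    rcases h j h1 h2 h3 h4 with h5 | h5
    · rw [mul_comm]; exact mul_le_mul kQ h5 nP (by positivity)
    · exact mul_le_mul kP h5 nQ (by positivity)
  · rw [← mul_assoc, Real.sqrt_mul (mul_nonneg (Cvar_nonneg _ _) (by positivity))]
    exact mul_le_mul_of_nonneg_right (le_G0 D l k (by omega) (by omega)) (Real.sqrt_nonneg _)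

lemma abs_sum_int {κ : Type*} (s : Finset κ) (P : κ → MvPolynomial ι ℝ) (b : κ → ℝ)
    (h : ∀ k ∈ s, ∫ x, |eval x (P k)| ∂(stdG ι) ≤ b k) : ∫ x, |eval x (∑ k ∈ s, P k)| ∂(stdG ι) ≤ ∑ k ∈ s, b k := by
  calc _ ≤ ∫ x, ∑ k ∈ s, |eval x (P k)| ∂(stdG ι) := by
        apply integral_mono (poly_integrable _).abs (integrable_finsetSum _ fun k _ => (poly_integrable _).abs)
        intro x
        show |eval x (∑ k ∈ s, P k)| ≤ _
        rw [map_sum]; exact Finset.abs_sum_le_sum_abs _ _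
    _ = ∑ k ∈ s, ∫ x, |eval x (P k)| ∂(stdG ι) := integral_finsetSum _ fun k _ => (poly_integrable _).abs
    _ ≤ _ := Finset.sum_le_sum h

lemma abs_C_mul_int (c : ℝ) (hc : |c| ≤ 1) (P : MvPolynomial ι ℝ) (b : ℝ) (h : ∫ x, |eval x P| ∂(stdG ι) ≤ b) :
    ∫ x, |eval x (C c * P)| ∂(stdG ι) ≤ b := by
  simp only [eval_mul, eval_C, abs_mul]
  rw [integral_const_mul]
  have : 0 ≤ ∫ x, |eval x P| ∂(stdG ι) := integral_nonneg fun _ => abs_nonneg _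
  nlinarith

lemma clt_chaos (J : Type*) [Fintype J] [DecidableEq J] (D : ℕ) : ∃ Cc : ℝ, 0 ≤ Cc ∧
    ∀ {ι ι' : Type} [Fintype ι] [DecidableEq ι] [Fintype ι'] [DecidableEq ι']
    (φ : (J → ℝ) → ℝ) (L : ℝ) (_ : 0 ≤ L) (_ : ∀ u v, |φ u - φ v| ≤ L * ‖u - v‖)
    (Xc Fc : J → ℕ → MvPolynomial ι ℝ) (n : J → ι' → ℝ) (b κ κ' : ℝ) (_ : 0 ≤ b) (_ : 0 ≤ κ)
    (_ : ∀ (j : J) (l : ℕ), l < 3 → Chaos l (Xc j l) ∧ E (Xc j l * Xc j l) ≤ b)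
    (_ : ∀ (j : J) (k : ℕ), 3 ≤ k → k ≤ D → Chaos k (Fc j k) ∧ E (Fc j k * Fc j k) ≤ b ∧ ∀ i, 1 ≤ i → i < k → Kc i (Fc j k) ≤ κ)
    (_ : ∀ i j, |(∑ k ∈ Finset.Icc 3 D, E (Fc j k * Fc i k)) - dotp (n j) (n i)| ≤ κ')
    (δ : ℝ) (_ : 0 < δ) (_ : √(b * √κ) + κ' ≤ δ ^ 2),
    |(∫ x, φ (fun j => eval x (∑ l ∈ Finset.range 3, Xc j l) + eval x (∑ k ∈ Finset.Icc 3 D, Fc j k)) ∂(stdG ι)) -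
      ∫ z, φ (fun j => eval z.1 (∑ l ∈ Finset.range 3, Xc j l) + dotp (n j) z.2) ∂((stdG ι).prod (stdG ι'))| ≤ Cc * L * δ := by
  obtain ⟨Cρ, hC, hclt⟩ := clt_lip J
  set A1 : ℝ := (Fintype.card J : ℝ) * ((Fintype.card J : ℝ) * ((3 + D) * (D * G0 D) + 1)) + 1 with hA1
  have hG := G0_nonneg D
  have hA0 : 0 < A1 := by positivity
  refine ⟨Cρ * √A1, by positivity, ?_⟩
  intro ι ι' _ _ _ _ φ L hL hφ Xc Fc n b κ κ' hb hκ hX hF hS δ hδ hδ2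
  set Xp : J → MvPolynomial ι ℝ := fun j => ∑ l ∈ Finset.range 3, Xc j l with hXp
  set Fp : J → MvPolynomial ι ℝ := fun j => ∑ k ∈ Finset.Icc 3 D, Fc j k with hFp
  set Up : J → MvPolynomial ι ℝ := fun j => ∑ k ∈ Finset.Icc 3 D, C ((k:ℝ)⁻¹) * Fc j k with hUp
  have hLU : ∀ i, Lop (Up i) = - Fp i := by
    intro i
    simp only [hUp, hFp, map_sum, ← Finset.sum_neg_distrib]
    apply Finset.sum_congr rfl; intro k hk
    rw [Finset.mem_Icc] at hk
    have h1 : Lop (Fc i k) = -((k:ℝ) • Fc i k) := (hF i k hk.1 hk.2).1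
    have hk0 : (k:ℝ) ≠ 0 := by have := hk.1; positivity
    rw [← smul_eq_C_mul, map_smul, h1, smul_neg, smul_smul, inv_mul_cancel₀ hk0, one_smul]
  have hκ'0 : ∀ _ : J, 0 ≤ κ' := fun j => (abs_nonneg _).trans (hS j j)
  set r := √(b * √κ) with hr
  have hr0 : 0 ≤ r := Real.sqrt_nonneg _
  have inv1 : ∀ k ∈ Finset.Icc 3 D, |((k:ℝ))⁻¹| ≤ 1 := by
    intro k hk
    rw [Finset.mem_Icc] at hk
    have : (1:ℝ) ≤ k := by exact_mod_cast (by omega : 1 ≤ k)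
    rw [abs_of_nonneg (by positivity)]; exact inv_le_one_of_one_le₀ this
  have cardI : ((Finset.Icc 3 D).card : ℝ) ≤ D := by
    rw [Nat.card_Icc]; exact_mod_cast (by omega : D + 1 - 3 ≤ D)
  have b1 : ∀ i j, ∫ x, |eval x (Gam (Xp j) (Up i))| ∂(stdG ι) ≤ 3 * (D * G0 D) * r := by
    intro i j
    rw [hXp, hUp, Gam_sum]
    refine (abs_sum_int _ _ (fun _ => D * G0 D * r) fun l hl => ?_).trans (by simp; linarith)
    refine (abs_sum_int _ _ (fun _ => G0 D * r) fun k hk => ?_).trans ?_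
    · rw [Gam_C_mul]
      apply abs_C_mul_int _ (inv1 k hk)
      rw [Finset.mem_Icc] at hk
      rw [Finset.mem_range] at hl
      obtain ⟨x1, x2⟩ := hX j l hl
      obtain ⟨f1, f2, f3⟩ := hF i k hk.1 hk.2
      have h1 := gam_dev' D l k (by omega) (by omega) (Xc j l) (Fc i k) x1 f1 b κ hb hκ x2 f2
        (fun q q1 q2 q3 q4 => Or.inr (f3 q q1 (by omega)))
      have h2 : E (Xc j l * Fc i k) = 0 := x1.orth f1 (by exact_mod_cast (by omega : l ≠ k))
      rw [h2, mul_zero, C_0, sub_zero] at h1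
      exact h1
    · rw [Finset.sum_const, nsmul_eq_mul, mul_assoc]
      exact mul_le_mul_of_nonneg_right cardI (by positivity)
  have b2 : ∀ i j, ∫ x, |eval x (Gam (Fp j) (Up i) - C (dotp (n j) (n i)))| ∂(stdG ι) ≤ D * (D * G0 D) * r + κ' := by
    intro i j
    have e : Gam (Fp j) (Up i) - C (dotp (n j) (n i)) =
        (∑ l ∈ Finset.Icc 3 D, ∑ k ∈ Finset.Icc 3 D, C ((k:ℝ)⁻¹) * (Gam (Fc j l) (Fc i k) - C (l * E (Fc j l * Fc i k)))) +
        C ((∑ k ∈ Finset.Icc 3 D, E (Fc j k * Fc i k)) - dotp (n j) (n i)) := by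
      have e1 : ∑ l ∈ Finset.Icc 3 D, ∑ k ∈ Finset.Icc 3 D, (k:ℝ)⁻¹ * (l * E (Fc j l * Fc i k)) = ∑ k ∈ Finset.Icc 3 D, E (Fc j k * Fc i k) := by
        apply Finset.sum_congr rfl; intro l hl
        rw [Finset.sum_eq_single l]
        · rw [Finset.mem_Icc] at hl
          have hk0 : (l:ℝ) ≠ 0 := by have := hl.1; positivity
          field_simp
        · intro k hk hkl
          rw [Finset.mem_Icc] at hk hl
          rw [(hF j l hl.1 hl.2).1.orth (hF i k hk.1 hk.2).1 (by exact_mod_cast hkl.symm)]; simp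
        · intro h; exact absurd hl h
      rw [← e1, hFp, hUp, Gam_sum]
      simp only [Gam_C_mul, mul_sub, Finset.sum_sub_distrib, map_sub, map_sum, map_mul]
      ring
    rw [e]
    have hi1 := poly_integrable (∑ l ∈ Finset.Icc 3 D, ∑ k ∈ Finset.Icc 3 D, C ((k:ℝ)⁻¹) * (Gam (Fc j l) (Fc i k) - C (l * E (Fc j l * Fc i k))))
    have h0 : ∫ x, |eval x (∑ l ∈ Finset.Icc 3 D, ∑ k ∈ Finset.Icc 3 D, C ((k:ℝ)⁻¹) * (Gam (Fc j l) (Fc i k) - C (l * E (Fc j l * Fc i k))))| ∂(stdG ι)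
        ≤ D * (D * G0 D) * r := by
      refine (abs_sum_int _ _ (fun _ => D * G0 D * r) fun l hl => ?_).trans ?_
      · refine (abs_sum_int _ _ (fun _ => G0 D * r) fun k hk => ?_).trans ?_
        · apply abs_C_mul_int _ (inv1 k hk)
          rw [Finset.mem_Icc] at hk hl
          obtain ⟨f1, f2, f3⟩ := hF i k hk.1 hk.2
          obtain ⟨f1', f2', f3'⟩ := hF j l hl.1 hl.2
          apply gam_dev' D l k (by omega) (by omega) (Fc j l) (Fc i k) f1' f1 b κ hb hκ f2' f2
          intro q q1 q2 q3 q4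
          rcases Nat.lt_or_ge q l with h | h
          · exact Or.inl (f3' q q1 h)
          · exact Or.inr (f3 q q1 (by omega))
        · rw [Finset.sum_const, nsmul_eq_mul, mul_assoc]
          exact mul_le_mul_of_nonneg_right cardI (by positivity)
      · rw [Finset.sum_const, nsmul_eq_mul]
        have := mul_le_mul_of_nonneg_right cardI (by positivity : 0 ≤ D * G0 D * r)
        linarith
    calc _ ≤ ∫ x, (|eval x (∑ l ∈ Finset.Icc 3 D, ∑ k ∈ Finset.Icc 3 D, C ((k:ℝ)⁻¹) * (Gam (Fc j l) (Fc i k) - C (l * E (Fc j l * Fc i k))))| + κ') ∂(stdG ι) := by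
          apply integral_mono (poly_integrable _).abs (hi1.abs.add (integrable_const _))
          intro x
          show |eval x (_ + C _)| ≤ |_| + κ'
          rw [map_add, eval_C]
          exact (abs_add_le _ _).trans (by linarith [hS i j])
      _ = _ := integral_add hi1.abs (integrable_const _)
      _ ≤ _ := by
          simp only [integral_const, probReal_univ, one_smul]
          linarith
  have hΔ : ∑ i, ∑ j, ((∫ x, |eval x (Gam (rn ι' (Xp j)) (rn ι' (Up i)))| ∂(stdG (ι ⊕ ι'))) +
      ∫ x, |eval x (Gam (rn ι' (Fp j)) (rn ι' (Up i)) - C (dotp (n j) (n i)))| ∂(stdG (ι ⊕ ι'))) ≤ (√A1 * δ) ^ 2 := by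
    rw [mul_pow, Real.sq_sqrt hA0.le]
    have h1 : ∀ i j, ((∫ x, |eval x (Gam (rn ι' (Xp j)) (rn ι' (Up i)))| ∂(stdG (ι ⊕ ι'))) +
        ∫ x, |eval x (Gam (rn ι' (Fp j)) (rn ι' (Up i)) - C (dotp (n j) (n i)))| ∂(stdG (ι ⊕ ι'))) ≤ ((3 + D) * (D * G0 D) + 1) * δ ^ 2 := by
      intro i j
      have e1 : ∫ x, |eval x (Gam (rn ι' (Xp j)) (rn ι' (Up i)))| ∂(stdG (ι ⊕ ι')) = ∫ x, |eval x (Gam (Xp j) (Up i))| ∂(stdG ι) := by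
        rw [← int_inl (ι' := ι') (fun x => |eval x (Gam (Xp j) (Up i))|) (poly_cont _).abs]
        simp only [Gam_rn, eval_rn]
      have e2 : ∫ x, |eval x (Gam (rn ι' (Fp j)) (rn ι' (Up i)) - C (dotp (n j) (n i)))| ∂(stdG (ι ⊕ ι')) =
          ∫ x, |eval x (Gam (Fp j) (Up i) - C (dotp (n j) (n i)))| ∂(stdG ι) := by
        rw [← int_inl (ι' := ι') (fun x => |eval x (Gam (Fp j) (Up i) - C (dotp (n j) (n i)))|) (poly_cont _).abs]
        simp only [Gam_rn, eval_rn, map_sub, eval_C]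
      rw [e1, e2]
      have h1 := b1 i j
      have h2 := b2 i j
      have h3 := hκ'0 i
      have h4 : (3 + (D:ℝ)) * (D * G0 D) * r ≤ (3 + (D:ℝ)) * (D * G0 D) * δ ^ 2 := by
        apply mul_le_mul_of_nonneg_left _ (by positivity); linarith
      nlinarith
    calc _ ≤ ∑ i : J, ∑ j : J, ((3 + D) * (D * G0 D) + 1) * δ ^ 2 := Finset.sum_le_sum fun i _ => Finset.sum_le_sum fun j _ => h1 i j
      _ ≤ _ := by
        simp only [Finset.sum_const, Finset.card_univ, nsmul_eq_mul, hA1]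
        nlinarith [sq_nonneg δ]
  have := hclt φ L hL hφ (fun j => rn ι' (Xp j)) (fun j => rn ι' (Fp j)) (fun j => ln ι (n j)) (fun j => rn ι' (Up j))
    (fun i j => dotp (n j) (n i)) (fun i => by rw [Lop_rn, hLU]; simp [rn]) (fun i => Lop_ln _) (fun i j => Gam_ln _ _)
    (fun i j => Gam_rn_ln _ _) (fun i j => Gam_rn_ln _ _) (fun i j => by rw [Gam_comm]; exact Gam_rn_ln _ _) (√A1 * δ) (by positivity) hΔ
  rw [int_prod_sum, ← int_inl (ι' := ι') (fun x => φ (fun j => eval x (Xp j) + eval x (Fp j)))]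
  · calc _ = _ := ?_
      _ ≤ _ := this
      _ = _ := by ring
    congr 3
    · ext x; congr 1; ext j; simp [ev, eval_rn]
    · ext x; congr 1; ext j; simp [ev, eval_rn, eval_ln, hXp]
  · exact (lip_cont hL hφ).comp (continuous_pi fun j => (poly_cont _).add (poly_cont _))

end UC

namespace UC
open MvPolynomial

/-! ### The partial Gaussian equivalent measure as one Gaussian vector -/

/-- index type of all the auxiliary Gaussians -/
abbrev PIdx (d p D' : ℕ) : Type := ((k : Fin (D' + 3)) × MIdx d k.1) ⊕ Fin p

lemma mp_curry {A : Type} [Fintype A] {B : A → Type} [∀ a, Fintype (B a)] :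
    MeasurePreserving (MeasurableEquiv.piCurry (fun (a : A) (_ : B a) => ℝ)) (stdG ((a : A) × B a))
      (Measure.pi fun a => stdG (B a)) := by
  refine ⟨MeasurableEquiv.measurable _, ?_⟩
  have h := Measure.infinitePi_map_piCurry (fun (a : A) (_ : B a) => gaussianReal 0 1)
  simp only [Measure.infinitePi_eq_pi] at h
  exact h

/-- regrouping map -/
def regroup (d p D' : ℕ) : ((PIdx d p D') → ℝ) ≃ᵐ ((k : Fin (D' + 3)) → MIdx d k.1 → ℝ) × (Fin p → ℝ) :=
  (MeasurableEquiv.sumPiEquivProdPi (fun _ : PIdx d p D' => ℝ)).trans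
    (MeasurableEquiv.prodCongr (MeasurableEquiv.piCurry (fun (k : Fin (D' + 3)) (_ : MIdx d k.1) => ℝ)) (MeasurableEquiv.refl _))

lemma mp_regroup (d p D' : ℕ) : MeasurePreserving (regroup d p D') (stdG (PIdx d p D'))
    ((Measure.pi fun k : Fin (D' + 3) => stdG (MIdx d k.1)).prod (stdG (Fin p))) := by
  have h1 := mp_sum (ι := (k : Fin (D' + 3)) × MIdx d k.1) (ι' := Fin p)
  have : ∀ k : Fin (D' + 3), SigmaFinite (stdG (MIdx d k.1)) := fun k => inferInstance
  have h2 := (mp_curry (A := Fin (D' + 3)) (B := fun k => MIdx d k.1)).prod (MeasurePreserving.id (stdG (Fin p)))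
  exact h2.comp h1

lemma pg_int (d p D' : ℕ) (f : PGfeat d p D' → ℝ) :
    ∫ ω, f ω ∂(PGfeatMeas d p D') = ∫ z, f (z.1, regroup d p D' z.2) ∂((stdG (Fin d)).prod (stdG (PIdx d p D'))) := by
  have h := (MeasurePreserving.id (stdG (Fin d))).prod (mp_regroup d p D')
  have h' : MeasurePreserving ((MeasurableEquiv.refl (Fin d → ℝ)).prodCongr (regroup d p D'))
    ((stdG (Fin d)).prod (stdG (PIdx d p D'))) (PGfeatMeas d p D') := h
  exact (h'.integral_comp' f).symm

lemma hCoef_eq_zero (σa : Polynomial ℝ) (k : ℕ) (h : σa.natDegree < k) : hCoef σa k = 0 := by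
  unfold hCoef
  simp_rw [He_expand σa.natDegree σa le_rfl, Finset.sum_mul]
  rw [integral_finsetSum]
  · apply Finset.sum_eq_zero
    intro l hl
    rw [Finset.mem_range] at hl
    simp_rw [mul_assoc, integral_const_mul, He_orth]
    rw [if_neg (by omega), mul_zero]
  · intro l hl
    simp_rw [mul_assoc]
    exact (He_integrable l k).const_mul _

/-- block vector -/
def blk {d p D' : ℕ} (k0 : Fin (D' + 3)) (b : MIdx d k0.1 → ℝ) : PIdx d p D' → ℝ :=
  Sum.elim (fun y => Pi.single (M := fun k : Fin (D' + 3) => MIdx d k.1 → ℝ) k0 b y.1 y.2) (fun _ => 0)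

lemma dotp_blk {d p D' : ℕ} (k0 : Fin (D' + 3)) (b : MIdx d k0.1 → ℝ) (g : PIdx d p D' → ℝ) :
    dotp (blk k0 b) g = dotp b (fun κ => g (Sum.inl ⟨k0, κ⟩)) := by
  unfold dotp blk
  rw [Fintype.sum_sum_type, Fintype.sum_sigma, Finset.sum_eq_single k0]
  · simp
  · intro k _ hk
    simp [Pi.single_eq_of_ne hk]
  · simp

lemma dotp_gst {d p D' : ℕ} (c : Fin p → ℝ) (g : PIdx d p D' → ℝ) :
    dotp (Sum.elim (fun _ => 0) c : PIdx d p D' → ℝ) g = dotp c (fun j => g (Sum.inr j)) := by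
  unfold dotp
  rw [Fintype.sum_sum_type]; simp

end UC

namespace UC
open MvPolynomial

/-! ### Deterministic comparison -/

variable {d p D' s : ℕ} {sk : ℕ → ℕ}

/-- low-order parts -/
def XcD (β : (k : ℕ) → Fin (sk k) → MIdx d k → ℝ) (σa : Polynomial ℝ) (w : Fin p → Fin d → ℝ) (θ : Fin p → ℝ) :
    Option (SigIdx s D' sk) → ℕ → MvPolynomial (Fin d) ℝ
  | none, l => C (hCoef σa l) * Yf l θ w
  | some (Sum.inl i), l => if h : (i : ℕ) < d then (if l = 1 then Hp 1 (Pi.single (⟨i, h⟩ : Fin d) (1 : ℝ)) else 0) else 0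
  | some (Sum.inr ki), l => if l = ki.1.1 then xiP (β ki.1.1 ki.2) else 0

/-- high-order parts -/
def FcD (β : (k : ℕ) → Fin (sk k) → MIdx d k → ℝ) (σa : Polynomial ℝ) (w : Fin p → Fin d → ℝ) (θ : Fin p → ℝ) :
    Option (SigIdx s D' sk) → ℕ → MvPolynomial (Fin d) ℝ
  | none, k => C (hCoef σa k) * Yf k θ w
  | some (Sum.inl _), _ => 0
  | some (Sum.inr ki), k => if k = ki.1.1 then xiP (β ki.1.1 ki.2) else 0

/-- Gaussian directions -/
def nD (D' : ℕ) (β : (k : ℕ) → Fin (sk k) → MIdx d k → ℝ) (μ : ℝ) (θ : Fin p → ℝ) :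
    Option (SigIdx s D' sk) → PIdx d p D' → ℝ
  | none => Sum.elim (fun _ => 0) (fun j => μ * θ j)
  | some (Sum.inl _) => 0
  | some (Sum.inr ki) => if ki.1.1 ≤ 2 then 0 else
      blk ⟨ki.1.1, by have h := (Finset.mem_Icc.mp ki.1.2).2; omega⟩ (β ki.1.1 ki.2)

lemma dotp_zero_left {ι : Type*} [Fintype ι] (u : ι → ℝ) : dotp 0 u = 0 := by simp [dotp]

lemma E_C_mul_both (a b : ℝ) {ι : Type*} [Fintype ι] [DecidableEq ι] (P Q : MvPolynomial ι ℝ) :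
    E (C a * P * (C b * Q)) = a * b * E (P * Q) := by
  rw [show C a * P * (C b * Q) = C (a * b) * (P * Q) by rw [C_mul]; ring, E_C_mul]

lemma chaos_CY (c : ℝ) (k : ℕ) (θ : Fin p → ℝ) (w : Fin p → Fin d → ℝ) (hw : ∀ a, ∑ i, w a i ^ 2 = 1) :
    Chaos k (C c * Yf k θ w) := by
  rw [← smul_eq_C_mul]; exact (Yf_chaos k θ w hw).smul c

lemma D_smul' {ι : Type*} [Fintype ι] [DecidableEq ι] (c : ℝ) (n : ℕ) (α : Fin n → ι) (P : MvPolynomial ι ℝ) :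
    D n α (C c * P) = C c * D n α P := by
  rw [← smul_eq_C_mul, ← smul_eq_C_mul]
  exact map_smul _ _ _

lemma Kc_C_mul {ι : Type*} [Fintype ι] [DecidableEq ι] (c : ℝ) (j : ℕ) (P : MvPolynomial ι ℝ) :
    Kc j (C c * P) = c ^ 4 * Kc j P := by
  unfold Kc
  simp only [D_smul', E_C_mul_both, Finset.mul_sum]
  apply Finset.sum_congr rfl; intro x _
  apply Finset.sum_congr rfl; intro y _
  ring

lemma Kc_poly_zero {ι : Type*} [Fintype ι] [DecidableEq ι] (j : ℕ) : Kc j (0 : MvPolynomial ι ℝ) = 0 := by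
  have := Kc_C_mul 0 j (0 : MvPolynomial ι ℝ)
  simpa using this

lemma E_xi_Yf (ξ : MvPolynomial (Fin d) ℝ) (k : ℕ) (c : ℝ) (θ : Fin p → ℝ) (w : Fin p → Fin d → ℝ) :
    E (ξ * (C c * Yf k θ w)) = c * ∑ a, θ a * E (ξ * Hp k (w a)) := by
  unfold Yf
  rw [show ξ * (C c * ∑ a, C (θ a) * Hp k (w a)) = C c * ∑ a, C (θ a) * (ξ * Hp k (w a)) by
    rw [Finset.mul_sum, Finset.mul_sum, Finset.mul_sum]
    apply Finset.sum_congr rfl; intro a _; ring, E_C_mul, map_sum]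
  simp_rw [E_C_mul]

lemma enorm2_one {ι : Type*} [Fintype ι] (u : ι → ℝ) (h : enorm2 u = 1) : dotp u u = 1 := by
  unfold enorm2 at h
  rw [Real.sqrt_eq_one] at h
  unfold dotp; rw [← h]; apply Finset.sum_congr rfl; intro i _; ring

lemma hS_D (β : (k : ℕ) → Fin (sk k) → MIdx d k → ℝ) (σa : Polynomial ℝ) (w : Fin p → Fin d → ℝ) (θ : Fin p → ℝ)
    (Dσ : ℕ) (hσ : σa.natDegree ≤ Dσ)
    (hw : ∀ a, ∑ i, w a i ^ 2 = 1) (κ' : ℝ) (hκ' : 0 ≤ κ')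
    (hx : ∀ k, 3 ≤ k → k ≤ D' → ∀ i, |hCoef σa k * ∑ a, θ a * E (xiP (β k i) * Hp k (w a))| ≤ κ')
    (hy : |∑ k ∈ Finset.Icc 3 Dσ, hCoef σa k ^ 2 * (tq k θ w - ∑ a, θ a ^ 2)| ≤ κ')
    (i j : Option (SigIdx s D' sk)) :
    |(∑ k ∈ Finset.Icc 3 (Dσ + D' + 3), E (FcD (s := s) (D' := D') β σa w θ j k * FcD (s := s) (D' := D') β σa w θ i k)) -
      dotp (nD D' β (muHigh σa Dσ) θ j) (nD D' β (muHigh σa Dσ) θ i)| ≤ κ' := by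
  have key : ∀ (ki : (k : {k : ℕ // k ∈ Finset.Icc 2 D'}) × Fin (sk k.1)) (Q : ℕ → MvPolynomial (Fin d) ℝ),
      ∑ k ∈ Finset.Icc 3 (Dσ + D' + 3), E ((if k = ki.1.1 then xiP (β ki.1.1 ki.2) else 0) * Q k) =
        if 3 ≤ ki.1.1 then E (xiP (β ki.1.1 ki.2) * Q ki.1.1) else 0 := by
    intro ki Q
    have hm := Finset.mem_Icc.1 ki.1.2
    split_ifs with h
    · rw [Finset.sum_eq_single ki.1.1]
      · simp
      · intro k _ hk; simp [hk]
      · intro h'; exact absurd (Finset.mem_Icc.2 ⟨h, by omega⟩) h'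
    · apply Finset.sum_eq_zero
      intro k hk
      rw [Finset.mem_Icc] at hk
      rw [if_neg (by omega)]; simp
  have mix : ∀ (ki : (k : {k : ℕ // k ∈ Finset.Icc 2 D'}) × Fin (sk k.1)),
      |(∑ k ∈ Finset.Icc 3 (Dσ + D' + 3), E ((if k = ki.1.1 then xiP (β ki.1.1 ki.2) else 0) * (C (hCoef σa k) * Yf k θ w))) -
      dotp (if ki.1.1 ≤ 2 then (0 : PIdx d p D' → ℝ) else
      blk ⟨ki.1.1, by have h := (Finset.mem_Icc.mp ki.1.2).2; omega⟩ (β ki.1.1 ki.2))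
        (Sum.elim (fun _ => 0) (fun j => muHigh σa Dσ * θ j))| ≤ κ' := by
    intro ki
    have hm := Finset.mem_Icc.1 ki.1.2
    rw [key]
    by_cases h : 3 ≤ ki.1.1
    · rw [if_pos h, if_neg (by omega), dotp_blk, E_xi_Yf]
      have := hx ki.1.1 h hm.2 ki.2
      simpa [dotp] using this
    · rw [if_neg h, if_pos (by omega), dotp_zero_left]; simpa using hκ'
  rcases j with _ | (j | kj)
  · rcases i with _ | (i | ki)
    · simp only [FcD, nD, E_C_mul_both, E_Yf _ θ w hw, dotp_gst]
      have e1 : ∑ k ∈ Finset.Icc 3 (Dσ + D' + 3), hCoef σa k * hCoef σa k * tq k θ w =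
          ∑ k ∈ Finset.Icc 3 Dσ, hCoef σa k ^ 2 * tq k θ w := by
        symm
        rw [← Finset.sum_subset (Finset.Icc_subset_Icc_right (by omega : Dσ ≤ Dσ + D' + 3))]
        · apply Finset.sum_congr rfl; intro k _; ring
        · intro k hk hk'
          rw [Finset.mem_Icc] at hk hk'
          rw [hCoef_eq_zero σa k (by omega)]; simp
      have e2 : dotp (fun j => muHigh σa Dσ * θ j) (fun j => (Sum.elim (fun _ => 0) (fun j => muHigh σa Dσ * θ j) : PIdx d p D' → ℝ) (Sum.inr j))
          = ∑ k ∈ Finset.Icc 3 Dσ, hCoef σa k ^ 2 * ∑ a, θ a ^ 2 := by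
        rw [← Finset.sum_mul]
        have : muHigh σa Dσ ^ 2 = ∑ k ∈ Finset.Icc 3 Dσ, hCoef σa k ^ 2 :=
          Real.sq_sqrt (Finset.sum_nonneg fun _ _ => sq_nonneg _)
        rw [← this]; unfold dotp
        rw [Finset.mul_sum]
        apply Finset.sum_congr rfl; intro a _; simp only [Sum.elim_inr]; ring
      rw [e1, e2, ← Finset.sum_sub_distrib]
      simpa only [mul_sub] using hy
    · simp only [FcD, nD, mul_zero, map_zero, Finset.sum_const_zero]
      rw [dotp_comm, dotp_zero_left]; simpa using hκ'
    · have := mix ki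
      rw [dotp_comm] at this
      simp only [mul_comm (if _ then _ else _)] at this
      exact this
  · simp only [FcD, nD, zero_mul, map_zero, Finset.sum_const_zero]
    rw [dotp_zero_left]; simpa using hκ'
  · rcases i with _ | (i | ki)
    · exact mix kj
    · simp only [FcD, nD, mul_zero, map_zero, Finset.sum_const_zero]
      rw [dotp_comm, dotp_zero_left]; simpa using hκ'
    · simp only [FcD, nD, key]
      obtain ⟨⟨k, hk⟩, a⟩ := ki
      obtain ⟨⟨l, hl⟩, b⟩ := kj
      simp only
      by_cases h : 3 ≤ l
      · rw [if_pos h, if_neg (by omega : ¬ l ≤ 2), dotp_blk]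
        by_cases hkl : l = k
        · subst hkl
          rw [if_pos rfl, if_neg (by omega), E_xiP]
          simp only [blk, Sum.elim_inl, Pi.single_eq_same]
          simpa using hκ'
        · rw [if_neg hkl]
          have : dotp (β l b) (fun κ => (if k ≤ 2 then (0 : PIdx d p D' → ℝ) else blk ⟨k, by have h := (Finset.mem_Icc.mp hk).2; omega⟩ (β k a)) (Sum.inl ⟨⟨l, by have h := (Finset.mem_Icc.mp hl).2; omega⟩, κ⟩)) = 0 := by
            split_ifs with h2
            · simp [dotp]
            · simp only [blk, Sum.elim_inl]
              rw [Pi.single_eq_of_ne (by simp; omega)]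
              simp [dotp]
          rw [this]; simpa using hκ'
      · rw [if_neg h, if_pos (by omega : l ≤ 2), dotp_zero_left]; simpa using hκ'

end UC

namespace UC
open MvPolynomial

lemma det (Dσ D' s : ℕ) (sk : ℕ → ℕ) : ∃ Cc : ℝ, 0 ≤ Cc ∧ ∀ (d p : ℕ)
    (β : (k : ℕ) → Fin (sk k) → MIdx d k → ℝ) (_ : ∀ k : ℕ, 2 ≤ k → k ≤ D' → ∀ i : Fin (sk k), enorm2 (β k i) = 1)
    (σa : Polynomial ℝ) (_ : σa.natDegree ≤ Dσ) (w : Fin p → Fin d → ℝ) (_ : ∀ a, ∑ i, w a i ^ 2 = 1)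
    (θ : Fin p → ℝ) (b κ κ' δ : ℝ) (_ : 1 ≤ b) (_ : 0 ≤ κ) (_ : 0 ≤ κ')
    (_ : ∀ k, k ≤ Dσ → hCoef σa k ^ 2 * tq k θ w ≤ b)
    (_ : ∀ k, 3 ≤ k → k ≤ D' → ∀ (i : Fin (sk k)) (j : ℕ), 1 ≤ j → j < k → Kc j (xiP (β k i)) ≤ κ)
    (_ : ∀ k, 3 ≤ k → k ≤ Dσ → ∀ j, 1 ≤ j → j < k → hCoef σa k ^ 4 * Kc j (Yf k θ w) ≤ κ)
    (_ : ∀ k, 3 ≤ k → k ≤ D' → ∀ i, |hCoef σa k * ∑ a, θ a * E (xiP (β k i) * Hp k (w a))| ≤ κ')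
    (_ : |∑ k ∈ Finset.Icc 3 Dσ, hCoef σa k ^ 2 * (tq k θ w - ∑ a, θ a ^ 2)| ≤ κ')
    (_ : 0 < δ) (_ : √(b * √κ) + κ' ≤ δ ^ 2)
    (φ : ((SigIdx s D' sk → ℝ) × ℝ) → ℝ) (L : ℝ) (_ : 0 < L)
    (_ : ∀ u v : (SigIdx s D' sk → ℝ) × ℝ, |φ u - φ v| ≤
                L * Real.sqrt ((∑ i, (u.1 i - v.1 i) ^ 2) + (u.2 - v.2) ^ 2)),
    |(∫ x, φ (fRF d s D' sk β x, dotp θ (zRF d p σa w x)) ∂(stdG (Fin d))) -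
                  (∫ ω : PGfeat d p D',
                    φ (fPG d s D' sk β ω.1 ω.2.1, dotp θ (zPG d p Dσ σa w ω.1 ω.2.2))
                    ∂(PGfeatMeas d p D'))| ≤ Cc * L * δ := by
  obtain ⟨Cc, hCc, hclt⟩ := clt_chaos (Option (SigIdx s D' sk)) (Dσ + D' + 3)
  refine ⟨Cc * √(Fintype.card (Option (SigIdx s D' sk))), by positivity, ?_⟩
  intro d p β hβ σa hσ w hw θ b κ κ' δ hb hκ hκ' hY hKξ hKY hx hy hδ hδ2 φ L hL hφ
  have hY' : ∀ k, hCoef σa k ^ 2 * tq k θ w ≤ b := by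
    intro k
    rcases Nat.lt_or_ge Dσ k with h | h
    · rw [hCoef_eq_zero σa k (by omega)]; simp; linarith
    · exact hY k h
  have hKY' : ∀ k, 3 ≤ k → ∀ j, 1 ≤ j → j < k → hCoef σa k ^ 4 * Kc j (Yf k θ w) ≤ κ := by
    intro k hk
    rcases Nat.lt_or_ge Dσ k with h | h
    · rw [hCoef_eq_zero σa k (by omega)]; simp [hκ]
    · exact hKY k hk h
  set φ' : (Option (SigIdx s D' sk) → ℝ) → ℝ := fun v => φ (fun i => v (some i), v none) with hφ'
  have h1 : ∀ u v, |φ' u - φ' v| ≤ (L * √(Fintype.card (Option (SigIdx s D' sk)))) * ‖u - v‖ := by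
    intro u v
    refine (hφ _ _).trans ?_
    rw [mul_assoc]
    apply mul_le_mul_of_nonneg_left _ hL.le
    rw [← Real.sqrt_sq (norm_nonneg (u - v)), ← Real.sqrt_mul (by positivity)]
    apply Real.sqrt_le_sqrt
    have : (∑ i, (u (some i) - v (some i)) ^ 2) + (u none - v none) ^ 2 = ∑ j, (u j - v j) ^ 2 := by
      rw [Fintype.sum_option]; ring
    simp only
    rw [this, ← nsmul_eq_mul, ← Finset.card_univ, ← Finset.sum_const]
    apply Finset.sum_le_sum
    intro j _
    apply sq_le_sq'
    · have := norm_le_pi_norm (u - v) j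
      rw [Real.norm_eq_abs] at this
      have := (abs_le.1 this).1
      simpa using this
    · have := norm_le_pi_norm (u - v) j
      rw [Real.norm_eq_abs] at this
      exact (abs_le.1 this).2
  have hxi : ∀ (ki : (k : {k : ℕ // k ∈ Finset.Icc 2 D'}) × Fin (sk k.1)),
      E (xiP (β ki.1.1 ki.2) * xiP (β ki.1.1 ki.2)) ≤ b := by
    intro ki
    have hm := Finset.mem_Icc.1 ki.1.2
    rw [E_xiP, enorm2_one _ (hβ _ hm.1 hm.2 _)]; exact hb
  have hX : ∀ (j : Option (SigIdx s D' sk)) (l : ℕ), l < 3 → Chaos l (XcD (s := s) (D' := D') β σa w θ j l) ∧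
      E (XcD (s := s) (D' := D') β σa w θ j l * XcD (s := s) (D' := D') β σa w θ j l) ≤ b := by
    intro j l hl
    rcases j with _ | (i | ki)
    · refine ⟨chaos_CY _ l θ w hw, ?_⟩
      simp only [XcD]
      rw [E_C_mul_both, E_Yf _ θ w hw, ← sq]; exact hY' l
    · simp only [XcD]
      split_ifs with h h'
      · subst h'
        refine ⟨Hp_chaos 1 _ (sum_single_sq _), ?_⟩
        rw [E_Hp _ _ _ (sum_single_sq _), dotp_single]; simpa using hb
      · exact ⟨Chaos.zero, by simp; linarith⟩
      · exact ⟨Chaos.zero, by simp; linarith⟩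
    · simp only [XcD]
      split_ifs with h
      · refine ⟨by rw [h]; exact xiP_chaos _, hxi ki⟩
      · exact ⟨Chaos.zero, by simp; linarith⟩
  have hF : ∀ (j : Option (SigIdx s D' sk)) (k : ℕ), 3 ≤ k → k ≤ Dσ + D' + 3 → Chaos k (FcD (s := s) (D' := D') β σa w θ j k) ∧
      E (FcD (s := s) (D' := D') β σa w θ j k * FcD (s := s) (D' := D') β σa w θ j k) ≤ b ∧
      ∀ i, 1 ≤ i → i < k → Kc i (FcD (s := s) (D' := D') β σa w θ j k) ≤ κ := by
    intro j k hk _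
    have hz : Chaos k (0 : MvPolynomial (Fin d) ℝ) ∧ E ((0 : MvPolynomial (Fin d) ℝ) * 0) ≤ b ∧
      ∀ i, 1 ≤ i → i < k → Kc i (0 : MvPolynomial (Fin d) ℝ) ≤ κ :=
      ⟨Chaos.zero, by simp; linarith, fun i _ _ => by rw [Kc_poly_zero]; exact hκ⟩
    rcases j with _ | (i | ki)
    · refine ⟨chaos_CY _ k θ w hw, ?_, ?_⟩
      · simp only [FcD]
        rw [E_C_mul_both, E_Yf _ θ w hw, ← sq]; exact hY' k
      · intro i hi hik
        simp only [FcD, Kc_C_mul]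
        exact hKY' k hk i hi hik
    · exact hz
    · simp only [FcD]
      split_ifs with h
      · refine ⟨by rw [h]; exact xiP_chaos _, hxi ki, ?_⟩
        subst h
        exact hKξ _ hk (Finset.mem_Icc.1 ki.1.2).2 ki.2
      · exact hz
  have hfin := hclt φ' _ (by positivity) h1 (XcD (s := s) (D' := D') β σa w θ) (FcD (s := s) (D' := D') β σa w θ)
    (nD D' β (muHigh σa Dσ) θ) b κ κ' (by linarith) hκ hX hF (hS_D β σa w θ Dσ hσ hw κ' hκ' hx hy) δ hδ hδ2
  have eY : ∀ k x, eval x (C (hCoef σa k) * Yf k θ w) = ∑ a, θ a * (hCoef σa k * He k (dotp (w a) x)) := by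
    intro k x
    rw [map_mul, eval_C, Yf, map_sum, Finset.mul_sum]
    apply Finset.sum_congr rfl; intro a _
    rw [map_mul, eval_C, eval_Hp]; ring
  have ecoord : ∀ (i : Fin s) x, eval x (∑ l ∈ Finset.range 3, XcD (s := s) (D' := D') β σa w θ (some (Sum.inl i)) l) = coordS d s x i := by
    intro i x
    simp only [XcD, coordS, Finset.sum_range_succ, Finset.sum_range_zero]
    by_cases h : (i : ℕ) < d
    · simp [h, Hp_one, eval_lin, dotp_single]
    · simp [h]
  have eR : ∀ x, φ' (fun j => eval x (∑ l ∈ Finset.range 3, XcD (s := s) (D' := D') β σa w θ j l) +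
      eval x (∑ k ∈ Finset.Icc 3 (Dσ + D' + 3), FcD (s := s) (D' := D') β σa w θ j k)) =
      φ (fRF d s D' sk β x, dotp θ (zRF d p σa w x)) := by
    intro x
    simp only [hφ']
    congr 2
    · funext idx
      rcases idx with i | ki
      · rw [ecoord]; simp [FcD, fRF]
      · have hm := Finset.mem_Icc.1 ki.1.2
        simp only [XcD, FcD, fRF]
        rw [Finset.sum_ite_eq', Finset.sum_ite_eq', ← eval_xiP]
        simp only [Finset.mem_range, Finset.mem_Icc]
        by_cases h : ki.1.1 < 3
        · rw [if_pos h, if_neg (by omega)]; simp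
        · rw [if_neg h, if_pos (by omega)]; simp
    · simp only [XcD, FcD, map_sum, eY]
      rw [← Finset.sum_union]
      · have : Finset.range 3 ∪ Finset.Icc 3 (Dσ + D' + 3) = Finset.range (Dσ + D' + 3 + 1) := by
          ext k; simp; omega
        rw [this, Finset.sum_comm]
        unfold dotp zRF
        apply Finset.sum_congr rfl; intro a _
        rw [He_expand (Dσ + D' + 3) σa (by omega), Finset.mul_sum]
        rfl
      · rw [Finset.disjoint_left]; intro k; simp; omega
  have aeq : ∀ᵐ z ∂((stdG (Fin d)).prod (stdG (PIdx d p D'))),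
      ∀ a, dotp (qvec d 2 (w a)) (hvec d 2 z.1) = He 2 (dotp (w a) z.1) :=
    Measure.quasiMeasurePreserving_fst.ae (ae_all_iff.2 fun a => Hp_eq_xiP_ae 2 (w a) (hw a))
  have eP : ∀ᵐ z ∂((stdG (Fin d)).prod (stdG (PIdx d p D'))),
      φ' (fun j => eval z.1 (∑ l ∈ Finset.range 3, XcD (s := s) (D' := D') β σa w θ j l) + dotp (nD D' β (muHigh σa Dσ) θ j) z.2) =
      φ (fPG d s D' sk β z.1 (regroup d p D' z.2).1, dotp θ (zPG d p Dσ σa w z.1 (regroup d p D' z.2).2)) := by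
    filter_upwards [aeq] with z hz
    simp only [hφ']
    congr 2
    · funext idx
      rcases idx with i | ki
      · rw [ecoord]; simp [nD, fPG, dotp_zero_left]
      · have hm := Finset.mem_Icc.1 ki.1.2
        simp only [XcD, nD, fPG]
        rw [Finset.sum_ite_eq']
        simp only [Finset.mem_range]
        by_cases h : ki.1.1 ≤ 2
        · rw [if_pos h, if_pos h, if_pos (by omega), dotp_zero_left, eval_xiP, add_zero]
        · rw [if_neg h, if_neg h, if_neg (by omega), dotp_blk]; simp
          rfl
    · simp only [XcD, nD, map_sum, eY, dotp_gst]
      rw [Finset.sum_comm]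
      unfold dotp zPG
      rw [← Finset.sum_add_distrib]
      apply Finset.sum_congr rfl; intro a _
      rw [hz a]
      have e : (regroup d p D' z.2).2 a = z.2 (Sum.inr a) := rfl
      rw [e, Finset.sum_range_succ, Finset.sum_range_succ, Finset.sum_range_succ, Finset.sum_range_zero]
      have h0 : ∀ t, He 0 t = 1 := by intro t; simp [He]
      have h1 : ∀ t, He 1 t = t := by intro t; simp [He]
      rw [h0, h1]
      unfold dotp
      ring
  rw [pg_int, ← integral_congr_ae eP]
  simp_rw [eR] at hfin
  calc _ ≤ _ := hfin
    _ = _ := by ring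

end UC

namespace UC
open MvPolynomial

/-! ### Quantitative estimates on the good event -/

variable {d p : ℕ}

lemma tq_zero_eq (θ : Fin p → ℝ) (w : Fin p → Fin d → ℝ) : tq 0 θ w = (∑ a, θ a) ^ 2 := by
  unfold tq; rw [sq, Finset.sum_mul_sum]; simp

lemma tq_one_eq (θ : Fin p → ℝ) (w : Fin p → Fin d → ℝ) : tq 1 θ w = ∑ i, (∑ a, w a i * θ a) ^ 2 := by
  unfold tq
  simp_rw [sq, Finset.sum_mul_sum, pow_one, dotp, Finset.mul_sum]
  rw [Finset.sum_comm' (t' := Finset.univ) (s' := fun _ => Finset.univ) (by simp)]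
  rw [Finset.sum_comm]
  conv_rhs => rw [Finset.sum_comm]
  apply Finset.sum_congr rfl; intro a _
  rw [Finset.sum_comm]
  conv_rhs => rw [Finset.sum_comm]
  rw [Finset.sum_comm]
  apply Finset.sum_congr rfl; intro b _
  apply Finset.sum_congr rfl; intro i _
  ring

lemma tq_bd (θ : Fin p → ℝ) (w : Fin p → Fin d → ℝ) (hw : ∀ a, ∑ i, w a i ^ 2 = 1) (Q q y : ℝ) (hQ : 58 ≤ Q)
    (hq0 : 0 < q) (hq : q ≤ 1) (hy0 : 0 ≤ y) (hy : y ≤ 1 / 3)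
    (hS : ∑ a, θ a ^ 2 ≤ Q ^ 2) (h0 : tq 0 θ w ≤ Q ^ 2) (h1 : y * tq 1 θ w ≤ Q ^ 4 * q ^ 4)
    (hG : ∀ v : Fin p → ℝ, |∑ a, ∑ b, v a * v b * (dotp (w a) (w b) ^ 2 - y)| ≤ (2 * Q) * ∑ a, v a ^ 2) (k : ℕ) :
    tq (k + 2) θ w ≤ 3 * Q ^ 4 := by
  have hQ2 : 2 * Q * ∑ a, θ a ^ 2 ≤ 2 * Q ^ 3 := by nlinarith
  have hQ3 : Q ^ 3 ≤ Q ^ 4 := pow_le_pow_right₀ (by linarith) (by norm_num)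
  have hQ24 : Q ^ 2 ≤ Q ^ 4 := pow_le_pow_right₀ (by linarith) (by norm_num)
  have hQ0 : 0 < Q ^ 4 := by positivity
  induction k using Nat.strong_induction_on with
  | _ k ih =>
    have hst := tq_step k θ w hw y (2 * Q) hG
    have : y * tq k θ w ≤ Q ^ 4 := by
      rcases k with _ | _ | k
      · have := tq_nonneg 0 θ w
        nlinarith
      · refine h1.trans ?_
        have : q ^ 4 ≤ 1 := pow_le_one₀ hq0.le hq
        nlinarith
      · have := ih k (by omega)
        have h2 := tq_nonneg (k + 2) θ w
        nlinarith
    linarith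

lemma tq_y_bd (θ : Fin p → ℝ) (w : Fin p → Fin d → ℝ) (hw : ∀ a, ∑ i, w a i ^ 2 = 1) (Q q y : ℝ) (hQ : 58 ≤ Q)
    (hq0 : 0 < q) (hq : q ≤ 1) (hy0 : 0 ≤ y) (hy : y ≤ 1 / 3) (hyq : y ≤ q ^ 4)
    (hS : ∑ a, θ a ^ 2 ≤ Q ^ 2) (h0 : tq 0 θ w ≤ Q ^ 2) (h1 : y * tq 1 θ w ≤ Q ^ 4 * q ^ 4)
    (hG : ∀ v : Fin p → ℝ, |∑ a, ∑ b, v a * v b * (dotp (w a) (w b) ^ 2 - y)| ≤ (2 * Q) * ∑ a, v a ^ 2) (k : ℕ) :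
    y * tq (k + 1) θ w ≤ 3 * Q ^ 4 * q ^ 4 := by
  have hQ0 : 0 < Q ^ 4 := by positivity
  rcases k with _ | k
  · have : 0 < q ^ 4 := by positivity
    refine h1.trans ?_
    nlinarith [mul_pos hQ0 this]
  · have := tq_bd θ w hw Q q y hQ hq0 hq hy0 hy hS h0 h1 hG k
    have h2 := tq_nonneg (k + 2) θ w
    calc y * tq (k + 1 + 1) θ w ≤ q ^ 4 * (3 * Q ^ 4) := mul_le_mul hyq this h2 (by positivity)
      _ = _ := by ring

lemma Kc_est (θ : Fin p → ℝ) (w : Fin p → Fin d → ℝ) (hw : ∀ a, ∑ i, w a i ^ 2 = 1) (Q q y ρ : ℝ) (hQ : 58 ≤ Q)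
    (hq0 : 0 < q) (hq : q ≤ 1) (hy0 : 0 ≤ y) (hy : y ≤ 1 / 3) (hyq : y ≤ q ^ 4)
    (hS : ∑ a, θ a ^ 2 ≤ Q ^ 2) (h0 : tq 0 θ w ≤ Q ^ 2) (h1 : y * tq 1 θ w ≤ Q ^ 4 * q ^ 4)
    (hG : ∀ v : Fin p → ℝ, |∑ a, ∑ b, v a * v b * (dotp (w a) (w b) ^ 2 - y)| ≤ (2 * Q) * ∑ a, v a ^ 2)
    (hθ : ∀ a, |θ a| ≤ Q * q ^ 2) (hρ0 : 0 ≤ ρ) (hρ1 : ρ ≤ 1) (hρ2 : ρ ≤ 2 * Q * q ^ 2) (hρ : ∀ a b, a ≠ b → |dotp (w a) (w b)| ≤ ρ)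
    (k j : ℕ) (hj : 1 ≤ j) (hjk : j < k) (hk : 3 ≤ k) (hf : (k.factorial : ℝ) ≤ Q) (μ : ℝ) (hμ : |μ| ≤ Q) :
    μ ^ 4 * Kc j (Yf k θ w) ≤ Q ^ 16 * q ^ 4 := by
  have hK := Kc_Yf_le k j hj hjk hk θ w hw y (2 * Q) (Q * q ^ 2) ρ (by linarith) hG hθ hρ1 hρ
  have hS0 : 0 ≤ ∑ a, θ a ^ 2 := Finset.sum_nonneg fun _ _ => sq_nonneg _
  set S := ∑ a, θ a ^ 2
  have hT := tq_y_bd θ w hw Q q y hQ hq0 hq hy0 hy hyq hS h0 h1 hG (k - 3)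
  rw [show k - 3 + 1 = k - 2 by omega] at hT
  have hT0 := tq_nonneg (k - 2) θ w
  have hQ0 : 0 < Q := by linarith
  have hq4 : q ^ 4 ≤ 1 := pow_le_one₀ hq0.le hq
  have hq40 : 0 < q ^ 4 := by positivity
  have a1 : y ^ 2 * tq (k - 2) θ w ^ 2 ≤ 9 * Q ^ 8 * q ^ 4 := by
    rw [← mul_pow]
    calc (y * tq (k - 2) θ w) ^ 2 ≤ (3 * Q ^ 4 * q ^ 4) ^ 2 := pow_le_pow_left₀ (by positivity) hT 2
      _ = 9 * Q ^ 8 * q ^ 4 * q ^ 4 := by ring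
      _ ≤ 9 * Q ^ 8 * q ^ 4 * 1 := by gcongr
      _ = _ := by ring
  have a2 : (Q * q ^ 2) ^ 2 * S ≤ Q ^ 4 * q ^ 4 := by
    calc (Q * q ^ 2) ^ 2 * S ≤ (Q * q ^ 2) ^ 2 * Q ^ 2 := by gcongr
      _ = _ := by ring
  have a3 : ρ ^ 2 * S ^ 2 ≤ 4 * Q ^ 6 * q ^ 4 := by
    calc ρ ^ 2 * S ^ 2 ≤ (2 * Q * q ^ 2) ^ 2 * (Q ^ 2) ^ 2 := by gcongr
      _ = _ := by ring
  have a4 : Q ^ 6 ≤ Q ^ 8 := pow_le_pow_right₀ (by linarith) (by norm_num)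
  have a5 : 2 * y ^ 2 * tq (k - 2) θ w ^ 2 + 2 * ((2 * Q) ^ 2 * ((Q * q ^ 2) ^ 2 * S + ρ ^ 2 * S ^ 2)) ≤ 58 * Q ^ 8 * q ^ 4 := by
    calc _ ≤ 2 * (9 * Q ^ 8 * q ^ 4) + 2 * ((2 * Q) ^ 2 * (Q ^ 4 * q ^ 4 + 4 * Q ^ 6 * q ^ 4)) := by
          rw [mul_assoc 2 (y ^ 2)]; gcongr
      _ = (50 * Q ^ 8 + 8 * Q ^ 6) * q ^ 4 := by ring
      _ ≤ (50 * Q ^ 8 + 8 * Q ^ 8) * q ^ 4 := by gcongr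
      _ = _ := by ring
  calc μ ^ 4 * Kc j (Yf k θ w) ≤ Q ^ 4 * (Q ^ 2 * (58 * Q ^ 8 * q ^ 4)) := by
        apply mul_le_mul _ _ (Kc_nonneg _ _) (by positivity)
        · calc μ ^ 4 = |μ| ^ 4 := by rw [← abs_pow, abs_of_nonneg (by positivity)]
            _ ≤ _ := by gcongr
        · refine hK.trans ?_
          apply mul_le_mul _ a5 (by positivity) (by positivity)
          gcongr
    _ = 58 * (Q ^ 14 * q ^ 4) := by ring
    _ ≤ Q * (Q ^ 14 * q ^ 4) := by gcongr
    _ = Q ^ 15 * q ^ 4 := by ring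
    _ ≤ _ := by
      gcongr ?_ * _
      exact pow_le_pow_right₀ (by linarith) (by norm_num)

lemma YY_est (θ : Fin p → ℝ) (w : Fin p → Fin d → ℝ) (hw : ∀ a, ∑ i, w a i ^ 2 = 1) (Q q y y3 : ℝ) (hQ : 58 ≤ Q)
    (hq0 : 0 < q) (hq : q ≤ 1) (hy0 : 0 ≤ y) (hy : y ≤ 1 / 3) (hyq : y ≤ q ^ 4) (hy3 : 0 ≤ y3) (hy3' : y3 ≤ 3 * y)
    (hS : ∑ a, θ a ^ 2 ≤ Q ^ 2) (h0 : tq 0 θ w ≤ Q ^ 2) (h1 : y * tq 1 θ w ≤ Q ^ 4 * q ^ 4)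
    (hG : ∀ v : Fin p → ℝ, |∑ a, ∑ b, v a * v b * (dotp (w a) (w b) ^ 2 - y)| ≤ (2 * Q) * ∑ a, v a ^ 2)
    (hG3 : ∀ v : Fin p → ℝ, |∑ a, ∑ b, v a * v b * (if a = b then 0 else dotp (w a) (w b) ^ 3 - y3 * dotp (w a) (w b))| ≤ Q * q ^ 4 * ∑ a, v a ^ 2)
    (Dσ : ℕ) (hD : (Dσ : ℝ) ≤ Q) (μ : ℕ → ℝ) (hμ : ∀ k, k ≤ Dσ → |μ k| ≤ Q) :
    |∑ k ∈ Finset.Icc 3 Dσ, μ k ^ 2 * (tq k θ w - ∑ a, θ a ^ 2)| ≤ Q ^ 8 * q ^ 2 := by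
  have hS0 : 0 ≤ ∑ a, θ a ^ 2 := Finset.sum_nonneg fun _ _ => sq_nonneg _
  set S := ∑ a, θ a ^ 2 with hSd
  have hQ0 : 0 < Q := by linarith
  have hq40 : 0 < q ^ 4 := by positivity
  have hq42 : q ^ 4 ≤ q ^ 2 := pow_le_pow_of_le_one hq0.le hq (by norm_num)
  have p1 : Q ^ 2 ≤ Q ^ 4 := pow_le_pow_right₀ (by linarith) (by norm_num)
  have p2 : Q ^ 3 ≤ Q ^ 4 := pow_le_pow_right₀ (by linarith) (by norm_num)
  have key : ∀ k, |tq (k + 3) θ w - S| ≤ 13 * Q ^ 4 * q ^ 4 := by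
    intro k
    have hT := tq_y_bd θ w hw Q q y hQ hq0 hq hy0 hy hyq hS h0 h1 hG k
    have hT0 := tq_nonneg (k + 1) θ w
    refine (tq_diff k θ w hw y3 _ hy3 hG3).trans ?_
    calc Q * q ^ 4 * S + y3 * (tq (k + 1) θ w + S) ≤ Q * q ^ 4 * Q ^ 2 + 3 * y * (tq (k + 1) θ w + S) := by gcongr
      _ = Q ^ 3 * q ^ 4 + 3 * (y * tq (k + 1) θ w) + 3 * (y * S) := by ring
      _ ≤ Q ^ 4 * q ^ 4 + 3 * (3 * Q ^ 4 * q ^ 4) + 3 * (q ^ 4 * Q ^ 4) := by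
        gcongr
        exact hS.trans p1
      _ = _ := by ring
  calc _ ≤ ∑ k ∈ Finset.Icc 3 Dσ, |μ k ^ 2 * (tq k θ w - S)| := Finset.abs_sum_le_sum_abs _ _
    _ ≤ ∑ k ∈ Finset.Icc 3 Dσ, Q ^ 2 * (13 * Q ^ 4 * q ^ 4) := by
        apply Finset.sum_le_sum
        intro k hk
        rw [Finset.mem_Icc] at hk
        rw [abs_mul, abs_of_nonneg (sq_nonneg _), ← sq_abs (μ k)]
        have := key (k - 3)
        rw [show k - 3 + 3 = k by omega] at this
        have := hμ k hk.2
        gcongr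
    _ = ((Finset.Icc 3 Dσ).card : ℝ) * (Q ^ 2 * (13 * Q ^ 4 * q ^ 4)) := by rw [Finset.sum_const, nsmul_eq_mul]
    _ ≤ Q * (Q ^ 2 * (Q * Q ^ 4 * q ^ 2)) := by
        have : ((Finset.Icc 3 Dσ).card : ℝ) ≤ Q := by
          refine le_trans ?_ hD
          rw [Nat.card_Icc]; exact_mod_cast (by omega : Dσ + 1 - 3 ≤ Dσ)
        gcongr
        linarith
    _ = _ := by ring

lemma cross_est (θ f : Fin p → ℝ) (Q q μ : ℝ) (hQ : 58 ≤ Q) (hq0 : 0 < q)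
    (hS : ∑ a, θ a ^ 2 ≤ Q ^ 2) (hf : ∑ a, f a ^ 2 ≤ 3 * Q * q ^ 4) (hμ : |μ| ≤ Q) :
    |μ * ∑ a, θ a * f a| ≤ Q ^ 8 * q ^ 2 := by
  have hQ0 : 0 < Q := by linarith
  have h := Finset.sum_mul_sq_le_sq_mul_sq Finset.univ θ f
  apply abs_le_of_sq_le_sq _ (by positivity)
  have hf0 : 0 ≤ ∑ a, f a ^ 2 := Finset.sum_nonneg fun _ _ => sq_nonneg _
  calc (μ * ∑ a, θ a * f a) ^ 2 = |μ| ^ 2 * (∑ a, θ a * f a) ^ 2 := by rw [mul_pow, sq_abs]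
    _ ≤ Q ^ 2 * (Q ^ 2 * (3 * Q * q ^ 4)) := by
      gcongr
      exact h.trans (by gcongr)
    _ = 3 * Q ^ 5 * q ^ 4 := by ring
    _ ≤ Q * Q ^ 5 * q ^ 4 := by gcongr; linarith
    _ = Q ^ 6 * q ^ 4 := by ring
    _ ≤ Q ^ 16 * q ^ 4 := by
      gcongr ?_ * _
      exact pow_le_pow_right₀ (by linarith) (by norm_num)
    _ = _ := by ring

end UC

namespace UC
open MvPolynomial

variable {d p : ℕ}

lemma G2_of (w : Fin p → Fin d → ℝ) (hd : 1 ≤ d) (hw : ∀ a, N2 (w a) = 1) (Q : ℝ) (hQ : 1 ≤ Q)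
    (h : ∀ v : Fin p → ℝ, |∑ a, ∑ b, v a * v b * (if a = b then 0 else H2 (w a) (w b))| ≤ Q * ∑ a, v a ^ 2) :
    ∀ v : Fin p → ℝ, |∑ a, ∑ b, v a * v b * (dotp (w a) (w b) ^ 2 - (d:ℝ)⁻¹)| ≤ (2 * Q) * ∑ a, v a ^ 2 := by
  intro v
  have hd1 : (1:ℝ) ≤ d := by exact_mod_cast hd
  have e : ∑ a, ∑ b, v a * v b * (dotp (w a) (w b) ^ 2 - (d:ℝ)⁻¹) =
      (∑ a, ∑ b, v a * v b * (if a = b then 0 else H2 (w a) (w b))) + (1 - (d:ℝ)⁻¹) * ∑ a, v a ^ 2 := by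
    rw [Finset.mul_sum, ← Finset.sum_add_distrib]
    apply Finset.sum_congr rfl; intro a _
    have : (1 - (d:ℝ)⁻¹) * v a ^ 2 = ∑ b, (if a = b then (1 - (d:ℝ)⁻¹) * v a ^ 2 else 0) := by simp
    rw [this, ← Finset.sum_add_distrib]
    apply Finset.sum_congr rfl; intro b _
    split_ifs with hab
    · subst hab
      rw [dotp_self, hw a]; ring
    · rw [H2, hw, hw, Fintype.card_fin]; ring
  have hi : (d:ℝ)⁻¹ ≤ 1 := inv_le_one_of_one_le₀ hd1
  have hi0 : 0 ≤ (d:ℝ)⁻¹ := by positivity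
  have hS : 0 ≤ ∑ a, v a ^ 2 := Finset.sum_nonneg fun _ _ => sq_nonneg _
  rw [e]
  refine (abs_add_le _ _).trans ?_
  have h2 : |(1 - (d:ℝ)⁻¹) * ∑ a, v a ^ 2| ≤ 1 * ∑ a, v a ^ 2 := by
    rw [abs_of_nonneg (mul_nonneg (by linarith) hS)]
    exact mul_le_mul_of_nonneg_right (by linarith) hS
  have := h v
  nlinarith

lemma G3_of (w : Fin p → Fin d → ℝ) (hw : ∀ a, N2 (w a) = 1) (a b : Fin p) :
    H3 (w a) (w b) = dotp (w a) (w b) ^ 3 - 3 / ((d:ℝ) + 2) * dotp (w a) (w b) := by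
  rw [H3, hw, hw, Fintype.card_fin]; ring

lemma entry_of (M : Fin p → Fin p → ℝ) (hM : ∀ a b, M a b = M b a) (hM0 : ∀ a, M a a = 0) (R : ℝ)
    (h : ∀ v : Fin p → ℝ, |∑ a, ∑ b, v a * v b * M a b| ≤ R * ∑ a, v a ^ 2) (a b : Fin p) (hab : a ≠ b) : |M a b| ≤ R := by
  have := h (Pi.single a 1 + Pi.single b 1)
  have e1 : ∑ c, ((Pi.single a 1 + Pi.single b 1 : Fin p → ℝ) c) ^ 2 = 2 := by
    have : ∀ c, ((Pi.single a 1 + Pi.single b 1 : Fin p → ℝ) c) ^ 2 = (if c = a then 1 else 0) + (if c = b then 1 else 0) := by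
      intro c
      simp only [Pi.add_apply, Pi.single_apply]
      split_ifs with h1 h2
      · exact absurd (h1.symm.trans h2) hab
      all_goals norm_num
    simp_rw [this, Finset.sum_add_distrib]
    simp; norm_num
  have e2 : ∑ c, ∑ e, (Pi.single a 1 + Pi.single b 1 : Fin p → ℝ) c * (Pi.single a 1 + Pi.single b 1 : Fin p → ℝ) e * M c e = 2 * M a b := by
    simp only [Pi.add_apply, Pi.single_apply, add_mul, mul_add, Finset.sum_add_distrib, ite_mul, one_mul, zero_mul, mul_ite, mul_one, mul_zero]
    simp [Finset.sum_add_distrib, hM0, hM b a]; ring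
  rw [e1, e2, abs_mul] at this
  norm_num at this
  linarith

lemma rho_of (w : Fin p → Fin d → ℝ) (hd : 1 ≤ d) (hw : ∀ a, N2 (w a) = 1) (Q q : ℝ) (hQ : 58 ≤ Q) (hq0 : 0 < q)
    (hdq : (d:ℝ)⁻¹ ≤ q ^ 6)
    (h : ∀ v : Fin p → ℝ, |∑ a, ∑ b, v a * v b * (if a = b then 0 else H3 (w a) (w b))| ≤ Q * q ^ 6 * ∑ a, v a ^ 2)
    (a b : Fin p) (hab : a ≠ b) : |dotp (w a) (w b)| ≤ 2 * Q * q ^ 2 := by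
  have h1 := entry_of (fun a b => if a = b then 0 else H3 (w a) (w b)) (by
    intro a b
    simp only [G3_of w hw, dotp_comm (w b), eq_comm]) (by simp) _ h a b hab
  simp only [if_neg hab, G3_of w hw] at h1
  have h2 := N2_dotp_le (w a) (w b) (hw a) (hw b)
  set g := dotp (w a) (w b)
  have hd1 : (1:ℝ) ≤ d := by exact_mod_cast hd
  have h3 : |3 / ((d:ℝ) + 2) * g| ≤ 3 * q ^ 6 := by
    rw [abs_mul, abs_of_nonneg (by positivity)]
    calc 3 / ((d:ℝ) + 2) * |g| ≤ 3 / (d:ℝ) * 1 := by gcongr; linarith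
      _ = 3 * (d:ℝ)⁻¹ := by ring
      _ ≤ _ := by gcongr
  have h4 : |g| ^ 3 ≤ (2 * Q * q ^ 2) ^ 3 := by
    rw [← abs_pow]
    calc |g ^ 3| = |(g ^ 3 - 3 / ((d:ℝ) + 2) * g) + 3 / ((d:ℝ) + 2) * g| := by congr 1; ring
      _ ≤ Q * q ^ 6 + 3 * q ^ 6 := (abs_add_le _ _).trans (add_le_add h1 h3)
      _ ≤ 2 * Q * q ^ 6 := by nlinarith [pow_pos hq0 6]
      _ ≤ 8 * Q ^ 3 * q ^ 6 := by
        gcongr ?_ * _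
        have : Q ^ 1 ≤ Q ^ 3 := pow_le_pow_right₀ (by linarith) (by norm_num)
        nlinarith
      _ = _ := by ring
  exact le_of_pow_le_pow_left₀ (by norm_num) (by positivity) h4

lemma Kc_xi {k : ℕ} (β : MIdx d k → ℝ) (hβ : enorm2 β = 1) (c : ℝ)
    (h4 : (∫ x, (dotp β (hvec d k x)) ^ 4 ∂(stdG (Fin d))) ≤ 3 + c) (j : ℕ) (hj : 1 ≤ j) (hjk : j < k) :
    Kc j (xiP β) ≤ (j.factorial : ℝ) ^ 2 * c := by
  refine (fourth_moment k j hj hjk _ (xiP_chaos β)).trans ?_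
  have e : E ((xiP β * xiP β) * (xiP β * xiP β)) = ∫ x, (dotp β (hvec d k x)) ^ 4 ∂(stdG (Fin d)) := by
    rw [E_def]; congr 1; funext x
    simp only [map_mul, eval_xiP]; ring
  rw [e, E_xiP, enorm2_one _ hβ]
  gcongr
  linarith

lemma main_det (Dσ D' s : ℕ) (sk : ℕ → ℕ) : ∃ Cc : ℝ, 0 ≤ Cc ∧ ∀ (d p : ℕ) (_ : 3 ≤ d) (Q q δ c : ℝ) (_ : 58 ≤ Q) (_ : 0 < q) (_ : q ≤ 1)
    (_ : (d:ℝ)⁻¹ ≤ q ^ 6) (_ : ((Dσ + D').factorial : ℝ) ≤ Q) (_ : (Dσ : ℝ) ≤ Q) (_ : 2 * Q * q ^ 2 ≤ 1) (_ : 0 ≤ c) (_ : c ≤ q ^ 8)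
    (_ : 0 < δ) (_ : Q ^ 9 * q ≤ δ ^ 2)
    (β : (k : ℕ) → Fin (sk k) → MIdx d k → ℝ) (_ : ∀ k : ℕ, 2 ≤ k → k ≤ D' → ∀ i : Fin (sk k), enorm2 (β k i) = 1 ∧
        (∫ x, (dotp (β k i) (hvec d k x)) ^ 4 ∂(stdG (Fin d))) ≤ 3 + c)
    (σa : Polynomial ℝ) (_ : σa.natDegree ≤ Dσ) (_ : ∀ k, k ≤ Dσ → |hCoef σa k| ≤ Q)
    (w : Fin p → Fin d → ℝ) (_ : ∀ a, N2 (w a) = 1)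
    (_ : ∀ v : Fin p → ℝ, |∑ a, ∑ b, v a * v b * (if a = b then 0 else H2 (w a) (w b))| ≤ Q * ∑ a, v a ^ 2)
    (_ : ∀ v : Fin p → ℝ, |∑ a, ∑ b, v a * v b * (if a = b then 0 else H3 (w a) (w b))| ≤ Q * q ^ 6 * ∑ a, v a ^ 2)
    (_ : ∀ k, 3 ≤ k → k ≤ D' → ∀ i, ∑ a, E (xiP (β k i) * Hp k (w a)) ^ 2 ≤ Q * ((d:ℝ)⁻¹ + √(Kc 2 (xiP (β k i)))))
    (θ : Fin p → ℝ) (_ : ∀ a, |θ a| ≤ Q * q ^ 2) (_ : ∑ a, θ a ^ 2 ≤ Q ^ 2) (_ : tq 0 θ w ≤ Q ^ 2)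
    (_ : hCoef σa 1 ^ 2 * tq 1 θ w ≤ Q ^ 2) (_ : (d:ℝ)⁻¹ * tq 1 θ w ≤ Q ^ 4 * q ^ 4)
    (φ : ((SigIdx s D' sk → ℝ) × ℝ) → ℝ) (L : ℝ) (_ : 0 < L)
    (_ : ∀ u v : (SigIdx s D' sk → ℝ) × ℝ, |φ u - φ v| ≤
                L * Real.sqrt ((∑ i, (u.1 i - v.1 i) ^ 2) + (u.2 - v.2) ^ 2)),
    |(∫ x, φ (fRF d s D' sk β x, dotp θ (zRF d p σa w x)) ∂(stdG (Fin d))) -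
                  (∫ ω : PGfeat d p D',
                    φ (fPG d s D' sk β ω.1 ω.2.1, dotp θ (zPG d p Dσ σa w ω.1 ω.2.2))
                    ∂(PGfeatMeas d p D'))| ≤ Cc * L * δ := by
  obtain ⟨Cc, hCc, H⟩ := det Dσ D' s sk
  refine ⟨Cc, hCc, ?_⟩
  intro d p hd Q q δ c hQ hq0 hq hdq hfac hDQ hQq hc0 hc hδ hδ2 β hβ σa hσ hμ w hw hH2 hH3 hf θ hθ hS h0 h1m h1 φ L hL hφ
  have hQ0 : 0 < Q := by linarith
  have hQ1 : 1 ≤ Q := by linarith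
  have hd3 : (3:ℝ) ≤ d := by exact_mod_cast hd
  have hy0 : 0 ≤ (d:ℝ)⁻¹ := by positivity
  have hy : (d:ℝ)⁻¹ ≤ 1 / 3 := by rw [one_div]; exact inv_anti₀ (by norm_num) hd3
  have q64 : q ^ 6 ≤ q ^ 4 := pow_le_pow_of_le_one hq0.le hq (by norm_num)
  have q84 : q ^ 8 ≤ q ^ 4 := pow_le_pow_of_le_one hq0.le hq (by norm_num)
  have q21 : q ^ 2 ≤ q := by nlinarith
  have hyq : (d:ℝ)⁻¹ ≤ q ^ 4 := hdq.trans q64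
  have hw' : ∀ a, ∑ i, w a i ^ 2 = 1 := hw
  have hG := G2_of w (by omega) hw Q hQ1 hH2
  have hG3 : ∀ v : Fin p → ℝ, |∑ a, ∑ b, v a * v b * (if a = b then 0 else dotp (w a) (w b) ^ 3 - 3 / ((d:ℝ) + 2) * dotp (w a) (w b))| ≤ Q * q ^ 4 * ∑ a, v a ^ 2 := by
    intro v
    have := hH3 v
    simp only [G3_of w hw] at this
    refine this.trans ?_
    have hS : 0 ≤ ∑ a, v a ^ 2 := Finset.sum_nonneg fun _ _ => sq_nonneg _
    gcongr
  have hρ := rho_of w (by omega) hw Q q hQ hq0 hdq hH3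
  have hfk : ∀ k, k ≤ Dσ + D' → (k.factorial : ℝ) ≤ Q := fun k hk =>
    le_trans (by exact_mod_cast Nat.factorial_le hk) hfac
  have hy3 : 3 / ((d:ℝ) + 2) ≤ 3 * (d:ℝ)⁻¹ := by
    rw [← div_eq_mul_inv]; gcongr; linarith
  apply H d p β (fun k h2 hk i => (hβ k h2 hk i).1) σa hσ w hw' θ (Q ^ 7) (Q ^ 16 * q ^ 4) (Q ^ 8 * q ^ 2) δ
    (one_le_pow₀ hQ1) (by positivity) (by positivity) _ _ _ _ _ hδ _ φ L hL hφ
  · intro k hk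
    have hμk : hCoef σa k ^ 2 ≤ Q ^ 2 := by rw [← sq_abs]; have := hμ k hk; gcongr
    rcases k with _ | _ | k
    · calc hCoef σa 0 ^ 2 * tq 0 θ w ≤ Q ^ 2 * Q ^ 2 := mul_le_mul hμk h0 (tq_nonneg _ _ _) (by positivity)
        _ = Q ^ 4 := by ring
        _ ≤ _ := pow_le_pow_right₀ hQ1 (by norm_num)
    · exact h1m.trans (pow_le_pow_right₀ hQ1 (by norm_num))
    · have := tq_bd θ w hw' Q q _ hQ hq0 hq hy0 hy hS h0 h1 hG k
      calc hCoef σa (k + 2) ^ 2 * tq (k + 2) θ w ≤ Q ^ 2 * (3 * Q ^ 4) := mul_le_mul hμk this (tq_nonneg _ _ _) (by positivity)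
        _ = 3 * Q ^ 6 := by ring
        _ ≤ Q * Q ^ 6 := by gcongr; linarith
        _ = _ := by ring
  · intro k hk hkD i j hj hjk
    refine (Kc_xi (β k i) (hβ k (by omega) hkD i).1 c (hβ k (by omega) hkD i).2 j hj hjk).trans ?_
    calc (j.factorial : ℝ) ^ 2 * c ≤ Q ^ 2 * q ^ 4 := by
          have := hfk j (by omega)
          have := hc.trans q84
          gcongr
      _ ≤ _ := by
        gcongr ?_ * _
        exact pow_le_pow_right₀ hQ1 (by norm_num)
  · intro k hk hkD j hj hjk
    exact Kc_est θ w hw' Q q _ (2 * Q * q ^ 2) hQ hq0 hq hy0 hy hyq hS h0 h1 hG hθ (by positivity) hQq le_rfl hρ k j hj hjk hk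
      (hfk k (by omega)) _ (hμ k hkD)
  · intro k hk hkD i
    rcases Nat.lt_or_ge Dσ k with h | h
    · rw [hCoef_eq_zero σa k (by omega)]; simp; positivity
    · apply cross_est θ _ Q q _ hQ hq0 hS _ (hμ k h)
      refine (hf k hk hkD i).trans ?_
      have hK := Kc_xi (β k i) (hβ k (by omega) hkD i).1 c (hβ k (by omega) hkD i).2 2 (by norm_num) (by omega)
      have : √(Kc 2 (xiP (β k i))) ≤ 2 * q ^ 4 := by
        apply Real.sqrt_le_iff.2 ⟨by positivity, hK.trans ?_⟩
        norm_num [Nat.factorial]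
        nlinarith
      calc Q * ((d:ℝ)⁻¹ + √(Kc 2 (xiP (β k i)))) ≤ Q * (q ^ 4 + 2 * q ^ 4) := by gcongr
        _ = _ := by ring
  · exact YY_est θ w hw' Q q _ _ hQ hq0 hq hy0 hy hyq (by positivity) hy3 hS h0 h1 hG hG3 Dσ hDQ _ hμ
  · refine le_trans ?_ hδ2
    have e1 : √(Q ^ 16 * q ^ 4) = Q ^ 8 * q ^ 2 := by
      rw [show Q ^ 16 * q ^ 4 = (Q ^ 8 * q ^ 2) ^ 2 by ring]; exact Real.sqrt_sq (by positivity)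
    rw [e1]
    have e2 : √(Q ^ 7 * (Q ^ 8 * q ^ 2)) ≤ Q ^ 8 * q := by
      apply Real.sqrt_le_iff.2 ⟨by positivity, ?_⟩
      calc Q ^ 7 * (Q ^ 8 * q ^ 2) = Q ^ 15 * q ^ 2 := by ring
        _ ≤ Q ^ 16 * q ^ 2 := by
          gcongr ?_ * _
          exact pow_le_pow_right₀ hQ1 (by norm_num)
        _ = _ := by ring
    calc _ ≤ Q ^ 8 * q + Q ^ 8 * q := by gcongr
      _ = 2 * (Q ^ 8 * q) := by ring
      _ ≤ Q * (Q ^ 8 * q) := by gcongr; linarith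
      _ = _ := by ring

end UC

namespace UC
open MvPolynomial

lemma sum_sq_of_enorm {ι : Type*} [Fintype ι] (u : ι → ℝ) (R : ℝ) (h : enorm2 u ≤ R) : ∑ i, u i ^ 2 ≤ R ^ 2 := by
  have h0 : 0 ≤ ∑ i, u i ^ 2 := Finset.sum_nonneg fun _ _ => sq_nonneg _
  unfold enorm2 at h
  rw [← Real.sq_sqrt h0]
  exact pow_le_pow_left₀ (Real.sqrt_nonneg _) h 2

lemma prob_of {Ω : Type*} [MeasurableSpace Ω] (μ : Measure Ω) [IsProbabilityMeasure μ] (S B : Set Ω) (e : ENNReal)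
    (hB : μ B ≤ e) (h : ∀ᵐ w ∂μ, w ∉ B → w ∈ S) : 1 - e ≤ μ S := by
  rw [tsub_le_iff_right]
  calc 1 = μ Set.univ := measure_univ.symm
    _ ≤ μ (S ∪ B) := measure_mono_ae (by
        filter_upwards [h] with w hw _
        by_cases hb : w ∈ B
        · exact Or.inr hb
        · exact Or.inl (hw hb))
    _ ≤ μ S + μ B := measure_union_le _ _
    _ ≤ μ S + e := by gcongr

set_option maxHeartbeats 1000000 in
theorem uniform_aux
    (C0 C6 c6 c3 : ℝ) (hC0 : 0 < C0) (hC6 : 0 < C6) (hc6 : 0 < c6) (hc6' : c6 < 1 / 2)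
    (hc3 : 0 < c3) (Dσ D' s : ℕ) (sk : ℕ → ℕ)
    (C K : ℝ) (hC : 0 < C) (hK : 0 < K) :
    ∃ c C' : ℝ, 0 < c ∧ 0 < C' ∧ ∃ d₀ : ℕ, 0 < d₀ ∧
      ∀ d : ℕ, d₀ ≤ d → ∀ p : ℕ, s ≤ d →
      (C0⁻¹ ≤ (p : ℝ) / (d : ℝ) ^ 2 ∧ (p : ℝ) / (d : ℝ) ^ 2 ≤ C0) →
      ∀ β : (k : ℕ) → Fin (sk k) → MIdx d k → ℝ,
      (∀ k : ℕ, 2 ≤ k → k ≤ D' → ∀ i : Fin (sk k),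
        enorm2 (β k i) = 1 ∧
        (∫ x, (dotp (β k i) (hvec d k x)) ^ 4 ∂(stdG (Fin d))) ≤ 3 + (d : ℝ) ^ (-c3)) →
      ∀ σa : Polynomial ℝ,
      (σa.natDegree ≤ Dσ ∧
        Real.log d ^ (-C6) ≤ |hCoef σa 0| ∧ Real.log d ^ (-C6) ≤ |hCoef σa 2| ∧
        (d : ℝ) ^ (-c6) / C6 ≤ |hCoef σa 1| ∧ |hCoef σa 1| ≤ C6 * (d : ℝ) ^ (-c6) ∧
        (∀ k : ℕ, k ≤ Dσ → |hCoef σa k| ≤ Real.log d ^ C6)) →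
      1 - ENNReal.ofReal ((d : ℝ) ^ (-C)) ≤
        (Measure.pi fun _ : Fin p => unifSphere (Fin d))
          {w | ∀ L : ℝ, 0 < L →
            ∀ φ : ((SigIdx s D' sk → ℝ) × ℝ) → ℝ,
            (∀ u v : (SigIdx s D' sk → ℝ) × ℝ,
              |φ u - φ v| ≤
                L * Real.sqrt ((∑ i, (u.1 i - v.1 i) ^ 2) + (u.2 - v.2) ^ 2)) →
            ∀ θ : Fin p → ℝ, θ ∈ ThetaPG d p K (hCoef σa 1) w →
              |(∫ x, φ (fRF d s D' sk β x, dotp θ (zRF d p σa w x)) ∂(stdG (Fin d))) -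
                  (∫ ω : PGfeat d p D',
                    φ (fPG d s D' sk β ω.1 ω.2.1, dotp θ (zPG d p Dσ σa w ω.1 ω.2.2))
                    ∂(PGfeatMeas d p D'))| ≤
                C' * L / (d : ℝ) ^ c} := by
  obtain ⟨Cc, hCc, H⟩ := main_det Dσ D' s sk
  obtain ⟨γ, hγ0, hγ1, hγ2, hγ3⟩ : ∃ γ : ℝ, 0 < γ ∧ γ ≤ 1 / 3 ∧ γ ≤ 1 - 2 * c6 ∧ 2 * γ ≤ c3 := by
    refine ⟨min (1 / 3) (min (1 - 2 * c6) (c3 / 2)), ?_, min_le_left _ _, (min_le_right _ _).trans (min_le_left _ _), ?_⟩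
    · refine lt_min (by norm_num) (lt_min (by linarith) (by linarith))
    · have := (min_le_right (1 / 3) (min (1 - 2 * c6) (c3 / 2))).trans (min_le_right _ _)
      linarith
  set ε := γ / 72 with hε
  have hε0 : 0 < ε := by positivity
  refine ⟨γ / 16, Cc + 1, by positivity, by positivity, ?_⟩
  set NN : ℝ := 2 + ∑ k ∈ Finset.Icc 3 D', (sk k : ℝ) with hNN
  have hfe : ∀ᶠ d : ℕ in Filter.atTop, ∀ k ∈ Finset.Icc 3 D', ∀ p : ℕ, (p:ℝ) ≤ C0 * (d:ℝ) ^ 2 → ∀ ξ : MvPolynomial (Fin d) ℝ, Chaos k ξ → E (ξ * ξ) = 1 →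
      (Measure.pi fun _ : Fin p => unifSphere (Fin d)) {w | ¬ ∑ a, E (ξ * Hp k (w a)) ^ 2 ≤ (d:ℝ) ^ ε * ((d:ℝ)⁻¹ + √(Kc 2 ξ))} ≤ ENNReal.ofReal ((d:ℝ) ^ (-(C + 1))) := by
    rw [Filter.eventually_all_finset]
    intro k hk
    exact f_event k (Finset.mem_Icc.1 hk).1 C0 ε (C + 1) hC0 hε0
  have hall := (Filter.eventually_ge_atTop 3).and <| (pow_dom 58 0 ε hε0).and <| (pow_dom ((Dσ + D').factorial : ℝ) 0 ε hε0).and <|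
    (pow_dom (Dσ : ℝ) 0 ε hε0).and <| (pow_dom C6 0 ε hε0).and <| (log_dom K ε hε0).and <| (log_dom C6 ε hε0).and <|
    (pow_dom 2 (ε - γ / 2) 0 (by rw [hε]; linarith)).and <| (H2_event C0 ε (C + 1) hC0 hε0).and <|
    (H3_event C0 ε (C + 1) hC0 hε0).and <| hfe.and <| (pow_dom NN (-(C + 1)) (-C) (by linarith))
  obtain ⟨d₀, hd₀⟩ := Filter.eventually_atTop.1 hall
  refine ⟨d₀ + 1, by omega, ?_⟩
  intro d hd p hs hp β hβ σa hσ
  obtain ⟨h3, hQ58, hQfac, hQD, hQC6, hlK, hlC6, hQq, hH2, hH3, hf, hN⟩ := hd₀ d (by omega)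
  obtain ⟨hσD, -, -, hμ1, -, hμ⟩ := hσ
  have hd3 : (3:ℝ) ≤ d := by exact_mod_cast h3
  have hd1 : (1:ℝ) ≤ d := by linarith
  have hd0 : (0:ℝ) < d := by linarith
  have hpC : (p:ℝ) ≤ C0 * (d:ℝ) ^ 2 := by
    have := hp.2
    rwa [div_le_iff₀ (by positivity)] at this
  simp only [Real.rpow_zero, mul_one] at hQ58 hQfac hQD hQC6 hQq
  have hne : Nonempty (Fin d) := ⟨⟨0, by omega⟩⟩
  have hpw : ∀ (a : ℝ) (n : ℕ), ((d:ℝ) ^ a) ^ n = (d:ℝ) ^ (a * n) := fun a n => by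
    rw [Real.rpow_mul hd0.le, Real.rpow_natCast]
  have hmono : ∀ a b : ℝ, a ≤ b → (d:ℝ) ^ a ≤ (d:ℝ) ^ b := fun a b h => Real.rpow_le_rpow_of_exponent_le hd1 h
  set Q := (d:ℝ) ^ ε with hQ
  set q := (d:ℝ) ^ (-(γ / 4)) with hq
  have hQ0 : 0 < Q := Real.rpow_pos_of_pos hd0 _
  have hq0 : 0 < q := Real.rpow_pos_of_pos hd0 _
  have hq1 : q ≤ 1 := Real.rpow_le_one_of_one_le_of_nonpos hd1 (by linarith)
  have hq2 : q ^ 2 = (d:ℝ) ^ (-(γ / 2)) := by rw [hq, hpw]; congr 1; push_cast; ring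
  have hq4 : q ^ 4 = (d:ℝ) ^ (-γ) := by rw [hq, hpw]; congr 1; push_cast; ring
  have hq6 : q ^ 6 = (d:ℝ) ^ (-(3 * γ / 2)) := by rw [hq, hpw]; congr 1; push_cast; ring
  have hq8 : q ^ 8 = (d:ℝ) ^ (-(2 * γ)) := by rw [hq, hpw]; congr 1; push_cast; ring
  have hdinv : (d:ℝ)⁻¹ = (d:ℝ) ^ (-1 : ℝ) := (Real.rpow_neg_one _).symm
  have hlog : 0 ≤ Real.log d := Real.log_nonneg hd1
  have hlogK : 0 ≤ Real.log d ^ K := Real.rpow_nonneg hlog _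
  have hlK2 : (Real.log d ^ K) ^ 2 ≤ Q ^ 2 := pow_le_pow_left₀ hlogK hlK 2
  set δ := (d:ℝ) ^ (-(γ / 16)) with hδ
  set μ := (Measure.pi fun _ : Fin p => unifSphere (Fin d)) with hμd
  have hpr : IsProbabilityMeasure μ := by rw [hμd]; infer_instance
  let B2 : Set (Fin p → Fin d → ℝ) := {w | ¬ ∀ v : Fin p → ℝ, |∑ a, ∑ b, v a * v b * (if a = b then 0 else H2 (w a) (w b))| ≤ (d:ℝ) ^ ε * ∑ a, v a ^ 2}
  let B3 : Set (Fin p → Fin d → ℝ) := {w | ¬ ∀ v : Fin p → ℝ, |∑ a, ∑ b, v a * v b * (if a = b then 0 else H3 (w a) (w b))| ≤ (d:ℝ) ^ (-(1/2:ℝ) + ε) * ∑ a, v a ^ 2}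
  let Bf : (k : ℕ) → Fin (sk k) → Set (Fin p → Fin d → ℝ) := fun k i =>
    {w | ¬ ∑ a, E (xiP (β k i) * Hp k (w a)) ^ 2 ≤ (d:ℝ) ^ ε * ((d:ℝ)⁻¹ + √(Kc 2 (xiP (β k i))))}
  have b2 : μ B2 ≤ ENNReal.ofReal ((d:ℝ) ^ (-(C + 1))) := hH2 p hpC
  have b3 : μ B3 ≤ ENNReal.ofReal ((d:ℝ) ^ (-(C + 1))) := hH3 p hpC
  have bf : ∀ k ∈ Finset.Icc 3 D', ∀ i, μ (Bf k i) ≤ ENNReal.ofReal ((d:ℝ) ^ (-(C + 1))) := by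
    intro k hk i
    have hk' := Finset.mem_Icc.1 hk
    refine hf k hk p hpC (xiP (β k i)) (xiP_chaos _) ?_
    rw [E_xiP, enorm2_one _ (hβ k (by omega) hk'.2 i).1]
  have hbad : μ ((B2 ∪ B3) ∪ ⋃ k ∈ Finset.Icc 3 D', ⋃ i, Bf k i) ≤ ENNReal.ofReal ((d:ℝ) ^ (-C)) := by
    have hdp : (0:ℝ) ≤ (d:ℝ) ^ (-(C + 1)) := (Real.rpow_pos_of_pos hd0 _).le
    have u : μ (⋃ k ∈ Finset.Icc 3 D', ⋃ i, Bf k i) ≤ ∑ k ∈ Finset.Icc 3 D', (sk k : ENNReal) * ENNReal.ofReal ((d:ℝ) ^ (-(C + 1))) := by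
      refine (measure_biUnion_finset_le _ _).trans (Finset.sum_le_sum fun k hk => ?_)
      refine (measure_iUnion_le _).trans ?_
      rw [tsum_fintype]
      refine (Finset.sum_le_sum fun i _ => bf k hk i).trans ?_
      simp
    calc _ ≤ (μ B2 + μ B3) + μ (⋃ k ∈ Finset.Icc 3 D', ⋃ i, Bf k i) :=
          (measure_union_le _ _).trans (add_le_add (measure_union_le _ _) le_rfl)
      _ ≤ (ENNReal.ofReal ((d:ℝ) ^ (-(C + 1))) + ENNReal.ofReal ((d:ℝ) ^ (-(C + 1)))) + ∑ k ∈ Finset.Icc 3 D', (sk k : ENNReal) * ENNReal.ofReal ((d:ℝ) ^ (-(C + 1))) :=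
          add_le_add (add_le_add b2 b3) u
      _ = ENNReal.ofReal (NN * (d:ℝ) ^ (-(C + 1))) := by
          have e : ∑ k ∈ Finset.Icc 3 D', (sk k : ENNReal) * ENNReal.ofReal ((d:ℝ) ^ (-(C + 1))) = ENNReal.ofReal (∑ k ∈ Finset.Icc 3 D', (sk k : ℝ) * (d:ℝ) ^ (-(C + 1))) := by
            rw [ENNReal.ofReal_sum_of_nonneg (fun k _ => by positivity)]
            refine Finset.sum_congr rfl fun k _ => ?_
            rw [ENNReal.ofReal_mul (by positivity), ENNReal.ofReal_natCast]
          rw [e, ← ENNReal.ofReal_add hdp hdp, ← ENNReal.ofReal_add (by positivity) (Finset.sum_nonneg fun k _ => by positivity), ← Finset.sum_mul]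
          congr 1
          rw [hNN]; ring
      _ ≤ _ := ENNReal.ofReal_le_ofReal hN
  refine prob_of μ _ _ _ hbad ?_
  filter_upwards [ae_unit d p (by omega)] with w hw hwB
  simp only [Set.mem_union, Set.mem_iUnion, not_or, not_exists] at hwB
  obtain ⟨⟨w2, w3⟩, wf⟩ := hwB
  have w2 := not_not.1 w2
  have w3 := not_not.1 w3
  intro L hL φ hφ θ hθ
  obtain ⟨t1, t2, t3, t4⟩ := hθ
  have t4' := sum_sq_of_enorm _ _ t4
  have e4 : ∑ i : Fin d, (hCoef σa 1 * ∑ j, w j i * θ j) ^ 2 = hCoef σa 1 ^ 2 * tq 1 θ w := by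
    rw [tq_one_eq, Finset.mul_sum]
    exact Finset.sum_congr rfl fun i _ => by ring
  rw [e4] at t4'
  have ht0 : 0 ≤ tq 1 θ w := by rw [tq_one_eq]; exact Finset.sum_nonneg fun _ _ => sq_nonneg _
  have hfin := H d p h3 Q q δ ((d:ℝ) ^ (-c3)) hQ58 hq0 hq1
    (by rw [hq6, hdinv]; exact hmono _ _ (by linarith)) hQfac hQD
    (by
      refine le_trans (le_of_eq ?_) hQq
      rw [hq2, hQ, mul_assoc, ← Real.rpow_add hd0]; rfl)
    (Real.rpow_pos_of_pos hd0 _).le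
    (by rw [hq8]; exact hmono _ _ (by linarith))
    (Real.rpow_pos_of_pos hd0 _)
    (by
      rw [hQ, hq, hδ, hpw, hpw, ← Real.rpow_add hd0]
      apply hmono
      rw [hε]; push_cast; linarith)
    β hβ σa hσD (fun k hk => (hμ k hk).trans hlC6) w hw w2
    (fun v => (w3 v).trans (by
      have hS : 0 ≤ ∑ a, v a ^ 2 := Finset.sum_nonneg fun _ _ => sq_nonneg _
      refine mul_le_mul_of_nonneg_right ?_ hS
      rw [hq6, hQ, ← Real.rpow_add hd0]
      apply hmono; linarith))
    (fun k hk hk' i => not_not.1 (wf k (Finset.mem_Icc.2 ⟨hk, hk'⟩) i))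
    θ
    (fun a => (t1 a).trans (by
      have : (d:ℝ) ^ (-(1 / 4 : ℝ)) ≤ q ^ 2 := by rw [hq2]; exact hmono _ _ (by linarith)
      exact mul_le_mul hlK this (Real.rpow_pos_of_pos hd0 _).le hQ0.le))
    ((sum_sq_of_enorm _ _ t2).trans hlK2)
    (by
      rw [tq_zero_eq, ← sq_abs]
      exact (pow_le_pow_left₀ (abs_nonneg _) t3 2).trans hlK2)
    (t4'.trans hlK2)
    (by
      have hm : (d:ℝ) ^ (-c6) ≤ C6 * |hCoef σa 1| := by
        rw [div_le_iff₀ hC6] at hμ1; linarith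
      have hm0 : 0 < (d:ℝ) ^ (-c6) := Real.rpow_pos_of_pos hd0 _
      have hm2 : ((d:ℝ) ^ (-c6)) ^ 2 ≤ C6 ^ 2 * hCoef σa 1 ^ 2 := by
        rw [← sq_abs (hCoef σa 1), ← mul_pow]
        exact pow_le_pow_left₀ hm0.le hm 2
      have hs1 : (d:ℝ)⁻¹ = (d:ℝ) ^ (2 * c6 - 1) * ((d:ℝ) ^ (-c6)) ^ 2 := by
        rw [hpw, ← Real.rpow_add hd0, hdinv]; congr 1; push_cast; ring
      have hs2 : (d:ℝ) ^ (2 * c6 - 1) ≤ q ^ 4 := by rw [hq4]; exact hmono _ _ (by linarith)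
      have hC62 : C6 ^ 2 ≤ Q ^ 2 := pow_le_pow_left₀ hC6.le hQC6 2
      calc (d:ℝ)⁻¹ * tq 1 θ w = (d:ℝ) ^ (2 * c6 - 1) * (((d:ℝ) ^ (-c6)) ^ 2 * tq 1 θ w) := by rw [hs1]; ring
        _ ≤ q ^ 4 * ((C6 ^ 2 * hCoef σa 1 ^ 2) * tq 1 θ w) := by gcongr
        _ = q ^ 4 * (C6 ^ 2 * (hCoef σa 1 ^ 2 * tq 1 θ w)) := by ring
        _ ≤ q ^ 4 * (Q ^ 2 * Q ^ 2) := by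
          have := t4'.trans hlK2
          gcongr
        _ = _ := by ring)
    φ L hL hφ
  refine hfin.trans ?_
  have hδ0 : 0 < δ := Real.rpow_pos_of_pos hd0 _
  have hdiv : (Cc + 1) * L / (d:ℝ) ^ (γ / 16) = (Cc + 1) * L * δ := by
    rw [hδ, Real.rpow_neg hd0.le, div_eq_mul_inv]
  rw [hdiv]
  exact mul_le_mul_of_nonneg_right (mul_le_mul_of_nonneg_right (by linarith only) hL.le) hδ0.le

end UC

/-- **Theorem 4.2**: uniform CLT over `Θ^PG_W(K)` and all Lipschitz test functions,
replacing the higher-order chaos of an RF model by isotropic Gaussians (PGE model). -/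
theorem uniform_clt_higher_order_chaos
    (C0 C6 c6 c3 : ℝ) (hC0 : 0 < C0) (hC6 : 0 < C6) (hc6 : 0 < c6) (hc6' : c6 < 1 / 2)
    (hc3 : 0 < c3) (Dσ D' s : ℕ) (sk : ℕ → ℕ)
    (C K : ℝ) (hC : 0 < C) (hK : 0 < K) :
    ∃ c C' : ℝ, 0 < c ∧ 0 < C' ∧ ∃ d₀ : ℕ, 0 < d₀ ∧
      ∀ d : ℕ, d₀ ≤ d → ∀ p : ℕ, s ≤ d →
      (C0⁻¹ ≤ (p : ℝ) / (d : ℝ) ^ 2 ∧ (p : ℝ) / (d : ℝ) ^ 2 ≤ C0) →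
      ∀ β : (k : ℕ) → Fin (sk k) → MIdx d k → ℝ,
      (∀ k : ℕ, 2 ≤ k → k ≤ D' → ∀ i : Fin (sk k),
        enorm2 (β k i) = 1 ∧
        (∫ x, (dotp (β k i) (hvec d k x)) ^ 4 ∂(stdG (Fin d))) ≤ 3 + (d : ℝ) ^ (-c3)) →
      ∀ σa : Polynomial ℝ,
      (σa.natDegree ≤ Dσ ∧
        Real.log d ^ (-C6) ≤ |hCoef σa 0| ∧ Real.log d ^ (-C6) ≤ |hCoef σa 2| ∧
        (d : ℝ) ^ (-c6) / C6 ≤ |hCoef σa 1| ∧ |hCoef σa 1| ≤ C6 * (d : ℝ) ^ (-c6) ∧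
        (∀ k : ℕ, k ≤ Dσ → |hCoef σa k| ≤ Real.log d ^ C6)) →
      1 - ENNReal.ofReal ((d : ℝ) ^ (-C)) ≤
        (Measure.pi fun _ : Fin p => unifSphere (Fin d))
          {w | ∀ L : ℝ, 0 < L →
            ∀ φ : ((SigIdx s D' sk → ℝ) × ℝ) → ℝ,
            (∀ u v : (SigIdx s D' sk → ℝ) × ℝ,
              |φ u - φ v| ≤
                L * Real.sqrt ((∑ i, (u.1 i - v.1 i) ^ 2) + (u.2 - v.2) ^ 2)) →
            ∀ θ : Fin p → ℝ, θ ∈ ThetaPG d p K (hCoef σa 1) w →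
              |(∫ x, φ (fRF d s D' sk β x, dotp θ (zRF d p σa w x)) ∂(stdG (Fin d))) -
                  (∫ ω : PGfeat d p D',
                    φ (fPG d s D' sk β ω.1 ω.2.1, dotp θ (zPG d p Dσ σa w ω.1 ω.2.2))
                    ∂(PGfeatMeas d p D'))| ≤
                C' * L / (d : ℝ) ^ c} := by
  exact UC.uniform_aux C0 C6 c6 c3 hC0 hC6 hc6 hc6' hc3 Dσ D' s sk C K hC hK
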